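/- Short interval Halász corollary: For every κ > 0 there is a constant C = C(κ) > 0 such that for all f in the class C(κ), all real x ≥ C and all δ with 0 < δ < 1/4, if M_δ is the real number defined by max_{|t| ≤ x^δ·(log x)^κ} |F(1+1/log x+it)| = e^{−M_δ}·(log x)^κ, then |∑_{x < n ≤ x + x^{1−δ}} f(n)| ≤ C · (x^{1−δ}/log x) · ( (1+M_δ)·e^{−M_δ}·(log x)^κ + (δ·log x + log log x)^κ ). -/

import Mathlib

open Complex MeasureTheory
open scoped Classical

noncomputable section

/-- Membership of `f` in the class `C(κ)`, witnessed by `Λf`. -/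
structure IsHalaszClass (κ : ℝ) (f : ℕ → ℂ) (Λf : ℕ → ℂ) : Prop where
  map_one : f 1 = 1
  mult : ∀ m n : ℕ, Nat.Coprime m n → f (m * n) = f m * f n
  supp : ∀ n : ℕ, ¬ IsPrimePow n → Λf n = 0
  bound : ∀ n : ℕ, 1 ≤ n → ‖Λf n‖ ≤ κ * ArithmeticFunction.vonMangoldt n
  conv : ∀ n : ℕ, 1 ≤ n →
    f n * (Real.log n : ℂ) = ∑ d ∈ n.divisors, Λf d * f (n / d)
  abs_conv : ∀ σ : ℝ, 1 < σ → Summable (fun n : ℕ => ‖f n‖ / (n : ℝ) ^ σ)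

/-- The Dirichlet series `F(s) = ∑ f(n) n^{-s}`. -/
def Fser (f : ℕ → ℂ) (s : ℂ) : ℂ := ∑' n : ℕ, f n / (n : ℂ) ^ s

section

open ArithmeticFunction in
lemma sum_moebius_divisors (n : ℕ) :
    ∑ d ∈ n.divisors, (moebius d : ℝ) = if n = 1 then 1 else 0 := by
  have h := congrArg (fun f : ArithmeticFunction ℤ => f n) moebius_mul_coe_zeta
  simp only [coe_mul_zeta_apply, one_apply] at h
  have h2 := congrArg (fun z : ℤ => (z : ℝ)) h
  simp only [Int.cast_sum, Int.cast_ite, Int.cast_one, Int.cast_zero] at h2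
  exact h2

open ArithmeticFunction in
lemma sum_moebius_multiples (l m : ℕ) (hm : Squarefree m) :
    ∑ d ∈ m.divisors with l ∣ d, (moebius d : ℝ) = if l = m then (moebius m : ℝ) else 0 := by
  have hm0 : m ≠ 0 := hm.ne_zero
  by_cases hl : l ∣ m
  · obtain ⟨k, rfl⟩ := hl
    have hl0 : l ≠ 0 := by rintro rfl; simp at hm0
    have hk0 : k ≠ 0 := by rintro rfl; simp at hm0
    have hcop : Nat.Coprime l k := Nat.coprime_of_squarefree_mul hm
    have himg : (l * k).divisors.filter (fun d => l ∣ d) = k.divisors.image (fun e => l * e) := by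
      ext d
      simp only [Finset.mem_filter, Nat.mem_divisors, Finset.mem_image]
      constructor
      · rintro ⟨⟨h1, _⟩, e, rfl⟩
        exact ⟨e, ⟨Nat.dvd_of_mul_dvd_mul_left (Nat.pos_of_ne_zero hl0) h1, hk0⟩, rfl⟩
      · rintro ⟨e, ⟨he, _⟩, rfl⟩
        exact ⟨⟨Nat.mul_dvd_mul_left l he, hm0⟩, dvd_mul_right _ _⟩
    rw [himg, Finset.sum_image (fun a _ b _ h => Nat.eq_of_mul_eq_mul_left
      (Nat.pos_of_ne_zero hl0) h)]
    have : ∀ e ∈ k.divisors, (moebius (l * e) : ℝ) = moebius l * moebius e := by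
      intro e he
      have hc : Nat.Coprime l e := Nat.Coprime.coprime_dvd_right (Nat.dvd_of_mem_divisors he) hcop
      rw [isMultiplicative_moebius.map_mul_of_coprime hc]; push_cast; ring
    rw [Finset.sum_congr rfl this, ← Finset.mul_sum, sum_moebius_divisors k]
    by_cases h1 : k = 1
    · subst h1; simp
    · have : l ≠ l * k := by
        intro h; apply h1
        exact Nat.eq_of_mul_eq_mul_left (Nat.pos_of_ne_zero hl0) (by omega)
      simp [h1, this]
  · have : l ≠ m := fun h => hl (h ▸ dvd_rfl)
    rw [if_neg this]
    apply Finset.sum_eq_zero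
    intro d hd
    simp only [Finset.mem_filter, Nat.mem_divisors] at hd
    exact absurd (hd.2.trans hd.1.1) hl

/-- The harmonic weight supported on squarefree numbers. -/
def sqfWeight (m : ℕ) : ℝ := if Squarefree m then (1 : ℝ) / m else 0

lemma sqfWeight_nonneg (m : ℕ) : 0 ≤ sqfWeight m := by
  unfold sqfWeight; split_ifs <;> positivity

/-- The normalising sum for the Selberg weights. -/
def sqfSum (D : ℕ) : ℝ := ∑ m ∈ Finset.range D, sqfWeight m

lemma one_le_sqfSum {D : ℕ} (hD : 2 ≤ D) : 1 ≤ sqfSum D := by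
  have : sqfWeight 1 ≤ sqfSum D :=
    Finset.single_le_sum (fun i _ => sqfWeight_nonneg i) (by simp; omega)
  simpa [sqfWeight] using this

lemma log_le_two_mul_sqfSum {D : ℕ} (hD : 2 ≤ D) : Real.log D ≤ 2 * sqfSum D := by
  have h1 : Real.log D ≤ ∑ n ∈ Finset.Icc 1 (D - 1), (1 : ℝ) / n := by
    have := log_add_one_le_harmonic (D - 1)
    rw [harmonic_eq_sum_Icc] at this
    rw [show D - 1 + 1 = D by omega] at this
    push_cast at this
    simpa [one_div] using this
  have h2 : ∑ n ∈ Finset.Icc 1 (D - 1), (1 : ℝ) / n ≤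
      ∑ a ∈ Finset.range D, ∑ b ∈ Finset.Icc 1 (D - 1), sqfWeight a * ((1 : ℝ) / (b : ℝ) ^ 2) := by
    rw [← Finset.sum_product']
    have hex : ∀ n : ℕ, ∃ p : ℕ × ℕ, p.2 ^ 2 * p.1 = n ∧ Squarefree p.1 := by
      intro n
      obtain ⟨a, b, h1, h2⟩ := Nat.sq_mul_squarefree n
      exact ⟨(a, b), h1, h2⟩
    choose φ hφ1 hφ2 using hex
    have hinj : Set.InjOn φ (Finset.Icc 1 (D - 1)) := by
      intro x _ y _ h
      rw [← hφ1 x, ← hφ1 y, h]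
    calc ∑ n ∈ Finset.Icc 1 (D - 1), (1 : ℝ) / n
        = ∑ n ∈ Finset.Icc 1 (D - 1), sqfWeight (φ n).1 * ((1 : ℝ) / ((φ n).2 : ℝ) ^ 2) := by
          apply Finset.sum_congr rfl
          intro n hn
          rw [sqfWeight, if_pos (hφ2 n)]
          conv_lhs => rw [← hφ1 n]
          push_cast
          rw [div_mul_div_comm, one_mul, mul_comm]
      _ = ∑ p ∈ (Finset.Icc 1 (D - 1)).image φ, sqfWeight p.1 * ((1 : ℝ) / (p.2 : ℝ) ^ 2) := by
          rw [Finset.sum_image hinj]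
      _ ≤ _ := by
          apply Finset.sum_le_sum_of_subset_of_nonneg
          · intro p hp
            simp only [Finset.mem_image, Finset.mem_Icc] at hp
            obtain ⟨n, ⟨hn1, hn2⟩, rfl⟩ := hp
            have h3 := hφ1 n
            have hb : (φ n).2 ≠ 0 := by
              intro h; rw [h] at h3; simp at h3; omega
            have ha : (φ n).1 ≠ 0 := by
              intro h; rw [h] at h3; simp at h3; omega
            have hb1 : 1 ≤ (φ n).2 := Nat.pos_of_ne_zero hb
            have ha1 : 1 ≤ (φ n).1 := Nat.pos_of_ne_zero ha
            simp only [Finset.mem_product, Finset.mem_range, Finset.mem_Icc]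
            have ha2 : (φ n).1 ≤ n := Nat.le_of_dvd (by omega) (Dvd.intro_left _ h3)
            refine ⟨by omega, hb1, ?_⟩
            have : (φ n).2 ≤ n := by nlinarith
            omega
          · intro p _ _
            exact mul_nonneg (sqfWeight_nonneg _) (by positivity)
  have h3 : ∑ b ∈ Finset.Icc 1 (D - 1), ((1 : ℝ) / (b : ℝ) ^ 2) ≤ 2 := by
    have : ∀ N : ℕ, ∑ b ∈ Finset.Icc 1 (N + 1), ((1 : ℝ) / (b : ℝ) ^ 2) ≤ 2 - 1 / (N + 1) := by
      intro N
      induction N with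
      | zero => norm_num
      | succ k ih =>
        rw [Finset.sum_Icc_succ_top (by omega)]
        have hk : (0 : ℝ) ≤ k := Nat.cast_nonneg k
        have : (1 : ℝ) / ((k + 1 + 1 : ℕ) : ℝ) ^ 2 ≤ 1 / ((k : ℝ) + 1) - 1 / ((k : ℝ) + 1 + 1) := by
          push_cast
          rw [div_sub_div _ _ (by positivity) (by positivity), div_le_div_iff₀ (by positivity)
            (by positivity)]
          nlinarith
        push_cast at this ⊢
        linarith
    have h := this (D - 2)
    rw [show D - 2 + 1 = D - 1 by omega] at h
    have : (0 : ℝ) ≤ 1 / ((D - 2 : ℕ) + 1 : ℝ) := by positivity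
    linarith
  have h4 : ∑ a ∈ Finset.range D, ∑ b ∈ Finset.Icc 1 (D - 1),
      sqfWeight a * ((1 : ℝ) / (b : ℝ) ^ 2) ≤ sqfSum D * 2 := by
    simp_rw [← Finset.mul_sum]
    rw [← Finset.sum_mul]
    exact mul_le_mul_of_nonneg_left h3 (Finset.sum_nonneg fun i _ => sqfWeight_nonneg i)
  linarith

/-- The Selberg-type weights divided by the index. -/
def selV (D d : ℕ) : ℝ :=
  (ArithmeticFunction.moebius d : ℝ) / sqfSum D *
    ∑ m ∈ Finset.range D with d ∣ m, sqfWeight m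

/-- The Selberg-type sieve weights. -/
def selW (D d : ℕ) : ℝ := d * selV D d

lemma selW_one {D : ℕ} (hD : 2 ≤ D) : selW D 1 = 1 := by
  have := one_le_sqfSum hD
  simp only [selW, selV, Nat.cast_one, one_mul, isUnit_one, IsUnit.dvd, Finset.filter_true,
    ArithmeticFunction.moebius_apply_one, Int.cast_one]
  change 1 / sqfSum D * sqfSum D = 1
  field_simp

lemma abs_selW_le_one {D : ℕ} (hD : 2 ≤ D) (d : ℕ) : |selW D d| ≤ 1 := by
  have hG := one_le_sqfSum hD
  rcases Nat.eq_zero_or_pos d with rfl | hd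
  · simp [selW]
  have hmu : |(ArithmeticFunction.moebius d : ℝ)| ≤ 1 := by
    exact_mod_cast ArithmeticFunction.abs_moebius_le_one (n := d)
  have hS : (d : ℝ) * ∑ m ∈ Finset.range D with d ∣ m, sqfWeight m ≤ sqfSum D := by
    rw [Finset.mul_sum]
    have : ∀ m ∈ (Finset.range D).filter (d ∣ ·), (d : ℝ) * sqfWeight m ≤ sqfWeight (m / d) := by
      intro m hm
      simp only [Finset.mem_filter] at hm
      obtain ⟨k, rfl⟩ := hm.2
      rw [Nat.mul_div_cancel_left _ hd]
      by_cases hs : Squarefree (d * k)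
      · have hk : Squarefree k := hs.of_mul_right
        have : (k : ℝ) ≠ 0 := by exact_mod_cast hk.ne_zero
        rw [sqfWeight, if_pos hs, sqfWeight, if_pos hk]
        push_cast
        have : (d : ℝ) ≠ 0 := by positivity
        apply le_of_eq; field_simp
      · rw [sqfWeight, if_neg hs]; simpa using sqfWeight_nonneg k
    refine (Finset.sum_le_sum this).trans ?_
    have hinj : Set.InjOn (fun m => m / d) ((Finset.range D).filter (d ∣ ·) : Finset ℕ) := by
      intro a ha b hb h
      simp only [Finset.coe_filter, Set.mem_ofPred_eq] at ha hb
      obtain ⟨x, rfl⟩ := ha.2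
      obtain ⟨y, rfl⟩ := hb.2
      simp only [Nat.mul_div_cancel_left _ hd] at h
      rw [h]
    rw [← Finset.sum_image (f := sqfWeight) (g := fun m => m / d) hinj]
    apply Finset.sum_le_sum_of_subset_of_nonneg
    · intro k hk
      simp only [Finset.mem_image, Finset.mem_filter, Finset.mem_range] at hk ⊢
      obtain ⟨m, ⟨hm, _⟩, rfl⟩ := hk
      exact lt_of_le_of_lt (Nat.div_le_self _ _) hm
    · intro i _ _; exact sqfWeight_nonneg i
  have hS0 : 0 ≤ (d : ℝ) * ∑ m ∈ Finset.range D with d ∣ m, sqfWeight m :=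
    mul_nonneg (by positivity) (Finset.sum_nonneg fun i _ => sqfWeight_nonneg i)
  have : selW D d = (ArithmeticFunction.moebius d : ℝ) *
      ((d * ∑ m ∈ Finset.range D with d ∣ m, sqfWeight m) / sqfSum D) := by
    rw [selW, selV]; ring
  rw [this, abs_mul]
  have h2 : |(d * ∑ m ∈ Finset.range D with d ∣ m, sqfWeight m) / sqfSum D| ≤ 1 := by
    rw [abs_of_nonneg (by positivity)]
    rw [div_le_one (by linarith)]
    exact hS
  calc _ ≤ (1 : ℝ) * 1 := mul_le_mul hmu h2 (abs_nonneg _) zero_le_one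
    _ = 1 := one_mul 1

lemma sum_selV_multiples {D : ℕ} (l : ℕ) (hl : l ∈ Finset.range D) :
    ∑ d ∈ Finset.range D with l ∣ d, selV D d =
      (ArithmeticFunction.moebius l : ℝ) * sqfWeight l / sqfSum D := by
  have h1 : ∑ d ∈ Finset.range D with l ∣ d, selV D d =
      (1 / sqfSum D) * ∑ m ∈ Finset.range D, sqfWeight m *
        ∑ d ∈ Finset.range D with l ∣ d ∧ d ∣ m, (ArithmeticFunction.moebius d : ℝ) := by
    have hswap : ∀ d ∈ Finset.range D, (if l ∣ d then selV D d else 0) =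
        ∑ m ∈ Finset.range D, 1 / sqfSum D * (sqfWeight m *
          if l ∣ d ∧ d ∣ m then (ArithmeticFunction.moebius d : ℝ) else 0) := by
      intro d _
      rw [selV, Finset.sum_filter]
      by_cases h : l ∣ d
      · rw [if_pos h, Finset.mul_sum]
        refine Finset.sum_congr rfl fun m _ => ?_
        by_cases h' : d ∣ m
        · simp only [h, h', and_self, if_true]; ring
        · simp [h']
      · simp [h]
    rw [Finset.sum_filter, Finset.sum_congr rfl hswap, Finset.sum_comm, Finset.mul_sum]
    refine Finset.sum_congr rfl fun m _ => ?_
    rw [Finset.sum_filter, Finset.mul_sum, Finset.mul_sum]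
  rw [h1]
  have h2 : ∀ m ∈ Finset.range D, sqfWeight m *
        ∑ d ∈ Finset.range D with l ∣ d ∧ d ∣ m, (ArithmeticFunction.moebius d : ℝ)
        = if l = m then sqfWeight m * (ArithmeticFunction.moebius m : ℝ) else 0 := by
    intro m hm
    by_cases hs : Squarefree m
    · have : (Finset.range D).filter (fun d => l ∣ d ∧ d ∣ m) = m.divisors.filter (l ∣ ·) := by
        ext d
        simp only [Finset.mem_filter, Finset.mem_range, Nat.mem_divisors] at hm ⊢
        constructor
        · rintro ⟨_, h2, h3⟩; exact ⟨⟨h3, hs.ne_zero⟩, h2⟩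
        · rintro ⟨⟨h2, h3⟩, h4⟩
          exact ⟨lt_of_le_of_lt (Nat.le_of_dvd (Nat.pos_of_ne_zero h3) h2) hm, h4, h2⟩
      rw [this, sum_moebius_multiples l m hs]
      split_ifs <;> simp
    · simp [sqfWeight, hs]
  rw [Finset.sum_congr rfl h2, Finset.sum_ite_eq, if_pos hl]
  ring

lemma selberg_quadratic {D : ℕ} (hD : 2 ≤ D) :
    ∑ d ∈ Finset.range D, ∑ e ∈ Finset.range D,
      selW D d * selW D e / (Nat.lcm d e : ℝ) ≤ 1 / sqfSum D := by
  have hG := one_le_sqfSum hD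
  have h1 : ∀ d ∈ Finset.range D, ∀ e ∈ Finset.range D,
      selW D d * selW D e / (Nat.lcm d e : ℝ) =
      ∑ l ∈ Finset.range D, (Nat.totient l : ℝ) *
        ((if l ∣ d then selV D d else 0) * (if l ∣ e then selV D e else 0)) := by
    intro d hd e he
    rcases Nat.eq_zero_or_pos d with rfl | hd0
    · simp [selW, selV]
    rcases Nat.eq_zero_or_pos e with rfl | he0
    · simp [selW, selV]
    have hg : ((Nat.gcd d e : ℕ) : ℝ) = ∑ l ∈ Finset.range D with l ∣ d ∧ l ∣ e,
        (Nat.totient l : ℝ) := by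
      rw [← Nat.sum_totient (Nat.gcd d e)]
      push_cast
      apply Finset.sum_congr _ (fun _ _ => rfl)
      ext l
      simp only [Nat.mem_divisors, Finset.mem_filter, Finset.mem_range] at hd ⊢
      constructor
      · rintro ⟨h, _⟩
        have hl := Nat.dvd_gcd_iff.mp h
        exact ⟨lt_of_le_of_lt (Nat.le_of_dvd hd0 hl.1) hd, hl⟩
      · rintro ⟨_, h⟩
        exact ⟨Nat.dvd_gcd h.1 h.2, (Nat.gcd_pos_of_pos_left _ hd0).ne'⟩
    have hprod : ((Nat.gcd d e : ℕ) : ℝ) * (Nat.lcm d e : ℝ) = d * e := by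
      exact_mod_cast Nat.gcd_mul_lcm d e
    have hl0 : (Nat.lcm d e : ℝ) ≠ 0 := by
      exact_mod_cast (Nat.lcm_pos hd0 he0).ne'
    have : selW D d * selW D e / (Nat.lcm d e : ℝ) =
        ((Nat.gcd d e : ℕ) : ℝ) * (selV D d * selV D e) := by
      rw [div_eq_iff hl0, selW, selW]
      linear_combination (-(selV D d * selV D e)) * hprod
    rw [this, hg, Finset.sum_mul, Finset.sum_filter]
    refine Finset.sum_congr rfl fun l _ => ?_
    by_cases h1 : l ∣ d <;> by_cases h2 : l ∣ e <;> simp [h1, h2]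
  rw [Finset.sum_congr rfl fun d hd => Finset.sum_congr rfl fun e he => h1 d hd e he]
  have h2 : ∑ d ∈ Finset.range D, ∑ e ∈ Finset.range D, ∑ l ∈ Finset.range D,
      (Nat.totient l : ℝ) *
        ((if l ∣ d then selV D d else 0) * (if l ∣ e then selV D e else 0)) =
      ∑ l ∈ Finset.range D, (Nat.totient l : ℝ) *
        (∑ d ∈ Finset.range D with l ∣ d, selV D d) ^ 2 := by
    have : ∀ d ∈ Finset.range D, ∑ e ∈ Finset.range D, ∑ l ∈ Finset.range D,
      (Nat.totient l : ℝ) *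
        ((if l ∣ d then selV D d else 0) * (if l ∣ e then selV D e else 0)) =
      ∑ l ∈ Finset.range D, ∑ e ∈ Finset.range D, (Nat.totient l : ℝ) *
        ((if l ∣ d then selV D d else 0) * (if l ∣ e then selV D e else 0)) :=
      fun d _ => Finset.sum_comm
    rw [Finset.sum_congr rfl this, Finset.sum_comm]
    refine Finset.sum_congr rfl fun l _ => ?_
    rw [sq, Finset.sum_filter, Finset.sum_mul_sum, Finset.mul_sum]
    refine Finset.sum_congr rfl fun d _ => ?_
    rw [Finset.mul_sum]
  rw [h2]
  have h3 : ∀ l ∈ Finset.range D, (Nat.totient l : ℝ) *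
        (∑ d ∈ Finset.range D with l ∣ d, selV D d) ^ 2 ≤ sqfWeight l / sqfSum D ^ 2 := by
    intro l hl
    rcases Nat.eq_zero_or_pos l with rfl | hl0
    · simp [sqfWeight]
    rw [sum_selV_multiples l hl]
    by_cases hs : Squarefree l
    · have hmu : (ArithmeticFunction.moebius l : ℝ) ^ 2 = 1 := by
        exact_mod_cast ArithmeticFunction.moebius_sq_eq_one_of_squarefree hs
      have ht : (Nat.totient l : ℝ) ≤ l := by exact_mod_cast Nat.totient_le l
      have hl' : (0 : ℝ) < l := by exact_mod_cast hl0
      rw [sqfWeight, if_pos hs, div_pow, mul_pow, hmu, one_mul, ← mul_div_assoc]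
      apply div_le_div_of_nonneg_right _ (by positivity)
      calc (Nat.totient l : ℝ) * (1 / (l : ℝ)) ^ 2 ≤ l * (1 / (l : ℝ)) ^ 2 := by gcongr
        _ = 1 / (l : ℝ) := by field_simp
    · simp [sqfWeight, hs]
  refine (Finset.sum_le_sum h3).trans ?_
  rw [← Finset.sum_div]
  change sqfSum D / sqfSum D ^ 2 ≤ _
  apply le_of_eq; field_simp

lemma abs_card_multiples_sub_le {X Y : ℝ} (hX : 0 ≤ X) (hY : 0 ≤ Y) (l : ℕ) (hl : l ≠ 0) :
    |(((Finset.Ioc ⌊X⌋₊ ⌊X + Y⌋₊).filter (l ∣ ·)).card : ℝ) - Y / l| ≤ 1 := by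
  have hle : ⌊X⌋₊ ≤ ⌊X + Y⌋₊ := Nat.floor_mono (by linarith)
  have hl0 : (0 : ℝ) < l := by positivity
  have h1 : ((Finset.Ioc ⌊X⌋₊ ⌊X + Y⌋₊).filter (l ∣ ·)).card + ⌊X⌋₊ / l = ⌊X + Y⌋₊ / l := by
    rw [← Nat.Ioc_filter_dvd_card_eq_div, ← Nat.Ioc_filter_dvd_card_eq_div, add_comm,
      ← Finset.card_union_of_disjoint]
    · rw [← Finset.filter_union, Finset.Ioc_union_Ioc_eq_Ioc (Nat.zero_le _) hle]
    · apply Finset.disjoint_filter_filter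
      rw [Finset.disjoint_left]
      intro a ha hb
      simp only [Finset.mem_Ioc] at ha hb
      omega
  rw [← Nat.floor_div_natCast, ← Nat.floor_div_natCast] at h1
  have h2 : (((Finset.Ioc ⌊X⌋₊ ⌊X + Y⌋₊).filter (l ∣ ·)).card : ℝ) =
      (⌊(X + Y) / l⌋₊ : ℝ) - ⌊X / l⌋₊ := by
    rw [eq_sub_iff_add_eq]; exact_mod_cast h1
  rw [h2]
  have a1 := Nat.floor_le (show 0 ≤ X / l by positivity)
  have a2 := Nat.lt_floor_add_one (X / l)
  have a3 := Nat.floor_le (show 0 ≤ (X + Y) / l by positivity)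
  have a4 := Nat.lt_floor_add_one ((X + Y) / l)
  have : (X + Y) / l = X / l + Y / l := add_div _ _ _
  rw [abs_le]; constructor <;> linarith

theorem sieve_bound {X Y : ℝ} (hX : 0 ≤ X) (hY : 0 ≤ Y) {D : ℕ} (hD : 2 ≤ D) :
    (((Finset.Ioc ⌊X⌋₊ ⌊X + Y⌋₊).filter
      (fun m => ∀ p : ℕ, p.Prime → p ∣ m → D ≤ p)).card : ℝ) ≤ 2 * Y / Real.log D + D ^ 2 := by
  have hG := one_le_sqfSum hD
  set I := Finset.Ioc ⌊X⌋₊ ⌊X + Y⌋₊ with hI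
  have h1 : ((I.filter (fun m => ∀ p : ℕ, p.Prime → p ∣ m → D ≤ p)).card : ℝ) ≤
      ∑ m ∈ I, (∑ d ∈ Finset.range D with d ∣ m, selW D d) ^ 2 := by
    rw [Finset.card_eq_sum_ones, Finset.sum_filter]
    push_cast
    apply Finset.sum_le_sum
    intro m hm
    split_ifs with h
    · have : (Finset.range D).filter (· ∣ m) = {1} := by
        ext d
        simp only [Finset.mem_filter, Finset.mem_range, Finset.mem_singleton]
        constructor
        · rintro ⟨h1, h2⟩
          by_contra hne
          obtain ⟨p, hp, hpd⟩ := Nat.exists_prime_and_dvd hne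
          have hm0 : 0 < m := by
            simp only [hI, Finset.mem_Ioc] at hm; omega
          have hd0 : 0 < d := Nat.pos_of_dvd_of_pos h2 hm0
          have := h p hp (hpd.trans h2)
          have := Nat.le_of_dvd hd0 hpd
          omega
        · rintro rfl; exact ⟨by omega, one_dvd _⟩
      rw [this, Finset.sum_singleton, selW_one hD]; simp
    · positivity
  have h2 : ∑ m ∈ I, (∑ d ∈ Finset.range D with d ∣ m, selW D d) ^ 2 =
      ∑ d ∈ Finset.range D, ∑ e ∈ Finset.range D,
        selW D d * selW D e * ((I.filter (Nat.lcm d e ∣ ·)).card : ℝ) := by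
    have : ∀ m ∈ I, (∑ d ∈ Finset.range D with d ∣ m, selW D d) ^ 2 =
        ∑ d ∈ Finset.range D, ∑ e ∈ Finset.range D,
          selW D d * selW D e * (if Nat.lcm d e ∣ m then 1 else 0) := by
      intro m _
      rw [sq, Finset.sum_filter, Finset.sum_mul_sum]
      refine Finset.sum_congr rfl fun d _ => Finset.sum_congr rfl fun e _ => ?_
      by_cases h1 : d ∣ m <;> by_cases h2 : e ∣ m <;> simp [h1, h2, Nat.lcm_dvd_iff]
    rw [Finset.sum_congr rfl this, Finset.sum_comm]
    refine Finset.sum_congr rfl fun d _ => ?_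
    rw [Finset.sum_comm]
    refine Finset.sum_congr rfl fun e _ => ?_
    rw [← Finset.mul_sum, Finset.sum_boole]
  have h3 : ∑ d ∈ Finset.range D, ∑ e ∈ Finset.range D,
        selW D d * selW D e * ((I.filter (Nat.lcm d e ∣ ·)).card : ℝ) ≤
      ∑ d ∈ Finset.range D, ∑ e ∈ Finset.range D,
        (Y * (selW D d * selW D e / (Nat.lcm d e : ℝ)) + 1) := by
    refine Finset.sum_le_sum fun d _ => Finset.sum_le_sum fun e _ => ?_
    rcases Nat.eq_zero_or_pos d with rfl | hd0
    · simp [selW]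
    rcases Nat.eq_zero_or_pos e with rfl | he0
    · simp [selW]
    have hc := abs_card_multiples_sub_le hX hY (Nat.lcm d e) (Nat.lcm_pos hd0 he0).ne'
    rw [← hI] at hc
    have hw : |selW D d * selW D e| ≤ 1 := by
      rw [abs_mul]
      exact mul_le_one₀ (abs_selW_le_one hD d) (abs_nonneg _) (abs_selW_le_one hD e)
    have hmul : |selW D d * selW D e *
        (((I.filter (Nat.lcm d e ∣ ·)).card : ℝ) - Y / (Nat.lcm d e : ℝ))| ≤ 1 := by
      rw [abs_mul]
      exact mul_le_one₀ hw (abs_nonneg _) hc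
    have := (abs_le.mp hmul).2
    have e1 : Y * (selW D d * selW D e / (Nat.lcm d e : ℝ)) =
      selW D d * selW D e * (Y / (Nat.lcm d e : ℝ)) := by ring
    rw [e1]
    linarith [mul_sub (selW D d * selW D e) ((I.filter (Nat.lcm d e ∣ ·)).card : ℝ)
      (Y / (Nat.lcm d e : ℝ))]
  have h4 : ∑ d ∈ Finset.range D, ∑ e ∈ Finset.range D,
        (Y * (selW D d * selW D e / (Nat.lcm d e : ℝ)) + 1) ≤ Y * (1 / sqfSum D) + D ^ 2 := by
    simp only [Finset.sum_add_distrib, ← Finset.mul_sum, Finset.sum_const, Finset.card_range,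
      nsmul_eq_mul, mul_one]
    have := mul_le_mul_of_nonneg_left (selberg_quadratic hD) hY
    nlinarith
  have hlog : 0 < Real.log D := Real.log_pos (by exact_mod_cast (by omega : 1 < D))
  have h5 : Y * (1 / sqfSum D) ≤ 2 * Y / Real.log D := by
    rw [mul_one_div, div_le_div_iff₀ (by linarith) hlog]
    nlinarith [log_le_two_mul_sqfSum hD]
  linarith

end

section

open LSeries in
/-- Exponential formula for a Dirichlet series with prescribed logarithmic derivative. -/
lemma LSeries_eq_exp {f Λf : ℕ → ℂ} {σ0 : ℝ} (h1 : f 1 = 1) (hΛ1 : Λf 1 = 0)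
    (hconv : ∀ n : ℕ, 1 ≤ n → f n * (Real.log n : ℂ) = ∑ d ∈ n.divisors, Λf d * f (n / d))
    (hf : abscissaOfAbsConv f ≤ σ0) (hΛ : abscissaOfAbsConv Λf ≤ σ0)
    {s : ℂ} (hs : σ0 < s.re) :
    LSeries f s = Complex.exp (LSeries (fun n => Λf n / (Real.log n : ℂ)) s) := by
  set P : ℕ → ℂ := fun n => Λf n / (Real.log n : ℂ) with hP
  have hPΛ : ∀ {n : ℕ}, n ≠ 0 → logMul P n = Λf n := by
    intro n hn
    rw [logMul, hP]
    rcases Nat.lt_or_ge 1 n with h | h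
    · have : (Real.log n : ℂ) ≠ 0 := by
        have := Real.log_pos (show (1 : ℝ) < n by exact_mod_cast h)
        exact_mod_cast this.ne'
      rw [Complex.natCast_log.symm]
      field_simp
    · have : n = 1 := by omega
      subst this; simp [hΛ1]
  have haP : abscissaOfAbsConv P ≤ σ0 := by
    rw [← abscissaOfAbsConv_logMul, abscissaOfAbsConv_congr hPΛ]; exact hΛ
  have hfc : ∀ {n : ℕ}, n ≠ 0 → logMul f n = (LSeries.convolution Λf f) n := by
    intro n hn
    rw [logMul, LSeries.convolution_def, ← Complex.natCast_log, mul_comm, hconv n (by omega)]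
    exact (Nat.sum_divisorsAntidiagonal (fun i j => Λf i * f j)).symm
  have hder : ∀ z : ℂ, σ0 < z.re →
      HasDerivAt (fun z => LSeries f z * Complex.exp (-LSeries P z)) 0 z := by
    intro z hz
    have hz' : (σ0 : EReal) < z.re := by exact_mod_cast hz
    have d1 := LSeries_hasDerivAt (lt_of_le_of_lt hf hz')
    have d2 := LSeries_hasDerivAt (lt_of_le_of_lt haP hz')
    have d3 := d1.mul d2.neg.cexp
    have e0 : -LSeries (logMul f) z * cexp ((-LSeries P) z) +
        LSeries f z * (cexp ((-LSeries P) z) * - -LSeries (logMul P) z) = 0 := by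
      rw [LSeries_congr hPΛ, LSeries_congr hfc, LSeries_convolution (lt_of_le_of_lt hΛ hz')
      (lt_of_le_of_lt hf hz')]
      ring
    rw [e0] at d3
    exact d3
  have hconst : ∀ z : ℂ, σ0 < z.re → ∀ w : ℂ, σ0 < w.re →
      LSeries f z * Complex.exp (-LSeries P z) = LSeries f w * Complex.exp (-LSeries P w) := by
    intro z hz w hw
    have hopen : IsOpen {z : ℂ | σ0 < z.re} := isOpen_lt continuous_const Complex.continuous_re
    have hconv : Convex ℝ {z : ℂ | σ0 < z.re} := convex_halfSpace_re_gt σ0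
    refine hopen.is_const_of_deriv_eq_zero (hconv.isPreconnected)
      (fun z hz => (hder z hz).differentiableAt.differentiableWithinAt)
      (fun z hz => (hder z hz).deriv) hz hw
  have hlim : Filter.Tendsto (fun x : ℝ => LSeries f x * Complex.exp (-LSeries P x)) Filter.atTop
      (nhds (1 * Complex.exp (-0))) := by
    have t1 := LSeries.tendsto_atTop (lt_of_le_of_lt hf (EReal.coe_lt_top σ0))
    have t2 := LSeries.tendsto_atTop (lt_of_le_of_lt haP (EReal.coe_lt_top σ0))
    rw [h1] at t1
    have : P 1 = 0 := by simp [hP]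
    rw [this] at t2
    exact t1.mul ((Complex.continuous_exp.tendsto _).comp t2.neg)
  have hev : (fun x : ℝ => LSeries f x * Complex.exp (-LSeries P x)) =ᶠ[Filter.atTop]
      fun _ => LSeries f s * Complex.exp (-LSeries P s) := by
    filter_upwards [Filter.eventually_gt_atTop σ0] with x hx
    exact hconst _ (by simpa using hx) _ hs
  have := tendsto_nhds_unique (hlim.congr' hev) tendsto_const_nhds
  rw [neg_zero, Complex.exp_zero, mul_one] at this
  rw [Complex.exp_neg] at this
  field_simp [Complex.exp_ne_zero] at this
  exact this.symm

lemma sum_rpow_le {η : ℝ} (hη : 0 < η) (N : ℕ) :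
    ∑ n ∈ Finset.Icc 1 (N + 1), (1 : ℝ) / (n : ℝ) ^ (1 + η) ≤
      1 + 1 / η - 1 / η * ((N + 1 : ℕ) : ℝ) ^ (-η) := by
  induction N with
  | zero => simp
  | succ k ih =>
    rw [Finset.sum_Icc_succ_top (by omega)]
    set m : ℝ := ((k + 1 : ℕ) : ℝ) with hm
    have hm0 : 0 < m := by rw [hm]; positivity
    have hm1 : ((k + 1 + 1 : ℕ) : ℝ) = m + 1 := by rw [hm]; push_cast; ring
    rw [hm1]
    have key : (1 : ℝ) / (m + 1) ^ (1 + η) ≤ 1 / η * m ^ (-η) - 1 / η * (m + 1) ^ (-η) := by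
      have e1 : (1 : ℝ) / (m + 1) ^ (1 + η) = (m + 1) ^ (-η) * (1 / (m + 1)) := by
        rw [Real.rpow_add (by positivity), Real.rpow_one, Real.rpow_neg (by positivity)]
        field_simp
      have e2 : m ^ (-η) = (m + 1) ^ (-η) * (m / (m + 1)) ^ (-η) := by
        rw [← Real.mul_rpow (by positivity) (by positivity)]
        congr 1; field_simp
      have e3 : 1 + η * (1 / (m + 1)) ≤ (m / (m + 1)) ^ (-η) := by
        rw [Real.rpow_def_of_pos (by positivity)]
        have h1 := Real.add_one_le_exp (Real.log (m / (m + 1)) * -η)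
        have h2 := Real.log_le_sub_one_of_pos (show 0 < m / (m + 1) by positivity)
        have h3 : m / (m + 1) - 1 = - (1 / (m + 1)) := by field_simp; ring
        nlinarith
      have e4 : 0 < (m + 1) ^ (-η) := by positivity
      rw [e1, e2]
      have e5 := mul_le_mul_of_nonneg_left e3 e4.le
      have : (m + 1) ^ (-η) * (1 / (m + 1)) =
        1 / η * ((m + 1) ^ (-η) * (1 + η * (1 / (m + 1)))) - 1 / η * (m + 1) ^ (-η) := by
        field_simp; ring
      rw [this]
      gcongr
    linarith

lemma summable_one_div_rpow {η : ℝ} (hη : 0 < η) :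
    Summable (fun n : ℕ => (1 : ℝ) / (n : ℝ) ^ (1 + η)) :=
  Real.summable_one_div_nat_rpow.mpr (by linarith)

lemma tsum_rpow_le {η : ℝ} (hη : 0 < η) :
    ∑' n : ℕ, (1 : ℝ) / (n : ℝ) ^ (1 + η) ≤ 1 + 1 / η := by
  refine Real.tsum_le_of_sum_range_le (fun n => by positivity) fun N => ?_
  have h1 : ∑ n ∈ Finset.range N, (1 : ℝ) / (n : ℝ) ^ (1 + η) ≤
      ∑ n ∈ Finset.Icc 1 (N + 1), (1 : ℝ) / (n : ℝ) ^ (1 + η) := by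
    have hsub : (Finset.range N).filter (· ≠ 0) ⊆ Finset.Icc 1 (N + 1) := by
      intro n hn
      simp only [Finset.mem_filter, Finset.mem_range, Finset.mem_Icc] at hn ⊢
      omega
    rw [← Finset.sum_filter_add_sum_filter_not (Finset.range N) (· ≠ 0)]
    have h0 : ∑ n ∈ (Finset.range N).filter (fun n => ¬ n ≠ 0), (1 : ℝ) / (n : ℝ) ^ (1 + η) = 0 := by
      apply Finset.sum_eq_zero
      intro n hn
      simp only [ne_eq, not_not, Finset.mem_filter] at hn
      rw [hn.2, Nat.cast_zero, Real.zero_rpow (by linarith)]; simp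
    rw [h0, add_zero]
    exact Finset.sum_le_sum_of_subset_of_nonneg hsub fun i _ _ => by positivity
  have h2 := sum_rpow_le hη N
  have h3 : 0 ≤ 1 / η * ((N + 1 : ℕ) : ℝ) ^ (-η) := by positivity
  linarith

open LSeries in
/-- The logarithm of the zeta function as a sum over prime powers. -/
lemma tsum_vonMangoldt_div_log_le {η : ℝ} (hη : 0 < η) :
    Summable (fun n : ℕ => ArithmeticFunction.vonMangoldt n / Real.log n / (n : ℝ) ^ (1 + η)) ∧
    ∑' n : ℕ, ArithmeticFunction.vonMangoldt n / Real.log n / (n : ℝ) ^ (1 + η)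
      ≤ Real.log (1 + 1 / η) := by
  have hs : (1 : ℝ) < ((1 + η : ℝ) : ℂ).re := by simpa using hη
  have a1 : abscissaOfAbsConv (fun _ : ℕ => (1 : ℂ)) ≤ (1 : ℝ) := by
    exact_mod_cast abscissaOfAbsConv_le_of_le_const ⟨1, fun n _ => by simp⟩
  have a2 : abscissaOfAbsConv (fun n : ℕ => (ArithmeticFunction.vonMangoldt n : ℂ)) ≤ (1 : ℝ) := by
    apply abscissaOfAbsConv_le_of_forall_lt_LSeriesSummable
    intro y hy
    exact ArithmeticFunction.LSeriesSummable_vonMangoldt (by simpa using hy)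
  have hexp := LSeries_eq_exp (f := fun _ => 1)
    (Λf := fun n => (ArithmeticFunction.vonMangoldt n : ℂ)) (σ0 := 1) rfl (by simp)
    (by
      intro n hn
      simp only [one_mul, mul_one]
      rw [← ArithmeticFunction.vonMangoldt_sum]
      push_cast; rfl) a1 a2 hs
  set P : ℕ → ℝ := fun n =>
    ArithmeticFunction.vonMangoldt n / Real.log n / (n : ℝ) ^ (1 + η) with hP
  have hnn : ∀ n, 0 ≤ P n := fun n => div_nonneg (div_nonneg
    ArithmeticFunction.vonMangoldt_nonneg (Real.log_natCast_nonneg n)) (by positivity)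
  have hsum : Summable P := by
    refine Summable.of_nonneg_of_le hnn (fun n => ?_) (summable_one_div_rpow hη)
    rw [hP]
    apply div_le_div_of_nonneg_right _ (by positivity)
    exact div_le_one_of_le₀ ArithmeticFunction.vonMangoldt_le_log (Real.log_natCast_nonneg n)
  refine ⟨hsum, ?_⟩
  have e1 : LSeries (fun _ : ℕ => (1 : ℂ)) ((1 + η : ℝ) : ℂ) =
      ((∑' n : ℕ, (1 : ℝ) / (n : ℝ) ^ (1 + η) : ℝ) : ℂ) := by
    rw [LSeries, Complex.ofReal_tsum]
    congr 1; ext n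
    rcases eq_or_ne n 0 with rfl | hn
    · rw [LSeries.term_zero, Nat.cast_zero, Real.zero_rpow (by linarith)]; simp
    · rw [LSeries.term_of_ne_zero hn]
      push_cast
      rw [Complex.ofReal_cpow (by positivity)]; push_cast; rfl
  have e2 : LSeries (fun n : ℕ => (ArithmeticFunction.vonMangoldt n : ℂ) / (Real.log n : ℂ))
      ((1 + η : ℝ) : ℂ) = ((∑' n : ℕ, P n : ℝ) : ℂ) := by
    rw [LSeries, Complex.ofReal_tsum]
    congr 1; ext n
    rcases eq_or_ne n 0 with rfl | hn
    · simp [hP]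
    · rw [LSeries.term_of_ne_zero hn, hP]
      push_cast
      rw [Complex.ofReal_cpow (by positivity)]; push_cast; rfl
  rw [e1, e2] at hexp
  have hexp' : (∑' n : ℕ, (1 : ℝ) / (n : ℝ) ^ (1 + η)) = Real.exp (∑' n : ℕ, P n) := by
    exact_mod_cast hexp
  rw [Real.le_log_iff_exp_le (by positivity), ← hexp']
  exact tsum_rpow_le hη

end

section

open scoped ArithmeticFunction.vonMangoldt

lemma vM_nonneg (n : ℕ) : 0 ≤ Λ n := ArithmeticFunction.vonMangoldt_nonneg

lemma sum_vM_le {S : Finset ℕ} {X : ℝ} (hX : 0 ≤ X) (hS : ∀ k ∈ S, (k : ℝ) ≤ X) :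
    ∑ k ∈ S, Λ k ≤ 6 * X := by
  have h1 : ∑ k ∈ S, Λ k ≤ Chebyshev.psi X := by
    rw [← Finset.sum_filter_add_sum_filter_not S (· ≠ 0)]
    have h0 : ∑ n ∈ S.filter (fun n => ¬ n ≠ 0), Λ n = 0 := by
      apply Finset.sum_eq_zero
      intro n hn
      simp only [ne_eq, not_not, Finset.mem_filter] at hn
      rw [hn.2]; simp
    rw [h0, add_zero, Chebyshev.psi]
    apply Finset.sum_le_sum_of_subset_of_nonneg
    · intro k hk
      simp only [Finset.mem_filter] at hk
      simp only [Finset.mem_Ioc]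
      exact ⟨Nat.pos_of_ne_zero hk.2, Nat.le_floor (hS k hk.1)⟩
    · intro i _ _; exact vM_nonneg i
  have h2 := Chebyshev.psi_le_const_mul_self hX
  have h3 : Real.log 4 ≤ 2 := by
    rw [show (4 : ℝ) = 2 ^ 2 by norm_num, Real.log_pow]
    have := Real.log_two_lt_d9; push_cast; linarith
  nlinarith

lemma sum_vM_div_le_of_block {S : Finset ℕ} {X : ℝ} (hX : 0 < X)
    (hS : ∀ k ∈ S, X ≤ k ∧ (k : ℝ) ≤ Real.exp 1 * X) : ∑ k ∈ S, Λ k / k ≤ 18 := by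
  have h1 : ∑ k ∈ S, Λ k / k ≤ ∑ k ∈ S, Λ k / X := by
    refine Finset.sum_le_sum fun k hk => ?_
    exact div_le_div_of_nonneg_left (vM_nonneg k) hX (hS k hk).1
  rw [← Finset.sum_div] at h1
  have h2 := sum_vM_le (S := S) (X := Real.exp 1 * X) (by positivity) (fun k hk => (hS k hk).2)
  have h3 := Real.exp_one_lt_d9
  refine h1.trans ?_
  rw [div_le_iff₀ hX]
  nlinarith

lemma sum_geom_exp_le {τ : ℝ} (hτ : 0 < τ) (hτ1 : τ ≤ 1) (M : ℕ) :
    ∑ j ∈ Finset.range M, Real.exp (-(τ * j)) ≤ 2 / τ := by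
  have h0 : Real.exp (-τ) < 1 := by rw [Real.exp_lt_one_iff]; linarith
  have h1 : ∀ j : ℕ, Real.exp (-(τ * j)) = Real.exp (-τ) ^ j := by
    intro j; rw [← Real.exp_nat_mul]; congr 1; ring
  simp_rw [h1]
  have h2 := Summable.sum_le_tsum (Finset.range M) (fun j _ => by positivity)
    (summable_geometric_of_lt_one (Real.exp_pos (-τ)).le h0)
  rw [tsum_geometric_of_lt_one (Real.exp_pos (-τ)).le h0] at h2
  refine h2.trans ?_
  have h3 : τ / 2 ≤ 1 - Real.exp (-τ) := by
    have h4 : Real.exp (-τ) * (1 + τ) ≤ 1 := by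
      have := Real.add_one_le_exp τ
      have h5 : Real.exp (-τ) * Real.exp τ = 1 := by rw [← Real.exp_add]; simp
      nlinarith [Real.exp_pos (-τ)]
    have : Real.exp (-τ) ≤ 1 - τ / 2 := by
      by_contra h
      push Not at h
      nlinarith
    linarith
  rw [inv_le_comm₀ (by linarith) (by positivity)]
  simpa using h3

/-- Weighted sums of `Λ(k)/k` by dyadic-type blocks. -/
lemma sum_vM_weight_le {S : Finset ℕ} {τ : ℝ} (hτ : 0 < τ) (hτ1 : τ ≤ 1) (J : ℕ → ℕ)
    (X : ℕ → ℝ) (hX : ∀ j, 0 < X j)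
    (hJ : ∀ k ∈ S, X (J k) ≤ k ∧ (k : ℝ) ≤ Real.exp 1 * X (J k))
    (φ : ℕ → ℝ) (hφ : ∀ k ∈ S, φ k ≤ Real.exp (-(τ * J k))) :
    ∑ k ∈ S, Λ k / k * φ k ≤ 36 / τ := by
  obtain ⟨M, hM⟩ : ∃ M, ∀ k ∈ S, J k ∈ Finset.range M := by
    refine ⟨S.sup J + 1, fun k hk => ?_⟩
    rw [Finset.mem_range]
    exact Nat.lt_succ_of_le (Finset.le_sup hk)
  calc ∑ k ∈ S, Λ k / k * φ k ≤ ∑ k ∈ S, Λ k / k * Real.exp (-(τ * J k)) := by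
        refine Finset.sum_le_sum fun k hk => ?_
        exact mul_le_mul_of_nonneg_left (hφ k hk) (div_nonneg (vM_nonneg k) (by positivity))
    _ = ∑ j ∈ Finset.range M, ∑ k ∈ S with J k = j, Λ k / k * Real.exp (-(τ * J k)) :=
        (Finset.sum_fiberwise_of_maps_to hM _).symm
    _ ≤ ∑ j ∈ Finset.range M, 18 * Real.exp (-(τ * j)) := by
        refine Finset.sum_le_sum fun j _ => ?_
        have : ∑ k ∈ S with J k = j, Λ k / k * Real.exp (-(τ * J k)) =
            (∑ k ∈ S with J k = j, Λ k / k) * Real.exp (-(τ * j)) := by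
          rw [Finset.sum_mul]
          refine Finset.sum_congr rfl fun k hk => ?_
          rw [(Finset.mem_filter.mp hk).2]
        rw [this]
        refine mul_le_mul_of_nonneg_right ?_ (Real.exp_pos _).le
        apply sum_vM_div_le_of_block (hX j)
        intro k hk
        rw [Finset.mem_filter] at hk
        have := hJ k hk.1
        rwa [hk.2] at this
    _ ≤ 36 / τ := by
        rw [← Finset.mul_sum]
        have := sum_geom_exp_le hτ hτ1 M
        calc _ ≤ 18 * (2 / τ) := by gcongr
          _ = 36 / τ := by ring

lemma sum_vM_rpow_neg_le {S : Finset ℕ} {τ : ℝ} (hτ : 0 < τ) (hτ1 : τ ≤ 1) :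
    ∑ k ∈ S, Λ k / (k : ℝ) ^ (1 + τ) ≤ 36 / τ := by
  have h0 : ∑ k ∈ S, Λ k / (k : ℝ) ^ (1 + τ) =
      ∑ k ∈ S.filter (· ≠ 0), Λ k / k * (k : ℝ) ^ (-τ) := by
    rw [Finset.sum_filter]
    refine Finset.sum_congr rfl fun k _ => ?_
    rcases eq_or_ne k 0 with rfl | hk
    · simp
    · have : (0 : ℝ) < k := by positivity
      rw [if_pos hk, Real.rpow_add this, Real.rpow_one, Real.rpow_neg this.le]
      field_simp
  rw [h0]
  apply sum_vM_weight_le hτ hτ1 (fun k => ⌊Real.log k⌋₊) (fun j => Real.exp j)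
    (fun j => Real.exp_pos _)
  · intro k hk
    have hk0 : (0 : ℝ) < k := by
      have := (Finset.mem_filter.mp hk).2
      positivity
    have a1 := Nat.floor_le (Real.log_natCast_nonneg k)
    have a2 := Nat.lt_floor_add_one (Real.log k)
    rw [← Real.exp_add]
    refine ⟨?_, ?_⟩
    · rwa [← Real.le_log_iff_exp_le hk0]
    · rw [← Real.log_le_iff_le_exp hk0]; linarith
  · intro k hk
    have hk0 : (0 : ℝ) < k := by
      have := (Finset.mem_filter.mp hk).2
      positivity
    have a1 := Nat.floor_le (Real.log_natCast_nonneg k)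
    rw [Real.rpow_def_of_pos hk0]
    apply Real.exp_le_exp.mpr
    nlinarith

lemma sum_vM_rpow_top_le {S : Finset ℕ} {τ N : ℝ} (hτ : 0 < τ) (hτ1 : τ ≤ 1)
    (hS : ∀ k ∈ S, (k : ℝ) ≤ N) :
    ∑ k ∈ S, Λ k / k * (k / N) ^ τ ≤ 36 / τ := by
  have h0 : ∑ k ∈ S, Λ k / k * (k / N) ^ τ =
      ∑ k ∈ S.filter (· ≠ 0), Λ k / k * (k / N) ^ τ := by
    rw [Finset.sum_filter]
    refine Finset.sum_congr rfl fun k _ => ?_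
    rcases eq_or_ne k 0 with rfl | hk
    · simp
    · rw [if_pos hk]
  rw [h0]
  rcases Finset.eq_empty_or_nonempty (S.filter (· ≠ 0)) with he | ⟨k0, hk0⟩
  · rw [he]; simp; positivity
  have hN : 0 < N := by
    have := hS k0 (Finset.mem_filter.mp hk0).1
    have h2 := (Finset.mem_filter.mp hk0).2
    have : (0 : ℝ) < k0 := by positivity
    linarith
  have hpos : ∀ k ∈ S.filter (· ≠ 0), (0 : ℝ) < k := by
    intro k hk
    have := (Finset.mem_filter.mp hk).2
    positivity
  have hlog : ∀ k ∈ S.filter (· ≠ 0), 0 ≤ Real.log (N / k) := by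
    intro k hk
    apply Real.log_nonneg
    rw [le_div_iff₀ (hpos k hk), one_mul]
    exact hS k (Finset.mem_filter.mp hk).1
  apply sum_vM_weight_le hτ hτ1 (fun k => ⌊Real.log (N / k)⌋₊) (fun j => N * Real.exp (-(j + 1)))
    (fun j => by positivity)
  · intro k hk
    have hk0 := hpos k hk
    have a1 := Nat.floor_le (hlog k hk)
    have a2 := Nat.lt_floor_add_one (Real.log (N / k))
    generalize ⌊Real.log (N / k)⌋₊ = j at a1 a2 ⊢
    rw [Real.log_div hN.ne' hk0.ne'] at a1 a2
    have e1 : N * Real.exp (-((j : ℝ) + 1)) = Real.exp (Real.log N + -((j : ℝ) + 1)) := by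
      rw [Real.exp_add, Real.exp_log hN]
    rw [e1, ← Real.exp_add]
    refine ⟨?_, ?_⟩
    · rw [← Real.le_log_iff_exp_le hk0]
      linarith
    · rw [← Real.log_le_iff_le_exp hk0]
      linarith
  · intro k hk
    have hk0 := hpos k hk
    have a1 := Nat.floor_le (hlog k hk)
    rw [Real.rpow_def_of_pos (by positivity)]
    apply Real.exp_le_exp.mpr
    have : Real.log (k / N) = - Real.log (N / k) := by
      rw [← Real.log_inv, inv_div]
    rw [this]
    nlinarith

lemma sum_vM_div_le (N : ℕ) : ∑ n ∈ Finset.Icc 1 N, Λ n / n ≤ Real.log N + 6 := by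
  rcases Nat.eq_zero_or_pos N with rfl | hN
  · simp
  have hN0 : (0 : ℝ) < N := by exact_mod_cast hN
  have h1 : Real.log (N.factorial) = ∑ d ∈ Finset.Icc 1 N, Λ d * ((N / d : ℕ) : ℝ) := by
    have : Real.log (N.factorial) = ∑ n ∈ Finset.Icc 1 N, Real.log n := by
      have : ∀ N : ℕ, Real.log (N.factorial) = ∑ n ∈ Finset.Icc 1 N, Real.log n := by
        intro N
        induction N with
        | zero => simp
        | succ k ih =>
          rw [Finset.sum_Icc_succ_top (by omega), ← ih, Nat.factorial_succ, Nat.cast_mul,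
            Real.log_mul (by positivity) (by positivity), add_comm]
      exact this N
    rw [this]
    have h2 : ∀ n ∈ Finset.Icc 1 N, Real.log n = ∑ d ∈ Finset.Icc 1 N, if d ∣ n then Λ d else 0 := by
      intro n hn
      simp only [Finset.mem_Icc] at hn
      rw [← ArithmeticFunction.vonMangoldt_sum, ← Finset.sum_filter]
      apply Finset.sum_congr _ (fun _ _ => rfl)
      ext d
      simp only [Nat.mem_divisors, Finset.mem_filter, Finset.mem_Icc]
      constructor
      · rintro ⟨h, h'⟩
        exact ⟨⟨Nat.pos_of_dvd_of_pos h (by omega), (Nat.le_of_dvd (by omega) h).trans hn.2⟩, h⟩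
      · rintro ⟨h, h'⟩
        exact ⟨h', by omega⟩
    rw [Finset.sum_congr rfl h2, Finset.sum_comm]
    refine Finset.sum_congr rfl fun d hd => ?_
    rw [← Finset.sum_filter, Finset.sum_const, nsmul_eq_mul, mul_comm]
    congr 2
    rw [← Nat.Ioc_filter_dvd_card_eq_div]
    rfl
  have h2 : Real.log (N.factorial) ≤ N * Real.log N := by
    rw [← Real.log_pow]
    apply Real.log_le_log (by positivity)
    exact_mod_cast Nat.factorial_le_pow N
  have h3 : ∑ d ∈ Finset.Icc 1 N, Λ d * ((N : ℝ) / d - 1) ≤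
      ∑ d ∈ Finset.Icc 1 N, Λ d * ((N / d : ℕ) : ℝ) := by
    refine Finset.sum_le_sum fun d _ => mul_le_mul_of_nonneg_left ?_ (vM_nonneg d)
    rw [← Nat.floor_div_eq_div (K := ℝ)]
    have := Nat.lt_floor_add_one ((N : ℝ) / d)
    linarith
  have h4 : ∑ d ∈ Finset.Icc 1 N, Λ d * ((N : ℝ) / d - 1) =
      N * (∑ n ∈ Finset.Icc 1 N, Λ n / n) - ∑ d ∈ Finset.Icc 1 N, Λ d := by
    rw [Finset.mul_sum, ← Finset.sum_sub_distrib]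
    refine Finset.sum_congr rfl fun d _ => ?_
    ring
  have h5 := sum_vM_le (S := Finset.Icc 1 N) (X := N) hN0.le (fun k hk => by
    simp only [Finset.mem_Icc] at hk; exact_mod_cast hk.2)
  have h6 : (N : ℝ) * (∑ n ∈ Finset.Icc 1 N, Λ n / n) ≤ N * (Real.log N + 6) := by
    linarith
  exact le_of_mul_le_mul_left h6 hN0

/-- Brun–Titchmarsh inequality for the von Mangoldt function in short intervals. -/
lemma exists_brun_titchmarsh : ∃ C : ℝ, 0 < C ∧ ∀ (S : Finset ℕ) (X Y : ℝ), 1 ≤ X →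
    X ^ (3 / 5 : ℝ) ≤ Y → (∀ k ∈ S, X < k ∧ (k : ℝ) ≤ X + Y) → ∑ k ∈ S, Λ k ≤ C * Y := by
  obtain ⟨C0, hC0⟩ := Chebyshev.psi_sub_theta_le_mul_sqrt
  refine ⟨2 * |C0| + 300, by positivity, fun S X Y hX hXY hS => ?_⟩
  have hY1 : 1 ≤ Y := (Real.one_le_rpow hX (by norm_num)).trans hXY
  rcases le_or_gt X (4 * Y) with hc | hc
  · have := sum_vM_le (S := S) (X := X + Y) (by linarith) (fun k hk => (hS k hk).2)
    nlinarith [abs_nonneg C0]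
  have hX4 : 4 < X := by linarith
  have hlogX : 0 < Real.log X := Real.log_pos (by linarith)
  have hsplit := Finset.sum_filter_add_sum_filter_not S Nat.Prime (fun k => Λ k)
  have hnp : ∑ k ∈ S with ¬ k.Prime, Λ k ≤ 2 * |C0| * Y := by
    have h1 : ∑ k ∈ S with ¬ k.Prime, Λ k ≤ Chebyshev.psi (X + Y) - Chebyshev.theta (X + Y) := by
      rw [Chebyshev.psi_sub_theta_eq_sum_not_prime]
      apply Finset.sum_le_sum_of_subset_of_nonneg
      · intro k hk
        simp only [Finset.mem_filter, Finset.mem_Ioc] at hk ⊢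
        have := hS k hk.1
        refine ⟨⟨?_, Nat.le_floor this.2⟩, hk.2⟩
        have : (0 : ℝ) < k := by linarith
        exact_mod_cast this
      · intro i _ _; exact vM_nonneg i
    refine h1.trans ((hC0 _).trans ?_)
    have h2 : Real.sqrt (X + Y) ≤ 2 * Y := by
      rw [Real.sqrt_le_left (by linarith)]
      have h3 : X ≤ Y ^ 2 := by
        calc X ≤ X ^ (6 / 5 : ℝ) := by
              conv_lhs => rw [← Real.rpow_one X]
              exact Real.rpow_le_rpow_of_exponent_le hX (by norm_num)
          _ = (X ^ (3 / 5 : ℝ)) ^ 2 := by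
              rw [← Real.rpow_natCast, ← Real.rpow_mul (by linarith)]; norm_num
          _ ≤ Y ^ 2 := by gcongr
      nlinarith
    calc C0 * Real.sqrt (X + Y) ≤ |C0| * Real.sqrt (X + Y) :=
          mul_le_mul_of_nonneg_right (le_abs_self _) (Real.sqrt_nonneg _)
      _ ≤ |C0| * (2 * Y) := by gcongr
      _ = 2 * |C0| * Y := by ring
  have hp : ∑ k ∈ S with k.Prime, Λ k ≤ 300 * Y := by
    set D := ⌈X ^ (1 / 5 : ℝ)⌉₊ with hD
    have hx5 : 1 < X ^ (1 / 5 : ℝ) := Real.one_lt_rpow (by linarith) (by norm_num)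
    have hDge : X ^ (1 / 5 : ℝ) ≤ D := Nat.le_ceil _
    have hDlt : (D : ℝ) < X ^ (1 / 5 : ℝ) + 1 := Nat.ceil_lt_add_one (by positivity)
    have hD2 : 2 ≤ D := by
      have : (1 : ℝ) < D := by linarith
      have : 1 < D := by exact_mod_cast this
      omega
    have hDX : (D : ℝ) < X := by
      have : X ^ (1 / 5 : ℝ) ≤ X ^ (1 / 2 : ℝ) :=
        Real.rpow_le_rpow_of_exponent_le hX (by norm_num)
      rw [← Real.sqrt_eq_rpow] at this
      have h2 : Real.sqrt X ^ 2 = X := Real.sq_sqrt (by linarith)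
      have h3 : 2 ≤ Real.sqrt X := Real.le_sqrt_of_sq_le (by linarith)
      nlinarith
    have hs := sieve_bound (X := X) (Y := Y) (by linarith) (by linarith) hD2
    have hcard : ((S.filter Nat.Prime).card : ℝ) ≤ 2 * Y / Real.log D + D ^ 2 := by
      refine le_trans ?_ hs
      norm_cast
      apply Finset.card_le_card
      intro k hk
      simp only [Finset.mem_filter, Finset.mem_Ioc] at hk ⊢
      have h1 := hS k hk.1
      refine ⟨⟨(Nat.floor_lt (by linarith)).mpr h1.1, Nat.le_floor h1.2⟩, fun p hp hpk => ?_⟩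
      rw [(Nat.prime_dvd_prime_iff_eq hp hk.2).mp hpk]
      have : (D : ℝ) < k := by linarith
      exact_mod_cast this.le
    have hlogle : ∀ k ∈ S.filter Nat.Prime, Λ k ≤ 2 * Real.log X := by
      intro k hk
      have h1 := hS k (Finset.mem_filter.mp hk).1
      refine ArithmeticFunction.vonMangoldt_le_log.trans ?_
      rw [show 2 * Real.log X = Real.log (X ^ 2) by rw [Real.log_pow]; norm_num]
      apply Real.log_le_log (by linarith)
      nlinarith
    have h1 : ∑ k ∈ S with k.Prime, Λ k ≤ (S.filter Nat.Prime).card * (2 * Real.log X) := by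
      have := Finset.sum_le_card_nsmul _ _ _ hlogle
      rwa [nsmul_eq_mul] at this
    have hlogD : Real.log X / 5 ≤ Real.log D := by
      have := Real.log_le_log (by positivity) hDge
      rw [Real.log_rpow (by linarith)] at this
      linarith
    have h2 : 2 * Y / Real.log D ≤ 10 * Y / Real.log X := by
      rw [div_le_div_iff₀ (by linarith) hlogX]
      nlinarith
    have h3 : (D : ℝ) ^ 2 ≤ 4 * X ^ (2 / 5 : ℝ) := by
      have e1 : X ^ (2 / 5 : ℝ) = (X ^ (1 / 5 : ℝ)) ^ 2 := by
        rw [← Real.rpow_natCast, ← Real.rpow_mul (by linarith)]; norm_num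
      rw [e1]
      have : (D : ℝ) ≤ 2 * X ^ (1 / 5 : ℝ) := by linarith
      have h0 : (0 : ℝ) ≤ D := Nat.cast_nonneg _
      nlinarith
    have h4 : X ^ (2 / 5 : ℝ) * Real.log X ≤ 5 * Y := by
      have := Real.log_le_rpow_div (x := X) (ε := 1 / 5) (by linarith) (by norm_num)
      calc X ^ (2 / 5 : ℝ) * Real.log X ≤ X ^ (2 / 5 : ℝ) * (X ^ (1 / 5 : ℝ) / (1 / 5)) := by gcongr
        _ = 5 * X ^ (3 / 5 : ℝ) := by
            rw [show (3 / 5 : ℝ) = 2 / 5 + 1 / 5 by norm_num, Real.rpow_add (by linarith)]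
            ring
        _ ≤ 5 * Y := by gcongr
    calc _ ≤ (S.filter Nat.Prime).card * (2 * Real.log X) := h1
      _ ≤ (10 * Y / Real.log X + 4 * X ^ (2 / 5 : ℝ)) * (2 * Real.log X) := by
          gcongr; linarith
      _ = 20 * Y + 8 * (X ^ (2 / 5 : ℝ) * Real.log X) := by field_simp; ring
      _ ≤ 300 * Y := by linarith
  linarith

/-- Upper bound in Mertens' second theorem. -/
lemma sum_one_div_prime_le {y : ℝ} (hy : Real.exp 1 ≤ y) {S : Finset ℕ}
    (hS : ∀ p ∈ S, p.Prime ∧ (p : ℝ) ≤ y) :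
    ∑ p ∈ S, (1 : ℝ) / p ≤ Real.log (Real.log y) + 8 := by
  have hy0 : 0 < y := (Real.exp_pos 1).trans_le hy
  set u := Real.log y with hu
  have hu1 : 1 ≤ u := (Real.le_log_iff_exp_le hy0).mpr hy
  set η := 1 / u with hη
  have hη0 : 0 < η := by positivity
  obtain ⟨hs1, hs2⟩ := tsum_vonMangoldt_div_log_le hη0
  have h1 : ∀ p ∈ S, (1 : ℝ) / p ≤ Λ p / Real.log p / (p : ℝ) ^ (1 + η) + η * (Λ p / p) := by
    intro p hp
    obtain ⟨hpp, hpy⟩ := hS p hp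
    have hp1 : (1 : ℝ) < p := by exact_mod_cast hpp.one_lt
    have hlp := Real.log_pos hp1
    rw [ArithmeticFunction.vonMangoldt_apply_prime hpp, div_self hlp.ne',
      Real.rpow_add (by linarith), Real.rpow_one]
    have e1 : 1 - η * Real.log p ≤ 1 / (p : ℝ) ^ η := by
      rw [one_div, ← Real.rpow_neg (by linarith), Real.rpow_def_of_pos (by linarith)]
      have := Real.add_one_le_exp (Real.log p * -η)
      linarith
    have e2 := mul_le_mul_of_nonneg_left e1 (show 0 ≤ 1 / (p : ℝ) by positivity)
    have e3 : 1 / (p : ℝ) * (1 / (p : ℝ) ^ η) = 1 / (p * (p : ℝ) ^ η) := by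
      rw [div_mul_div_comm, one_mul]
    rw [e3] at e2
    have e4 : 1 / (p : ℝ) * (1 - η * Real.log p) = 1 / p - η * (Real.log p / p) := by ring
    linarith
  have h2 : ∑ p ∈ S, Λ p / Real.log p / (p : ℝ) ^ (1 + η) ≤ Real.log (1 + 1 / η) :=
    (hs1.sum_le_tsum S (fun n _ => div_nonneg (div_nonneg (vM_nonneg n)
      (Real.log_natCast_nonneg n)) (by positivity))).trans hs2
  have h3 : ∑ p ∈ S, Λ p / p ≤ u + 6 := by
    have hfl : (⌊y⌋₊ : ℝ) ≤ y := Nat.floor_le hy0.le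
    have a1 : ∑ p ∈ S, Λ p / p ≤ ∑ n ∈ Finset.Icc 1 ⌊y⌋₊, Λ n / n := by
      apply Finset.sum_le_sum_of_subset_of_nonneg
      · intro p hp
        have := hS p hp
        exact Finset.mem_Icc.mpr ⟨this.1.one_lt.le, Nat.le_floor this.2⟩
      · intro i _ _; exact div_nonneg (vM_nonneg i) (by positivity)
    have a2 := sum_vM_div_le ⌊y⌋₊
    have a3 : Real.log ⌊y⌋₊ ≤ u := by
      rcases Nat.eq_zero_or_pos ⌊y⌋₊ with h | h
      · rw [h]; simp; linarith
      · exact Real.log_le_log (by exact_mod_cast h) hfl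
    linarith
  have h4 : Real.log (1 + 1 / η) ≤ Real.log u + 1 := by
    rw [hη, one_div_one_div]
    have : (1 + u) ≤ Real.exp 1 * u := by
      have := Real.exp_one_gt_d9
      nlinarith
    calc Real.log (1 + u) ≤ Real.log (Real.exp 1 * u) := Real.log_le_log (by positivity) this
      _ = Real.log u + 1 := by
        rw [Real.log_mul (Real.exp_pos 1).ne' (by positivity), Real.log_exp]; ring
  have h5 : ∑ p ∈ S, (1 : ℝ) / p ≤ Real.log (1 + 1 / η) + η * (u + 6) := by
    refine (Finset.sum_le_sum h1).trans ?_
    rw [Finset.sum_add_distrib, ← Finset.mul_sum]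
    gcongr
  have h6 : η * (u + 6) ≤ 7 := by
    rw [hη, div_mul_eq_mul_div, one_mul, div_le_iff₀ (by positivity)]; linarith
  linarith

/-- Tail of the prime zeta function. -/
lemma sum_prime_rpow_tail_le {y : ℝ} (hy : Real.exp 1 ≤ y) {S : Finset ℕ}
    (hS : ∀ p ∈ S, p.Prime ∧ y < p) :
    ∑ p ∈ S, (1 : ℝ) / (p : ℝ) ^ (1 + 1 / Real.log y) ≤ 36 := by
  have hy0 : 0 < y := (Real.exp_pos 1).trans_le hy
  have hu1 : 1 ≤ Real.log y := (Real.le_log_iff_exp_le hy0).mpr hy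
  have h1 := sum_vM_rpow_neg_le (S := S) (τ := 1 / Real.log y) (by positivity)
    ((div_le_one (by linarith)).mpr hu1)
  have h2 : ∑ p ∈ S, (1 : ℝ) / (p : ℝ) ^ (1 + 1 / Real.log y) ≤
      1 / Real.log y * ∑ k ∈ S, Λ k / (k : ℝ) ^ (1 + 1 / Real.log y) := by
    rw [Finset.mul_sum]
    refine Finset.sum_le_sum fun p hp => ?_
    obtain ⟨hpp, hpy⟩ := hS p hp
    rw [ArithmeticFunction.vonMangoldt_apply_prime hpp, ← mul_div_assoc]
    apply div_le_div_of_nonneg_right _ (by positivity)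
    rw [div_mul_eq_mul_div, one_mul, le_div_iff₀ (by linarith), one_mul]
    exact Real.log_le_log hy0 hpy.le
  refine h2.trans ?_
  have : 1 / Real.log y * (36 / (1 / Real.log y)) = 36 := by field_simp
  rw [← this]
  gcongr

end

section

/-- All prime factors are less than `y`. -/
def SmoothBelow (y n : ℕ) : Prop := ∀ p : ℕ, p.Prime → p ∣ n → p < y

/-- All prime factors are at least `y`. -/
def RoughFrom (y n : ℕ) : Prop := ∀ p : ℕ, p.Prime → p ∣ n → y ≤ p

lemma SmoothBelow.ne_zero {y n : ℕ} (h : SmoothBelow y n) : n ≠ 0 := by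
  rintro rfl
  obtain ⟨p, hp1, hp⟩ := Nat.exists_infinite_primes y
  have := h p hp (dvd_zero p)
  omega

lemma SmoothBelow.of_dvd {y m n : ℕ} (h : SmoothBelow y n) (hmn : m ∣ n) : SmoothBelow y m :=
  fun p hp hpm => h p hp (hpm.trans hmn)

lemma RoughFrom.of_dvd {y m n : ℕ} (h : RoughFrom y n) (hmn : m ∣ n) : RoughFrom y m :=
  fun p hp hpm => h p hp (hpm.trans hmn)

lemma SmoothBelow.mul {y m n : ℕ} (hm : SmoothBelow y m) (hn : SmoothBelow y n) :
    SmoothBelow y (m * n) := fun p hp h => (hp.dvd_mul.mp h).elim (hm p hp) (hn p hp)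

lemma RoughFrom.mul {y m n : ℕ} (hm : RoughFrom y m) (hn : RoughFrom y n) :
    RoughFrom y (m * n) := fun p hp h => (hp.dvd_mul.mp h).elim (hm p hp) (hn p hp)

lemma smoothBelow_one (y : ℕ) : SmoothBelow y 1 := fun _ hp h =>
  absurd (Nat.dvd_one.mp h) hp.one_lt.ne'

lemma roughFrom_one (y : ℕ) : RoughFrom y 1 := fun _ hp h =>
  absurd (Nat.dvd_one.mp h) hp.one_lt.ne'

lemma SmoothBelow.coprime {y m n : ℕ} (hm : SmoothBelow y m) (hn : RoughFrom y n) :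
    Nat.Coprime m n := by
  by_contra h
  obtain ⟨p, hp, h1, h2⟩ := Nat.Prime.not_coprime_iff_dvd.mp h
  have := hm p hp h1
  have := hn p hp h2
  omega

lemma exists_smooth_rough (y n : ℕ) (hn : n ≠ 0) :
    ∃ a b : ℕ, a * b = n ∧ SmoothBelow y a ∧ RoughFrom y b := by
  induction n using induction_on_primes with
  | zero => exact absurd rfl hn
  | one => exact ⟨1, 1, rfl, smoothBelow_one y, roughFrom_one y⟩
  | prime_mul p m hp ih =>
    have hm : m ≠ 0 := by rintro rfl; simp at hn
    obtain ⟨a, b, h1, h2, h3⟩ := ih hm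
    have hpp : ∀ q : ℕ, q.Prime → q ∣ p → q = p := fun q hq h =>
      (Nat.prime_dvd_prime_iff_eq hq hp).mp h
    rcases lt_or_ge p y with h | h
    · exact ⟨p * a, b, by rw [mul_assoc, h1],
        SmoothBelow.mul (fun q hq hqp => by rw [hpp q hq hqp]; exact h) h2, h3⟩
    · exact ⟨a, p * b, by rw [mul_left_comm, h1], h2,
        RoughFrom.mul (fun q hq hqp => by rw [hpp q hq hqp]; exact h) h3⟩

/-- The `y`-smooth part of `n`. -/
def smPart (y n : ℕ) : ℕ := if h : n = 0 then 1 else (exists_smooth_rough y n h).choose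

/-- The `y`-rough part of `n`. -/
def roPart (y n : ℕ) : ℕ := n / smPart y n

lemma smPart_spec {y n : ℕ} (hn : n ≠ 0) :
    smPart y n * roPart y n = n ∧ SmoothBelow y (smPart y n) ∧ RoughFrom y (roPart y n) := by
  have h1 : smPart y n = (exists_smooth_rough y n hn).choose := by rw [smPart, dif_neg hn]
  obtain ⟨b, hb1, hb2, hb3⟩ := (exists_smooth_rough y n hn).choose_spec
  rw [← h1] at hb1 hb2
  have h2 : roPart y n = b := by
    exact Nat.div_eq_of_eq_mul_right (Nat.pos_of_ne_zero hb2.ne_zero) hb1.symm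
  rw [h2]
  exact ⟨hb1, hb2, hb3⟩

lemma smPart_roPart_unique {y a b : ℕ} (ha : SmoothBelow y a) (hb : RoughFrom y b) (hb0 : b ≠ 0) :
    smPart y (a * b) = a ∧ roPart y (a * b) = b := by
  have hab : a * b ≠ 0 := mul_ne_zero ha.ne_zero hb0
  obtain ⟨h1, h2, h3⟩ := smPart_spec (y := y) hab
  have e : smPart y (a * b) = a := by
    apply Nat.dvd_antisymm
    · exact (h2.coprime hb).dvd_of_dvd_mul_right (Dvd.intro _ h1)
    · exact (ha.coprime h3).dvd_of_dvd_mul_right (Dvd.intro b rfl |>.trans (dvd_of_eq h1.symm))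
  refine ⟨e, ?_⟩
  rw [e] at h1
  exact Nat.eq_of_mul_eq_mul_left (Nat.pos_of_ne_zero ha.ne_zero) h1

/-- Combinatorial trichotomy behind Shiu's theorem. -/
lemma shiu_trichotomy {X : ℝ} (hX : 16 ≤ X) {W : ℝ} (hW : 1 < W) {n : ℕ} (hn : X < n) :
    (∃ d : ℕ, X ^ (1 / 24 : ℝ) < d ∧ (d : ℝ) ≤ X ^ (1 / 6 : ℝ) ∧ d ^ 2 ∣ n) ∨
    (∃ a : ℕ, a ∣ n ∧ X ^ (1 / 8 : ℝ) < a ∧ (a : ℝ) ≤ X ^ (1 / 4 : ℝ) ∧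
      SmoothBelow ⌈W⌉₊ a) ∨
    (∃ j a : ℕ, 1 ≤ j ∧ a ∣ n ∧ (a : ℝ) ≤ X ^ (1 / 4 : ℝ) ∧ 1 ≤ a ∧
      (∀ p : ℕ, p.Prime → p ∣ a → (p : ℝ) ≤ X ^ (1 / (j : ℝ))) ∧
      (∀ p : ℕ, p.Prime → p ∣ n / a → X ^ (1 / ((j : ℝ) + 1)) < p) ∧
      Nat.Coprime a (n / a) ∧ (X ^ (1 / 8 : ℝ) < a ∨ j ≤ 8) ∧
      (j * Real.log W ≤ Real.log X ∨ j ≤ 8)) := by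
  have hX0 : 0 < X := by linarith
  have hn0 : n ≠ 0 := by rintro rfl; simp at hn; linarith
  have hZn : X ^ (1 / 4 : ℝ) < n := by
    refine lt_of_le_of_lt ?_ hn
    conv_rhs => rw [← Real.rpow_one X]
    exact Real.rpow_le_rpow_of_exponent_le (by linarith) (by norm_num)
  have hex : ∃ t : ℕ, X ^ (1 / 4 : ℝ) < smPart (t + 1) n := by
    refine ⟨n, ?_⟩
    have h1 : SmoothBelow (n + 1) n := fun p hp h =>
      Nat.lt_succ_of_le (Nat.le_of_dvd (Nat.pos_of_ne_zero hn0) h)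
    have := (smPart_roPart_unique h1 (roughFrom_one _) one_ne_zero).1
    rw [mul_one] at this
    rw [this]; exact hZn
  set t := Nat.find hex with ht
  have ht1 : X ^ (1 / 4 : ℝ) < smPart (t + 1) n := Nat.find_spec hex
  have ht2 : (smPart t n : ℝ) ≤ X ^ (1 / 4 : ℝ) := by
    rcases Nat.eq_zero_or_pos t with h0 | h0
    · rw [h0]
      have h1 := (smPart_spec (y := 0) hn0).2.1
      have : smPart 0 n = 1 := by
        by_contra hne
        obtain ⟨p, hp, hpd⟩ := Nat.exists_prime_and_dvd hne
        exact absurd (h1 p hp hpd) (Nat.not_lt_zero p)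
      rw [this, Nat.cast_one]
      exact Real.one_le_rpow (by linarith) (by norm_num)
    · have := Nat.find_min hex (m := t - 1) (by omega)
      rw [Nat.sub_add_cancel h0] at this
      exact not_lt.mp this
  obtain ⟨s1, s2, s3⟩ := smPart_spec (y := t) hn0
  obtain ⟨u1, u2, u3⟩ := smPart_spec (y := t + 1) hn0
  set a := smPart t n with ha
  set b := roPart t n with hb
  set a' := smPart (t + 1) n with ha'
  have ha0 : a ≠ 0 := s2.ne_zero
  have haa' : a ∣ a' := by
    have hc : Nat.Coprime a (roPart (t + 1) n) :=
      SmoothBelow.coprime (y := t + 1) (fun p hp h => (s2 p hp h).trans (Nat.lt_succ_self t)) u3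
    exact hc.dvd_of_dvd_mul_right (u1.symm ▸ s1 ▸ dvd_mul_right _ _)
  obtain ⟨q, hq⟩ := haa'
  have hq0 : q ≠ 0 := by rintro rfl; rw [mul_zero] at hq; exact u2.ne_zero hq
  have hqb : q ∣ b := by
    have h1 : a * q ∣ a * b := by rw [← hq, s1, ← u1]; exact dvd_mul_right _ _
    exact Nat.dvd_of_mul_dvd_mul_left (Nat.pos_of_ne_zero ha0) h1
  have hqt : ∀ p : ℕ, p.Prime → p ∣ q → p = t := by
    intro p hp hpq
    have h1 := u2 p hp (hpq.trans (hq ▸ dvd_mul_left q a))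
    have h2 := s3 p hp (hpq.trans hqb)
    omega
  have hq1 : q ≠ 1 := by
    rintro rfl
    rw [mul_one] at hq
    rw [hq] at ht1
    linarith
  have htp : t.Prime := by
    obtain ⟨p, hp, hpd⟩ := Nat.exists_prime_and_dvd hq1
    rwa [← hqt p hp hpd]
  have hqe := Nat.eq_prime_pow_of_unique_prime_dvd hq0 (fun {d} hd h => hqt d hd h)
  set e := q.primeFactorsList.length with he
  have hqlt : X ^ (1 / 4 : ℝ) < a * (t : ℝ) ^ e := by
    have : (a' : ℝ) = a * (t : ℝ) ^ e := by rw [hq, hqe]; push_cast; rfl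
    rwa [this] at ht1
  have hnb : n / a = b := by
    rw [← s1]; exact Nat.mul_div_cancel_left b (Nat.pos_of_ne_zero ha0)
  have htn : a ∣ n := s1 ▸ dvd_mul_right _ _
  have htpos : (1 : ℝ) < t := by exact_mod_cast htp.one_lt
  have hlt : 0 < Real.log t := Real.log_pos htpos
  have hlX : 0 < Real.log X := Real.log_pos (by linarith)
  by_cases hc : (a : ℝ) ≤ X ^ (1 / 8 : ℝ) ∧ (t : ℝ) ≤ X ^ (1 / 9 : ℝ)
  · left
    obtain ⟨hc1, hc2⟩ := hc
    have h8 : X ^ (1 / 8 : ℝ) < (t : ℝ) ^ e := by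
      have e1 : X ^ (1 / 4 : ℝ) = X ^ (1 / 8 : ℝ) * X ^ (1 / 8 : ℝ) := by
        rw [← Real.rpow_add hX0]; norm_num
      rw [e1] at hqlt
      have h0 : 0 < X ^ (1 / 8 : ℝ) := by positivity
      have h2 : (a : ℝ) * (t : ℝ) ^ e ≤ X ^ (1 / 8 : ℝ) * (t : ℝ) ^ e := by gcongr
      exact lt_of_mul_lt_mul_left (hqlt.trans_le h2) h0.le
    have he2 : 2 ≤ e := by
      by_contra h
      have : (t : ℝ) ^ e ≤ t := by
        calc (t : ℝ) ^ e ≤ (t : ℝ) ^ 1 := pow_le_pow_right₀ htpos.le (by omega)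
          _ = t := pow_one _
      have h9 : X ^ (1 / 9 : ℝ) ≤ X ^ (1 / 8 : ℝ) :=
        Real.rpow_le_rpow_of_exponent_le (by linarith) (by norm_num)
      linarith
    have hex2 : X ^ (1 / 24 : ℝ) < (t : ℝ) ^ (e / 2) := by
      have h1 : e ≤ 3 * (e / 2) := by omega
      have h2 : X ^ (1 / 8 : ℝ) < ((t : ℝ) ^ (e / 2)) ^ 3 := by
        refine h8.trans_le ?_
        rw [← pow_mul]
        exact pow_le_pow_right₀ htpos.le (by omega)
      have h3 : X ^ (1 / 8 : ℝ) = (X ^ (1 / 24 : ℝ)) ^ 3 := by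
        rw [← Real.rpow_natCast, ← Real.rpow_mul hX0.le]; norm_num
      rw [h3] at h2
      exact lt_of_pow_lt_pow_left₀ 3 (by positivity) h2
    have hex3 : ∃ i : ℕ, X ^ (1 / 24 : ℝ) < (t : ℝ) ^ i := ⟨_, hex2⟩
    set i := Nat.find hex3 with hi
    have hi1 : X ^ (1 / 24 : ℝ) < (t : ℝ) ^ i := Nat.find_spec hex3
    have hi2 : i ≤ e / 2 := Nat.find_min' hex3 hex2
    have hi0 : 0 < i := by
      rcases Nat.eq_zero_or_pos i with h | h
      · rw [h, pow_zero] at hi1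
        have := Real.one_le_rpow (x := X) (z := 1 / 24) (by linarith) (by norm_num)
        linarith
      · exact h
    have hi3 : (t : ℝ) ^ (i - 1) ≤ X ^ (1 / 24 : ℝ) :=
      not_lt.mp (Nat.find_min hex3 (m := i - 1) (by omega))
    refine ⟨t ^ i, by push_cast; exact hi1, ?_, ?_⟩
    · push_cast
      calc (t : ℝ) ^ i = (t : ℝ) ^ (i - 1) * t := by
            rw [← pow_succ, Nat.sub_add_cancel hi0]
        _ ≤ X ^ (1 / 24 : ℝ) * X ^ (1 / 9 : ℝ) := by gcongr
        _ = X ^ (1 / 24 + 1 / 9 : ℝ) := (Real.rpow_add hX0 _ _).symm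
        _ ≤ X ^ (1 / 6 : ℝ) := Real.rpow_le_rpow_of_exponent_le (by linarith) (by norm_num)
    · rw [← pow_mul]
      have h1 : t ^ (i * 2) ∣ q := by rw [hqe]; exact pow_dvd_pow t (by omega)
      exact h1.trans (hqb.trans (s1 ▸ dvd_mul_left b a))
  right
  by_cases hw : t < ⌈W⌉₊ ∧ X ^ (1 / 8 : ℝ) < a
  · left
    exact ⟨a, htn, hw.2, ht2, fun p hp h => (s2 p hp h).trans hw.1⟩
  right
  set j := max 1 ⌊Real.log X / Real.log t⌋₊ with hj
  have hj1 : 1 ≤ j := le_max_left _ _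
  have hj0 : (0 : ℝ) < j := by exact_mod_cast hj1
  have hfl := Nat.lt_floor_add_one (Real.log X / Real.log t)
  have hfl2 := Nat.floor_le (show 0 ≤ Real.log X / Real.log t by positivity)
  have hjle : j = 1 ∨ (j : ℝ) * Real.log t ≤ Real.log X := by
    rcases max_choice 1 ⌊Real.log X / Real.log t⌋₊ with h | h
    · left; rw [hj, h]
    · right; rw [hj, h, ← le_div_iff₀ hlt]; exact hfl2
  have hjge : Real.log X < ((j : ℝ) + 1) * Real.log t := by
    rw [← div_lt_iff₀ hlt]
    have : (⌊Real.log X / Real.log t⌋₊ : ℝ) ≤ j := by exact_mod_cast le_max_right _ _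
    linarith
  have hj8 : (a : ℝ) ≤ X ^ (1 / 8 : ℝ) → j ≤ 8 := by
    intro h
    have h9 : X ^ (1 / 9 : ℝ) < t := by
      by_contra h'
      exact hc ⟨h, not_lt.mp h'⟩
    have h10 : Real.log X / 9 < Real.log t := by
      have := Real.log_lt_log (by positivity) h9
      rw [Real.log_rpow hX0] at this
      linarith
    rcases hjle with h' | h'
    · omega
    · by_contra h''
      have : (9 : ℝ) ≤ j := by exact_mod_cast (by omega : 9 ≤ j)
      nlinarith
  refine ⟨j, a, hj1, htn, ht2, Nat.pos_of_ne_zero ha0, ?_, ?_, ?_, ?_, ?_⟩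
  · intro p hp hpa
    rcases hjle with h | h
    · rw [h, Nat.cast_one, div_one, Real.rpow_one]
      have h1 : (p : ℝ) ≤ a := by exact_mod_cast Nat.le_of_dvd (Nat.pos_of_ne_zero ha0) hpa
      have h2 : X ^ (1 / 4 : ℝ) ≤ X := by
        conv_rhs => rw [← Real.rpow_one X]
        exact Real.rpow_le_rpow_of_exponent_le (by linarith) (by norm_num)
      linarith
    · have h1 : (p : ℝ) ≤ t := by exact_mod_cast (s2 p hp hpa).le
      refine h1.trans ?_
      rw [Real.rpow_def_of_pos hX0, ← Real.log_le_iff_le_exp (by linarith), mul_one_div,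
        le_div_iff₀ hj0]
      linarith
  · intro p hp hpb
    rw [hnb] at hpb
    have h1 : (t : ℝ) ≤ p := by exact_mod_cast s3 p hp hpb
    refine lt_of_lt_of_le ?_ h1
    rw [Real.rpow_def_of_pos hX0, ← Real.lt_log_iff_exp_lt (by linarith), mul_one_div,
      div_lt_iff₀ (by positivity)]
    linarith
  · rw [hnb]; exact s2.coprime s3
  · exact (lt_or_ge _ _).imp_right hj8
  · by_cases h : X ^ (1 / 8 : ℝ) < a
    · rcases hjle with h' | h'
      · right; omega
      · left
        have h1 : ⌈W⌉₊ ≤ t := by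
          by_contra h''
          exact hw ⟨not_le.mp h'', h⟩
        have h2 : W ≤ t := (Nat.le_ceil W).trans (by exact_mod_cast h1)
        have h3 : Real.log W ≤ Real.log t := Real.log_le_log (by linarith) h2
        nlinarith
    · exact Or.inr (hj8 (not_lt.mp h))

end

section

/-- Nonnegative multiplicative functions of the type handled by Shiu's theorem. -/
structure ShiuClass (B : ℝ) (g : ℕ → ℝ) : Prop where
  nonneg : ∀ n, 0 ≤ g n
  map_one : g 1 = 1
  mult : ∀ m n : ℕ, Nat.Coprime m n → g (m * n) = g m * g n
  pow_le : ∀ p k : ℕ, p.Prime → g (p ^ k) ≤ B ^ k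
  le_rpow : ∀ n : ℕ, 1 ≤ n → g n ≤ B * (n : ℝ) ^ (1 / 100 : ℝ)

lemma ShiuClass.euler_factor {B : ℝ} {g : ℕ → ℝ} (hg : ShiuClass B g) (hB : 0 ≤ B) {ν : ℝ}
    (hν1 : ν ≤ 1 / 20) {p : ℕ} (hp : p.Prime) :
    Summable (fun k : ℕ => g (p ^ k) * ((p ^ k : ℕ) : ℝ) ^ (ν - 1)) ∧
    ∑' k : ℕ, g (p ^ k) * ((p ^ k : ℕ) : ℝ) ^ (ν - 1) ≤
      Real.exp (g p * (p : ℝ) ^ (ν - 1) + 3 * B * (1 / (p : ℝ) ^ (1 + 1 / 2 : ℝ))) := by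
  have hp2 : (2 : ℝ) ≤ p := by exact_mod_cast hp.two_le
  have hp0 : (0 : ℝ) < p := by linarith
  set r : ℝ := (p : ℝ) ^ (-(94 / 100) : ℝ) with hr
  have hr0 : 0 < r := by positivity
  have hr1 : r ≤ 2 / 3 := by
    have h1 : r ≤ (2 : ℝ) ^ (-(94 / 100) : ℝ) :=
      Real.rpow_le_rpow_of_nonpos (by norm_num) hp2 (by norm_num)
    have h2 : (2 : ℝ) ^ (-(94 / 100) : ℝ) ≤ 2 / 3 := by
      rw [Real.rpow_neg (by norm_num), inv_le_comm₀ (by positivity) (by norm_num)]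
      have h3 : (2 : ℝ) ^ (3 / 4 : ℝ) ≤ (2 : ℝ) ^ (94 / 100 : ℝ) :=
        Real.rpow_le_rpow_of_exponent_le (by norm_num) (by norm_num)
      have h4 : (3 / 2 : ℝ) ≤ (2 : ℝ) ^ (3 / 4 : ℝ) := by
        have h5 : ((2 : ℝ) ^ (3 / 4 : ℝ)) ^ 4 = 8 := by
          rw [← Real.rpow_natCast, ← Real.rpow_mul (by norm_num)]; norm_num
        by_contra h
        push Not at h
        have := pow_lt_pow_left₀ h (by positivity) (n := 4) (by norm_num)
        norm_num at this
        linarith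
      norm_num
      linarith
    linarith
  have hterm : ∀ k : ℕ, g (p ^ k) * ((p ^ k : ℕ) : ℝ) ^ (ν - 1) ≤ B * r ^ k := by
    intro k
    have hpk : (1 : ℝ) ≤ ((p ^ k : ℕ) : ℝ) := by exact_mod_cast Nat.one_le_pow _ _ hp.pos
    calc g (p ^ k) * ((p ^ k : ℕ) : ℝ) ^ (ν - 1)
        ≤ (B * ((p ^ k : ℕ) : ℝ) ^ (1 / 100 : ℝ)) * ((p ^ k : ℕ) : ℝ) ^ (-(95 / 100) : ℝ) := by
          apply mul_le_mul (hg.le_rpow _ (Nat.one_le_pow _ _ hp.pos)) _ (by positivity)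
            (by positivity)
          exact Real.rpow_le_rpow_of_exponent_le hpk (by linarith)
      _ = B * ((p ^ k : ℕ) : ℝ) ^ (-(94 / 100) : ℝ) := by
          rw [mul_assoc, ← Real.rpow_add (by linarith)]; norm_num
      _ = B * r ^ k := by
          rw [hr, ← Real.rpow_natCast, ← Real.rpow_mul hp0.le, Nat.cast_pow, ← Real.rpow_natCast,
            ← Real.rpow_mul hp0.le, mul_comm (k : ℝ)]
  have hgeo : Summable (fun k : ℕ => B * r ^ k) :=
    (summable_geometric_of_lt_one hr0.le (by linarith)).mul_left B
  have hs : Summable (fun k : ℕ => g (p ^ k) * ((p ^ k : ℕ) : ℝ) ^ (ν - 1)) :=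
    Summable.of_nonneg_of_le (fun k => mul_nonneg (hg.nonneg _) (by positivity)) hterm hgeo
  refine ⟨hs, ?_⟩
  have h0 := hs.sum_add_tsum_nat_add 2
  rw [← h0, Finset.sum_range_succ, Finset.sum_range_one]
  simp only [pow_zero, pow_one, Nat.cast_one, Real.one_rpow, mul_one, hg.map_one]
  have htail : ∑' k : ℕ, g (p ^ (k + 2)) * ((p ^ (k + 2) : ℕ) : ℝ) ^ (ν - 1) ≤
      3 * B * (1 / (p : ℝ) ^ (1 + 1 / 2 : ℝ)) := by
    have h2 : ∑' k : ℕ, B * r ^ (k + 2) = B * r ^ 2 * (1 - r)⁻¹ := by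
      rw [← tsum_geometric_of_lt_one hr0.le (by linarith), ← tsum_mul_left]
      congr 1; ext k; ring
    have h3 : Summable (fun k : ℕ => B * r ^ (k + 2)) := (summable_nat_add_iff 2).mpr hgeo
    calc _ ≤ ∑' k : ℕ, B * r ^ (k + 2) :=
          Summable.tsum_le_tsum (fun k => hterm (k + 2)) ((summable_nat_add_iff 2).mpr hs) h3
      _ = B * r ^ 2 * (1 - r)⁻¹ := h2
      _ ≤ B * (1 / (p : ℝ) ^ (1 + 1 / 2 : ℝ)) * 3 := by
          have h4 : r ^ 2 ≤ 1 / (p : ℝ) ^ (1 + 1 / 2 : ℝ) := by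
            rw [hr, ← Real.rpow_natCast, ← Real.rpow_mul hp0.le, one_div, ← Real.rpow_neg hp0.le]
            exact Real.rpow_le_rpow_of_exponent_le (by linarith) (by norm_num)
          have h5 : (1 - r)⁻¹ ≤ 3 := by
            rw [inv_le_comm₀ (by linarith) (by norm_num)]; linarith
          have h6 : 0 < (1 - r)⁻¹ := inv_pos.mpr (by linarith)
          gcongr
      _ = _ := by ring
  have := Real.add_one_le_exp
    (g p * (p : ℝ) ^ (ν - 1) + 3 * B * (1 / (p : ℝ) ^ (1 + 1 / 2 : ℝ)))
  linarith

lemma ShiuClass.sum_smooth_le {B : ℝ} {g : ℕ → ℝ} (hg : ShiuClass B g) (hB : 0 ≤ B) {ν : ℝ}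
    (hν1 : ν ≤ 1 / 20) {y : ℕ} {S : Finset ℕ} (hS : ∀ a ∈ S, SmoothBelow y a) :
    ∑ a ∈ S, g a * (a : ℝ) ^ (ν - 1) ≤
      Real.exp (9 * B + ∑ p ∈ y.primesBelow, g p * (p : ℝ) ^ (ν - 1)) := by
  set h : ℕ → ℝ := fun a => g a * (a : ℝ) ^ (ν - 1) with hh
  have hnn : ∀ a, 0 ≤ h a := fun a => mul_nonneg (hg.nonneg a) (by positivity)
  have h1 : h 1 = 1 := by simp [hh, hg.map_one]
  have hmul : ∀ {m n : ℕ}, Nat.Coprime m n → h (m * n) = h m * h n := by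
    intro m n hmn
    simp only [hh, hg.mult m n hmn, Nat.cast_mul]
    rw [Real.mul_rpow (by positivity) (by positivity)]; ring
  have hsum : ∀ {p : ℕ}, p.Prime → Summable (fun n : ℕ => ‖h (p ^ n)‖) := by
    intro p hp
    exact (hg.euler_factor hB hν1 hp).1.norm
  obtain ⟨-, hH⟩ := EulerProduct.summable_and_hasSum_smoothNumbers_prod_primesBelow_tsum
    h1 hmul hsum y
  have hle : ∑ a ∈ S, h a ≤ ∏ p ∈ y.primesBelow, ∑' n : ℕ, h (p ^ n) := by
    rw [← hH.tsum_eq]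
    have e : ∑ a ∈ S, h a = ∑ m ∈ S.attach.map
        ⟨fun a => (⟨a.1, Nat.mem_smoothNumbers'.mpr fun p hp h => hS a.1 a.2 p hp h⟩ : y.smoothNumbers),
          fun a b hab => Subtype.ext (by simpa using hab)⟩, h m := by
      rw [Finset.sum_map, ← Finset.sum_attach]
      rfl
    rw [e]
    exact hH.summable.sum_le_tsum _ (fun m _ => hnn m)
  refine hle.trans ?_
  calc ∏ p ∈ y.primesBelow, ∑' n : ℕ, h (p ^ n)
      ≤ ∏ p ∈ y.primesBelow,
        Real.exp (g p * (p : ℝ) ^ (ν - 1) + 3 * B * (1 / (p : ℝ) ^ (1 + 1 / 2 : ℝ))) :=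
        Finset.prod_le_prod (fun p _ => tsum_nonneg fun n => hnn _)
          (fun p hp => (hg.euler_factor hB hν1 (Nat.prime_of_mem_primesBelow hp)).2)
    _ = Real.exp (∑ p ∈ y.primesBelow, g p * (p : ℝ) ^ (ν - 1) +
          3 * B * ∑ p ∈ y.primesBelow, 1 / (p : ℝ) ^ (1 + 1 / 2 : ℝ)) := by
        rw [← Real.exp_sum, Finset.sum_add_distrib, Finset.mul_sum]
    _ ≤ _ := by
        apply Real.exp_le_exp.mpr
        have h2 : ∑ p ∈ y.primesBelow, 1 / (p : ℝ) ^ (1 + 1 / 2 : ℝ) ≤ 3 := by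
          have h3 := tsum_rpow_le (η := 1 / 2) (by norm_num)
          have h4 := (summable_one_div_rpow (η := 1 / 2) (by norm_num)).sum_le_tsum
            y.primesBelow (fun n _ => by positivity)
          norm_num at h3 h4 ⊢
          linarith
        nlinarith

end

section

lemma sum_le_sum_of_witness {α : Type*} (T : Finset ℕ) (P : Finset α) (F : α → ℝ)
    (hF : ∀ p ∈ P, 0 ≤ F p) (π : α → ℕ) (g : ℕ → ℝ)
    (h : ∀ n ∈ T, ∃ p ∈ P, π p = n ∧ g n ≤ F p) : ∑ n ∈ T, g n ≤ ∑ p ∈ P, F p := by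
  rcases T.eq_empty_or_nonempty with rfl | ⟨n0, hn0⟩
  · simpa using Finset.sum_nonneg hF
  obtain ⟨p0, -⟩ := h n0 hn0
  have h' : ∀ n : ℕ, ∃ p : α, n ∈ T → p ∈ P ∧ π p = n ∧ g n ≤ F p := by
    intro n
    by_cases hn : n ∈ T
    · obtain ⟨p, hp⟩ := h n hn; exact ⟨p, fun _ => hp⟩
    · exact ⟨p0, fun h => absurd h hn⟩
  choose φ hφ using h'
  have hinj : Set.InjOn φ T := by
    intro a ha b hb hab
    rw [← (hφ a ha).2.1, hab, (hφ b hb).2.1]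
  calc ∑ n ∈ T, g n ≤ ∑ n ∈ T, F (φ n) := Finset.sum_le_sum fun n hn => (hφ n hn).2.2
    _ = ∑ p ∈ T.image φ, F p := (Finset.sum_image hinj).symm
    _ ≤ ∑ p ∈ P, F p := by
        apply Finset.sum_le_sum_of_subset_of_nonneg
        · intro p hp
          obtain ⟨n, hn, rfl⟩ := Finset.mem_image.mp hp
          exact (hφ n hn).1
        · exact fun p hp _ => hF p hp

lemma exists_sum_smooth_rpow_le (y : ℕ) :
    ∃ K : ℝ, 0 ≤ K ∧ ∀ S : Finset ℕ, (∀ a ∈ S, SmoothBelow y a) →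
      ∑ a ∈ S, (a : ℝ) ^ (-(1 / 2) : ℝ) ≤ K := by
  let h : ℕ →* ℝ :=
    { toFun := fun a => (a : ℝ) ^ (-(1 / 2) : ℝ)
      map_one' := by simp
      map_mul' := fun m n => by
        rw [Nat.cast_mul, Real.mul_rpow (by positivity) (by positivity)] }
  have hnn : ∀ a, 0 ≤ h a := fun a => Real.rpow_nonneg (by positivity) _
  have hlt : ∀ {p : ℕ}, p.Prime → ‖h p‖ < 1 := by
    intro p hp
    rw [Real.norm_of_nonneg (hnn p)]
    exact Real.rpow_lt_one_of_one_lt_of_neg (by exact_mod_cast hp.one_lt) (by norm_num)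
  obtain ⟨-, hH⟩ := EulerProduct.summable_and_hasSum_smoothNumbers_prod_primesBelow_geometric
    hlt y
  refine ⟨∑' m : y.smoothNumbers, h m, tsum_nonneg fun m => hnn m, fun S hS => ?_⟩
  have e : ∑ a ∈ S, h a = ∑ m ∈ S.attach.map
      ⟨fun a => (⟨a.1, Nat.mem_smoothNumbers'.mpr fun p hp h => hS a.1 a.2 p hp h⟩ :
        y.smoothNumbers), fun a b hab => Subtype.ext (by simpa using hab)⟩, h m := by
    rw [Finset.sum_map, ← Finset.sum_attach]
    rfl
  change ∑ a ∈ S, h a ≤ _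
  rw [e]
  exact hH.summable.sum_le_tsum _ (fun m _ => hnn m)

lemma ShiuClass.le_rpow_of_rough {B : ℝ} {g : ℕ → ℝ} (hg : ShiuClass B g) {θ : ℝ} (hB : 0 ≤ B)
    {b : ℕ} (hb0 : b ≠ 0) (hb : ∀ p : ℕ, p.Prime → p ∣ b → B ≤ (p : ℝ) ^ θ) :
    g b ≤ (b : ℝ) ^ θ := by
  induction b using Nat.recOnPosPrimePosCoprime with
  | prime_pow p n hp hn =>
    calc g (p ^ n) ≤ B ^ n := hg.pow_le p n hp
      _ ≤ ((p : ℝ) ^ θ) ^ n := pow_le_pow_left₀ hB (hb p hp (dvd_pow_self p hn.ne')) n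
      _ = ((p ^ n : ℕ) : ℝ) ^ θ := by
        rw [Nat.cast_pow, ← Real.rpow_natCast, ← Real.rpow_natCast,
          ← Real.rpow_mul (by positivity), ← Real.rpow_mul (by positivity), mul_comm]
  | zero => exact absurd rfl hb0
  | one => simp [hg.map_one]
  | coprime a b ha hb' hab iha ihb =>
    rw [hg.mult a b hab, Nat.cast_mul, Real.mul_rpow (by positivity) (by positivity)]
    exact mul_le_mul (iha (by omega) fun p hp h => hb p hp (h.mul_right b))
      (ihb (by omega) fun p hp h => hb p hp (h.mul_left a)) (hg.nonneg b) (by positivity)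

section ShiuCases

variable {B : ℝ} {g : ℕ → ℝ} {X Y : ℝ}

lemma ShiuClass.le_on_interval (hg : ShiuClass B g) (hB : 1 ≤ B) (hX : 16 ≤ X) (hYX : Y ≤ X)
    {n : ℕ} (hn : n ∈ Finset.Ioc ⌊X⌋₊ ⌊X + Y⌋₊) : g n ≤ 2 * B * X ^ (1 / 100 : ℝ) := by
  rw [Finset.mem_Ioc] at hn
  have h1 : (n : ℝ) ≤ X + Y := by
    have : 0 ≤ X + Y := by
      by_contra h
      have h0 := Nat.floor_of_nonpos (not_le.mp h).le
      omega
    exact (Nat.le_floor_iff this).mp hn.2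
  calc g n ≤ B * (n : ℝ) ^ (1 / 100 : ℝ) := hg.le_rpow n (by omega)
    _ ≤ B * (2 * X) ^ (1 / 100 : ℝ) := by gcongr; linarith
    _ = B * ((2 : ℝ) ^ (1 / 100 : ℝ) * X ^ (1 / 100 : ℝ)) := by
        rw [Real.mul_rpow (by norm_num) (by linarith)]
    _ ≤ B * (2 * X ^ (1 / 100 : ℝ)) := by
        gcongr
        calc (2 : ℝ) ^ (1 / 100 : ℝ) ≤ (2 : ℝ) ^ (1 : ℝ) :=
              Real.rpow_le_rpow_of_exponent_le (by norm_num) (by norm_num)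
          _ = 2 := Real.rpow_one 2
    _ = _ := by ring

lemma ShiuClass.shiu_square (hg : ShiuClass B g) (hB : 1 ≤ B) (hX : 16 ≤ X) (hYX : Y ≤ X)
    (hXY : X ^ (2 / 3 : ℝ) ≤ Y) :
    ∑ n ∈ (Finset.Ioc ⌊X⌋₊ ⌊X + Y⌋₊).filter (fun n => ∃ d : ℕ, X ^ (1 / 24 : ℝ) < d ∧
      (d : ℝ) ≤ X ^ (1 / 6 : ℝ) ∧ d ^ 2 ∣ n), g n ≤ 8 * B * Y * X ^ (-(1 / 100) : ℝ) := by
  have hX0 : 0 < X := by linarith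
  have hY0 : 0 < Y := lt_of_lt_of_le (by positivity) hXY
  set I := Finset.Ioc ⌊X⌋₊ ⌊X + Y⌋₊ with hI
  set D := (Finset.Icc 1 ⌊X ^ (1 / 6 : ℝ)⌋₊).filter (fun d : ℕ => X ^ (1 / 24 : ℝ) < d) with hD
  set M := 2 * B * X ^ (1 / 100 : ℝ) with hM
  have hM0 : 0 < M := by positivity
  have hDmem : ∀ d : ℕ, X ^ (1 / 24 : ℝ) < d → (d : ℝ) ≤ X ^ (1 / 6 : ℝ) → d ∈ D := by
    intro d h1 h2
    rw [hD, Finset.mem_filter, Finset.mem_Icc]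
    refine ⟨⟨?_, Nat.le_floor h2⟩, h1⟩
    have : (0 : ℝ) < d := lt_trans (by positivity) h1
    exact_mod_cast this
  have h1 := sum_le_sum_of_witness (I.filter (fun n => ∃ d : ℕ, X ^ (1 / 24 : ℝ) < d ∧
      (d : ℝ) ≤ X ^ (1 / 6 : ℝ) ∧ d ^ 2 ∣ n)) (D.sigma fun d => I.filter (d ^ 2 ∣ ·))
      (fun _ => M) (fun _ _ => hM0.le) (fun p => p.2) g (by
        intro n hn
        rw [Finset.mem_filter] at hn
        obtain ⟨hnI, d, h1, h2, h3⟩ := hn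
        exact ⟨⟨d, n⟩, Finset.mem_sigma.mpr ⟨hDmem d h1 h2, Finset.mem_filter.mpr ⟨hnI, h3⟩⟩, rfl,
          hg.le_on_interval hB hX hYX hnI⟩)
  refine h1.trans ?_
  rw [Finset.sum_sigma]
  simp only [Finset.sum_const, nsmul_eq_mul]
  have h2 : ∀ d ∈ D, ((I.filter (d ^ 2 ∣ ·)).card : ℝ) * M ≤
      M * (Y * X ^ (-(1 / 48) : ℝ) * (1 / (d : ℝ) ^ (1 + 1 / 2 : ℝ)) + 1) := by
    intro d hd
    rw [hD, Finset.mem_filter, Finset.mem_Icc] at hd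
    have hd0 : (0 : ℝ) < d := lt_trans (by positivity) hd.2
    have h3 := abs_card_multiples_sub_le hX0.le hY0.le (d ^ 2)
      (pow_ne_zero 2 (by omega))
    have h4 := (abs_le.mp h3).2
    rw [mul_comm]
    refine mul_le_mul_of_nonneg_left ?_ hM0.le
    have h5 : Y / ((d ^ 2 : ℕ) : ℝ) ≤ Y * X ^ (-(1 / 48) : ℝ) * (1 / (d : ℝ) ^ (1 + 1 / 2 : ℝ)) := by
      rw [div_eq_mul_one_div, mul_assoc]
      refine mul_le_mul_of_nonneg_left ?_ hY0.le
      have e1 : 1 / ((d ^ 2 : ℕ) : ℝ) =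
          (d : ℝ) ^ (-(1 / 2) : ℝ) * (1 / (d : ℝ) ^ (1 + 1 / 2 : ℝ)) := by
        rw [one_div ((d ^ 2 : ℕ) : ℝ), one_div ((d : ℝ) ^ (1 + 1 / 2 : ℝ)),
          ← Real.rpow_neg hd0.le, ← Real.rpow_add hd0, Nat.cast_pow,
          ← Real.rpow_natCast, ← Real.rpow_neg hd0.le]
        congr 1
        norm_num
      rw [e1]
      refine mul_le_mul_of_nonneg_right ?_ (by positivity)
      calc (d : ℝ) ^ (-(1 / 2) : ℝ) ≤ (X ^ (1 / 24 : ℝ)) ^ (-(1 / 2) : ℝ) :=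
            Real.rpow_le_rpow_of_nonpos (by positivity) hd.2.le (by norm_num)
        _ = X ^ (-(1 / 48) : ℝ) := by rw [← Real.rpow_mul hX0.le]; norm_num
    linarith
  refine (Finset.sum_le_sum h2).trans ?_
  rw [← Finset.mul_sum, Finset.sum_add_distrib, ← Finset.mul_sum]
  have h3 : ∑ d ∈ D, 1 / (d : ℝ) ^ (1 + 1 / 2 : ℝ) ≤ 3 := by
    have h3 := tsum_rpow_le (η := 1 / 2) (by norm_num)
    have h4 := (summable_one_div_rpow (η := 1 / 2) (by norm_num)).sum_le_tsum
      D (fun n _ => by positivity)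
    norm_num at h3 h4 ⊢
    linarith
  have h4 : ∑ d ∈ D, (1 : ℝ) ≤ Y * X ^ (-(1 / 48) : ℝ) := by
    rw [Finset.sum_const, nsmul_eq_mul, mul_one]
    calc (D.card : ℝ) ≤ ⌊X ^ (1 / 6 : ℝ)⌋₊ := by
          exact_mod_cast (Finset.card_filter_le _ _).trans (by simp)
      _ ≤ X ^ (1 / 6 : ℝ) := Nat.floor_le (by positivity)
      _ ≤ X ^ (2 / 3 + -(1 / 48) : ℝ) :=
          Real.rpow_le_rpow_of_exponent_le (by linarith) (by norm_num)
      _ = X ^ (2 / 3 : ℝ) * X ^ (-(1 / 48) : ℝ) := Real.rpow_add hX0 _ _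
      _ ≤ _ := by gcongr
  calc M * (Y * X ^ (-(1 / 48) : ℝ) * ∑ d ∈ D, 1 / (d : ℝ) ^ (1 + 1 / 2 : ℝ) + ∑ d ∈ D, (1 : ℝ))
      ≤ M * (Y * X ^ (-(1 / 48) : ℝ) * 3 + Y * X ^ (-(1 / 48) : ℝ)) := by gcongr
    _ = 8 * B * Y * (X ^ (1 / 100 : ℝ) * X ^ (-(1 / 48) : ℝ)) := by rw [hM]; ring
    _ ≤ 8 * B * Y * X ^ (-(1 / 100) : ℝ) := by
        rw [← Real.rpow_add hX0]
        have : X ^ (1 / 100 + -(1 / 48) : ℝ) ≤ X ^ (-(1 / 100) : ℝ) :=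
          Real.rpow_le_rpow_of_exponent_le (by linarith) (by norm_num)
        gcongr

lemma ShiuClass.shiu_smooth (hg : ShiuClass B g) (hB : 1 ≤ B) (hX : 16 ≤ X) (hYX : Y ≤ X)
    (hXY : X ^ (2 / 3 : ℝ) ≤ Y) {w : ℕ} {K : ℝ} (hK : ∀ S : Finset ℕ, (∀ a ∈ S, SmoothBelow w a) →
      ∑ a ∈ S, (a : ℝ) ^ (-(1 / 2) : ℝ) ≤ K) :
    ∑ n ∈ (Finset.Ioc ⌊X⌋₊ ⌊X + Y⌋₊).filter (fun n => ∃ a : ℕ, a ∣ n ∧ X ^ (1 / 8 : ℝ) < a ∧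
      (a : ℝ) ≤ X ^ (1 / 4 : ℝ) ∧ SmoothBelow w a), g n ≤
        4 * B * K * Y * X ^ (-(1 / 100) : ℝ) := by
  have hX0 : 0 < X := by linarith
  have hY0 : 0 < Y := lt_of_lt_of_le (by positivity) hXY
  have hK0 : 0 ≤ K := by simpa using hK ∅ (by simp)
  set I := Finset.Ioc ⌊X⌋₊ ⌊X + Y⌋₊ with hI
  set D := (Finset.Icc 1 ⌊X ^ (1 / 4 : ℝ)⌋₊).filter
    (fun d : ℕ => X ^ (1 / 8 : ℝ) < d ∧ SmoothBelow w d) with hD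
  set M := 2 * B * X ^ (1 / 100 : ℝ) with hM
  have hM0 : 0 < M := by positivity
  have hDmem : ∀ d : ℕ, X ^ (1 / 8 : ℝ) < d → (d : ℝ) ≤ X ^ (1 / 4 : ℝ) → SmoothBelow w d →
      d ∈ D := by
    intro d h1 h2 h3
    rw [hD, Finset.mem_filter, Finset.mem_Icc]
    refine ⟨⟨?_, Nat.le_floor h2⟩, h1, h3⟩
    have : (0 : ℝ) < d := lt_trans (by positivity) h1
    exact_mod_cast this
  have h1 := sum_le_sum_of_witness (I.filter (fun n => ∃ a : ℕ, a ∣ n ∧ X ^ (1 / 8 : ℝ) < a ∧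
      (a : ℝ) ≤ X ^ (1 / 4 : ℝ) ∧ SmoothBelow w a)) (D.sigma fun d => I.filter (d ∣ ·))
      (fun _ => M) (fun _ _ => hM0.le) (fun p => p.2) g (by
        intro n hn
        rw [Finset.mem_filter] at hn
        obtain ⟨hnI, d, h0, h1, h2, h3⟩ := hn
        exact ⟨⟨d, n⟩, Finset.mem_sigma.mpr ⟨hDmem d h1 h2 h3, Finset.mem_filter.mpr ⟨hnI, h0⟩⟩,
          rfl, hg.le_on_interval hB hX hYX hnI⟩)
  refine h1.trans ?_
  rw [Finset.sum_sigma]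
  simp only [Finset.sum_const, nsmul_eq_mul]
  have h2 : ∀ d ∈ D, ((I.filter (d ∣ ·)).card : ℝ) * M ≤
      M * (2 * Y * X ^ (-(1 / 16) : ℝ)) * (d : ℝ) ^ (-(1 / 2) : ℝ) := by
    intro d hd
    rw [hD, Finset.mem_filter, Finset.mem_Icc] at hd
    have hd0 : (0 : ℝ) < d := lt_trans (by positivity) hd.2.1
    have h3 := abs_card_multiples_sub_le hX0.le hY0.le d (by omega)
    have h4 := (abs_le.mp h3).2
    rw [mul_comm, mul_assoc M]
    refine mul_le_mul_of_nonneg_left ?_ hM0.le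
    have h6 : 1 ≤ Y / d := by
      rw [le_div_iff₀ hd0, one_mul]
      calc (d : ℝ) ≤ X ^ (1 / 4 : ℝ) := (Nat.le_floor_iff (by positivity)).mp hd.1.2
        _ ≤ X ^ (2 / 3 : ℝ) := Real.rpow_le_rpow_of_exponent_le (by linarith) (by norm_num)
        _ ≤ Y := hXY
    have h5 : Y / d ≤ Y * X ^ (-(1 / 16) : ℝ) * (d : ℝ) ^ (-(1 / 2) : ℝ) := by
      rw [div_eq_mul_one_div, mul_assoc]
      refine mul_le_mul_of_nonneg_left ?_ hY0.le
      have e1 : 1 / (d : ℝ) = (d : ℝ) ^ (-(1 / 2) : ℝ) * (d : ℝ) ^ (-(1 / 2) : ℝ) := by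
        rw [← Real.rpow_add hd0, one_div, ← Real.rpow_neg_one]
        norm_num
      rw [e1]
      refine mul_le_mul_of_nonneg_right ?_ (by positivity)
      calc (d : ℝ) ^ (-(1 / 2) : ℝ) ≤ (X ^ (1 / 8 : ℝ)) ^ (-(1 / 2) : ℝ) :=
            Real.rpow_le_rpow_of_nonpos (by positivity) hd.2.1.le (by norm_num)
        _ = X ^ (-(1 / 16) : ℝ) := by rw [← Real.rpow_mul hX0.le]; norm_num
    linarith
  refine (Finset.sum_le_sum h2).trans ?_
  rw [← Finset.mul_sum]
  have h3 := hK D (fun a ha => (Finset.mem_filter.mp ha).2.2)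
  calc M * (2 * Y * X ^ (-(1 / 16) : ℝ)) * ∑ d ∈ D, (d : ℝ) ^ (-(1 / 2) : ℝ)
      ≤ M * (2 * Y * X ^ (-(1 / 16) : ℝ)) * K := by gcongr
    _ = 4 * B * K * Y * (X ^ (1 / 100 : ℝ) * X ^ (-(1 / 16) : ℝ)) := by rw [hM]; ring
    _ ≤ 4 * B * K * Y * X ^ (-(1 / 100) : ℝ) := by
        rw [← Real.rpow_add hX0]
        have : X ^ (1 / 100 + -(1 / 16) : ℝ) ≤ X ^ (-(1 / 100) : ℝ) :=
          Real.rpow_le_rpow_of_exponent_le (by linarith) (by norm_num)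
        gcongr

end ShiuCases

end

section

open scoped ArithmeticFunction.vonMangoldt

/-- Shifted prime sums: the Rankin twist costs only a constant factor. -/
lemma ShiuClass.sum_primes_shift_le {B : ℝ} {g : ℕ → ℝ} (hg : ShiuClass B g) (hB : 1 ≤ B)
    {X A ν : ℝ} (hX : 1 < X) (hA : 0 ≤ A) {j : ℕ} (hj : 1 ≤ j)
    (hν : ν = A * j / Real.log X) (hν1 : ν ≤ 1 / 20) :
    ∑ p ∈ (⌊X ^ (1 / (j : ℝ))⌋₊ + 1).primesBelow, g p * (p : ℝ) ^ (ν - 1) ≤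
      ∑ p ∈ (⌊X⌋₊ + 1).primesBelow, g p / p + B * Real.exp A * (A + 1) := by
  have hX0 : 0 < X := by linarith
  have hlX : 0 < Real.log X := Real.log_pos hX
  have hj0 : (0 : ℝ) < j := by exact_mod_cast hj
  have hν0 : 0 ≤ ν := by rw [hν]; positivity
  set Q := X ^ (1 / (j : ℝ)) with hQ
  have hQ1 : 1 ≤ Q := Real.one_le_rpow hX.le (by positivity)
  have hlQ : Real.log Q = Real.log X / j := by rw [hQ, Real.log_rpow hX0]; ring
  have hQX : Q ≤ X := by
    conv_rhs => rw [← Real.rpow_one X]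
    exact Real.rpow_le_rpow_of_exponent_le hX.le
      ((div_le_one hj0).mpr (by exact_mod_cast hj))
  have hterm : ∀ p ∈ (⌊Q⌋₊ + 1).primesBelow, g p * (p : ℝ) ^ (ν - 1) ≤
      g p / p + B * Real.exp A * ν * (Λ p / p) := by
    intro p hp
    have hpp := Nat.prime_of_mem_primesBelow hp
    have hp1 : (1 : ℝ) < p := by exact_mod_cast hpp.one_lt
    have hpQ : (p : ℝ) ≤ Q := (Nat.le_floor_iff (by linarith)).mp
      (Nat.lt_succ_iff.mp (Nat.lt_of_mem_primesBelow hp))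
    have hlp : 0 < Real.log p := Real.log_pos hp1
    have hlpQ : Real.log p ≤ Real.log X / j := by
      rw [← hlQ]; exact Real.log_le_log (by linarith) hpQ
    have hνA : ν * Real.log p ≤ A := by
      calc ν * Real.log p ≤ ν * (Real.log X / j) := by gcongr
        _ = A := by rw [hν]; field_simp
    have hgp : g p ≤ B := by simpa using hg.pow_le p 1 hpp
    have e1 : (p : ℝ) ^ ν ≤ 1 + Real.exp A * ν * Real.log p := by
      rw [Real.rpow_def_of_pos (by linarith), mul_comm]
      set u := ν * Real.log p with hu
      have hu0 : 0 ≤ u := by positivity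
      have h1 : 1 - u ≤ Real.exp (-u) := by linarith [Real.add_one_le_exp (-u)]
      have h2 : Real.exp u * Real.exp (-u) = 1 := by rw [← Real.exp_add]; simp
      have h3 : Real.exp u ≤ Real.exp A := Real.exp_le_exp.mpr hνA
      have h4 : Real.exp u * (1 - u) ≤ 1 := by
        exact (mul_le_mul_of_nonneg_left h1 (Real.exp_pos u).le).trans h2.le
      have h5 : Real.exp u * u ≤ Real.exp A * u := by gcongr
      rw [mul_assoc]
      linarith
    have e2 : (p : ℝ) ^ (ν - 1) = (p : ℝ) ^ ν / p := by
      rw [Real.rpow_sub (by linarith), Real.rpow_one]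
    rw [e2, ArithmeticFunction.vonMangoldt_apply_prime hpp]
    have h6 : g p * (p : ℝ) ^ ν ≤ g p + B * Real.exp A * ν * Real.log p := by
      calc g p * (p : ℝ) ^ ν ≤ g p * (1 + Real.exp A * ν * Real.log p) :=
            mul_le_mul_of_nonneg_left e1 (hg.nonneg p)
        _ = g p + g p * (Real.exp A * ν * Real.log p) := by ring
        _ ≤ g p + B * (Real.exp A * ν * Real.log p) := by gcongr
        _ = _ := by ring
    calc g p * ((p : ℝ) ^ ν / p) = (g p * (p : ℝ) ^ ν) / p := by ring
      _ ≤ (g p + B * Real.exp A * ν * Real.log p) / p := by gcongr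
      _ = _ := by ring
  refine (Finset.sum_le_sum hterm).trans ?_
  rw [Finset.sum_add_distrib, ← Finset.mul_sum]
  have h1 : ∑ p ∈ (⌊Q⌋₊ + 1).primesBelow, g p / p ≤ ∑ p ∈ (⌊X⌋₊ + 1).primesBelow, g p / p := by
    apply Finset.sum_le_sum_of_subset_of_nonneg
    · intro p hp
      have h0 := Nat.floor_le_floor hQX
      exact Nat.mem_primesBelow.mpr ⟨(Nat.lt_of_mem_primesBelow hp).trans_le (by omega),
        Nat.prime_of_mem_primesBelow hp⟩
    · intro p _ _; exact div_nonneg (hg.nonneg p) (by positivity)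
  have h2 : ∑ p ∈ (⌊Q⌋₊ + 1).primesBelow, Λ p / p ≤ Real.log X / j + 6 := by
    calc ∑ p ∈ (⌊Q⌋₊ + 1).primesBelow, Λ p / p ≤ ∑ p ∈ Finset.Icc 1 ⌊Q⌋₊, Λ p / p := by
          apply Finset.sum_le_sum_of_subset_of_nonneg
          · intro p hp
            exact Finset.mem_Icc.mpr ⟨(Nat.prime_of_mem_primesBelow hp).one_lt.le,
              Nat.lt_succ_iff.mp (Nat.lt_of_mem_primesBelow hp)⟩
          · intro p _ _; exact div_nonneg (vM_nonneg p) (by positivity)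
      _ ≤ Real.log ⌊Q⌋₊ + 6 := sum_vM_div_le _
      _ ≤ Real.log Q + 6 := by
          have : (1 : ℝ) ≤ ⌊Q⌋₊ := by exact_mod_cast Nat.le_floor (by simpa using hQ1)
          have := Real.log_le_log (by linarith) (Nat.floor_le (by linarith : 0 ≤ Q))
          linarith
      _ = _ := by rw [hlQ]
  have h3 : B * Real.exp A * ν * ∑ p ∈ (⌊Q⌋₊ + 1).primesBelow, Λ p / p ≤
      B * Real.exp A * (A + 1) := by
    calc _ ≤ B * Real.exp A * ν * (Real.log X / j + 6) := by gcongr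
      _ = B * Real.exp A * (ν * (Real.log X / j) + 6 * ν) := by ring
      _ ≤ B * Real.exp A * (A + 1) := by
          have : ν * (Real.log X / j) = A := by rw [hν]; field_simp
          gcongr
          · rw [this]
          · linarith
  linarith

/-- The sieve estimate for the rough cofactor. -/
lemma card_rough_le {X Y : ℝ} (hX : 16 ≤ X) (hXY : X ^ (2 / 3 : ℝ) ≤ Y)
    {a : ℕ} (ha : 1 ≤ a) (haX : (a : ℝ) ≤ X ^ (1 / 4 : ℝ)) {j : ℕ} (hj : 1 ≤ j) :
    (((Finset.Ioc ⌊X / a⌋₊ ⌊X / a + Y / a⌋₊).filter (fun b => ∀ p : ℕ, p.Prime → p ∣ b →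
      X ^ (1 / ((j : ℝ) + 1)) < p)).card : ℝ) ≤ 20 * (j + 1) * (Y / a) / Real.log X := by
  have hX0 : 0 < X := by linarith
  have hlX : 0 < Real.log X := Real.log_pos (by linarith)
  have hY0 : 0 < Y := lt_of_lt_of_le (by positivity) hXY
  have hj0 : (1 : ℝ) ≤ j := by exact_mod_cast hj
  have ha0 : (0 : ℝ) < a := by exact_mod_cast ha
  set E := X ^ (1 / (6 * ((j : ℝ) + 1))) with hE
  have hE1 : 1 < E := Real.one_lt_rpow (by linarith) (by positivity)
  have hE2 : E ≤ X ^ (1 / 12 : ℝ) := by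
    apply Real.rpow_le_rpow_of_exponent_le (by linarith)
    apply one_div_le_one_div_of_le (by norm_num) (by linarith)
  have hD : 2 ≤ ⌈E⌉₊ := Nat.lt_ceil.mpr (by simpa using hE1)
  have hs := sieve_bound (X := X / a) (Y := Y / a) (by positivity) (by positivity) hD
  refine (le_trans ?_ hs).trans ?_
  · refine Nat.cast_le.mpr (Finset.card_le_card ?_)
    intro b hb
    rw [Finset.mem_filter] at hb ⊢
    refine ⟨hb.1, fun p hp hpb => ?_⟩
    rw [Nat.ceil_le]
    refine le_trans ?_ (hb.2 p hp hpb).le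
    apply Real.rpow_le_rpow_of_exponent_le (by linarith)
    apply one_div_le_one_div_of_le (by positivity) (by linarith)
  · have h1 : Real.log X / (6 * (j + 1)) ≤ Real.log ⌈E⌉₊ := by
      calc Real.log X / (6 * (j + 1)) = Real.log E := by rw [hE, Real.log_rpow hX0]; ring
        _ ≤ _ := Real.log_le_log (by linarith) (Nat.le_ceil E)
    have h2 : 2 * (Y / a) / Real.log ⌈E⌉₊ ≤ 12 * (j + 1) * (Y / a) / Real.log X := by
      calc 2 * (Y / a) / Real.log ⌈E⌉₊ ≤ 2 * (Y / a) / (Real.log X / (6 * (j + 1))) := by gcongr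
        _ = _ := by field_simp; ring
    have h3 : ((⌈E⌉₊ : ℕ) : ℝ) ^ 2 ≤ 16 * (Y / a) / Real.log X := by
      have h4 : ((⌈E⌉₊ : ℕ) : ℝ) ≤ 2 * X ^ (1 / 12 : ℝ) := by
        have := Nat.ceil_lt_add_one (by linarith : 0 ≤ E)
        linarith
      have h5 : Real.log X ≤ 4 * X ^ (1 / 4 : ℝ) := by
        have := Real.log_le_rpow_div hX0.le (show (0 : ℝ) < 1 / 4 by norm_num)
        linarith
      have h6 : X ^ (5 / 12 : ℝ) ≤ Y / a := by
        rw [le_div_iff₀ ha0]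
        calc X ^ (5 / 12 : ℝ) * a ≤ X ^ (5 / 12 : ℝ) * X ^ (1 / 4 : ℝ) := by gcongr
          _ = X ^ (2 / 3 : ℝ) := by rw [← Real.rpow_add hX0]; norm_num
          _ ≤ Y := hXY
      rw [le_div_iff₀ hlX]
      calc ((⌈E⌉₊ : ℕ) : ℝ) ^ 2 * Real.log X
          ≤ (2 * X ^ (1 / 12 : ℝ)) ^ 2 * (4 * X ^ (1 / 4 : ℝ)) := by gcongr
        _ = 16 * (X ^ (1 / 12 : ℝ) * X ^ (1 / 12 : ℝ) * X ^ (1 / 4 : ℝ)) := by ring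
        _ = 16 * X ^ (5 / 12 : ℝ) := by
            rw [← Real.rpow_add hX0, ← Real.rpow_add hX0]; norm_num
        _ ≤ _ := by gcongr
    have h4 : 16 * (Y / a) / Real.log X ≤ 8 * (j + 1) * (Y / a) / Real.log X := by
      gcongr
      linarith
    calc _ ≤ 12 * (j + 1) * (Y / a) / Real.log X + 8 * (j + 1) * (Y / a) / Real.log X := by
          linarith
      _ = _ := by ring

lemma ShiuClass.shiu_main {B : ℝ} {g : ℕ → ℝ} (hg : ShiuClass B g) (hB : 1 ≤ B) {X Y : ℝ}
    (hX : 16 ≤ X) (hYX : Y ≤ X) (hXY : X ^ (2 / 3 : ℝ) ≤ Y) {A : ℝ}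
    (hA : A = 16 * Real.log B + 16) (hXA : 160 * A ≤ Real.log X) :
    ∑ n ∈ (Finset.Ioc ⌊X⌋₊ ⌊X + Y⌋₊).filter (fun n =>
      ∃ j a : ℕ, 1 ≤ j ∧ a ∣ n ∧ (a : ℝ) ≤ X ^ (1 / 4 : ℝ) ∧ 1 ≤ a ∧
      (∀ p : ℕ, p.Prime → p ∣ a → (p : ℝ) ≤ X ^ (1 / (j : ℝ))) ∧
      (∀ p : ℕ, p.Prime → p ∣ n / a → X ^ (1 / ((j : ℝ) + 1)) < p) ∧
      Nat.Coprime a (n / a) ∧ (X ^ (1 / 8 : ℝ) < a ∨ j ≤ 8) ∧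
      (j * Real.log (Real.exp (20 * A)) ≤ Real.log X ∨ j ≤ 8)), g n ≤
      20 * B ^ 2 * Real.exp A * Real.exp (9 * B + B * Real.exp A * (A + 1)) *
        (Y / Real.log X) * Real.exp (∑ p ∈ (⌊X⌋₊ + 1).primesBelow, g p / p) := by
  have hX0 : 0 < X := by linarith
  have hlX : 0 < Real.log X := Real.log_pos (by linarith)
  have hY0 : 0 < Y := lt_of_lt_of_le (by positivity) hXY
  have hlB : 0 ≤ Real.log B := Real.log_nonneg hB
  have hA0 : 16 ≤ A := by linarith
  set P := ∑ p ∈ (⌊X⌋₊ + 1).primesBelow, g p / p with hP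
  set Js := (Finset.Icc 1 (⌊Real.log X⌋₊ + 8)).filter
    (fun j : ℕ => A * j / Real.log X ≤ 1 / 20) with hJs
  set As : ℕ → Finset ℕ := fun j => (Finset.Icc 1 ⌊X ^ (1 / 4 : ℝ)⌋₊).filter (fun a : ℕ =>
    (∀ p : ℕ, p.Prime → p ∣ a → (p : ℝ) ≤ X ^ (1 / (j : ℝ))) ∧
      (X ^ (1 / 8 : ℝ) < a ∨ j ≤ 8)) with hAs
  set Bs : ℕ → ℕ → Finset ℕ := fun j a =>
    (Finset.Ioc ⌊X / a⌋₊ ⌊X / a + Y / a⌋₊).filter (fun b => ∀ p : ℕ, p.Prime → p ∣ b →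
      X ^ (1 / ((j : ℝ) + 1)) < p) with hBs
  set F : ℕ → ℕ → ℝ := fun j a => g a * B ^ (2 * (j + 1)) with hF
  have hF0 : ∀ j a, 0 ≤ F j a := fun j a => mul_nonneg (hg.nonneg a) (by positivity)
  refine (sum_le_sum_of_witness _ (Js.sigma fun j => (As j).sigma fun a => Bs j a)
    (fun q => F q.1 q.2.1) (fun q _ => hF0 _ _) (fun q => q.2.1 * q.2.2) g ?_).trans ?_
  · intro n hn
    rw [Finset.mem_filter, Finset.mem_Ioc] at hn
    obtain ⟨⟨hn1, hn2⟩, j, a, hj, han, haX, ha1, hpa, hpb, hco, hor1, hor2⟩ := hn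
    obtain ⟨b, rfl⟩ := han
    rw [Nat.mul_div_cancel_left b ha1] at hpb hco
    have ha0 : (0 : ℝ) < a := by exact_mod_cast ha1
    have hb0 : b ≠ 0 := by rintro rfl; simp at hn1
    have hXn : X < (a : ℝ) * b := by exact_mod_cast (Nat.floor_lt hX0.le).mp hn1
    have hnX : (a : ℝ) * b ≤ X + Y := by
      exact_mod_cast (Nat.le_floor_iff (by linarith : 0 ≤ X + Y)).mp hn2
    have hj0 : (1 : ℝ) ≤ j := by exact_mod_cast hj
    have hjA : A * j / Real.log X ≤ 1 / 20 ∧ j ≤ ⌊Real.log X⌋₊ + 8 := by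
      rw [Real.log_exp] at hor2
      rcases hor2 with h | h
      · constructor
        · rw [div_le_div_iff₀ hlX (by norm_num)]; linarith
        · have : j ≤ ⌊Real.log X⌋₊ := Nat.le_floor (by nlinarith)
          omega
      · have h8 : (j : ℝ) ≤ 8 := by exact_mod_cast h
        constructor
        · rw [div_le_div_iff₀ hlX (by norm_num)]; nlinarith
        · omega
    refine ⟨⟨j, a, b⟩, ?_, rfl, ?_⟩
    · rw [Finset.mem_sigma, Finset.mem_sigma]
      refine ⟨Finset.mem_filter.mpr ⟨Finset.mem_Icc.mpr ⟨hj, hjA.2⟩, hjA.1⟩,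
        Finset.mem_filter.mpr ⟨Finset.mem_Icc.mpr ⟨ha1, Nat.le_floor haX⟩, hpa, hor1⟩,
        Finset.mem_filter.mpr ⟨Finset.mem_Ioc.mpr ⟨?_, ?_⟩, hpb⟩⟩
      · rw [Nat.floor_lt (by positivity), div_lt_iff₀ ha0]; linarith
      · apply Nat.le_floor
        rw [← add_div, le_div_iff₀ ha0]; linarith
    · rw [hg.mult a b hco]
      refine mul_le_mul_of_nonneg_left ?_ (hg.nonneg a)
      set θ := ((j : ℝ) + 1) * Real.log B / Real.log X with hθ
      have hθ0 : 0 ≤ θ := by positivity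
      have h1 := hg.le_rpow_of_rough (θ := θ) (by linarith) hb0 (by
        intro p hp hpd
        have h2 := (hpb p hp hpd).le
        calc B = (X ^ (1 / ((j : ℝ) + 1))) ^ θ := by
              rw [← Real.rpow_mul hX0.le, Real.rpow_def_of_pos hX0, hθ]
              have : Real.log X * (1 / ((j : ℝ) + 1) * (((j : ℝ) + 1) * Real.log B / Real.log X))
                = Real.log B := by field_simp
              rw [this, Real.exp_log (by linarith)]
          _ ≤ _ := by gcongr)
      refine h1.trans ?_
      have h2 : (b : ℝ) ≤ X ^ 2 := by
        have h3 : (1 : ℝ) ≤ a := by exact_mod_cast ha1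
        have h4 : (0 : ℝ) ≤ b := by positivity
        nlinarith
      calc (b : ℝ) ^ θ ≤ (X ^ 2) ^ θ := by gcongr
        _ = B ^ (2 * (j + 1)) := by
          rw [← Real.rpow_natCast, ← Real.rpow_mul hX0.le, Real.rpow_def_of_pos hX0, hθ]
          rw [← Real.exp_log (show 0 < B by linarith), ← Real.exp_nat_mul, Real.log_exp]
          congr 1
          push_cast
          field_simp
  rw [Finset.sum_sigma]
  have hjterm : ∀ j ∈ Js, ∑ q ∈ (As j).sigma fun a => Bs j a, F j q.1 ≤
      20 * B ^ 2 * Real.exp A * Real.exp (9 * B + B * Real.exp A * (A + 1)) *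
        (Y / Real.log X) * Real.exp P * Real.exp (-1) ^ j := by
    intro j hj
    rw [hJs, Finset.mem_filter, Finset.mem_Icc] at hj
    obtain ⟨⟨hj1, -⟩, hjν⟩ := hj
    have hj0 : (1 : ℝ) ≤ j := by exact_mod_cast hj1
    set ν := A * j / Real.log X with hν
    have hν0 : 0 ≤ ν := by positivity
    rw [Finset.sum_sigma]
    simp only [Finset.sum_const, nsmul_eq_mul]
    have hat : ∀ a ∈ As j, ((Bs j a).card : ℝ) * F j a ≤
        20 * (j + 1) * (Y / Real.log X) * B ^ (2 * (j + 1)) * Real.exp (A - A * j / 8) *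
          (g a * (a : ℝ) ^ (ν - 1)) := by
      intro a ha
      rw [hAs] at ha
      simp only [Finset.mem_filter, Finset.mem_Icc] at ha
      obtain ⟨⟨ha1, ha2⟩, ha3, ha4⟩ := ha
      have haX := (Nat.le_floor_iff (by positivity)).mp ha2
      have ha0 : (0 : ℝ) < a := by exact_mod_cast ha1
      have hc := card_rough_le hX hXY ha1 haX hj1
      have hr : 1 ≤ Real.exp (A - A * j / 8) * (a : ℝ) ^ ν := by
        rcases ha4 with h | h
        · have h1 : Real.exp (A * j / 8) ≤ (a : ℝ) ^ ν := by
            calc Real.exp (A * j / 8) = (X ^ (1 / 8 : ℝ)) ^ ν := by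
                  rw [← Real.rpow_mul hX0.le, Real.rpow_def_of_pos hX0, hν]
                  congr 1; field_simp
              _ ≤ _ := by gcongr
          calc (1 : ℝ) ≤ Real.exp A := Real.one_le_exp (by linarith)
            _ = Real.exp (A - A * j / 8) * Real.exp (A * j / 8) := by
                rw [← Real.exp_add]; congr 1; ring
            _ ≤ _ := by gcongr
        · have h8 : (j : ℝ) ≤ 8 := by exact_mod_cast h
          exact one_le_mul_of_one_le_of_one_le (Real.one_le_exp (by nlinarith))
            (Real.one_le_rpow (by exact_mod_cast ha1) hν0)
      have e2 : (a : ℝ) ^ (ν - 1) = (a : ℝ) ^ ν / a := by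
        rw [Real.rpow_sub ha0, Real.rpow_one]
      have hga := hg.nonneg a
      calc ((Bs j a).card : ℝ) * F j a ≤ (20 * (j + 1) * (Y / a) / Real.log X) * F j a :=
            mul_le_mul_of_nonneg_right hc (hF0 _ _)
        _ = (20 * (j + 1) * (Y / Real.log X) * B ^ (2 * (j + 1)) * (g a / a)) * 1 := by
            rw [hF]; ring
        _ ≤ (20 * (j + 1) * (Y / Real.log X) * B ^ (2 * (j + 1)) * (g a / a)) *
            (Real.exp (A - A * j / 8) * (a : ℝ) ^ ν) := by
            refine mul_le_mul_of_nonneg_left hr ?_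
            positivity
        _ = _ := by rw [e2]; ring
    refine (Finset.sum_le_sum hat).trans ?_
    rw [← Finset.mul_sum]
    have hsm := hg.sum_smooth_le (B := B) (by linarith) hjν
      (y := ⌊X ^ (1 / (j : ℝ))⌋₊ + 1) (S := As j) (by
        intro a ha p hp hpa
        exact Nat.lt_succ_of_le (Nat.le_floor ((Finset.mem_filter.mp ha).2.1 p hp hpa)))
    have hpr := hg.sum_primes_shift_le hB (by linarith : 1 < X) (by linarith : 0 ≤ A) hj1 hν hjν
    have hsm2 : ∑ a ∈ As j, g a * (a : ℝ) ^ (ν - 1) ≤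
        Real.exp (9 * B + B * Real.exp A * (A + 1)) * Real.exp P := by
      rw [← Real.exp_add]
      exact hsm.trans (Real.exp_le_exp.mpr (by linarith))
    have hcoef : ((j : ℝ) + 1) * B ^ (2 * (j + 1)) * Real.exp (A - A * j / 8) ≤
        B ^ 2 * Real.exp A * Real.exp (-1) ^ j := by
      have h1 : ((j : ℝ) + 1) ≤ Real.exp j := Real.add_one_le_exp _
      have h2 : B ^ (2 * (j + 1)) = B ^ 2 * Real.exp (2 * j * Real.log B) := by
        have : Real.exp (2 * j * Real.log B) = B ^ (2 * j) := by
          conv_rhs => rw [← Real.exp_log (show 0 < B by linarith), ← Real.exp_nat_mul]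
          push_cast; rfl
        rw [this]; ring
      rw [h2, ← Real.exp_nat_mul]
      calc ((j : ℝ) + 1) * (B ^ 2 * Real.exp (2 * j * Real.log B)) * Real.exp (A - A * j / 8)
          ≤ Real.exp j * (B ^ 2 * Real.exp (2 * j * Real.log B)) * Real.exp (A - A * j / 8) := by
            gcongr
        _ = B ^ 2 * (Real.exp j * Real.exp (2 * j * Real.log B) * Real.exp (A - A * j / 8)) := by
            ring
        _ = B ^ 2 * Real.exp A * Real.exp (j * -1) := by
            rw [← Real.exp_add, ← Real.exp_add, mul_assoc (B ^ 2), ← Real.exp_add]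
            congr 2; rw [hA]; ring
    calc 20 * (j + 1) * (Y / Real.log X) * B ^ (2 * (j + 1)) * Real.exp (A - A * j / 8) *
          ∑ a ∈ As j, g a * (a : ℝ) ^ (ν - 1)
        = 20 * (Y / Real.log X) * (((j : ℝ) + 1) * B ^ (2 * (j + 1)) * Real.exp (A - A * j / 8)) *
          ∑ a ∈ As j, g a * (a : ℝ) ^ (ν - 1) := by ring
      _ ≤ 20 * (Y / Real.log X) * (B ^ 2 * Real.exp A * Real.exp (-1) ^ j) *
          (Real.exp (9 * B + B * Real.exp A * (A + 1)) * Real.exp P) := by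
          gcongr
          exact Finset.sum_nonneg fun a _ => mul_nonneg (hg.nonneg a) (by positivity)
      _ = _ := by ring
  refine (Finset.sum_le_sum hjterm).trans ?_
  rw [← Finset.mul_sum]
  have hgeo : ∑ j ∈ Js, Real.exp (-1) ^ j ≤ 1 := by
    have he : Real.exp (-1) ≤ 1 / 2 := by
      rw [Real.exp_neg, ← one_div]
      exact one_div_le_one_div_of_le (by norm_num) (by linarith [Real.add_one_le_exp (1 : ℝ)])
    have h0 := Real.exp_pos (-1)
    calc ∑ j ∈ Js, Real.exp (-1) ^ j ≤ ∑ j ∈ Finset.Icc 1 (⌊Real.log X⌋₊ + 8), (1 / 2 : ℝ) ^ j :=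
          (Finset.sum_le_sum fun j _ => pow_le_pow_left₀ h0.le he j).trans
            (Finset.sum_le_sum_of_subset_of_nonneg (Finset.filter_subset _ _)
              fun _ _ _ => by positivity)
      _ ≤ 1 := by
          have : ∀ N : ℕ, ∑ j ∈ Finset.Icc 1 N, (1 / 2 : ℝ) ^ j = 1 - (1 / 2) ^ N := by
            intro N
            induction N with
            | zero => simp
            | succ N ih => rw [Finset.sum_Icc_succ_top (by omega), ih]; ring
          rw [this]
          linarith [pow_pos (by norm_num : (0 : ℝ) < 1 / 2) (⌊Real.log X⌋₊ + 8)]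
  refine mul_le_of_le_one_right ?_ hgeo
  positivity

/-- Shiu's theorem in short intervals. -/
theorem exists_shiu {B : ℝ} (hB : 1 ≤ B) : ∃ C : ℝ, 0 < C ∧ ∀ g : ℕ → ℝ, ShiuClass B g →
    ∀ X Y : ℝ, C ≤ X → X ^ (2 / 3 : ℝ) ≤ Y → Y ≤ X →
    ∑ n ∈ Finset.Ioc ⌊X⌋₊ ⌊X + Y⌋₊, g n ≤
      C * (Y / Real.log X) * Real.exp (∑ p ∈ (⌊X⌋₊ + 1).primesBelow, g p / p) := by
  set A := 16 * Real.log B + 16 with hA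
  have hlB : 0 ≤ Real.log B := Real.log_nonneg hB
  obtain ⟨K, hK0, hK⟩ := exists_sum_smooth_rpow_le ⌈Real.exp (20 * A)⌉₊
  set C3 := 20 * B ^ 2 * Real.exp A * Real.exp (9 * B + B * Real.exp A * (A + 1)) with hC3
  have hC30 : 0 < C3 := by positivity
  refine ⟨16 + Real.exp (160 * A) + (8 * B + 4 * B * K) * 100 + C3, by positivity, ?_⟩
  intro g hg X Y hCX hXY hYX
  have hpos : 0 ≤ (8 * B + 4 * B * K) * 100 := by positivity
  have hE := Real.exp_pos (160 * A)
  have hX : 16 ≤ X := by linarith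
  have hX0 : 0 < X := by linarith
  have hlX : 0 < Real.log X := Real.log_pos (by linarith)
  have hY0 : 0 < Y := lt_of_lt_of_le (by positivity) hXY
  have hXA : 160 * A ≤ Real.log X := by
    rw [Real.le_log_iff_exp_le hX0]; linarith
  set P := ∑ p ∈ (⌊X⌋₊ + 1).primesBelow, g p / p with hP
  have hP1 : 1 ≤ Real.exp P := Real.one_le_exp
    (Finset.sum_nonneg fun p _ => div_nonneg (hg.nonneg p) (by positivity))
  have h1 := hg.shiu_square hB hX hYX hXY
  have h2 := hg.shiu_smooth hB hX hYX hXY hK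
  have h3 := hg.shiu_main hB hX hYX hXY hA hXA
  have hunion : ∑ n ∈ Finset.Ioc ⌊X⌋₊ ⌊X + Y⌋₊, g n ≤ 8 * B * Y * X ^ (-(1 / 100) : ℝ) +
      (4 * B * K * Y * X ^ (-(1 / 100) : ℝ) + C3 * (Y / Real.log X) * Real.exp P) := by
    refine le_trans ?_ (add_le_add h1 (add_le_add h2 h3))
    have hun : ∀ S T : Finset ℕ, ∑ n ∈ S ∪ T, g n ≤ ∑ n ∈ S, g n + ∑ n ∈ T, g n := by
      intro S T
      rw [← Finset.sum_union_inter]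
      linarith [Finset.sum_nonneg (s := S ∩ T) fun n _ => hg.nonneg n]
    refine le_trans ?_ (add_le_add_right (hun _ _) _)
    refine le_trans ?_ (hun _ _)
    apply Finset.sum_le_sum_of_subset_of_nonneg
    · intro n hn
      have hXn : X < n := (Nat.floor_lt hX0.le).mp (Finset.mem_Ioc.mp hn).1
      simp only [Finset.mem_union, Finset.mem_filter]
      rcases shiu_trichotomy hX (Real.one_lt_exp_iff.mpr (by linarith : 0 < 20 * A)) hXn with
        h | h | h
      · exact Or.inl ⟨hn, h⟩
      · exact Or.inr (Or.inl ⟨hn, h⟩)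
      · exact Or.inr (Or.inr ⟨hn, h⟩)
    · exact fun n _ _ => hg.nonneg n
  have h4 : X ^ (-(1 / 100) : ℝ) ≤ 100 / Real.log X := by
    have := Real.log_le_rpow_div hX0.le (show (0 : ℝ) < 1 / 100 by norm_num)
    rw [Real.rpow_neg hX0.le, inv_eq_one_div, div_le_div_iff₀ (by positivity) hlX]
    linarith
  calc _ ≤ _ := hunion
    _ = (8 * B + 4 * B * K) * Y * X ^ (-(1 / 100) : ℝ) + C3 * (Y / Real.log X) * Real.exp P := by
        ring
    _ ≤ (8 * B + 4 * B * K) * Y * (100 / Real.log X) * Real.exp P +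
        C3 * (Y / Real.log X) * Real.exp P := by
        refine add_le_add_left ?_ _
        refine le_trans ?_ (le_mul_of_one_le_right (by positivity) hP1)
        gcongr
    _ = ((8 * B + 4 * B * K) * 100 + C3) * (Y / Real.log X) * Real.exp P := by ring
    _ ≤ _ := by
        gcongr
        linarith

end

section

open scoped ArithmeticFunction.vonMangoldt

/-- Restriction of an arithmetic function to the positive integers satisfying `P`. -/
def restr (P : ℕ → Prop) (f : ℕ → ℂ) : ℕ → ℂ := fun n => if n ≠ 0 ∧ P n then f n else 0

lemma restr_of {P : ℕ → Prop} {f : ℕ → ℂ} {n : ℕ} (hn : n ≠ 0) (h : P n) :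
    restr P f n = f n := by rw [restr, if_pos ⟨hn, h⟩]

lemma restr_of_not {P : ℕ → Prop} {f : ℕ → ℂ} {n : ℕ} (h : ¬ P n) :
    restr P f n = 0 := by rw [restr, if_neg (fun h' => h h'.2)]

lemma restr_zero {P : ℕ → Prop} {f : ℕ → ℂ} : restr P f 0 = 0 := by
  rw [restr, if_neg (fun h' => h'.1 rfl)]

lemma norm_restr_le {P : ℕ → Prop} {f : ℕ → ℂ} (n : ℕ) : ‖restr P f n‖ ≤ ‖f n‖ := by
  rw [restr]; split_ifs <;> simp

lemma IsHalaszClass.restr {κ : ℝ} {f Λf : ℕ → ℂ} (h : IsHalaszClass κ f Λf)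
    {P : ℕ → Prop}
    (P1 : P 1) (Pm : ∀ m n, m ≠ 0 → n ≠ 0 → (P (m * n) ↔ P m ∧ P n)) :
    IsHalaszClass κ (restr P f) (restr P Λf) where
  map_one := by rw [restr_of one_ne_zero P1, h.map_one]
  mult := by
    intro m n hmn
    rcases eq_or_ne m 0 with rfl | hm
    · simp [restr_zero]
    rcases eq_or_ne n 0 with rfl | hn
    · simp [restr_zero]
    by_cases hP : P m ∧ P n
    · rw [restr_of (mul_ne_zero hm hn) ((Pm m n hm hn).mpr hP), restr_of hm hP.1,
        restr_of hn hP.2, h.mult m n hmn]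
    · rw [restr_of_not (fun h' => hP ((Pm m n hm hn).mp h'))]
      rcases not_and_or.mp hP with h' | h'
      · rw [restr_of_not h', zero_mul]
      · rw [restr_of_not (n := n) h', mul_zero]
  supp := by
    intro n hn
    have := norm_restr_le (P := P) (f := Λf) n
    rw [h.supp n hn, norm_zero] at this
    exact norm_le_zero_iff.mp this
  bound := fun n hn => (norm_restr_le n).trans (h.bound n hn)
  conv := by
    intro n hn
    have hn0 : n ≠ 0 := by omega
    by_cases hP : P n
    · rw [restr_of hn0 hP, h.conv n hn]
      refine Finset.sum_congr rfl fun d hd => ?_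
      obtain ⟨e, rfl⟩ := (Nat.mem_divisors.mp hd).1
      have hd0 : d ≠ 0 := left_ne_zero_of_mul hn0
      have he0 : e ≠ 0 := right_ne_zero_of_mul hn0
      rw [Nat.mul_div_cancel_left e (Nat.pos_of_ne_zero hd0)]
      have := (Pm d e hd0 he0).mp hP
      rw [restr_of hd0 this.1, restr_of he0 this.2]
    · rw [restr_of_not hP, zero_mul]
      symm
      refine Finset.sum_eq_zero fun d hd => ?_
      obtain ⟨e, rfl⟩ := (Nat.mem_divisors.mp hd).1
      have hd0 : d ≠ 0 := left_ne_zero_of_mul hn0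
      have he0 : e ≠ 0 := right_ne_zero_of_mul hn0
      rw [Nat.mul_div_cancel_left e (Nat.pos_of_ne_zero hd0)]
      rcases not_and_or.mp (fun h' => hP ((Pm d e hd0 he0).mpr h')) with h' | h'
      · rw [restr_of_not h', zero_mul]
      · rw [restr_of_not (n := e) h', mul_zero]
  abs_conv := fun σ hσ => (h.abs_conv σ hσ).of_nonneg_of_le (fun n => by positivity)
    (fun n => by gcongr; exact norm_restr_le n)

lemma smoothBelow_mul_iff (y : ℕ) (m n : ℕ) :
    SmoothBelow y (m * n) ↔ SmoothBelow y m ∧ SmoothBelow y n :=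
  ⟨fun h => ⟨h.of_dvd (dvd_mul_right _ _), h.of_dvd (dvd_mul_left _ _)⟩, fun h => h.1.mul h.2⟩

lemma roughFrom_mul_iff (y : ℕ) (m n : ℕ) :
    RoughFrom y (m * n) ↔ RoughFrom y m ∧ RoughFrom y n :=
  ⟨fun h => ⟨h.of_dvd (dvd_mul_right _ _), h.of_dvd (dvd_mul_left _ _)⟩, fun h => h.1.mul h.2⟩

section

variable {κ : ℝ} {f Λf : ℕ → ℂ}

lemma IsHalaszClass.smooth (h : IsHalaszClass κ f Λf) (y : ℕ) :
    IsHalaszClass κ (_root_.restr (SmoothBelow y) f) (_root_.restr (SmoothBelow y) Λf) :=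
  h.restr (smoothBelow_one y) fun m n _ _ => smoothBelow_mul_iff y m n

lemma IsHalaszClass.rough (h : IsHalaszClass κ f Λf) (y : ℕ) :
    IsHalaszClass κ (_root_.restr (RoughFrom y) f) (_root_.restr (RoughFrom y) Λf) :=
  h.restr (roughFrom_one y) fun m n _ _ => roughFrom_mul_iff y m n

lemma IsHalaszClass.Λ_one (h : IsHalaszClass κ f Λf) : Λf 1 = 0 := h.supp 1 not_isPrimePow_one

lemma IsHalaszClass.LSeriesSummable (h : IsHalaszClass κ f Λf) {s : ℂ} (hs : 1 < s.re) :
    _root_.LSeriesSummable f s := by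
  refine ((h.abs_conv s.re hs).congr_cofinite ?_).of_norm
  rw [Filter.EventuallyEq, Filter.eventually_cofinite]
  refine Set.Finite.subset (Set.finite_singleton 0) fun n hn => ?_
  by_contra hn0
  refine hn ?_
  rw [LSeries.norm_term_eq, if_neg (by simpa using hn0)]

lemma abscissa_le_of_bound {c : ℕ → ℂ} {σ0 : ℝ} (h : ∀ s : ℂ, σ0 < s.re → LSeriesSummable c s) :
    LSeries.abscissaOfAbsConv c ≤ σ0 :=
  LSeries.abscissaOfAbsConv_le_of_forall_lt_LSeriesSummable fun y hy => h y (by simpa using hy)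

lemma IsHalaszClass.Λ_LSeriesSummable (h : IsHalaszClass κ f Λf) {s : ℂ} (hs : 1 < s.re) :
    _root_.LSeriesSummable Λf s := by
  have h1 := (ArithmeticFunction.LSeriesSummable_vonMangoldt hs).norm
  refine Summable.of_norm_bounded (h1.mul_left κ) fun n => ?_
  rcases eq_or_ne n 0 with rfl | hn
  · simp
  · rw [LSeries.norm_term_eq, LSeries.norm_term_eq, if_neg hn, if_neg hn, ← mul_div_assoc]
    gcongr
    refine (h.bound n (by omega)).trans (le_of_eq ?_)
    simp [abs_of_nonneg (vM_nonneg n)]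

lemma IsHalaszClass.LSeries_eq_exp (h : IsHalaszClass κ f Λf) {s : ℂ} (hs : 1 < s.re) :
    LSeries f s = Complex.exp (LSeries (fun n => Λf n / (Real.log n : ℂ)) s) :=
  _root_.LSeries_eq_exp (σ0 := 1) h.map_one h.Λ_one h.conv
    (abscissa_le_of_bound fun _ hs => h.LSeriesSummable hs)
    (abscissa_le_of_bound fun _ hs => h.Λ_LSeriesSummable hs) hs

lemma IsHalaszClass.norm_LSeries_le (h : IsHalaszClass κ f Λf) (hκ : 0 < κ) {s : ℂ}
    (hs : 1 < s.re) : ‖LSeries f s‖ ≤ (1 + 1 / (s.re - 1)) ^ κ := by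
  have hη : 0 < s.re - 1 := by linarith
  obtain ⟨h1, h2⟩ := tsum_vonMangoldt_div_log_le hη
  have h3 : ‖LSeries (fun n => Λf n / (Real.log n : ℂ)) s‖ ≤
      κ * ∑' n : ℕ, Λ n / Real.log n / (n : ℝ) ^ (1 + (s.re - 1)) := by
    rw [← tsum_mul_left, LSeries]
    refine tsum_of_norm_bounded (h1.mul_left κ).hasSum fun n => ?_
    rcases eq_or_ne n 0 with rfl | hn
    · simp
    · rw [LSeries.norm_term_eq, if_neg hn, norm_div, Complex.norm_real, Real.norm_of_nonneg
        (Real.log_natCast_nonneg n), add_sub_cancel, ← mul_div_assoc, ← mul_div_assoc]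
      have := h.bound n (by omega)
      have := Real.log_natCast_nonneg n
      gcongr
  rw [h.LSeries_eq_exp hs, Complex.norm_exp, Real.rpow_def_of_pos (by positivity)]
  apply Real.exp_le_exp.mpr
  calc _ ≤ _ := Complex.re_le_norm _
    _ ≤ _ := h3
    _ ≤ κ * Real.log (1 + 1 / (s.re - 1)) := by gcongr
    _ = _ := mul_comm _ _

lemma IsHalaszClass.pow_rec (h : IsHalaszClass κ f Λf) {p : ℕ} (hp : p.Prime)
    (k : ℕ) : k * ‖f (p ^ k)‖ ≤ κ * ∑ i ∈ Finset.range k, ‖f (p ^ i)‖ := by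
  have hlp : 0 < Real.log p := Real.log_pos (by exact_mod_cast hp.one_lt)
  have h1 := h.conv (p ^ k) (Nat.one_le_pow _ _ hp.pos)
  rw [Nat.sum_divisors_prime_pow hp, Finset.sum_range_succ'] at h1
  simp only [pow_zero, h.Λ_one, zero_mul, add_zero] at h1
  have h2 : ‖f (p ^ k)‖ * (k * Real.log p) ≤
      ∑ i ∈ Finset.range k, κ * Real.log p * ‖f (p ^ (k - 1 - i))‖ := by
    have h3 : ‖f (p ^ k) * (Real.log ((p ^ k : ℕ) : ℝ) : ℂ)‖ = ‖f (p ^ k)‖ * (k * Real.log p) := by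
      rw [norm_mul, Complex.norm_real, Real.norm_of_nonneg (Real.log_natCast_nonneg _)]
      push_cast
      rw [Real.log_pow]
    rw [← h3, h1]
    refine norm_sum_le_of_le _ fun i hi => ?_
    have hi' := Finset.mem_range.mp hi
    rw [norm_mul, Nat.pow_div (by omega) hp.pos, show k - (i + 1) = k - 1 - i by omega]
    refine mul_le_mul_of_nonneg_right ?_ (norm_nonneg _)
    have := h.bound (p ^ (i + 1)) (Nat.one_le_pow _ _ hp.pos)
    rwa [ArithmeticFunction.vonMangoldt_apply_pow (by omega),
      ArithmeticFunction.vonMangoldt_apply_prime hp] at this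
  rw [← Finset.mul_sum, Finset.sum_range_reflect (fun i => ‖f (p ^ i)‖) k] at h2
  have h4 : Real.log p * (k * ‖f (p ^ k)‖) ≤
      Real.log p * (κ * ∑ i ∈ Finset.range k, ‖f (p ^ i)‖) := by linarith
  exact le_of_mul_le_mul_left h4 hlp

lemma IsHalaszClass.norm_prime_le (h : IsHalaszClass κ f Λf) (hκ : 0 < κ) {p : ℕ} (hp : p.Prime) :
    ‖f p‖ ≤ κ := by
  have := h.pow_rec hp 1
  simpa [h.map_one] using this

lemma IsHalaszClass.norm_pow_le (h : IsHalaszClass κ f Λf) (hκ : 0 < κ) {p : ℕ} (hp : p.Prime)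
    (k : ℕ) : ‖f (p ^ k)‖ ≤ max 1 κ ^ k := by
  induction k using Nat.strong_induction_on with
  | _ k ih =>
    rcases Nat.eq_zero_or_pos k with rfl | hk
    · simp [h.map_one]
    have hk0 : (0 : ℝ) < k := by exact_mod_cast hk
    have h1 : ∑ i ∈ Finset.range k, ‖f (p ^ i)‖ ≤ k * max 1 κ ^ (k - 1) := by
      calc _ ≤ ∑ i ∈ Finset.range k, max 1 κ ^ (k - 1) := by
            refine Finset.sum_le_sum fun i hi => (ih i (Finset.mem_range.mp hi)).trans ?_
            exact pow_le_pow_right₀ (le_max_left _ _) (by have := Finset.mem_range.mp hi; omega)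
        _ = _ := by simp
    have h2 : k * ‖f (p ^ k)‖ ≤ k * max 1 κ ^ k := by
      calc k * ‖f (p ^ k)‖ ≤ κ * ∑ i ∈ Finset.range k, ‖f (p ^ i)‖ := h.pow_rec hp k
        _ ≤ max 1 κ * (k * max 1 κ ^ (k - 1)) := by
            gcongr
            exact le_max_right _ _
        _ = k * (max 1 κ ^ (k - 1) * max 1 κ) := by ring
        _ = _ := by rw [← pow_succ, Nat.sub_add_cancel hk]
    exact le_of_mul_le_mul_left h2 hk0

lemma IsHalaszClass.exists_pow_le_geom (hκ : 0 < κ) {r : ℝ} (hr : 1 < r) : ∃ C : ℝ, 1 ≤ C ∧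
    ∀ f Λf : ℕ → ℂ, IsHalaszClass κ f Λf → ∀ p k : ℕ, p.Prime → ‖f (p ^ k)‖ ≤ C * r ^ k := by
  set K := ⌈κ / (r - 1)⌉₊ with hK
  have hm : 1 ≤ max 1 κ := le_max_left _ _
  refine ⟨max 1 κ ^ K, one_le_pow₀ hm, fun f Λf h p k hp => ?_⟩
  induction k using Nat.strong_induction_on with
  | _ k ih =>
    rcases le_or_gt k K with hk | hk
    · calc ‖f (p ^ k)‖ ≤ max 1 κ ^ k := h.norm_pow_le hκ hp k
        _ ≤ max 1 κ ^ K := pow_le_pow_right₀ hm hk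
        _ ≤ _ := le_mul_of_one_le_right (by positivity) (one_le_pow₀ hr.le)
    · have hk0 : (0 : ℝ) < k := by exact_mod_cast (by omega : 0 < k)
      have hr1 : 0 < r - 1 := by linarith
      have hkk : κ ≤ k * (r - 1) := by
        rw [← div_le_iff₀ hr1]
        exact (Nat.le_ceil _).trans (by exact_mod_cast hk.le)
      have h2 : k * ‖f (p ^ k)‖ ≤ k * (max 1 κ ^ K * r ^ k) := by
        calc k * ‖f (p ^ k)‖ ≤ κ * ∑ i ∈ Finset.range k, ‖f (p ^ i)‖ := h.pow_rec hp k
          _ ≤ κ * ∑ i ∈ Finset.range k, max 1 κ ^ K * r ^ i := by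
              gcongr with i hi
              exact ih i (Finset.mem_range.mp hi)
          _ = κ * (max 1 κ ^ K * ((r ^ k - 1) / (r - 1))) := by
              rw [← Finset.mul_sum, geom_sum_eq hr.ne']
          _ ≤ (k * (r - 1)) * (max 1 κ ^ K * (r ^ k / (r - 1))) := by
              refine mul_le_mul hkk ?_ (mul_nonneg (by positivity) (div_nonneg
                (by linarith [one_le_pow₀ hr.le (n := k)]) hr1.le)) (by positivity)
              gcongr
              linarith
          _ = _ := by field_simp
      exact le_of_mul_le_mul_left h2 hk0

lemma IsHalaszClass.exists_norm_le_rpow (hκ : 0 < κ) {ε : ℝ} (hε : 0 < ε) : ∃ C : ℝ, 1 ≤ C ∧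
    ∀ f Λf : ℕ → ℂ, IsHalaszClass κ f Λf → ∀ n : ℕ, 1 ≤ n → ‖f n‖ ≤ C * (n : ℝ) ^ ε := by
  obtain ⟨c, hc1, hc⟩ := IsHalaszClass.exists_pow_le_geom hκ
    (Real.one_lt_rpow (by norm_num : (1 : ℝ) < 2) hε)
  set Y := ⌈max 1 κ ^ (1 / ε)⌉₊ with hY
  set w : ℕ → ℝ := fun p => if p < Y then c else 1 with hw
  have hw1 : ∀ p, 1 ≤ w p := fun p => by rw [hw]; dsimp only; split_ifs <;> linarith
  refine ⟨c ^ Y, one_le_pow₀ hc1, fun f Λf h n hn => ?_⟩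
  have hmain : ∀ n : ℕ, n ≠ 0 → ‖f n‖ ≤ (∏ p ∈ n.primeFactors, w p) * (n : ℝ) ^ ε := by
    intro n
    induction n using Nat.recOnPosPrimePosCoprime with
    | prime_pow p k hp hk =>
      intro _
      rw [Nat.primeFactors_prime_pow hk.ne' hp, Finset.prod_singleton, Nat.cast_pow,
        ← Real.rpow_natCast, ← Real.rpow_mul (by positivity), mul_comm (k : ℝ),
        Real.rpow_mul (by positivity), Real.rpow_natCast, hw]
      dsimp only
      split_ifs with hpY
      · refine (hc f Λf h p k hp).trans ?_
        have : (2 : ℝ) ≤ p := by exact_mod_cast hp.two_le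
        gcongr
      · rw [one_mul]
        refine (h.norm_pow_le hκ hp k).trans (pow_le_pow_left₀ (by positivity) ?_ k)
        have h1 : max 1 κ ^ (1 / ε) ≤ p := (Nat.le_ceil _).trans (by exact_mod_cast not_lt.mp hpY)
        calc max 1 κ = (max 1 κ ^ (1 / ε)) ^ ε := by
              rw [← Real.rpow_mul (by positivity), one_div_mul_cancel hε.ne', Real.rpow_one]
          _ ≤ _ := by gcongr
    | zero => intro h0; exact absurd rfl h0
    | one => intro _; simp [h.map_one]
    | coprime a b ha hb hab iha ihb =>
      intro _
      rw [h.mult a b hab, norm_mul, hab.primeFactors_mul, Finset.prod_union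
        hab.disjoint_primeFactors, Nat.cast_mul, Real.mul_rpow (by positivity) (by positivity)]
      calc ‖f a‖ * ‖f b‖ ≤ ((∏ p ∈ a.primeFactors, w p) * (a : ℝ) ^ ε) *
            ((∏ p ∈ b.primeFactors, w p) * (b : ℝ) ^ ε) :=
            mul_le_mul (iha (by omega)) (ihb (by omega)) (norm_nonneg _)
              (mul_nonneg (Finset.prod_nonneg fun p _ => by linarith [hw1 p]) (by positivity))
        _ = _ := by ring
  refine (hmain n (by omega)).trans ?_
  gcongr
  rw [hw, Finset.prod_ite]
  simp only [Finset.prod_const, one_pow, mul_one]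
  refine pow_le_pow_right₀ hc1 ?_
  have := Finset.card_le_card (s := n.primeFactors.filter (· < Y)) (t := Finset.range Y)
    fun p hp => Finset.mem_range.mpr (Finset.mem_filter.mp hp).2
  simpa using this

end

end

section

open scoped ArithmeticFunction.vonMangoldt

lemma smPart_pos (y n : ℕ) : 0 < smPart y n := by
  rcases eq_or_ne n 0 with rfl | hn
  · simp [smPart]
  · refine Nat.pos_of_ne_zero fun h => hn ?_
    rw [← (smPart_spec (y := y) hn).1, h, zero_mul]

lemma roPart_pos {y n : ℕ} (hn : n ≠ 0) : 0 < roPart y n := by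
  refine Nat.pos_of_ne_zero fun h => hn ?_
  rw [← (smPart_spec (y := y) hn).1, h, mul_zero]

lemma smPart_roPart_mul {y m n : ℕ} (hm : m ≠ 0) (hn : n ≠ 0) :
    smPart y (m * n) = smPart y m * smPart y n ∧ roPart y (m * n) = roPart y m * roPart y n := by
  obtain ⟨h1, h2, h3⟩ := smPart_spec (y := y) hm
  obtain ⟨k1, k2, k3⟩ := smPart_spec (y := y) hn
  have := smPart_roPart_unique (h2.mul k2) (h3.mul k3)
    (mul_pos (roPart_pos hm) (roPart_pos hn)).ne'
  rwa [show smPart y m * smPart y n * (roPart y m * roPart y n) =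
    (smPart y m * roPart y m) * (smPart y n * roPart y n) by ring, h1, k1] at this

lemma smoothBelow_prime_pow {y p : ℕ} (hp : p.Prime) (h : p < y) (k : ℕ) :
    SmoothBelow y (p ^ k) := fun q hq hqp => by
  rwa [(Nat.prime_dvd_prime_iff_eq hq hp).mp (hq.dvd_of_dvd_pow hqp)]

lemma roughFrom_prime_pow {y p : ℕ} (hp : p.Prime) (h : y ≤ p) (k : ℕ) :
    RoughFrom y (p ^ k) := fun q hq hqp => by
  rwa [(Nat.prime_dvd_prime_iff_eq hq hp).mp (hq.dvd_of_dvd_pow hqp)]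

lemma smPart_roPart_of_smooth {y a : ℕ} (ha : SmoothBelow y a) :
    smPart y a = a ∧ roPart y a = 1 := by
  simpa using smPart_roPart_unique ha (roughFrom_one y) one_ne_zero

lemma smPart_roPart_of_rough {y b : ℕ} (hb : RoughFrom y b) (hb0 : b ≠ 0) :
    smPart y b = 1 ∧ roPart y b = b := by
  simpa using smPart_roPart_unique (smoothBelow_one y) hb hb0

/-- The absolute value of `f`, twisted by powers of the smooth and the rough part. -/
def twistAbs (y : ℕ) (u v : ℝ) (f : ℕ → ℂ) (n : ℕ) : ℝ :=
  ‖f n‖ * (smPart y n : ℝ) ^ u * (roPart y n : ℝ) ^ (-v)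

lemma twistAbs_nonneg (y : ℕ) (u v : ℝ) (f : ℕ → ℂ) (n : ℕ) : 0 ≤ twistAbs y u v f n := by
  unfold twistAbs; positivity

lemma rpow_le_exp_of_le {a y u : ℝ} (ha : 0 < a) (hy : 1 < y) (hay : a ≤ y) (hu : 0 ≤ u)
    (huy : u ≤ 1 / Real.log y) : a ^ u ≤ Real.exp 1 := by
  rw [Real.rpow_def_of_pos ha, Real.exp_le_exp]
  have hl := Real.log_pos hy
  calc Real.log a * u ≤ Real.log y * u := by gcongr
    _ ≤ Real.log y * (1 / Real.log y) := by gcongr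
    _ = 1 := by field_simp

section

variable {κ : ℝ}

lemma IsHalaszClass.exists_shiuClass (hκ : 0 < κ) : ∃ B : ℝ, 1 ≤ B ∧
    ∀ f Λf : ℕ → ℂ, IsHalaszClass κ f Λf → ∀ (y : ℕ) (u v : ℝ), 2 ≤ y → 0 ≤ u →
      u ≤ 1 / 200 → u ≤ 1 / Real.log y → 0 ≤ v → ShiuClass B (twistAbs y u v f) := by
  obtain ⟨c, hc1, hc⟩ := IsHalaszClass.exists_norm_le_rpow hκ (ε := 1 / 200) (by norm_num)
  have hm : 1 ≤ max 1 κ := le_max_left _ _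
  refine ⟨max c (Real.exp 1 * max 1 κ), hc1.trans (le_max_left _ _),
    fun f Λf h y u v hy hu hu2 huy hv => ⟨twistAbs_nonneg y u v f, ?_, ?_, ?_, ?_⟩⟩
  · have := smPart_roPart_of_smooth (smoothBelow_one y)
    simp [twistAbs, this.1, this.2, h.map_one]
  · intro m n hmn
    rcases eq_or_ne m 0 with rfl | hm
    · obtain rfl : n = 1 := by simpa using hmn
      have := smPart_roPart_of_smooth (smoothBelow_one y)
      simp [twistAbs, this.1, this.2, h.map_one]
    rcases eq_or_ne n 0 with rfl | hn
    · obtain rfl : m = 1 := by simpa using hmn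
      have := smPart_roPart_of_smooth (smoothBelow_one y)
      simp [twistAbs, this.1, this.2, h.map_one]
    have := smPart_roPart_mul (y := y) hm hn
    unfold twistAbs
    rw [h.mult m n hmn, norm_mul, this.1, this.2, Nat.cast_mul, Nat.cast_mul,
      Real.mul_rpow (by positivity) (by positivity), Real.mul_rpow (by positivity) (by positivity)]
    ring
  · intro p k hp
    have hp0 : 0 < p := hp.pos
    have h1 := h.norm_pow_le hκ hp k
    have hB : (Real.exp 1 * max 1 κ) ^ k ≤ (max c (Real.exp 1 * max 1 κ)) ^ k := by
      gcongr; exact le_max_right _ _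
    refine le_trans ?_ hB
    rw [mul_pow]
    rcases lt_or_ge p y with hpy | hpy
    · have := smPart_roPart_of_smooth (smoothBelow_prime_pow hp hpy k)
      unfold twistAbs
      rw [this.1, this.2, Nat.cast_one, Real.one_rpow, mul_one, mul_comm, Nat.cast_pow,
        ← Real.rpow_natCast, ← Real.rpow_mul (by positivity), mul_comm (k : ℝ),
        Real.rpow_mul (by positivity), Real.rpow_natCast]
      gcongr
      exact rpow_le_exp_of_le (by exact_mod_cast hp.pos)
        (by exact_mod_cast (by omega : 1 < y)) (by exact_mod_cast hpy.le) hu huy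
    · have := smPart_roPart_of_rough (roughFrom_prime_pow hp hpy k) (by positivity)
      unfold twistAbs
      rw [this.1, this.2, Nat.cast_one, Real.one_rpow, mul_one]
      have h2 : ((p ^ k : ℕ) : ℝ) ^ (-v) ≤ 1 :=
        Real.rpow_le_one_of_one_le_of_nonpos (by exact_mod_cast Nat.one_le_pow _ _ hp.pos)
          (by linarith)
      have h3 : (1 : ℝ) ≤ Real.exp 1 ^ k := one_le_pow₀ (by linarith [Real.exp_one_gt_d9])
      calc ‖f (p ^ k)‖ * ((p ^ k : ℕ) : ℝ) ^ (-v) ≤ max 1 κ ^ k * 1 := by gcongr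
        _ = 1 * max 1 κ ^ k := by ring
        _ ≤ _ := by gcongr
  · intro n hn
    have hn0 : n ≠ 0 := by omega
    have hs := smPart_spec (y := y) hn0
    have h1 : (smPart y n : ℝ) ^ u ≤ (n : ℝ) ^ (1 / 200 : ℝ) := by
      have h3 : (1 : ℝ) ≤ n := by exact_mod_cast hn
      have h4 : (smPart y n : ℝ) ≤ n := by
        exact_mod_cast Nat.le_of_dvd (by omega) (Dvd.intro _ hs.1)
      calc (smPart y n : ℝ) ^ u ≤ (n : ℝ) ^ u := by gcongr
        _ ≤ _ := by gcongr
    have h2 : (roPart y n : ℝ) ^ (-v) ≤ 1 :=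
      Real.rpow_le_one_of_one_le_of_nonpos (by exact_mod_cast roPart_pos hn0) (by linarith)
    calc twistAbs y u v f n ≤ (c * (n : ℝ) ^ (1 / 200 : ℝ)) * (n : ℝ) ^ (1 / 200 : ℝ) * 1 := by
          unfold twistAbs
          gcongr
          exact hc f Λf h n hn
      _ = c * (n : ℝ) ^ (1 / 100 : ℝ) := by
          rw [mul_one, mul_assoc, ← Real.rpow_add (by exact_mod_cast hn)]; norm_num
      _ ≤ _ := by gcongr; exact le_max_left _ _

variable {f Λf : ℕ → ℂ}

lemma IsHalaszClass.sum_primes_norm_le (h : IsHalaszClass κ f Λf) (hκ : 0 < κ) {X : ℝ}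
    (hX : Real.exp 1 ≤ X) {S : Finset ℕ} (hS : ∀ p ∈ S, p.Prime ∧ (p : ℝ) ≤ X) :
    ∑ p ∈ S, ‖f p‖ / p ≤ κ * (Real.log (Real.log X) + 8) := by
  calc ∑ p ∈ S, ‖f p‖ / p ≤ ∑ p ∈ S, κ * (1 / (p : ℝ)) := by
        refine Finset.sum_le_sum fun p hp => ?_
        rw [mul_one_div]
        gcongr
        exact h.norm_prime_le hκ (hS p hp).1
    _ = κ * ∑ p ∈ S, 1 / (p : ℝ) := by rw [Finset.mul_sum]
    _ ≤ _ := by gcongr; exact sum_one_div_prime_le hX hS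

lemma sum_log_prime_div_le {y : ℕ} {S : Finset ℕ} (hS : ∀ p ∈ S, p.Prime ∧ p ≤ y) :
    ∑ p ∈ S, Real.log p / p ≤ Real.log y + 6 := by
  refine le_trans ?_ (sum_vM_div_le y)
  calc ∑ p ∈ S, Real.log p / p = ∑ p ∈ S, Λ p / p := by
        refine Finset.sum_congr rfl fun p hp => ?_
        rw [ArithmeticFunction.vonMangoldt_apply_prime (hS p hp).1]
    _ ≤ _ := Finset.sum_le_sum_of_subset_of_nonneg (fun p hp => Finset.mem_Icc.mpr
        ⟨(hS p hp).1.one_le, (hS p hp).2⟩) fun n _ _ => div_nonneg (vM_nonneg n) (by positivity)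

lemma IsHalaszClass.sum_primes_twistAbs_le (h : IsHalaszClass κ f Λf) (hκ : 0 < κ) {y : ℕ}
    (hy : Real.exp 200 ≤ y) {u v : ℝ} (hu : 0 ≤ u) (huy : u ≤ 1 / Real.log y)
    (hv : 1 / Real.log y ≤ v) {S : Finset ℕ} (hS : ∀ p ∈ S, p.Prime) :
    ∑ p ∈ S, twistAbs y u v f p / p ≤ κ * (Real.log (Real.log y) + 48) := by
  have hy1 : Real.exp 1 ≤ y := (Real.exp_le_exp.mpr (by norm_num)).trans hy
  have hy0 : (0 : ℝ) < y := (Real.exp_pos _).trans_le hy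
  have hl : 200 ≤ Real.log y := by rwa [Real.le_log_iff_exp_le hy0]
  have hv0 : 0 ≤ v := le_trans (by positivity) hv
  have key : ∀ p ∈ S, twistAbs y u v f p / p ≤
      if p ≤ y then κ * (1 / p) + κ * (3 * u) * (Real.log p / p)
      else κ * (1 / (p : ℝ) ^ (1 + 1 / Real.log y)) := by
    intro p hp
    have hpp := hS p hp
    have hp0 : (0 : ℝ) < p := by exact_mod_cast hpp.pos
    have hlp : 0 ≤ Real.log p := Real.log_natCast_nonneg p
    have hfp := h.norm_prime_le hκ hpp
    rcases lt_trichotomy p y with hpy | hpy | hpy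
    · rw [if_pos hpy.le]
      have h1 := smPart_roPart_of_smooth (smoothBelow_prime_pow hpp hpy 1)
      rw [pow_one] at h1
      unfold twistAbs
      rw [h1.1, h1.2, Nat.cast_one, Real.one_rpow, mul_one]
      have h2 : (p : ℝ) ^ u ≤ 1 + 3 * u * Real.log p := by
        have h3 := rpow_le_exp_of_le hp0 (by linarith [Real.exp_one_gt_d9])
          (show (p : ℝ) ≤ y by exact_mod_cast hpy.le) hu huy
        have h4 : 1 - Real.log p * u ≤ ((p : ℝ) ^ u)⁻¹ := by
          rw [Real.rpow_def_of_pos hp0, ← Real.exp_neg]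
          linarith [Real.add_one_le_exp (-(Real.log p * u))]
        have h5 : 0 < (p : ℝ) ^ u := by positivity
        have h6 : (1 - Real.log p * u) * (p : ℝ) ^ u ≤ 1 := by
          calc _ ≤ ((p : ℝ) ^ u)⁻¹ * (p : ℝ) ^ u := by gcongr
            _ = 1 := inv_mul_cancel₀ h5.ne'
        have h7 : Real.log p * u * (p : ℝ) ^ u ≤ Real.log p * u * 3 := by
          gcongr; linarith [Real.exp_one_lt_d9]
        linarith
      calc ‖f p‖ * (p : ℝ) ^ u / p ≤ κ * (1 + 3 * u * Real.log p) / p := by gcongr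
        _ = _ := by ring
    · rw [if_pos hpy.le]
      have h1 := smPart_roPart_of_rough (roughFrom_prime_pow hpp hpy.ge 1) (by simpa using hpp.ne_zero)
      rw [pow_one] at h1
      unfold twistAbs
      rw [h1.1, h1.2, Nat.cast_one, Real.one_rpow, mul_one]
      have h2 : (p : ℝ) ^ (-v) ≤ 1 :=
        Real.rpow_le_one_of_one_le_of_nonpos (by exact_mod_cast hpp.one_le) (by linarith)
      calc ‖f p‖ * (p : ℝ) ^ (-v) / p ≤ κ * 1 / p := by gcongr
        _ = κ * (1 / p) + 0 := by ring
        _ ≤ _ := by gcongr; positivity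
    · rw [if_neg (by omega)]
      have h1 := smPart_roPart_of_rough (roughFrom_prime_pow hpp hpy.le 1) (by simpa using hpp.ne_zero)
      rw [pow_one] at h1
      unfold twistAbs
      rw [h1.1, h1.2, Nat.cast_one, Real.one_rpow, mul_one]
      have h2 : (p : ℝ) ^ (-v) ≤ (p : ℝ) ^ (-(1 / Real.log y)) := by
        have : (1 : ℝ) ≤ p := by exact_mod_cast hpp.one_le
        gcongr
      calc ‖f p‖ * (p : ℝ) ^ (-v) / p ≤ κ * (p : ℝ) ^ (-(1 / Real.log y)) / p := by gcongr
        _ = _ := by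
          rw [Real.rpow_neg hp0.le, Real.rpow_add hp0, Real.rpow_one]
          field_simp
  refine (Finset.sum_le_sum key).trans ?_
  rw [Finset.sum_ite, Finset.sum_add_distrib, ← Finset.mul_sum, ← Finset.mul_sum, ← Finset.mul_sum]
  have h1 := sum_one_div_prime_le hy1 (S := S.filter (· ≤ y)) (fun p hp =>
    ⟨hS p (Finset.mem_filter.mp hp).1, by exact_mod_cast (Finset.mem_filter.mp hp).2⟩)
  have h2 := sum_log_prime_div_le (y := y) (S := S.filter (· ≤ y)) (fun p hp =>
    ⟨hS p (Finset.mem_filter.mp hp).1, (Finset.mem_filter.mp hp).2⟩)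
  have h3 := sum_prime_rpow_tail_le hy1 (S := S.filter (¬ · ≤ y)) (fun p hp =>
    ⟨hS p (Finset.mem_filter.mp hp).1, by
      exact_mod_cast not_le.mp (Finset.mem_filter.mp hp).2⟩)
  have h4 : u * ∑ p ∈ S.filter (· ≤ y), Real.log p / p ≤ 1 / Real.log y * (Real.log y + 6) :=
    mul_le_mul huy h2 (Finset.sum_nonneg fun p _ => div_nonneg (Real.log_natCast_nonneg p)
      (by positivity)) (by positivity)
  have h5 : 1 / Real.log y * (Real.log y + 6) ≤ 1 + 6 / 200 := by
    rw [mul_add, one_div_mul_cancel (by linarith), one_div_mul_eq_div]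
    gcongr
  calc _ = κ * (∑ p ∈ S.filter (· ≤ y), 1 / (p : ℝ) +
        3 * (u * ∑ p ∈ S.filter (· ≤ y), Real.log p / p) +
        ∑ p ∈ S.filter (¬ · ≤ y), 1 / (p : ℝ) ^ (1 + 1 / Real.log y)) := by ring
    _ ≤ _ := mul_le_mul_of_nonneg_left (by linarith) hκ.le

end

end

section

open scoped ArithmeticFunction.vonMangoldt

lemma sum_smooth_vM_rpow_le {y : ℕ} {σ : ℝ} (hσ : 9 / 10 ≤ σ) {S : Finset ℕ}
    (hS : ∀ n ∈ S, SmoothBelow y n) :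
    ∑ n ∈ S, Λ n * (n : ℝ) ^ (-σ) ≤
      3 * ∑ p ∈ y.primesBelow, Real.log p * (p : ℝ) ^ (-σ) := by
  set N := S.sup id with hN
  have hgeom : ∀ p ∈ y.primesBelow, ∑ k ∈ Finset.Icc 1 N, ((p : ℝ) ^ (-σ)) ^ k ≤
      3 * (p : ℝ) ^ (-σ) := by
    intro p hp
    have hpp := Nat.prime_of_mem_primesBelow hp
    have hp2 : (2 : ℝ) ≤ p := by exact_mod_cast hpp.two_le
    set q := (p : ℝ) ^ (-σ) with hq
    have hq0 : 0 < q := by positivity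
    have hq1 : q ≤ 2 / 3 := by
      calc q ≤ (2 : ℝ) ^ (-σ) := Real.rpow_le_rpow_of_nonpos (by norm_num) hp2 (by linarith)
        _ ≤ (2 : ℝ) ^ (-(9 / 10) : ℝ) := by gcongr; norm_num
        _ ≤ 2 / 3 := by
          rw [Real.rpow_neg (by norm_num), inv_le_comm₀ (by positivity) (by norm_num)]
          refine le_of_pow_le_pow_left₀ (n := 10) (by norm_num) (by positivity) ?_
          rw [← Real.rpow_natCast, ← Real.rpow_natCast, ← Real.rpow_mul (by norm_num)]
          norm_num
    have h1 : ∀ M : ℕ, ∑ k ∈ Finset.Icc 1 M, q ^ k = q * ∑ k ∈ Finset.range M, q ^ k := by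
      intro M
      induction M with
      | zero => simp
      | succ M ih =>
        rw [Finset.sum_Icc_succ_top (by omega), ih, Finset.sum_range_succ]
        ring
    rw [h1, mul_comm]
    gcongr
    have h2 : (∑ k ∈ Finset.range N, q ^ k) * (1 - q) = 1 - q ^ N := geom_sum_mul_neg q N
    have h3 : 0 ≤ q ^ N := by positivity
    have h4 : 0 ≤ ∑ k ∈ Finset.range N, q ^ k := Finset.sum_nonneg fun k _ => by positivity
    nlinarith
  calc ∑ n ∈ S, Λ n * (n : ℝ) ^ (-σ) =
        ∑ n ∈ S.filter IsPrimePow, Λ n * (n : ℝ) ^ (-σ) := by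
        rw [Finset.sum_filter]
        refine Finset.sum_congr rfl fun n _ => ?_
        split_ifs with hn
        · rfl
        · rw [ArithmeticFunction.vonMangoldt_apply, if_neg hn, zero_mul]
    _ ≤ ∑ a ∈ y.primesBelow ×ˢ Finset.Icc 1 N, Real.log a.1 * ((a.1 : ℝ) ^ (-σ)) ^ a.2 := by
        refine sum_le_sum_of_witness _ _ _ (fun a ha => ?_) (fun a => a.1 ^ a.2) _ ?_
        · exact mul_nonneg (Real.log_natCast_nonneg _) (by positivity)
        · intro n hn
          obtain ⟨hnS, hpp⟩ := Finset.mem_filter.mp hn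
          obtain ⟨p, k, hp, hk, rfl⟩ := (isPrimePow_nat_iff _).mp hpp
          refine ⟨(p, k), ?_, rfl, ?_⟩
          · have h1 : p ^ k ≤ N := Finset.le_sup (f := id) hnS
            have h2 : k < p ^ k := Nat.lt_pow_self hp.one_lt
            simp only [Finset.mem_product, Finset.mem_Icc, Nat.mem_primesBelow]
            exact ⟨⟨hS _ hnS p hp (dvd_pow_self p hk.ne'), hp⟩, hk, by omega⟩
          · dsimp only
            rw [ArithmeticFunction.vonMangoldt_apply_pow hk.ne',
              ArithmeticFunction.vonMangoldt_apply_prime hp, Nat.cast_pow, ← Real.rpow_natCast,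
              ← Real.rpow_natCast, ← Real.rpow_mul (by positivity), ← Real.rpow_mul (by positivity),
              mul_comm (k : ℝ)]
    _ = ∑ p ∈ y.primesBelow, Real.log p * ∑ k ∈ Finset.Icc 1 N, ((p : ℝ) ^ (-σ)) ^ k := by
        rw [Finset.sum_product]
        simp_rw [Finset.mul_sum]
    _ ≤ ∑ p ∈ y.primesBelow, Real.log p * (3 * (p : ℝ) ^ (-σ)) := by
        refine Finset.sum_le_sum fun p hp => ?_
        have := Real.log_natCast_nonneg p
        gcongr
        exact hgeom p hp
    _ = _ := by rw [Finset.mul_sum]; exact Finset.sum_congr rfl fun p _ => by ring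

section

variable {κ : ℝ} {f Λf : ℕ → ℂ}

lemma IsHalaszClass.smooth_summable (h : IsHalaszClass κ f Λf) (hκ : 0 < κ) {y : ℕ} (hy : 2 ≤ y)
    {s : ℂ} (hs : 19 / 20 ≤ s.re) : _root_.LSeriesSummable (_root_.restr (SmoothBelow y) f) s := by
  obtain ⟨B, hB1, hB⟩ := IsHalaszClass.exists_shiuClass hκ
  have hg := hB f Λf h y 0 0 hy le_rfl (by norm_num)
    (div_nonneg zero_le_one (Real.log_natCast_nonneg y)) le_rfl
  refine Summable.of_norm (summable_of_sum_le (c := Real.exp (9 * B +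
    ∑ p ∈ y.primesBelow, twistAbs y 0 0 f p * (p : ℝ) ^ ((1 / 20 : ℝ) - 1)))
    (fun _ => norm_nonneg _) fun u => ?_)
  calc ∑ n ∈ u, ‖LSeries.term (_root_.restr (SmoothBelow y) f) s n‖ ≤
      ∑ n ∈ u, if SmoothBelow y n then twistAbs y 0 0 f n * (n : ℝ) ^ ((1 / 20 : ℝ) - 1) else 0 := by
        refine Finset.sum_le_sum fun n _ => ?_
        rw [LSeries.norm_term_eq]
        rcases eq_or_ne n 0 with rfl | hn
        · rw [if_pos rfl]
          split_ifs
          · exact mul_nonneg (twistAbs_nonneg _ _ _ _ _) (by positivity)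
          · exact le_rfl
        rw [if_neg hn]
        split_ifs with hsm
        · rw [restr_of hn hsm]
          simp only [twistAbs, Real.rpow_zero, mul_one, neg_zero]
          rw [div_eq_mul_inv, ← Real.rpow_neg (by positivity)]
          have : (1 : ℝ) ≤ n := by exact_mod_cast Nat.one_le_iff_ne_zero.mpr hn
          gcongr
          linarith
        · rw [restr_of_not hsm, norm_zero, zero_div]
    _ = ∑ n ∈ u.filter (SmoothBelow y), twistAbs y 0 0 f n * (n : ℝ) ^ ((1 / 20 : ℝ) - 1) := by
        rw [Finset.sum_filter]
    _ ≤ _ := hg.sum_smooth_le (by linarith) le_rfl fun a ha => (Finset.mem_filter.mp ha).2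

lemma IsHalaszClass.smooth_Λ_summable (h : IsHalaszClass κ f Λf) (hκ : 0 < κ) (y : ℕ)
    {s : ℂ} (hs : 9 / 10 ≤ s.re) :
    _root_.LSeriesSummable (_root_.restr (SmoothBelow y) Λf) s := by
  refine Summable.of_norm (summable_of_sum_le (c := κ * (3 * ∑ p ∈ y.primesBelow,
    Real.log p * (p : ℝ) ^ (-s.re))) (fun _ => norm_nonneg _) fun u => ?_)
  calc ∑ n ∈ u, ‖LSeries.term (_root_.restr (SmoothBelow y) Λf) s n‖ ≤
      ∑ n ∈ u, if SmoothBelow y n then κ * (Λ n * (n : ℝ) ^ (-s.re)) else 0 := by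
        refine Finset.sum_le_sum fun n _ => ?_
        rw [LSeries.norm_term_eq]
        rcases eq_or_ne n 0 with rfl | hn
        · rw [if_pos rfl]
          split_ifs
          · exact mul_nonneg hκ.le (mul_nonneg (vM_nonneg _) (by positivity))
          · exact le_rfl
        rw [if_neg hn]
        split_ifs with hsm
        · rw [restr_of hn hsm, div_eq_mul_inv, ← Real.rpow_neg (by positivity), ← mul_assoc]
          gcongr
          exact h.bound n (by omega)
        · rw [restr_of_not hsm, norm_zero, zero_div]
    _ = κ * ∑ n ∈ u.filter (SmoothBelow y), Λ n * (n : ℝ) ^ (-s.re) := by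
        rw [← Finset.sum_filter, Finset.mul_sum]
    _ ≤ _ := by
        gcongr
        exact sum_smooth_vM_rpow_le hs fun a ha => (Finset.mem_filter.mp ha).2

lemma IsHalaszClass.smooth_eq_exp (h : IsHalaszClass κ f Λf) (hκ : 0 < κ) {y : ℕ} (hy : 2 ≤ y)
    {s : ℂ} (hs : 19 / 20 < s.re) : LSeries (_root_.restr (SmoothBelow y) f) s =
      Complex.exp (LSeries (fun n => _root_.restr (SmoothBelow y) Λf n / (Real.log n : ℂ)) s) :=
  have h' := h.smooth y
  _root_.LSeries_eq_exp (σ0 := 19 / 20) h'.map_one h'.Λ_one h'.conv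
    (abscissa_le_of_bound fun _ hs => h.smooth_summable hκ hy (le_of_lt hs))
    (abscissa_le_of_bound fun _ hs => h.smooth_Λ_summable hκ y (by linarith)) hs

lemma norm_cpow_sub_cpow_shift_le {n : ℕ} (hn : n ≠ 0) (s : ℂ) {d : ℝ} (hd : 0 ≤ d) :
    ‖1 / (n : ℂ) ^ s - 1 / (n : ℂ) ^ (s + d)‖ ≤ d * Real.log n * (n : ℝ) ^ (-s.re) := by
  have hn0 : (n : ℂ) ≠ 0 := by exact_mod_cast hn
  have hnr : (0 : ℝ) < n := by exact_mod_cast Nat.pos_of_ne_zero hn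
  have h1 : 1 / (n : ℂ) ^ s - 1 / (n : ℂ) ^ (s + d) =
      (n : ℂ) ^ (-s) * ((1 - (n : ℝ) ^ (-d) : ℝ) : ℂ) := by
    rw [one_div, one_div, ← cpow_neg, ← cpow_neg, neg_add, cpow_add _ _ hn0]
    push_cast
    rw [Complex.ofReal_cpow hnr.le]
    push_cast
    ring
  rw [h1, norm_mul, Complex.norm_natCast_cpow_of_pos (Nat.pos_of_ne_zero hn), Complex.norm_real,
    mul_comm, neg_re]
  gcongr
  have h2 : (n : ℝ) ^ (-d) ≤ 1 := Real.rpow_le_one_of_one_le_of_nonpos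
    (by exact_mod_cast Nat.pos_of_ne_zero hn) (by linarith)
  rw [Real.norm_of_nonneg (by linarith), Real.rpow_def_of_pos hnr]
  linarith [Real.add_one_le_exp (Real.log n * -d)]

lemma IsHalaszClass.smooth_ratio (h : IsHalaszClass κ f Λf) (hκ : 0 < κ) {y : ℕ}
    (hy : Real.exp 200 ≤ y) {s : ℂ} {d : ℝ} (hs : 1 - 2 / Real.log y ≤ s.re) (hd : 0 ≤ d)
    (hdy : d ≤ 3 / Real.log y) :
    ‖LSeries (_root_.restr (SmoothBelow y) f) s‖ ≤
      Real.exp (80 * κ) * ‖LSeries (_root_.restr (SmoothBelow y) f) (s + d)‖ := by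
  have hy0 : (0 : ℝ) < y := (Real.exp_pos _).trans_le hy
  have hl : 200 ≤ Real.log y := by rwa [Real.le_log_iff_exp_le hy0]
  have hy1 : (1 : ℝ) < y := by
    by_contra h'
    linarith [Real.log_nonpos hy0.le (not_lt.mp h')]
  have hy2 : 2 ≤ y := by exact_mod_cast hy1
  have hl2 : 2 / Real.log y ≤ 1 / 100 := by
    rw [div_le_iff₀ (by linarith)]; linarith
  have hs1 : 19 / 20 < s.re := by linarith
  have hs2 : 19 / 20 < (s + d).re := by simp; linarith
  rw [h.smooth_eq_exp hκ hy2 hs1, h.smooth_eq_exp hκ hy2 hs2, Complex.norm_exp, Complex.norm_exp,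
    ← Real.exp_add, Real.exp_le_exp, ← sub_le_iff_le_add, ← Complex.sub_re]
  refine (Complex.re_le_norm _).trans ?_
  set E : ℕ → ℂ := fun n => _root_.restr (SmoothBelow y) Λf n / (Real.log n : ℂ) with hE
  have hEs : ∀ w : ℂ, 9 / 10 ≤ w.re → _root_.LSeriesSummable E w := by
    intro w hw
    refine Summable.of_norm_bounded ((h.smooth_Λ_summable hκ y hw).norm.mul_left 2) fun n => ?_
    rcases eq_or_ne n 0 with rfl | hn
    · simp
    rw [LSeries.norm_term_eq, LSeries.norm_term_eq, if_neg hn, if_neg hn, ← mul_div_assoc]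
    gcongr
    rw [hE]
    dsimp only
    rcases eq_or_ne n 1 with rfl | hn1
    · simp
    rw [norm_div, Complex.norm_real, Real.norm_of_nonneg (Real.log_natCast_nonneg n)]
    have h2 : (1 / 2 : ℝ) ≤ Real.log n := by
      have : Real.log 2 ≤ Real.log n := Real.log_le_log (by norm_num)
        (by exact_mod_cast (by omega : 2 ≤ n))
      linarith [Real.log_two_gt_d9]
    rw [div_le_iff₀ (by linarith)]
    nlinarith [norm_nonneg (_root_.restr (SmoothBelow y) Λf n)]
  have hsub : LSeries E s - LSeries E (s + d) =
      ∑' n, (LSeries.term E s n - LSeries.term E (s + d) n) :=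
    ((hEs s (by linarith)).tsum_sub (hEs (s + d) (by linarith))).symm
  rw [hsub]
  have hterm : ∀ n, ‖LSeries.term E s n - LSeries.term E (s + d) n‖ ≤
      if SmoothBelow y n then κ * d * (Λ n * (n : ℝ) ^ (-(1 - 2 / Real.log y))) else 0 := by
    intro n
    rcases eq_or_ne n 0 with rfl | hn
    · simp only [LSeries.term_zero, sub_zero, norm_zero]
      split_ifs
      · exact mul_nonneg (by positivity) (mul_nonneg (vM_nonneg _) (by positivity))
      · exact le_rfl
    rw [LSeries.term_of_ne_zero hn, LSeries.term_of_ne_zero hn]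
    split_ifs with hsm
    · have h1 : E n / (n : ℂ) ^ s - E n / (n : ℂ) ^ (s + d) =
          E n * (1 / (n : ℂ) ^ s - 1 / (n : ℂ) ^ (s + d)) := by ring
      have h2 : ‖E n‖ * Real.log n ≤ κ * Λ n := by
        rw [hE]
        dsimp only
        rw [restr_of hn hsm, norm_div, Complex.norm_real,
          Real.norm_of_nonneg (Real.log_natCast_nonneg n)]
        rcases eq_or_ne n 1 with rfl | hn1
        · simp
        have : 0 < Real.log n := Real.log_pos (by exact_mod_cast (by omega : 1 < n))
        rw [div_mul_cancel₀ _ this.ne']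
        exact h.bound n (by omega)
      have h3 : (1 : ℝ) ≤ n := by exact_mod_cast Nat.one_le_iff_ne_zero.mpr hn
      rw [h1, norm_mul]
      calc _ ≤ ‖E n‖ * (d * Real.log n * (n : ℝ) ^ (-s.re)) := by
            gcongr
            exact norm_cpow_sub_cpow_shift_le hn s hd
        _ = (‖E n‖ * Real.log n) * d * (n : ℝ) ^ (-s.re) := by ring
        _ ≤ (κ * Λ n) * d * (n : ℝ) ^ (-(1 - 2 / Real.log y)) := by
            have := vM_nonneg n
            gcongr
        _ = _ := by ring
    · simp only [hE]
      rw [restr_of_not hsm]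
      simp
  have hfin : ∀ u : Finset ℕ, ∑ n ∈ u, (if SmoothBelow y n then
      κ * d * (Λ n * (n : ℝ) ^ (-(1 - 2 / Real.log y))) else 0) ≤ 80 * κ := by
    intro u
    rw [← Finset.sum_filter, ← Finset.mul_sum]
    have h1 := sum_smooth_vM_rpow_le (y := y) (σ := 1 - 2 / Real.log y) (by linarith)
      (S := u.filter (SmoothBelow y)) fun n hn => (Finset.mem_filter.mp hn).2
    have h2 : ∑ p ∈ y.primesBelow, Real.log p * (p : ℝ) ^ (-(1 - 2 / Real.log y)) ≤
        Real.exp 2 * (Real.log y + 6) := by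
      calc _ ≤ ∑ p ∈ y.primesBelow, Real.exp 2 * (Real.log p / p) := by
            refine Finset.sum_le_sum fun p hp => ?_
            have hpp := Nat.prime_of_mem_primesBelow hp
            have hp0 : (0 : ℝ) < p := by exact_mod_cast hpp.pos
            have h3 := rpow_le_exp_of_le hp0 hy1 (by
              exact_mod_cast (Nat.lt_of_mem_primesBelow hp).le) (by positivity) le_rfl
            have h4 : (p : ℝ) ^ (-(1 - 2 / Real.log y)) ≤ Real.exp 2 * (1 / p) := by
              rw [show -(1 - 2 / Real.log y) = 1 / Real.log y * (2 : ℕ) + (-1) by push_cast; ring,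
                Real.rpow_add hp0, Real.rpow_mul hp0.le, Real.rpow_natCast, Real.rpow_neg_one,
                one_div (p : ℝ), show (2 : ℝ) = (2 : ℕ) * 1 by norm_num, Real.exp_nat_mul]
              gcongr
            have := Real.log_natCast_nonneg p
            calc _ ≤ Real.log p * (Real.exp 2 * (1 / p)) := by gcongr
              _ = _ := by ring
        _ = Real.exp 2 * ∑ p ∈ y.primesBelow, Real.log p / p := by rw [Finset.mul_sum]
        _ ≤ _ := by
            gcongr
            exact sum_log_prime_div_le fun p hp =>
              ⟨Nat.prime_of_mem_primesBelow hp, (Nat.lt_of_mem_primesBelow hp).le⟩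
    have h3 : Real.exp 2 ≤ 7.4 := by
      rw [show (2 : ℝ) = (2 : ℕ) * 1 by norm_num, Real.exp_nat_mul]
      nlinarith [Real.exp_one_lt_d9, Real.exp_pos 1]
    have h5 : d * (Real.log y + 6) ≤ 3 * (1 + 6 / 200) := by
      calc _ ≤ 3 / Real.log y * (Real.log y + 6) := by gcongr
        _ = 3 * (1 + 6 / Real.log y) := by field_simp
        _ ≤ _ := by gcongr
    have h6 : 0 ≤ d * (Real.log y + 6) := by positivity
    calc _ ≤ κ * d * (3 * (Real.exp 2 * (Real.log y + 6))) := by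
          refine mul_le_mul_of_nonneg_left (h1.trans ?_) (by positivity)
          linarith
      _ = κ * (3 * (Real.exp 2 * (d * (Real.log y + 6)))) := by ring
      _ ≤ κ * (3 * (7.4 * (3 * (1 + 6 / 200)))) := by gcongr
      _ ≤ 80 * κ := by linarith
  have hnn : ∀ n, 0 ≤ (if SmoothBelow y n then
      κ * d * (Λ n * (n : ℝ) ^ (-(1 - 2 / Real.log y))) else 0) :=
    fun n => (norm_nonneg _).trans (hterm n)
  have hsum := summable_of_sum_le hnn hfin
  exact (tsum_of_norm_bounded hsum.hasSum hterm).trans (hsum.tsum_le_of_sum_le hfin)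

lemma IsHalaszClass.convolution_smooth_rough (h : IsHalaszClass κ f Λf) (y : ℕ) {n : ℕ}
    (hn : n ≠ 0) : LSeries.convolution (_root_.restr (SmoothBelow y) f)
      (_root_.restr (RoughFrom y) f) n = f n := by
  obtain ⟨h1, h2, h3⟩ := smPart_spec (y := y) hn
  rw [LSeries.convolution_def]
  dsimp only
  rw [Finset.sum_eq_single (smPart y n, roPart y n)]
  · rw [restr_of (smPart_pos y n).ne' h2, restr_of (roPart_pos hn).ne' h3,
      ← h.mult _ _ (h2.coprime h3), h1]
  · rintro ⟨a, b⟩ hab hne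
    obtain ⟨hab', -⟩ := Nat.mem_divisorsAntidiagonal.mp hab
    dsimp only at hab' ⊢
    by_cases ha : SmoothBelow y a
    · by_cases hb : RoughFrom y b
      · exfalso
        have hb0 : b ≠ 0 := by rintro rfl; exact hn (by rw [← hab', mul_zero])
        have := smPart_roPart_unique ha hb hb0
        rw [hab'] at this
        exact hne (by rw [this.1, this.2])
      · rw [restr_of_not hb, mul_zero]
    · rw [restr_of_not ha, zero_mul]
  · intro h'
    exact absurd (Nat.mem_divisorsAntidiagonal.mpr ⟨h1, hn⟩) h'

lemma IsHalaszClass.LSeries_eq_smooth_mul_rough (h : IsHalaszClass κ f Λf) (hκ : 0 < κ) (y : ℕ)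
    {s : ℂ} (hs : 1 < s.re) : LSeries f s =
      LSeries (_root_.restr (SmoothBelow y) f) s * LSeries (_root_.restr (RoughFrom y) f) s := by
  rw [← LSeries_convolution' ((h.smooth y).LSeriesSummable hs)
    ((h.rough y).LSeriesSummable hs)]
  exact LSeries_congr (fun hn => (h.convolution_smooth_rough y hn).symm) s

end

end

section

lemma integrable_cauchy {β : ℝ} (hβ : 0 < β) :
    Integrable fun y : ℝ => 2 * β / (β ^ 2 + y ^ 2) := by
  have h := (integrable_inv_one_add_sq.comp_div hβ.ne').const_mul (2 / β)
  refine h.congr (Filter.Eventually.of_forall fun y => ?_)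
  have : 0 < β ^ 2 + y ^ 2 := by positivity
  dsimp only
  field_simp

lemma hasMellin_cpow_Ioi (a : ℂ) {s : ℂ} (hs : s.re + a.re < 0) :
    HasMellin ((Set.Ioi 1).indicator fun t : ℝ => (t : ℂ) ^ a) s (-1 / (s + a)) := by
  have hsa : (s + a - 1).re < -1 := by simp; linarith
  have hsub : Set.Ioi (0 : ℝ) ∩ Set.Ioi 1 = Set.Ioi 1 :=
    Set.inter_eq_right.mpr (Set.Ioi_subset_Ioi zero_le_one)
  have heq : Set.EqOn (fun t : ℝ => (t : ℂ) ^ (s - 1) • (t : ℂ) ^ a)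
      (fun t : ℝ => (t : ℂ) ^ (s + a - 1)) (Set.Ioi 1) := by
    intro t ht
    have ht0 : (t : ℂ) ≠ 0 := by
      have : (0 : ℝ) < t := zero_lt_one.trans ht
      exact_mod_cast this.ne'
    dsimp only
    rw [smul_eq_mul, ← cpow_add _ _ ht0]
    ring_nf
  have hne : s + a ≠ 0 := by
    intro h0
    have := congrArg Complex.re h0
    simp at this; linarith
  constructor
  · simp_rw [MellinConvergent, ← Set.indicator_smul]
    rw [IntegrableOn, integrable_indicator_iff measurableSet_Ioi, IntegrableOn,
      Measure.restrict_restrict measurableSet_Ioi, Set.inter_comm, hsub]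
    exact (integrableOn_congr_fun heq measurableSet_Ioi).mpr
      (integrableOn_Ioi_cpow_of_lt hsa zero_lt_one)
  · simp_rw [mellin, ← Set.indicator_smul]
    rw [setIntegral_indicator measurableSet_Ioi, hsub,
      setIntegral_congr_fun measurableSet_Ioi heq, integral_Ioi_cpow_of_lt hsa zero_lt_one]
    simp

lemma integral_cauchy {β : ℝ} (hβ : 0 < β) (v : ℝ) :
    ∫ y : ℝ, cexp (-(v * y) * I) * ((2 * β / (β ^ 2 + y ^ 2) : ℝ) : ℂ) =
      ((2 * Real.pi * Real.exp (-β * |v|) : ℝ) : ℂ) := by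
  set F : ℝ → ℂ := fun t => (Set.Ioc (0 : ℝ) 1).indicator (fun t : ℝ => (t : ℂ) ^ (β : ℂ)) t +
    (Set.Ioi (1 : ℝ)).indicator (fun t : ℝ => (t : ℂ) ^ (-β : ℂ)) t with hF
  have hFv : ∀ v : ℝ, F (Real.exp v) = (Real.exp (-β * |v|) : ℂ) := by
    intro v
    have hpos := Real.exp_pos v
    have hlog : Complex.log (Real.exp v : ℂ) = v := by
      rw [← Complex.ofReal_log hpos.le, Real.log_exp]
    have hne : (Real.exp v : ℂ) ≠ 0 := by exact_mod_cast hpos.ne'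
    rw [hF]
    dsimp only
    rcases le_or_gt v 0 with hv | hv
    · rw [Set.indicator_of_mem (show Real.exp v ∈ Set.Ioc (0 : ℝ) 1 from
        ⟨hpos, Real.exp_le_one_iff.mpr hv⟩), Set.indicator_of_notMem, abs_of_nonpos hv, add_zero,
        cpow_def_of_ne_zero hne, hlog, Complex.ofReal_exp]
      · congr 1; push_cast; ring
      · simpa using hv
    · rw [Set.indicator_of_notMem, Set.indicator_of_mem (show Real.exp v ∈ Set.Ioi (1 : ℝ) from
        Real.one_lt_exp_iff.mpr hv), abs_of_pos hv, zero_add,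
        cpow_def_of_ne_zero hne, hlog, Complex.ofReal_exp]
      · congr 1; push_cast; ring
      · simp [hpos, hv]
  have hmel : ∀ y : ℝ, HasMellin F (y * I) ((2 * β / (β ^ 2 + y ^ 2) : ℝ) : ℂ) := by
    intro y
    have h1 := hasMellin_cpow_Ioc (β : ℂ) (s := y * I) (by simpa using hβ)
    have h2 := hasMellin_cpow_Ioi (-β : ℂ) (s := y * I) (by simpa using hβ)
    have h3 := hasMellin_add h1.1 h2.1
    refine ⟨h3.1, h3.2.trans ?_⟩
    rw [h1.2, h2.2]
    have hne1 : (y : ℂ) * I + β ≠ 0 := by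
      intro h0
      have := congrArg Complex.re h0
      simp at this; linarith
    have hne2 : (y : ℂ) * I + -β ≠ 0 := by
      intro h0
      have := congrArg Complex.re h0
      simp at this; linarith
    have hne3 : (β : ℂ) ^ 2 + (y : ℂ) ^ 2 ≠ 0 := by
      have : 0 < β ^ 2 + y ^ 2 := by positivity
      exact_mod_cast this.ne'
    push_cast
    rw [div_add_div _ _ hne1 hne2, div_eq_div_iff (mul_ne_zero hne1 hne2) hne3]
    linear_combination (-2 * (β : ℂ) * (y : ℂ) ^ 2) * I_sq
  have hvert : VerticalIntegrable (mellin F) 0 := by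
    refine (integrable_cauchy hβ).ofReal.congr (Filter.Eventually.of_forall fun y => ?_)
    have := (hmel y).2
    simp only [ofReal_zero, zero_add]
    rw [this]
    rfl
  have hcont : ContinuousAt F (Real.exp v) := by
    have hF2 : F =ᶠ[nhds (Real.exp v)] fun u => (Real.exp (-β * |Real.log u|) : ℂ) := by
      filter_upwards [lt_mem_nhds (Real.exp_pos v)] with u hu
      rw [← hFv, Real.exp_log hu]
    refine ContinuousAt.congr ?_ hF2.symm
    have : ContinuousAt Real.log (Real.exp v) := Real.continuousAt_log (Real.exp_pos v).ne'
    fun_prop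
  have hinv := mellinInv_mellin_eq 0 F (Real.exp_pos v) (by simpa using (hmel 0).1) hvert hcont
  rw [hFv, mellinInv] at hinv
  have h_itg : ∫ y : ℝ, (Real.exp v : ℂ) ^ (-(((0 : ℝ) : ℂ) + y * I)) •
      mellin F (((0 : ℝ) : ℂ) + y * I) =
      ∫ y : ℝ, cexp (-(v * y) * I) * ((2 * β / (β ^ 2 + y ^ 2) : ℝ) : ℂ) := by
    congr 1
    ext y
    have hne : (Real.exp v : ℂ) ≠ 0 := by exact_mod_cast (Real.exp_pos v).ne'
    have hlog : Complex.log (Real.exp v : ℂ) = v := by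
      rw [← Complex.ofReal_log (Real.exp_pos v).le, Real.log_exp]
    rw [ofReal_zero, zero_add, (hmel y).2, smul_eq_mul, cpow_def_of_ne_zero hne, hlog]
    congr 2
    ring
  rw [h_itg] at hinv
  rw [Complex.ofReal_mul, ← hinv, Complex.real_smul]
  have : (Real.pi : ℂ) ≠ 0 := by exact_mod_cast Real.pi_ne_zero
  generalize (∫ y : ℝ, cexp (-(v * y) * I) * ((2 * β / (β ^ 2 + y ^ 2) : ℝ) : ℂ)) = J
  push_cast
  field_simp

lemma integral_cauchy_zero {β : ℝ} (hβ : 0 < β) :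
    ∫ y : ℝ, 2 * β / (β ^ 2 + y ^ 2) = 2 * Real.pi := by
  have := integral_cauchy hβ 0
  simp only [ofReal_zero, zero_mul, neg_zero, Complex.exp_zero, one_mul, abs_zero, mul_zero,
    Real.exp_zero, mul_one] at this
  rw [integral_complex_ofReal] at this
  exact_mod_cast this

end

section

/-- The ramp function `u ↦ (p - u)₊`. -/
def ramp (p u : ℝ) : ℝ := max (p - u) 0

/-- The trapezoid equal to `1` on `[p, q]` and vanishing outside `(p - h, q + h)`. -/
def trap (p q h u : ℝ) : ℝ := (ramp (p - h) u - ramp p u - ramp q u + ramp (q + h) u) / h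

/-- The Mellin transform of `trap p q h`. -/
def trapMellin (p q h : ℝ) (s : ℂ) : ℂ :=
  (((p - h : ℝ) : ℂ) ^ (s + 1) - (p : ℂ) ^ (s + 1) - (q : ℂ) ^ (s + 1) +
    ((q + h : ℝ) : ℂ) ^ (s + 1)) / (h * (s * (s + 1)))

lemma hasMellin_ramp {p : ℝ} (hp : 0 < p) {s : ℂ} (hs : 0 < s.re) :
    HasMellin (fun u => (ramp p u : ℂ)) s ((p : ℂ) ^ (s + 1) / (s * (s + 1))) := by
  have h1 := hasMellin_sub (hasMellin_one_Ioc hs).1 (hasMellin_cpow_Ioc 1 (s := s)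
    (by simp; linarith)).1
  rw [(hasMellin_one_Ioc hs).2, (hasMellin_cpow_Ioc 1 (s := s) (by simp; linarith)).2] at h1
  set g : ℝ → ℂ := fun t => (Set.Ioc (0 : ℝ) 1).indicator (fun _ => 1 : ℝ → ℂ) t -
    (Set.Ioc (0 : ℝ) 1).indicator (fun t => (t : ℂ) ^ (1 : ℂ) : ℝ → ℂ) t with hg
  have hip : 0 < p⁻¹ := inv_pos.mpr hp
  have hconv : MellinConvergent (fun t => (p : ℂ) • g (p⁻¹ * t)) s :=
    ((MellinConvergent.comp_mul_left hip).mpr h1.1).const_smul _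
  have heq : Set.EqOn (fun t : ℝ => (t : ℂ) ^ (s - 1) • ((p : ℂ) • g (p⁻¹ * t)))
      (fun t : ℝ => (t : ℂ) ^ (s - 1) • (ramp p t : ℂ)) (Set.Ioi 0) := by
    intro t ht
    have ht0 : 0 < t := ht
    dsimp only
    congr 1
    rw [hg]
    dsimp only
    rcases le_or_gt t p with htp | htp
    · have hmem : p⁻¹ * t ∈ Set.Ioc (0 : ℝ) 1 := by
        refine ⟨by positivity, ?_⟩
        rw [inv_mul_le_iff₀ hp]; linarith
      rw [Set.indicator_of_mem hmem, Set.indicator_of_mem hmem, ramp, max_eq_left (by linarith)]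
      have : (p : ℂ) ≠ 0 := by exact_mod_cast hp.ne'
      rw [cpow_one, smul_eq_mul]
      push_cast
      field_simp
    · have hmem : p⁻¹ * t ∉ Set.Ioc (0 : ℝ) 1 := by
        intro h
        have := h.2
        rw [inv_mul_le_iff₀ hp] at this; linarith
      rw [Set.indicator_of_notMem hmem, Set.indicator_of_notMem hmem, ramp,
        max_eq_right (by linarith)]
      simp
  refine ⟨(integrableOn_congr_fun heq measurableSet_Ioi).mp hconv, ?_⟩
  rw [mellin, ← setIntegral_congr_fun measurableSet_Ioi heq]
  change mellin (fun t => (p : ℂ) • g (p⁻¹ * t)) s = _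
  rw [mellin_const_smul, mellin_comp_mul_left g s hip, h1.2]
  have hs0 : s ≠ 0 := by rintro rfl; simp at hs
  have hs1 : s + 1 ≠ 0 := by
    intro h0
    have := congrArg Complex.re h0
    simp at this; linarith
  have hp0 : (p : ℂ) ≠ 0 := by exact_mod_cast hp.ne'
  rw [cpow_add _ _ hp0, cpow_one, Complex.ofReal_inv, smul_eq_mul, smul_eq_mul,
    inv_cpow _ _ (by rw [Complex.arg_ofReal_of_nonneg hp.le]; exact Real.pi_pos.ne), cpow_neg, inv_inv]
  field_simp
  ring

section

variable {p q h : ℝ}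

lemma hasMellin_trap (h0 : 0 < h) (hp : h < p) (hq : p ≤ q) {s : ℂ} (hs : 0 < s.re) :
    HasMellin (fun u => (trap p q h u : ℂ)) s (trapMellin p q h s) := by
  have h1 := hasMellin_ramp (p := p - h) (by linarith) hs
  have h2 := hasMellin_ramp (p := p) (by linarith) hs
  have h3 := hasMellin_ramp (p := q) (by linarith) hs
  have h4 := hasMellin_ramp (p := q + h) (by linarith) hs
  have h12 := hasMellin_sub h1.1 h2.1
  have h123 := hasMellin_sub h12.1 h3.1
  have h1234 := hasMellin_add h123.1 h4.1
  have hc := h1234.1.const_smul ((h : ℂ)⁻¹)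
  have he : (fun u => (trap p q h u : ℂ)) = fun u => (h : ℂ)⁻¹ • (((ramp (p - h) u : ℂ) -
      (ramp p u : ℂ) - (ramp q u : ℂ)) + (ramp (q + h) u : ℂ)) := by
    ext u
    rw [trap, smul_eq_mul]
    push_cast
    ring
  rw [he]
  refine ⟨hc, ?_⟩
  rw [mellin_const_smul, h1234.2, h123.2, h12.2, h1.2, h2.2, h3.2, h4.2, smul_eq_mul, trapMellin]
  simp only [div_eq_mul_inv, mul_inv]
  ring

lemma continuous_trap : Continuous (trap p q h) := by
  unfold trap ramp
  fun_prop

lemma trap_eq_one (h0 : 0 < h) {u : ℝ} (hp : p ≤ u) (hq : u ≤ q) : trap p q h u = 1 := by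
  rw [trap, ramp, ramp, ramp, ramp, max_eq_right (by linarith), max_eq_right (by linarith),
    max_eq_left (by linarith), max_eq_left (by linarith)]
  field_simp
  ring

lemma trap_eq_zero_left (h0 : 0 < h) (hpq : p ≤ q) {u : ℝ} (hu : u ≤ p - h) :
    trap p q h u = 0 := by
  rw [trap, ramp, ramp, ramp, ramp, max_eq_left (by linarith), max_eq_left (by linarith),
    max_eq_left (by linarith), max_eq_left (by linarith)]
  field_simp
  ring

lemma trap_eq_zero_right (h0 : 0 < h) (hpq : p ≤ q) {u : ℝ} (hu : q + h ≤ u) :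
    trap p q h u = 0 := by
  rw [trap, ramp, ramp, ramp, ramp, max_eq_right (by linarith), max_eq_right (by linarith),
    max_eq_right (by linarith), max_eq_right (by linarith)]
  simp

lemma trap_mem_Icc (h0 : 0 < h) (hpq : p ≤ q) (u : ℝ) : 0 ≤ trap p q h u ∧ trap p q h u ≤ 1 := by
  rw [trap, le_div_iff₀ h0, div_le_iff₀ h0, zero_mul, one_mul, ramp, ramp, ramp, ramp]
  rcases max_cases (p - h - u) 0 with h1 | h1 <;> rcases max_cases (p - u) 0 with h2 | h2 <;>
  rcases max_cases (q - u) 0 with h3 | h3 <;> rcases max_cases (q + h - u) 0 with h4 | h4 <;>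
  constructor <;> linarith

lemma norm_cpow_add_one_sub_le {a b : ℝ} (ha : 0 < a) (hab : a ≤ b) {s : ℂ} (hs : 0 < s.re) :
    ‖(b : ℂ) ^ (s + 1) - (a : ℂ) ^ (s + 1)‖ ≤ ‖s + 1‖ * ((b - a) * b ^ s.re) := by
  have hs1 : s + 1 ≠ 0 := by
    intro h0
    have := congrArg Complex.re h0
    simp at this; linarith
  have hsn : s ≠ -1 := fun h => hs1 (by rw [h]; ring)
  have h1 : ‖(b : ℂ) ^ (s + 1) / (s + 1) - (a : ℂ) ^ (s + 1) / (s + 1)‖ ≤ b ^ s.re * (b - a) := by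
    refine norm_image_sub_le_of_norm_deriv_le_segment' (f := fun y : ℝ => (y : ℂ) ^ (s + 1) / (s + 1))
      (f' := fun y : ℝ => (y : ℂ) ^ s) (fun t ht => ?_) (fun t ht => ?_) b (Set.right_mem_Icc.mpr hab)
    · exact (hasDerivAt_ofReal_cpow_const' (ha.trans_le ht.1).ne' hsn).hasDerivWithinAt
    · have ht0 : 0 < t := ha.trans_le ht.1
      rw [Complex.norm_cpow_eq_rpow_re_of_pos ht0]
      exact Real.rpow_le_rpow ht0.le ht.2.le hs.le
  rw [← sub_div, norm_div, div_le_iff₀ (norm_pos_iff.mpr hs1)] at h1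
  linarith

lemma rpow_le_four_mul_rpow {x u a : ℝ} (hx : 0 < x) (h1 : x / 4 ≤ u) (h2 : u ≤ 4 * x)
    (ha : |a| ≤ 1) : u ^ a ≤ 4 * x ^ a := by
  have hu : 0 < u := by linarith
  obtain ⟨ha1, ha2⟩ := abs_le.mp ha
  have h3 : (u / x) ^ a ≤ 4 := by
    rcases le_or_gt 0 a with h | h
    · calc (u / x) ^ a ≤ 4 ^ a := by
            refine Real.rpow_le_rpow (by positivity) ?_ h
            rw [div_le_iff₀ hx]; exact h2
        _ ≤ 4 ^ (1 : ℝ) := Real.rpow_le_rpow_of_exponent_le (by norm_num) ha2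
        _ = 4 := by norm_num
    · calc (u / x) ^ a ≤ (1 / 4) ^ a := by
            refine Real.rpow_le_rpow_of_nonpos (by norm_num) ?_ h.le
            rw [le_div_iff₀ hx]; linarith
        _ ≤ (1 / 4) ^ (-1 : ℝ) :=
            Real.rpow_le_rpow_of_exponent_ge (by norm_num) (by norm_num) (by linarith)
        _ = 4 := by rw [Real.rpow_neg_one]; norm_num
  rwa [Real.div_rpow hu.le hx.le, div_le_iff₀ (by positivity)] at h3

lemma norm_trapMellin_le_length {x z : ℝ} (h0 : 0 < h) (hx : h ≤ x / 4) (hz : 0 ≤ z)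
    (hzx : z ≤ x) {s : ℂ} (hs : 9 / 10 ≤ s.re) (hs2 : s.re ≤ 2) :
    ‖trapMellin x (x + z) h s‖ ≤ 4 * x ^ (s.re - 1) * (z + 2 * h) := by
  have hx0 : 0 < x := by linarith
  rw [← (hasMellin_trap h0 (by linarith) (by linarith) (by linarith : 0 < s.re)).2, mellin]
  have hle : ∀ t ∈ Set.Ioi (0 : ℝ), ‖(t : ℂ) ^ (s - 1) • (trap x (x + z) h t : ℂ)‖ ≤
      (Set.Icc (x - h) (x + z + h)).indicator (fun _ => 4 * x ^ (s.re - 1)) t := by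
    intro t ht
    have ht0 : 0 < t := ht
    obtain ⟨h1, h2⟩ := trap_mem_Icc h0 (show x ≤ x + z by linarith) t
    by_cases hmem : t ∈ Set.Icc (x - h) (x + z + h)
    · rw [Set.indicator_of_mem hmem, norm_smul, Complex.norm_cpow_eq_rpow_re_of_pos ht0,
        Complex.norm_real, Real.norm_of_nonneg h1, sub_re, one_re]
      have h3 := rpow_le_four_mul_rpow (u := t) (a := s.re - 1) hx0 (by linarith [hmem.1])
        (by linarith [hmem.2]) (by rw [abs_le]; constructor <;> linarith)
      calc _ ≤ t ^ (s.re - 1) * 1 := by gcongr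
        _ ≤ _ := by linarith
    · rw [Set.indicator_of_notMem hmem]
      have : trap x (x + z) h t = 0 := by
        rcases not_and_or.mp hmem with h' | h'
        · exact trap_eq_zero_left h0 (by linarith) (by linarith)
        · exact trap_eq_zero_right h0 (by linarith) (by linarith)
      simp [this]
  have h_itg : Integrable ((Set.Icc (x - h) (x + z + h)).indicator
      (fun _ : ℝ => 4 * x ^ (s.re - 1))) := by
    rw [integrable_indicator_iff measurableSet_Icc]
    exact integrableOn_const (by simp)
  refine (norm_integral_le_of_norm_le h_itg.integrableOn
    ((ae_restrict_iff' measurableSet_Ioi).mpr (Filter.Eventually.of_forall hle))).trans ?_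
  calc _ ≤ ∫ t, (Set.Icc (x - h) (x + z + h)).indicator (fun _ : ℝ => 4 * x ^ (s.re - 1)) t :=
        setIntegral_le_integral h_itg (Filter.Eventually.of_forall fun t =>
          Set.indicator_nonneg (fun _ _ => by positivity) t)
    _ = _ := by
        rw [integral_indicator measurableSet_Icc, setIntegral_const]
        rw [measureReal_def, Real.volume_Icc, ENNReal.toReal_ofReal (by linarith), smul_eq_mul]
        ring

lemma norm_trapMellin_le_inv {x z : ℝ} (h0 : 0 < h) (hx : h ≤ x / 4) (hz : 0 ≤ z)
    (hzx : z ≤ x) {s : ℂ} (hs : 9 / 10 ≤ s.re) (hs2 : s.re ≤ 2) :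
    ‖trapMellin x (x + z) h s‖ ≤ 18 * x ^ s.re / ‖s‖ := by
  have hx0 : 0 < x := by linarith
  have hs0 : 0 < s.re := by linarith
  have hsn : 0 < ‖s‖ := hs0.trans_le (Complex.re_le_norm s)
  have hsn1 : 0 < ‖s + 1‖ := by
    refine lt_of_lt_of_le ?_ (Complex.re_le_norm _)
    simp; linarith
  have hpow : (x + z + h) ^ s.re ≤ 9 * x ^ s.re := by
    calc (x + z + h) ^ s.re ≤ (3 * x) ^ s.re := by gcongr; linarith
      _ = 3 ^ s.re * x ^ s.re := Real.mul_rpow (by norm_num) hx0.le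
      _ ≤ 3 ^ (2 : ℝ) * x ^ s.re := by gcongr; norm_num
      _ = _ := by norm_num
  have h1 := norm_cpow_add_one_sub_le (a := x - h) (b := x) (by linarith) (by linarith) hs0
  have h2 := norm_cpow_add_one_sub_le (a := x + z) (b := x + z + h) (by linarith) (by linarith) hs0
  have h3 : x ^ s.re ≤ 9 * x ^ s.re := by linarith [Real.rpow_pos_of_pos hx0 s.re]
  have h4 : ‖((x - h : ℝ) : ℂ) ^ (s + 1) - (x : ℂ) ^ (s + 1) - ((x + z : ℝ) : ℂ) ^ (s + 1) +
      ((x + z + h : ℝ) : ℂ) ^ (s + 1)‖ ≤ ‖s + 1‖ * (h * (18 * x ^ s.re)) := by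
    have he : ((x - h : ℝ) : ℂ) ^ (s + 1) - (x : ℂ) ^ (s + 1) - ((x + z : ℝ) : ℂ) ^ (s + 1) +
      ((x + z + h : ℝ) : ℂ) ^ (s + 1) = (((x + z + h : ℝ) : ℂ) ^ (s + 1) -
        ((x + z : ℝ) : ℂ) ^ (s + 1)) - ((x : ℂ) ^ (s + 1) - ((x - h : ℝ) : ℂ) ^ (s + 1)) := by ring
    rw [he]
    refine (norm_sub_le _ _).trans ?_
    calc _ ≤ ‖s + 1‖ * ((x + z + h - (x + z)) * (9 * x ^ s.re)) +
          ‖s + 1‖ * ((x - (x - h)) * (9 * x ^ s.re)) := by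
          refine add_le_add (h2.trans ?_) (h1.trans ?_)
          · have : 0 ≤ x + z + h - (x + z) := by linarith
            gcongr
          · have : 0 ≤ x - (x - h) := by linarith
            gcongr
      _ = _ := by ring
  rw [trapMellin, norm_div, norm_mul, norm_mul, Complex.norm_real, Real.norm_of_nonneg h0.le,
    div_le_div_iff₀ (by positivity) hsn]
  calc _ ≤ ‖s + 1‖ * (h * (18 * x ^ s.re)) * ‖s‖ := by gcongr
    _ = _ := by ring

lemma norm_trapMellin_le_inv_sq {x z : ℝ} (h0 : 0 < h) (hx : h ≤ x / 4) (hz : 0 ≤ z)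
    (hzx : z ≤ x) {s : ℂ} (hs : 9 / 10 ≤ s.re) (hs2 : s.re ≤ 2) :
    ‖trapMellin x (x + z) h s‖ ≤ 108 * x ^ (s.re + 1) / (h * ‖s‖ ^ 2) := by
  have hx0 : 0 < x := by linarith
  have hs0 : 0 < s.re := by linarith
  have hsn : 0 < ‖s‖ := hs0.trans_le (Complex.re_le_norm s)
  have hsn1 : ‖s‖ ≤ ‖s + 1‖ := by
    rw [Complex.norm_eq_sqrt_sq_add_sq, Complex.norm_eq_sqrt_sq_add_sq]
    refine Real.sqrt_le_sqrt ?_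
    simp only [add_re, one_re, add_im, one_im, add_zero]
    nlinarith
  have hpow : ∀ u : ℝ, 0 < u → u ≤ 3 * x → ‖(u : ℂ) ^ (s + 1)‖ ≤ 27 * x ^ (s.re + 1) := by
    intro u hu hux
    rw [Complex.norm_cpow_eq_rpow_re_of_pos hu, add_re, one_re]
    calc u ^ (s.re + 1) ≤ (3 * x) ^ (s.re + 1) := by gcongr
      _ = 3 ^ (s.re + 1) * x ^ (s.re + 1) := Real.mul_rpow (by norm_num) hx0.le
      _ ≤ 3 ^ (3 : ℝ) * x ^ (s.re + 1) := by gcongr <;> linarith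
      _ = _ := by norm_num
  rw [trapMellin, norm_div, norm_mul, norm_mul, Complex.norm_real, Real.norm_of_nonneg h0.le]
  have h4 : ‖((x - h : ℝ) : ℂ) ^ (s + 1) - (x : ℂ) ^ (s + 1) - ((x + z : ℝ) : ℂ) ^ (s + 1) +
      ((x + z + h : ℝ) : ℂ) ^ (s + 1)‖ ≤ 108 * x ^ (s.re + 1) := by
    refine (norm_add_le _ _).trans ?_
    have h5 := norm_sub_le (((x - h : ℝ) : ℂ) ^ (s + 1) - (x : ℂ) ^ (s + 1))
      (((x + z : ℝ) : ℂ) ^ (s + 1))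
    have h6 := norm_sub_le (((x - h : ℝ) : ℂ) ^ (s + 1)) ((x : ℂ) ^ (s + 1))
    have := hpow (x - h) (by linarith) (by linarith)
    have := hpow x (by linarith) (by linarith)
    have := hpow (x + z) (by linarith) (by linarith)
    have := hpow (x + z + h) (by linarith) (by linarith)
    linarith
  gcongr
  rw [sq]
  gcongr

lemma trapMellin_integrable {x z : ℝ} (h0 : 0 < h) (hx : h ≤ x / 4) (hz : 0 ≤ z)
    (hzx : z ≤ x) {σ : ℝ} (hs : 9 / 10 ≤ σ) (hs2 : σ ≤ 2) :
    Integrable fun t : ℝ => trapMellin x (x + z) h (σ + t * I) := by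
  have hx0 : 0 < x := by linarith
  have hre : ∀ t : ℝ, ((σ : ℂ) + t * I).re = σ := fun t => by simp
  have hcont : Continuous fun t : ℝ => trapMellin x (x + z) h (σ + t * I) := by
    unfold trapMellin
    have hc : ∀ u : ℝ, 0 < u → Continuous fun t : ℝ => (u : ℂ) ^ ((σ : ℂ) + t * I + 1) := by
      intro u hu
      refine Continuous.const_cpow (by fun_prop) (Or.inl ?_)
      exact_mod_cast hu.ne'
    refine Continuous.div ((((hc _ (by linarith)).sub (hc _ hx0)).sub (hc _ (by linarith))).add
      (hc _ (by linarith))) (by fun_prop) fun t => ?_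
    have h1 : (h : ℂ) ≠ 0 := by exact_mod_cast h0.ne'
    have h2 : (σ : ℂ) + t * I ≠ 0 := by
      intro h'
      have := congrArg Complex.re h'
      rw [hre] at this; simp at this; linarith
    have h3 : (σ : ℂ) + t * I + 1 ≠ 0 := by
      intro h'
      have := congrArg Complex.re h'
      rw [add_re, hre] at this; simp at this; linarith
    exact mul_ne_zero h1 (mul_ne_zero h2 h3)
  refine Integrable.mono' (integrable_inv_one_add_sq.const_mul
    (2 * (108 * x ^ (σ + 1) / h))) hcont.aestronglyMeasurable (Filter.Eventually.of_forall fun t => ?_)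
  have h1 := norm_trapMellin_le_inv_sq h0 hx hz hzx (s := σ + t * I) (by rw [hre]; exact hs)
    (by rw [hre]; exact hs2)
  rw [hre] at h1
  refine h1.trans ?_
  have h2 : ‖(σ : ℂ) + t * I‖ ^ 2 = σ ^ 2 + t ^ 2 := by
    rw [Complex.sq_norm, Complex.normSq_add_mul_I]
  rw [h2, div_eq_mul_inv, mul_inv]
  have h3 : (σ ^ 2 + t ^ 2)⁻¹ ≤ 2 * (1 + t ^ 2)⁻¹ := by
    rw [← div_eq_mul_inv, inv_le_comm₀ (by positivity) (by positivity), inv_div,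
      div_le_iff₀ (by norm_num)]
    nlinarith
  calc _ ≤ 108 * x ^ (σ + 1) * (h⁻¹ * (2 * (1 + t ^ 2)⁻¹)) := by gcongr
    _ = _ := by ring

/-- A smoothed Perron formula, as an upper bound. -/
lemma norm_sum_trap_le {x z : ℝ} (h0 : 0 < h) (hx : h ≤ x / 4) (hz : 0 ≤ z)
    (hzx : z ≤ x) {σ : ℝ} (hs : 9 / 10 ≤ σ) (hs2 : σ ≤ 2) {c : ℕ → ℂ}
    (hc : LSeriesSummable c σ) {D : ℝ → ℝ} (hD : Integrable D)
    (hle : ∀ t : ℝ, ‖trapMellin x (x + z) h (σ + t * I) * LSeries c (σ + t * I)‖ ≤ D t)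
    {T : Finset ℕ} (hT : ∀ n ∉ T, trap x (x + z) h n = 0) :
    ‖∑ n ∈ T, c n * trap x (x + z) h n‖ ≤ ∫ t, D t := by
  have hx0 : 0 < x := by linarith
  have hGi := trapMellin_integrable h0 hx hz hzx hs hs2
  have hmel : ∀ s : ℂ, 0 < s.re → HasMellin (fun u => (trap x (x + z) h u : ℂ)) s
    (trapMellin x (x + z) h s) := fun s hs => hasMellin_trap h0 (by linarith) (by linarith) hs
  have hre : ∀ t : ℝ, ((σ : ℂ) + t * I).re = σ := fun t => by simp
  have hinv : ∀ n : ℕ, (trap x (x + z) h n : ℂ) * c n = (1 / (2 * Real.pi) : ℝ) •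
      ∫ t : ℝ, LSeries.term c (σ + t * I) n * trapMellin x (x + z) h (σ + t * I) := by
    intro n
    rcases eq_or_ne n 0 with rfl | hn
    · have : trap x (x + z) h ((0 : ℕ) : ℝ) = 0 :=
        trap_eq_zero_left h0 (by linarith) (by push_cast; linarith)
      rw [this]
      simp
    have hn0 : (0 : ℝ) < n := by exact_mod_cast Nat.pos_of_ne_zero hn
    have h1 := mellinInv_mellin_eq σ (fun u => (trap x (x + z) h u : ℂ)) hn0
      (hmel σ (by simp; linarith)).1 (by
        refine hGi.congr (Filter.Eventually.of_forall fun t => ?_)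
        exact ((hmel (σ + t * I) (by rw [hre]; linarith)).2).symm)
      (by
        have := (continuous_trap (p := x) (q := x + z) (h := h))
        exact (Complex.continuous_ofReal.comp this).continuousAt)
    rw [← h1, mellinInv, smul_mul_assoc, ← integral_mul_const]
    congr 2
    ext t
    rw [(hmel (σ + t * I) (by rw [hre]; linarith)).2, LSeries.term_of_ne_zero hn, cpow_neg,
      smul_eq_mul, Complex.ofReal_natCast]
    ring
  have hFint : ∀ n : ℕ, Integrable fun t : ℝ =>
      LSeries.term c (σ + t * I) n * trapMellin x (x + z) h (σ + t * I) := by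
    intro n
    refine hGi.bdd_mul (c := ‖LSeries.term c σ n‖) ?_ (Filter.Eventually.of_forall fun t => ?_)
    · refine Continuous.aestronglyMeasurable ?_
      rcases eq_or_ne n 0 with rfl | hn
      · simp only [LSeries.term_zero]; exact continuous_const
      · simp only [LSeries.term_of_ne_zero hn]
        have hn0 : (n : ℂ) ≠ 0 := by exact_mod_cast hn
        refine Continuous.div continuous_const (Continuous.const_cpow (by fun_prop) (Or.inl hn0))
          fun t => ?_
        simp [cpow_eq_zero_iff, hn0]
    · rw [LSeries.norm_term_eq, LSeries.norm_term_eq, hre, Complex.ofReal_re]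
  have hnorm : ∀ n : ℕ, ∫ t : ℝ, ‖LSeries.term c (σ + t * I) n *
      trapMellin x (x + z) h (σ + t * I)‖ =
      ‖LSeries.term c σ n‖ * ∫ t : ℝ, ‖trapMellin x (x + z) h (σ + t * I)‖ := by
    intro n
    rw [← integral_const_mul]
    congr 1
    ext t
    rw [norm_mul, LSeries.norm_term_eq, LSeries.norm_term_eq, hre, Complex.ofReal_re]
  have hsum := hasSum_integral_of_summable_integral_norm hFint (by
    simp_rw [hnorm]
    exact hc.norm.mul_right _)
  have h2 : HasSum (fun n : ℕ => (trap x (x + z) h n : ℂ) * c n) ((1 / (2 * Real.pi) : ℝ) •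
      ∫ t : ℝ, ∑' n, LSeries.term c (σ + t * I) n * trapMellin x (x + z) h (σ + t * I)) := by
    simp_rw [hinv]
    exact hsum.const_smul _
  have h3 : ∑ n ∈ T, c n * trap x (x + z) h n = (1 / (2 * Real.pi) : ℝ) •
      ∫ t : ℝ, ∑' n, LSeries.term c (σ + t * I) n * trapMellin x (x + z) h (σ + t * I) := by
    rw [← h2.tsum_eq, tsum_eq_sum (s := T)]
    · exact Finset.sum_congr rfl fun n _ => mul_comm _ _
    · intro n hn
      rw [hT n hn]
      simp
  have hDnn : 0 ≤ ∫ t, D t := integral_nonneg fun t => (norm_nonneg _).trans (hle t)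
  rw [h3, norm_smul]
  have h4 : ‖∫ t : ℝ, ∑' n, LSeries.term c (σ + t * I) n *
      trapMellin x (x + z) h (σ + t * I)‖ ≤ ∫ t, D t := by
    refine norm_integral_le_of_norm_le hD (Filter.Eventually.of_forall fun t => ?_)
    rw [tsum_mul_right, mul_comm]
    exact hle t
  have h5 : ‖(1 / (2 * Real.pi) : ℝ)‖ ≤ 1 := by
    rw [Real.norm_of_nonneg (by positivity), div_le_one (by positivity)]
    linarith [Real.pi_gt_three]
  calc _ ≤ 1 * ∫ t, D t := by gcongr
    _ = _ := one_mul _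

end

end

section

open scoped ArithmeticFunction.vonMangoldt

lemma exists_sum_vM_log_block_le : ∃ C : ℝ, 0 < C ∧ ∀ (S : Finset ℕ) (y T v : ℝ), 2 ≤ T →
    T ^ 4 ≤ y → (∀ l ∈ S, y ≤ (l : ℝ) ∧ |Real.log l - v| ≤ 1 / T) →
    ∑ l ∈ S, Λ l ≤ C * Real.exp v / T := by
  obtain ⟨C, hC, hbt⟩ := exists_brun_titchmarsh
  refine ⟨4 * C, by positivity, fun S y T v hT hy hS => ?_⟩
  have hT0 : 0 < T := by linarith
  rcases S.eq_empty_or_nonempty with rfl | ⟨l0, hl0⟩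
  · simp; positivity
  have hu : 0 < 1 / T := by positivity
  have hu1 : 1 / T ≤ 1 / 2 := one_div_le_one_div_of_le (by norm_num) hT
  have hy16 : 16 ≤ T ^ 4 := by
    calc (16 : ℝ) = 2 ^ 4 := by norm_num
      _ ≤ T ^ 4 := by gcongr
  have hpos : ∀ l ∈ S, (0 : ℝ) < l := fun l hl => by linarith [(hS l hl).1]
  set X := Real.exp (v - 2 * (1 / T)) with hX
  set Y := Real.exp (v + 1 / T) - X with hY
  have hXY : X + Y = Real.exp (v + 1 / T) := by rw [hY]; ring
  have hylow : y ≤ Real.exp (v + 1 / T) := by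
    refine (hS l0 hl0).1.trans ?_
    rw [← Real.exp_log (hpos l0 hl0)]
    exact Real.exp_le_exp.mpr (by linarith [(abs_le.mp (hS l0 hl0).2).2])
  have he : Real.exp (v + 1 / T) = X * Real.exp (3 * (1 / T)) := by
    rw [hX, ← Real.exp_add]; ring_nf
  have he5 : Real.exp (3 * (1 / T)) ≤ 5 := by
    have : Real.exp (3 * (1 / T)) ≤ Real.exp (3 / 2) := Real.exp_le_exp.mpr (by linarith)
    have h2 : Real.exp (3 / 2) ^ 2 = Real.exp 1 ^ 3 := by
      rw [← Real.exp_nat_mul, ← Real.exp_nat_mul]; norm_num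
    have h3 : Real.exp 1 ^ 3 ≤ 2.72 ^ 3 := by
      gcongr; exact Real.exp_one_lt_d9.le.trans (by norm_num)
    nlinarith [Real.exp_pos (3 / 2)]
  have hX0 : 0 < X := Real.exp_pos _
  have hX5 : T ^ 4 / 5 ≤ X := by
    have : T ^ 4 ≤ X * 5 := by
      calc T ^ 4 ≤ X * Real.exp (3 * (1 / T)) := by rw [← he]; linarith
        _ ≤ X * 5 := by gcongr
    linarith
  have hYlow : X * (3 * (1 / T)) ≤ Y := by
    rw [hY, he]
    nlinarith [Real.add_one_le_exp (3 * (1 / T))]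
  have hYup : Y ≤ 4 * Real.exp v / T := by
    rw [hY, hX, Real.exp_add, sub_eq_add_neg v, Real.exp_add]
    have h1 : Real.exp (1 / T) ≤ 1 + 2 * (1 / T) := by
      have := Real.abs_exp_sub_one_sub_id_le (x := 1 / T) (by rw [abs_of_pos hu]; linarith)
      have := (abs_le.mp this).2
      nlinarith
    have h2 := Real.add_one_le_exp (-(2 * (1 / T)))
    have : Real.exp v * (Real.exp (1 / T) - Real.exp (-(2 * (1 / T)))) ≤
        Real.exp v * (4 * (1 / T)) := by
      gcongr; linarith
    calc _ = Real.exp v * (Real.exp (1 / T) - Real.exp (-(2 * (1 / T)))) := by ring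
      _ ≤ _ := this
      _ = _ := by ring
  have hpow : X ^ (3 / 5 : ℝ) ≤ Y := by
    refine le_trans ?_ hYlow
    have h1 : T / 3 ≤ X ^ (2 / 5 : ℝ) := by
      have h2 : (T / 3) ^ 5 ≤ X ^ 2 := by
        calc (T / 3) ^ 5 = T ^ 5 / 243 := by ring
          _ ≤ (T ^ 4 / 5) ^ 2 := by
            have : T ^ 5 * 8 ≤ T ^ 5 * T ^ 3 := by
              gcongr
              calc (8 : ℝ) = 2 ^ 3 := by norm_num
                _ ≤ T ^ 3 := by gcongr
            have h5 : 0 < T ^ 5 := by positivity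
            nlinarith
          _ ≤ X ^ 2 := by gcongr
      calc T / 3 = ((T / 3) ^ 5) ^ (1 / 5 : ℝ) := by
            rw [← Real.rpow_natCast, ← Real.rpow_mul (by positivity)]; norm_num
        _ ≤ (X ^ 2) ^ (1 / 5 : ℝ) := by gcongr
        _ = X ^ (2 / 5 : ℝ) := by
            rw [← Real.rpow_natCast, ← Real.rpow_mul hX0.le]; norm_num
    have h3 : X = X ^ (3 / 5 : ℝ) * X ^ (2 / 5 : ℝ) := by
      rw [← Real.rpow_add hX0]; norm_num
    have h4 : 0 < X ^ (3 / 5 : ℝ) := by positivity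
    calc X ^ (3 / 5 : ℝ) = X ^ (3 / 5 : ℝ) * (T / 3) * (3 * (1 / T)) := by field_simp
      _ ≤ X ^ (3 / 5 : ℝ) * X ^ (2 / 5 : ℝ) * (3 * (1 / T)) := by gcongr
      _ = X * (3 * (1 / T)) := by rw [← h3]
  have := hbt S X Y (by linarith) hpow (fun k hk => by
    have hk0 := hpos k hk
    obtain ⟨ha, hb⟩ := abs_le.mp (hS k hk).2
    rw [hXY, ← Real.exp_log hk0]
    exact ⟨Real.exp_lt_exp.mpr (by linarith), Real.exp_le_exp.mpr (by linarith)⟩)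
  calc _ ≤ _ := this
    _ ≤ C * (4 * Real.exp v / T) := by gcongr
    _ = _ := by ring

lemma exists_sum_vM_exp_neg_abs_log_le : ∃ C : ℝ, 0 < C ∧ ∀ (S : Finset ℕ) (y T : ℝ), 2 ≤ T →
    T ^ 4 ≤ y → (∀ l ∈ S, y ≤ (l : ℝ)) → ∀ k : ℕ, 0 < k →
    ∑ l ∈ S, Λ l * Real.exp (-T * |Real.log k - Real.log l|) ≤ C * k / T := by
  obtain ⟨C, hC, hbl⟩ := exists_sum_vM_log_block_le
  refine ⟨6 * C, by positivity, fun S y T hT hy hS k hk => ?_⟩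
  have hT0 : 0 < T := by linarith
  have hk0 : (0 : ℝ) < k := by exact_mod_cast hk
  set J : ℕ → ℕ := fun l => ⌊T * |Real.log k - Real.log l|⌋₊ with hJ
  have hfib : ∀ j : ℕ, ∑ l ∈ S with J l = j, Λ l ≤ 2 * C * k / T * Real.exp (1 / 2) ^ j := by
    intro j
    have hsub : (S.filter fun l => J l = j) ⊆
        (S.filter fun l => |Real.log l - (Real.log k + j / T)| ≤ 1 / T) ∪
        (S.filter fun l => |Real.log l - (Real.log k - j / T)| ≤ 1 / T) := by
      intro l hl
      simp only [Finset.mem_filter, Finset.mem_union] at hl ⊢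
      obtain ⟨hl, hj⟩ := hl
      have h1 := Nat.floor_le (a := T * |Real.log k - Real.log l|) (by positivity)
      have h2 := Nat.lt_floor_add_one (T * |Real.log k - Real.log l|)
      rw [show ⌊T * |Real.log k - Real.log l|⌋₊ = j from hj] at h1 h2
      have h1' : (j : ℝ) / T ≤ |Real.log k - Real.log l| := by
        rw [div_le_iff₀ hT0]; linarith
      have h2' : |Real.log k - Real.log l| ≤ j / T + 1 / T := by
        rw [← add_div, le_div_iff₀ hT0]; linarith
      rcases abs_cases (Real.log k - Real.log l) with ⟨ha, -⟩ | ⟨ha, -⟩ <;> rw [ha] at h1' h2'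
      · right; exact ⟨hl, abs_le.mpr ⟨by linarith, by linarith⟩⟩
      · left; exact ⟨hl, abs_le.mpr ⟨by linarith, by linarith⟩⟩
    have hb : ∀ v : ℝ, ∑ l ∈ S with |Real.log (l : ℕ) - v| ≤ 1 / T, Λ l ≤ C * Real.exp v / T := fun v =>
      hbl _ y T v hT hy fun l hl => by
        rw [Finset.mem_filter] at hl
        exact ⟨hS l hl.1, hl.2⟩
    have hexp : Real.exp (j / T) ≤ Real.exp (1 / 2) ^ j := by
      rw [← Real.exp_nat_mul]
      refine Real.exp_le_exp.mpr ?_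
      rw [div_eq_mul_one_div]
      gcongr
    calc ∑ l ∈ S with J l = j, Λ l ≤ _ :=
          Finset.sum_le_sum_of_subset_of_nonneg hsub fun l _ _ => vM_nonneg l
      _ ≤ ∑ l ∈ S with |Real.log (l : ℕ) - (Real.log k + j / T)| ≤ 1 / T, Λ l +
          ∑ l ∈ S with |Real.log (l : ℕ) - (Real.log k - j / T)| ≤ 1 / T, Λ l := by
          rw [← Finset.sum_union_inter]
          have : 0 ≤ ∑ l ∈ (S.filter fun l => |Real.log (l : ℕ) - (Real.log k + j / T)| ≤ 1 / T) ∩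
            (S.filter fun l => |Real.log (l : ℕ) - (Real.log k - j / T)| ≤ 1 / T), Λ l :=
            Finset.sum_nonneg fun l _ => vM_nonneg l
          linarith
      _ ≤ C * Real.exp (Real.log k + j / T) / T + C * Real.exp (Real.log k - j / T) / T :=
          add_le_add (hb _) (hb _)
      _ ≤ C * Real.exp (Real.log k + j / T) / T + C * Real.exp (Real.log k + j / T) / T := by
          gcongr
          have : (0 : ℝ) ≤ j / T := by positivity
          linarith
      _ = 2 * C * k / T * Real.exp (j / T) := by
          rw [Real.exp_add, Real.exp_log hk0]; ring
      _ ≤ _ := by gcongr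
  have h23 : Real.exp (-1) * Real.exp (1 / 2) ≤ 2 / 3 := by
    rw [← Real.exp_add]
    have h1 : Real.exp (-1 + 1 / 2) = (Real.exp (1 / 2))⁻¹ := by rw [← Real.exp_neg]; norm_num
    rw [h1, show (2 : ℝ) / 3 = (3 / 2)⁻¹ by norm_num]
    exact inv_anti₀ (by norm_num) (by linarith [Real.add_one_le_exp (1 / 2 : ℝ)])
  calc ∑ l ∈ S, Λ l * Real.exp (-T * |Real.log k - Real.log l|)
      = ∑ j ∈ S.image J, ∑ l ∈ S with J l = j,
          Λ l * Real.exp (-T * |Real.log k - Real.log l|) :=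
        (Finset.sum_fiberwise_of_maps_to (fun l hl => Finset.mem_image_of_mem J hl) _).symm
    _ ≤ ∑ j ∈ S.image J, 2 * C * k / T * (2 / 3) ^ j := by
        refine Finset.sum_le_sum fun j _ => ?_
        calc ∑ l ∈ S with J l = j, Λ l * Real.exp (-T * |Real.log k - Real.log l|)
            ≤ ∑ l ∈ S with J l = j, Λ l * Real.exp (-1) ^ j := by
              refine Finset.sum_le_sum fun l hl => ?_
              refine mul_le_mul_of_nonneg_left ?_ (vM_nonneg l)
              rw [← Real.exp_nat_mul]
              refine Real.exp_le_exp.mpr ?_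
              have h1 := Nat.floor_le (a := T * |Real.log k - Real.log l|) (by positivity)
              rw [show ⌊T * |Real.log k - Real.log l|⌋₊ = j from (Finset.mem_filter.mp hl).2] at h1
              linarith
          _ = (∑ l ∈ S with J l = j, Λ l) * Real.exp (-1) ^ j := by rw [Finset.sum_mul]
          _ ≤ 2 * C * k / T * Real.exp (1 / 2) ^ j * Real.exp (-1) ^ j := by gcongr; exact hfib j
          _ = 2 * C * k / T * (Real.exp (-1) * Real.exp (1 / 2)) ^ j := by rw [mul_pow]; ring
          _ ≤ _ := by gcongr
    _ = 2 * C * k / T * ∑ j ∈ S.image J, (2 / 3 : ℝ) ^ j := by rw [Finset.mul_sum]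
    _ ≤ 2 * C * k / T * 3 := by
        gcongr
        have h := Summable.sum_le_tsum (f := fun j : ℕ => (2 / 3 : ℝ) ^ j) (S.image J)
          (fun j _ => by positivity) (summable_geometric_of_lt_one (by norm_num) (by norm_num))
        rw [tsum_geometric_of_lt_one (by norm_num) (by norm_num)] at h
        norm_num at h; simpa using h
    _ = _ := by ring

/-- A large-sieve type mean value bound for Dirichlet polynomials over prime powers. -/
lemma exists_mean_value : ∃ C : ℝ, 0 < C ∧ ∀ (S : Finset ℕ) (y T κ : ℝ), 2 ≤ T →
    T ^ 4 ≤ y → 0 ≤ κ → (∀ l ∈ S, y ≤ (l : ℝ)) → ∀ (w : ℕ → ℝ) (c : ℕ → ℂ),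
    (∀ k ∈ S, 0 ≤ w k) → (∀ k ∈ S, ‖c k‖ ≤ κ * Λ k * w k) →
    Integrable (fun t : ℝ => 2 * T / (T ^ 2 + t ^ 2) *
      ‖∑ k ∈ S, c k * cexp (-(Real.log k * t) * I)‖ ^ 2) ∧
    ∫ t : ℝ, 2 * T / (T ^ 2 + t ^ 2) * ‖∑ k ∈ S, c k * cexp (-(Real.log k * t) * I)‖ ^ 2 ≤
      C * κ ^ 2 / T * ∑ k ∈ S, Λ k * k * w k ^ 2 := by
  obtain ⟨C, hC, hbd⟩ := exists_sum_vM_exp_neg_abs_log_le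
  refine ⟨2 * Real.pi * C, by positivity, fun S y T κ hT hy hκ hS w c hw hc => ?_⟩
  have hT0 : 0 < T := by linarith
  have hy0 : 0 < y := lt_of_lt_of_le (by positivity) hy
  have hexp : ∀ t : ℝ, ((2 * T / (T ^ 2 + t ^ 2) *
      ‖∑ k ∈ S, c k * cexp (-(Real.log k * t) * I)‖ ^ 2 : ℝ) : ℂ) =
      ∑ k ∈ S, ∑ l ∈ S, c k * starRingEnd ℂ (c l) *
        (cexp (-((Real.log k - Real.log l : ℝ) * t) * I) *
          ((2 * T / (T ^ 2 + t ^ 2) : ℝ) : ℂ)) := by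
    intro t
    rw [ofReal_mul, ofReal_pow, ← Complex.mul_conj', map_sum, Finset.sum_mul_sum, Finset.mul_sum]
    refine Finset.sum_congr rfl fun k _ => ?_
    rw [Finset.mul_sum]
    refine Finset.sum_congr rfl fun l _ => ?_
    have : cexp (-((Real.log k - Real.log l : ℝ) * t) * I) =
        cexp (-(Real.log k * t) * I) * starRingEnd ℂ (cexp (-(Real.log l * t) * I)) := by
      rw [← Complex.exp_conj, ← Complex.exp_add]
      congr 1
      simp only [map_mul, map_neg, conj_ofReal, conj_I]
      push_cast; ring
    rw [this, map_mul]; ring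
  have h_itg : ∀ v : ℝ, Integrable fun t : ℝ =>
      cexp (-(v * t) * I) * ((2 * T / (T ^ 2 + t ^ 2) : ℝ) : ℂ) := by
    intro v
    refine (integrable_cauchy hT0).ofReal.bdd_mul (c := 1) ?_ ?_
    · exact (by fun_prop : Continuous fun t : ℝ => cexp (-(v * t) * I)).aestronglyMeasurable
    · refine Filter.Eventually.of_forall fun t => ?_
      rw [Complex.norm_exp]; simp
  have hintc : Integrable fun t : ℝ => ((2 * T / (T ^ 2 + t ^ 2) *
      ‖∑ k ∈ S, c k * cexp (-(Real.log k * t) * I)‖ ^ 2 : ℝ) : ℂ) := by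
    simp_rw [hexp]
    exact integrable_finsetSum _ fun k _ => integrable_finsetSum _ fun l _ =>
      (h_itg _).const_mul _
  refine ⟨hintc.re, ?_⟩
  have hval : ((∫ t : ℝ, 2 * T / (T ^ 2 + t ^ 2) *
      ‖∑ k ∈ S, c k * cexp (-(Real.log k * t) * I)‖ ^ 2 : ℝ) : ℂ) =
      ∑ k ∈ S, ∑ l ∈ S, c k * starRingEnd ℂ (c l) *
        ((2 * Real.pi * Real.exp (-T * |Real.log k - Real.log l|) : ℝ) : ℂ) := by
    rw [← integral_complex_ofReal]
    simp_rw [hexp]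
    rw [integral_finsetSum _ fun k _ => integrable_finsetSum _ fun l _ =>
      (h_itg _).const_mul _]
    refine Finset.sum_congr rfl fun k _ => ?_
    rw [integral_finsetSum _ fun l _ => (h_itg _).const_mul _]
    refine Finset.sum_congr rfl fun l _ => ?_
    rw [integral_const_mul, integral_cauchy hT0]
  set e : ℕ → ℕ → ℝ := fun k l => Real.exp (-T * |Real.log k - Real.log l|) with he
  have hsymm : ∀ k l, e k l = e l k := fun k l => by simp only [he]; rw [abs_sub_comm]
  have he0 : ∀ k l, 0 < e k l := fun k l => Real.exp_pos _
  have hdiag : ∑ k ∈ S, ∑ l ∈ S, Λ k * Λ l * w k ^ 2 * e k l ≤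
      C / T * ∑ k ∈ S, Λ k * k * w k ^ 2 := by
    rw [Finset.mul_sum]
    refine Finset.sum_le_sum fun k hk => ?_
    have hk0 : 0 < k := by
      have := hS k hk
      exact_mod_cast hy0.trans_le this
    have h1 := hbd S y T hT hy hS k hk0
    calc ∑ l ∈ S, Λ k * Λ l * w k ^ 2 * e k l = Λ k * w k ^ 2 * ∑ l ∈ S, Λ l * e k l := by
          rw [Finset.mul_sum]; exact Finset.sum_congr rfl fun l _ => by ring
      _ ≤ Λ k * w k ^ 2 * (C * k / T) :=
          mul_le_mul_of_nonneg_left h1 (mul_nonneg (vM_nonneg k) (sq_nonneg _))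
      _ = _ := by ring
  have hdiag' : ∑ k ∈ S, ∑ l ∈ S, Λ k * Λ l * w l ^ 2 * e k l =
      ∑ k ∈ S, ∑ l ∈ S, Λ k * Λ l * w k ^ 2 * e k l := by
    rw [Finset.sum_comm]
    refine Finset.sum_congr rfl fun k _ => Finset.sum_congr rfl fun l _ => ?_
    rw [hsymm l k]; ring
  refine (le_abs_self _).trans ?_
  rw [← Real.norm_eq_abs, ← Complex.norm_real, hval]
  calc _ ≤ ∑ k ∈ S, ∑ l ∈ S, ‖c k * starRingEnd ℂ (c l) * ((2 * Real.pi * e k l : ℝ) : ℂ)‖ :=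
        (norm_sum_le _ _).trans (Finset.sum_le_sum fun k _ => norm_sum_le _ _)
    _ ≤ ∑ k ∈ S, ∑ l ∈ S, Real.pi * κ ^ 2 *
        (Λ k * Λ l * w k ^ 2 * e k l + Λ k * Λ l * w l ^ 2 * e k l) := by
        refine Finset.sum_le_sum fun k hk => Finset.sum_le_sum fun l hl => ?_
        rw [norm_mul, norm_mul, RCLike.norm_conj, Complex.norm_real, Real.norm_of_nonneg
          (by have := he0 k l; positivity)]
        have h1 := vM_nonneg k
        have h2 := vM_nonneg l
        have h3 := he0 k l
        have h4 := hw k hk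
        have h5 := hw l hl
        calc ‖c k‖ * ‖c l‖ * (2 * Real.pi * e k l)
            ≤ (κ * Λ k * w k) * (κ * Λ l * w l) * (2 * Real.pi * e k l) := by
              gcongr
              · exact hc k hk
              · exact hc l hl
          _ = Real.pi * κ ^ 2 * (Λ k * Λ l * e k l * (2 * w k * w l)) := by ring
          _ ≤ Real.pi * κ ^ 2 * (Λ k * Λ l * e k l * (w k ^ 2 + w l ^ 2)) := by
              gcongr
              exact two_mul_le_add_sq _ _
          _ = _ := by ring
    _ = Real.pi * κ ^ 2 * (∑ k ∈ S, ∑ l ∈ S, Λ k * Λ l * w k ^ 2 * e k l +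
          ∑ k ∈ S, ∑ l ∈ S, Λ k * Λ l * w l ^ 2 * e k l) := by
        simp_rw [← Finset.mul_sum, Finset.sum_add_distrib]
    _ ≤ Real.pi * κ ^ 2 * (C / T * ∑ k ∈ S, Λ k * k * w k ^ 2 +
          C / T * ∑ k ∈ S, Λ k * k * w k ^ 2) := by
        rw [hdiag']; gcongr
    _ = _ := by ring

end

section

open scoped ArithmeticFunction.vonMangoldt

/-- Poisson's formula for a Dirichlet series in its half plane of absolute convergence. -/
lemma LSeries_poisson {c : ℕ → ℂ} {σ β : ℝ} (hc : LSeriesSummable c σ) (hβ : 0 < β) (t : ℝ) :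
    ∫ u : ℝ, LSeries c (σ + (t + u : ℝ) * I) * ((2 * β / (β ^ 2 + u ^ 2) : ℝ) : ℂ) =
      (2 * Real.pi : ℝ) * LSeries c ((σ + β : ℝ) + t * I) := by
  have hre : ∀ v : ℝ, ((σ : ℂ) + v * I).re = σ := fun v => by simp
  have hsum : ∀ v : ℝ, LSeriesSummable c (σ + v * I) := fun v =>
    hc.of_re_le_re (by simp)
  have hnorm : ∀ (v : ℝ) (n : ℕ), ‖LSeries.term c (σ + v * I) n‖ = ‖LSeries.term c σ n‖ := by
    intro v n
    rw [LSeries.norm_term_eq, LSeries.norm_term_eq, hre, ofReal_re]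
  have hterm : ∀ (n : ℕ) (u : ℝ), LSeries.term c (σ + (t + u : ℝ) * I) n =
      LSeries.term c (σ + t * I) n * cexp (-(Real.log n * u) * I) := by
    intro n u
    rcases eq_or_ne n 0 with rfl | hn
    · simp
    have hn0 : (n : ℂ) ≠ 0 := by exact_mod_cast hn
    rw [LSeries.term_of_ne_zero hn, LSeries.term_of_ne_zero hn,
      show (σ : ℂ) + (t + u : ℝ) * I = (σ + t * I) + u * I by push_cast; ring,
      Complex.cpow_add _ _ hn0, Complex.cpow_def_of_ne_zero hn0 (u * I),
      show -((Real.log n : ℂ) * u) * I = -(Complex.log n * (u * I)) by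
        rw [Complex.natCast_log]; ring, Complex.exp_neg]
    field_simp
  have hK : ∀ u : ℝ, 0 ≤ 2 * β / (β ^ 2 + u ^ 2) := fun u => by positivity
  set φ : ℕ → ℝ → ℂ := fun n u => LSeries.term c (σ + (t + u : ℝ) * I) n *
    ((2 * β / (β ^ 2 + u ^ 2) : ℝ) : ℂ) with hφ
  have hφeq : ∀ n, φ n = fun u : ℝ => LSeries.term c (σ + t * I) n *
      (cexp (-(Real.log n * u) * I) * ((2 * β / (β ^ 2 + u ^ 2) : ℝ) : ℂ)) := by
    intro n; funext u; simp only [hφ]; rw [hterm]; ring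
  have h_itg : ∀ n, Integrable (φ n) := by
    intro n
    rw [hφeq]
    refine Integrable.const_mul ?_ _
    refine (integrable_cauchy hβ).ofReal.bdd_mul (c := 1) ?_ ?_
    · exact (by fun_prop :
        Continuous fun u : ℝ => cexp (-(Real.log n * u) * I)).aestronglyMeasurable
    · refine Filter.Eventually.of_forall fun u => ?_
      rw [Complex.norm_exp, ← ofReal_mul, ← ofReal_neg, re_ofReal_mul, I_re, mul_zero,
        Real.exp_zero]
  have hnint : ∀ n, ∫ u, ‖φ n u‖ = ‖LSeries.term c σ n‖ * (2 * Real.pi) := by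
    intro n
    rw [← integral_cauchy_zero hβ, ← integral_const_mul]
    congr 1; funext u
    simp only [hφ]
    rw [norm_mul, hnorm, Complex.norm_real, Real.norm_of_nonneg (hK u)]
  have hmain := hasSum_integral_of_summable_integral_norm h_itg (by
    simp_rw [hnint]; exact (hc.norm).mul_right _)
  have h1 : ∀ u : ℝ, ∑' n, φ n u = LSeries c (σ + (t + u : ℝ) * I) *
      ((2 * β / (β ^ 2 + u ^ 2) : ℝ) : ℂ) := by
    intro u
    simp only [hφ]
    rw [tsum_mul_right, LSeries]
  simp_rw [h1] at hmain
  rw [← hmain.tsum_eq, LSeries, ← tsum_mul_left]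
  congr 1; funext n
  rw [hφeq, integral_const_mul, integral_cauchy hβ]
  rcases eq_or_ne n 0 with rfl | hn
  · simp
  have hn0 : (0 : ℝ) < n := by exact_mod_cast Nat.pos_of_ne_zero hn
  have hnc : (n : ℂ) ≠ 0 := by exact_mod_cast hn
  have hln : 0 ≤ Real.log n := Real.log_natCast_nonneg n
  rw [LSeries.term_of_ne_zero hn, LSeries.term_of_ne_zero hn, abs_of_nonneg hln,
    show ((σ + β : ℝ) : ℂ) + t * I = (σ + t * I) + β by push_cast; ring,
    Complex.cpow_add (σ + t * I : ℂ) _ hnc, Complex.cpow_def_of_ne_zero hnc (β : ℂ),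
    show -β * Real.log n = -(Real.log n * β) by ring, Real.exp_neg, ← Complex.natCast_log]
  push_cast
  have := Complex.exp_ne_zero ((Real.log n : ℂ) * β)
  field_simp

lemma norm_LSeries_shift_le {c : ℕ → ℂ} {σ β : ℝ} (hc : LSeriesSummable c σ) (hβ : 0 ≤ β)
    {Q G T : ℝ} (hQ0 : 0 ≤ Q) (hT : 0 < T)
    (hQ : ∀ u : ℝ, |u| ≤ T → ‖LSeries c (σ + u * I)‖ ≤ Q)
    (hG : ∀ u : ℝ, ‖LSeries c (σ + u * I)‖ ≤ G) {t : ℝ} (ht : |t| ≤ T / 2) :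
    ‖LSeries c ((σ + β : ℝ) + t * I)‖ ≤ Q + 4 * G * β / T := by
  have hG0 : 0 ≤ G := (norm_nonneg _).trans (hG 0)
  rcases hβ.eq_or_lt with rfl | hβ
  · simpa using hQ t (ht.trans (by linarith))
  have ha : 0 < T / 2 := by positivity
  have hK : ∀ u : ℝ, 0 ≤ 2 * β / (β ^ 2 + u ^ 2) := fun u => by positivity
  have hK' : ∀ u : ℝ, 0 ≤ 2 * (T / 2) / ((T / 2) ^ 2 + u ^ 2) := fun u => by positivity
  have hpt : ∀ u : ℝ, ‖LSeries c (σ + (t + u : ℝ) * I) * ((2 * β / (β ^ 2 + u ^ 2) : ℝ) : ℂ)‖ ≤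
      Q * (2 * β / (β ^ 2 + u ^ 2)) +
        (4 * G * β / T) * (2 * (T / 2) / ((T / 2) ^ 2 + u ^ 2)) := by
    intro u
    rw [norm_mul, Complex.norm_real, Real.norm_of_nonneg (hK u)]
    rcases le_or_gt |u| (T / 2) with h | h
    · have h1 := hQ (t + u) ((abs_add_le _ _).trans (by linarith))
      calc _ ≤ Q * (2 * β / (β ^ 2 + u ^ 2)) := mul_le_mul_of_nonneg_right h1 (hK u)
        _ ≤ _ := le_add_of_nonneg_right (mul_nonneg (by positivity) (hK' u))
    · have hu2 : (T / 2) ^ 2 ≤ u ^ 2 := by rw [← sq_abs u]; gcongr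
      have h2 : 2 * β / (β ^ 2 + u ^ 2) ≤
          (4 * β / T) * (2 * (T / 2) / ((T / 2) ^ 2 + u ^ 2)) := by
        have hpos : 0 < (T / 2) ^ 2 + u ^ 2 := by positivity
        rw [div_mul_div_comm, div_le_div_iff₀ (by positivity) (by positivity)]
        have h3 : (T / 2) ^ 2 + u ^ 2 ≤ 2 * (β ^ 2 + u ^ 2) := by nlinarith
        calc 2 * β * (T * ((T / 2) ^ 2 + u ^ 2)) ≤ 2 * β * (T * (2 * (β ^ 2 + u ^ 2))) := by gcongr
          _ = _ := by ring
      calc _ ≤ G * ((4 * β / T) * (2 * (T / 2) / ((T / 2) ^ 2 + u ^ 2))) :=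
            mul_le_mul (hG _) h2 (hK u) hG0
        _ = (4 * G * β / T) * (2 * (T / 2) / ((T / 2) ^ 2 + u ^ 2)) := by ring
        _ ≤ _ := le_add_of_nonneg_left (mul_nonneg hQ0 (hK u))
  have h := norm_integral_le_of_norm_le
    (((integrable_cauchy hβ).const_mul Q).add ((integrable_cauchy ha).const_mul (4 * G * β / T)))
    (Filter.Eventually.of_forall hpt)
  rw [LSeries_poisson hc hβ, integral_add' ((integrable_cauchy hβ).const_mul Q)
    ((integrable_cauchy ha).const_mul (4 * G * β / T)), integral_const_mul, integral_const_mul,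
    integral_cauchy_zero hβ, integral_cauchy_zero ha, norm_mul, Complex.norm_real,
    Real.norm_of_nonneg (by positivity)] at h
  have hp : 0 < 2 * Real.pi := by positivity
  have h' : 2 * Real.pi * ‖LSeries c ((σ + β : ℝ) + t * I)‖ ≤
      2 * Real.pi * (Q + 4 * G * β / T) := by linarith
  exact le_of_mul_le_mul_left h' hp

end

section

open scoped ArithmeticFunction.vonMangoldt
open scoped LSeries.notation

/-- The twist `n ↦ c(n) n^{-a}`. -/
def powTwist (a : ℝ) (c : ℕ → ℂ) (n : ℕ) : ℂ := c n * (((n : ℝ) ^ (-a) : ℝ) : ℂ)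

/-- The twist of `f` by a power of the rough part. -/
def roTwist (y : ℕ) (a : ℝ) (f : ℕ → ℂ) (n : ℕ) : ℂ :=
  f n * (((roPart y n : ℝ) ^ (-a) : ℝ) : ℂ)

lemma term_powTwist (a : ℝ) (c : ℕ → ℂ) (s : ℂ) :
    LSeries.term (powTwist a c) s = LSeries.term c (s + a) := by
  funext n
  rcases eq_or_ne n 0 with rfl | hn
  · simp
  have hn0 : (n : ℂ) ≠ 0 := by exact_mod_cast hn
  rw [LSeries.term_of_ne_zero hn, LSeries.term_of_ne_zero hn, powTwist,
    Complex.cpow_add _ _ hn0, Real.rpow_neg (Nat.cast_nonneg n), ofReal_inv,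
    Complex.ofReal_cpow (Nat.cast_nonneg n), ofReal_natCast]
  field_simp

lemma LSeries_powTwist (a : ℝ) (c : ℕ → ℂ) (s : ℂ) :
    LSeries (powTwist a c) s = LSeries c (s + a) := by
  rw [LSeries, LSeries, term_powTwist]

lemma LSeriesSummable_powTwist {a : ℝ} {c : ℕ → ℂ} {s : ℂ} :
    LSeriesSummable (powTwist a c) s ↔ LSeriesSummable c (s + a) := by
  rw [LSeriesSummable, LSeriesSummable, term_powTwist]

variable {κ : ℝ} {f Λf : ℕ → ℂ}

lemma IsHalaszClass.roTwist_eq_convolution (h : IsHalaszClass κ f Λf) (y : ℕ) (a : ℝ) {n : ℕ}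
    (hn : n ≠ 0) : roTwist y a f n =
      ((_root_.restr (SmoothBelow y) f) ⍟ powTwist a (_root_.restr (RoughFrom y) f)) n := by
  rw [roTwist, ← h.convolution_smooth_rough y hn, LSeries.convolution_def,
    LSeries.convolution_def]
  dsimp only
  rw [Finset.sum_mul]
  refine Finset.sum_congr rfl fun p hp => ?_
  obtain ⟨hp1, -⟩ := Nat.mem_divisorsAntidiagonal.mp hp
  by_cases hs : SmoothBelow y p.1
  · by_cases hr : RoughFrom y p.2
    · have h2 : p.2 ≠ 0 := fun h0 => hn (by rw [← hp1, h0, mul_zero])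
      rw [← hp1, (smPart_roPart_unique hs hr h2).2, powTwist, mul_assoc]
    · rw [powTwist, restr_of_not hr]; simp
  · rw [restr_of_not hs]; simp

lemma IsHalaszClass.mul_log_roPart (h : IsHalaszClass κ f Λf) (hκ : 0 < κ) (y : ℕ) {n : ℕ}
    (hn : n ≠ 0) : f n * (Real.log (roPart y n) : ℂ) =
      ∑ p ∈ n.divisorsAntidiagonal, _root_.restr (RoughFrom y) Λf p.1 * f p.2 := by
  obtain ⟨h1, h2, h3⟩ := smPart_spec (y := y) hn
  set a := smPart y n with ha
  set b := roPart y n with hb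
  have hb0 : b ≠ 0 := (roPart_pos hn).ne'
  have hcop : Nat.Coprime a b := h2.coprime h3
  have hrb : _root_.restr (RoughFrom y) f b = f b := restr_of hb0 h3
  have e1 := (h.rough y).conv b (Nat.pos_of_ne_zero hb0)
  rw [hrb] at e1
  have e2 : ∑ p ∈ n.divisorsAntidiagonal, _root_.restr (RoughFrom y) Λf p.1 * f p.2 =
      ∑ d ∈ n.divisors, _root_.restr (RoughFrom y) Λf d * f (n / d) :=
    Nat.sum_divisorsAntidiagonal (fun i j => _root_.restr (RoughFrom y) Λf i * f j)
  rw [e2, ← Finset.sum_subset (Nat.divisors_subset_of_dvd hn (Dvd.intro_left a h1))]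
  · conv_lhs => rw [← h1]
    rw [h.mult _ _ hcop, mul_assoc, e1, Finset.mul_sum]
    refine Finset.sum_congr rfl fun d hd => ?_
    have hd' := Nat.dvd_of_mem_divisors hd
    have hbd0 : b / d ≠ 0 := (Nat.div_pos (Nat.le_of_dvd (Nat.pos_of_ne_zero hb0) hd')
      (Nat.pos_of_mem_divisors hd)).ne'
    have hrd : RoughFrom y (b / d) := h3.of_dvd (Nat.div_dvd_of_dvd hd')
    rw [restr_of hbd0 hrd, ← h1, Nat.mul_div_assoc _ hd', h.mult _ _ (h2.coprime hrd)]
    ring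
  · intro d hd hdb
    have hd' := Nat.dvd_of_mem_divisors hd
    by_cases hr : RoughFrom y d
    · refine absurd (Nat.mem_divisors.mpr ⟨?_, hb0⟩) hdb
      rw [← h1] at hd'
      exact (Nat.Coprime.symm (h2.coprime hr)).dvd_of_dvd_mul_left hd'
    · rw [restr_of_not hr, zero_mul]

lemma roPart_mul_of_rough {y k m : ℕ} (hk : RoughFrom y k) (hk0 : k ≠ 0) (hm : m ≠ 0) :
    smPart y (k * m) = smPart y m ∧ roPart y (k * m) = k * roPart y m := by
  obtain ⟨h1, h2⟩ := smPart_roPart_mul (y := y) hk0 hm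
  obtain ⟨h3, h4⟩ := smPart_roPart_of_rough hk hk0
  rw [h1, h2, h3, h4, one_mul]
  exact ⟨rfl, rfl⟩

/-- The rough part of `Λf`, truncated at `N`. -/
def roughTrunc (y N : ℕ) (Λf : ℕ → ℂ) (k : ℕ) : ℂ :=
  if k ≤ N then restr (RoughFrom y) Λf k else 0

lemma IsHalaszClass.roughTrunc_convolution_roTwist (h : IsHalaszClass κ f Λf) (hκ : 0 < κ)
    (y N : ℕ) (a : ℝ) {n : ℕ} (hn : n ≠ 0) (hnN : n ≤ N) :
    ((powTwist a (roughTrunc y N Λf)) ⍟ roTwist y a f) n =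
      roTwist y a f n * (Real.log (roPart y n) : ℂ) := by
  rw [LSeries.convolution_def, roTwist, mul_right_comm, h.mul_log_roPart hκ y hn, Finset.sum_mul]
  refine Finset.sum_congr rfl fun p hp => ?_
  obtain ⟨hp1, -⟩ := Nat.mem_divisorsAntidiagonal.mp hp
  have hp0 : p.1 ≠ 0 := fun h0 => hn (by rw [← hp1, h0, zero_mul])
  have hp20 : p.2 ≠ 0 := fun h0 => hn (by rw [← hp1, h0, mul_zero])
  have hpN : p.1 ≤ N := (Nat.le_of_dvd (Nat.pos_of_ne_zero hn) (Dvd.intro _ hp1)).trans hnN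
  rw [powTwist, roughTrunc, if_pos hpN]
  by_cases hr : RoughFrom y p.1
  · rw [roTwist, ← hp1, (roPart_mul_of_rough hr hp0 hp20).2, Nat.cast_mul,
      Real.mul_rpow (Nat.cast_nonneg _) (Nat.cast_nonneg _), ofReal_mul]
    ring
  · rw [restr_of_not hr]; ring

/-- The coefficients `λ⍟λ⍟f` (with twists) appearing in the doubly integrated Perron formula. -/
def dblConv (y N : ℕ) (α β : ℝ) (f Λf : ℕ → ℂ) : ℕ → ℂ :=
  powTwist α (roughTrunc y N Λf) ⍟
    (powTwist (α + 2 * β) (roughTrunc y N Λf) ⍟ roTwist y (α + 2 * β) f)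

lemma IsHalaszClass.dblConv_eq (h : IsHalaszClass κ f Λf) (hκ : 0 < κ) (y N : ℕ) (α β : ℝ)
    {n : ℕ} (hn : n ≠ 0) (hnN : n ≤ N) : dblConv y N α β f Λf n =
      ∑ p ∈ n.divisorsAntidiagonal, _root_.restr (RoughFrom y) Λf p.1 * f p.2 *
        ((Real.log (roPart y p.2) * (roPart y p.2 : ℝ) ^ (-(2 * β)) *
          (roPart y n : ℝ) ^ (-α) : ℝ) : ℂ) := by
  rw [dblConv, LSeries.convolution_def]
  refine Finset.sum_congr rfl fun p hp => ?_
  obtain ⟨hp1, -⟩ := Nat.mem_divisorsAntidiagonal.mp hp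
  have hp0 : p.1 ≠ 0 := fun h0 => hn (by rw [← hp1, h0, zero_mul])
  have hp20 : p.2 ≠ 0 := fun h0 => hn (by rw [← hp1, h0, mul_zero])
  have hpN : p.1 ≤ N := (Nat.le_of_dvd (Nat.pos_of_ne_zero hn) (Dvd.intro _ hp1)).trans hnN
  have hp2N : p.2 ≤ N := (Nat.le_of_dvd (Nat.pos_of_ne_zero hn) (Dvd.intro_left _ hp1)).trans hnN
  rw [h.roughTrunc_convolution_roTwist hκ y N _ hp20 hp2N, powTwist, roughTrunc, if_pos hpN]
  by_cases hr : RoughFrom y p.1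
  · have hro : (0 : ℝ) < roPart y p.2 := by exact_mod_cast roPart_pos hp20
    rw [roTwist, ← hp1, (roPart_mul_of_rough hr hp0 hp20).2, Nat.cast_mul,
      Real.mul_rpow (Nat.cast_nonneg _) (Nat.cast_nonneg _),
      show -(α + 2 * β) = -α + -(2 * β) by ring, Real.rpow_add hro]
    push_cast
    ring
  · rw [restr_of_not hr]; ring

lemma integral_log_mul_rpow_neg {b : ℝ} (hb : 0 < b) (c η : ℝ) :
    ∫ t in (0 : ℝ)..η, c * Real.log b * b ^ (-(c * t)) = 1 - b ^ (-(c * η)) := by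
  have hd : ∀ t : ℝ, HasDerivAt (fun t : ℝ => -b ^ (-(c * t))) (c * Real.log b * b ^ (-(c * t))) t := by
    intro t
    have h1 : HasDerivAt (fun t : ℝ => -(c * t)) (-c) t := by
      simpa using ((hasDerivAt_id' t).const_mul c).fun_neg
    have h2 := (h1.const_rpow hb).fun_neg
    exact h2.congr_deriv (by ring)
  rw [intervalIntegral.integral_eq_sub_of_hasDerivAt (fun t _ => hd t)]
  · simp; ring
  · refine Continuous.intervalIntegrable ?_ _ _
    exact continuous_const.mul ((Real.continuous_const_rpow hb.ne').comp (by fun_prop))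

/-- `∫₀^η b^{-α} dα`. -/
def powInt (η b : ℝ) : ℝ := ∫ α in (0 : ℝ)..η, b ^ (-α)

lemma integral_integral_powers {ι : Type*} (S : Finset ι) (C : ι → ℂ) (b d : ι → ℝ) (η : ℝ)
    (hb : ∀ i ∈ S, 0 < b i) (hd : ∀ i ∈ S, 0 < d i) :
    ∫ α in (0 : ℝ)..η, ∫ β in (0 : ℝ)..η,
        2 * ∑ i ∈ S, C i * ((Real.log (b i) * b i ^ (-(2 * β)) * d i ^ (-α) : ℝ) : ℂ) =
      ∑ i ∈ S, C i * (1 - b i ^ (-(2 * η)) : ℝ) * (powInt η (d i) : ℂ) := by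
  have hin : ∀ α : ℝ, ∫ β in (0 : ℝ)..η,
        2 * ∑ i ∈ S, C i * ((Real.log (b i) * b i ^ (-(2 * β)) * d i ^ (-α) : ℝ) : ℂ) =
      ∑ i ∈ S, C i * (1 - b i ^ (-(2 * η)) : ℝ) * ((d i ^ (-α) : ℝ) : ℂ) := by
    intro α
    have e : ∀ β : ℝ, 2 * ∑ i ∈ S, C i *
          ((Real.log (b i) * b i ^ (-(2 * β)) * d i ^ (-α) : ℝ) : ℂ) =
        ∑ i ∈ S, C i * ((d i ^ (-α) : ℝ) : ℂ) *
          ((2 * Real.log (b i) * b i ^ (-(2 * β)) : ℝ) : ℂ) := by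
      intro β
      rw [Finset.mul_sum]
      refine Finset.sum_congr rfl fun i _ => ?_
      push_cast; ring
    simp_rw [e]
    rw [intervalIntegral.integral_finsetSum]
    · refine Finset.sum_congr rfl fun i hi => ?_
      rw [intervalIntegral.integral_const_mul, intervalIntegral.integral_ofReal,
        integral_log_mul_rpow_neg (hb i hi)]
      ring
    · intro i hi
      refine Continuous.intervalIntegrable (continuous_const.mul (continuous_ofReal.comp ?_)) _ _
      exact continuous_const.mul ((Real.continuous_const_rpow (hb i hi).ne').comp (by fun_prop))
  simp_rw [hin]
  rw [intervalIntegral.integral_finsetSum]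
  · refine Finset.sum_congr rfl fun i hi => ?_
    rw [intervalIntegral.integral_const_mul, intervalIntegral.integral_ofReal, powInt]
  · intro i hi
    refine Continuous.intervalIntegrable (continuous_const.mul (continuous_ofReal.comp ?_)) _ _
    exact (Real.continuous_const_rpow (hd i hi).ne').comp (by fun_prop)

lemma IsHalaszClass.sum_eq_add_add_integral (h : IsHalaszClass κ f Λf) (hκ : 0 < κ) (y N : ℕ)
    (η : ℝ) (w : ℕ → ℝ) {T : Finset ℕ} (hT : ∀ n ∈ T, n ≠ 0 ∧ n ≤ N) :
    ∑ n ∈ T, f n * (w n : ℂ) = ∑ n ∈ T, roTwist y η f n * (w n : ℂ) +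
      ∑ n ∈ T, (∑ p ∈ n.divisorsAntidiagonal, _root_.restr (RoughFrom y) Λf p.1 *
        roTwist y (2 * η) f p.2) * (powInt η (roPart y n) * w n : ℝ) +
      ∫ α in (0 : ℝ)..η, ∫ β in (0 : ℝ)..η,
        2 * ∑ n ∈ T, dblConv y N α β f Λf n * (w n : ℂ) := by
  set S : Finset (Σ _ : ℕ, ℕ × ℕ) := T.sigma fun n => n.divisorsAntidiagonal with hS
  have e : ∀ α β : ℝ, ∑ n ∈ T, dblConv y N α β f Λf n * (w n : ℂ) =
      ∑ i ∈ S, (_root_.restr (RoughFrom y) Λf i.2.1 * f i.2.2 * (w i.1 : ℂ)) *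
        ((Real.log (roPart y i.2.2) * (roPart y i.2.2 : ℝ) ^ (-(2 * β)) *
          (roPart y i.1 : ℝ) ^ (-α) : ℝ) : ℂ) := by
    intro α β
    rw [hS, Finset.sum_sigma]
    refine Finset.sum_congr rfl fun n hn => ?_
    rw [h.dblConv_eq hκ y N α β (hT n hn).1 (hT n hn).2, Finset.sum_mul]
    refine Finset.sum_congr rfl fun p _ => ?_
    ring
  simp_rw [e]
  rw [integral_integral_powers, hS, Finset.sum_sigma, ← Finset.sum_add_distrib,
    ← Finset.sum_add_distrib]
  · refine Finset.sum_congr rfl fun n hn => ?_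
    have hro : (0 : ℝ) < roPart y n := by exact_mod_cast roPart_pos (hT n hn).1
    have e1 : ((Real.log (roPart y n) : ℝ) : ℂ) * (powInt η (roPart y n) : ℂ) =
        ((1 - (roPart y n : ℝ) ^ (-η) : ℝ) : ℂ) := by
      have := integral_log_mul_rpow_neg hro 1 η
      simp only [one_mul] at this
      rw [← ofReal_mul, ← this, powInt, intervalIntegral.integral_const_mul]
    have e2 : f n * (w n : ℂ) = roTwist y η f n * (w n : ℂ) +
        (f n * (Real.log (roPart y n) : ℂ)) * (powInt η (roPart y n) : ℂ) * (w n : ℂ) := by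
      rw [mul_assoc (f n), e1, roTwist]; push_cast; ring
    rw [e2, h.mul_log_roPart hκ y (hT n hn).1, add_assoc]
    congr 1
    rw [Finset.sum_mul, Finset.sum_mul, Finset.sum_mul, ← Finset.sum_add_distrib]
    refine Finset.sum_congr rfl fun p _ => ?_
    rw [roTwist]; push_cast; ring
  · intro i hi
    rw [hS, Finset.mem_sigma] at hi
    have := (Nat.mem_divisorsAntidiagonal.mp hi.2)
    have h0 : i.2.2 ≠ 0 := fun h0 => this.2 (by rw [← this.1, h0, mul_zero])
    exact_mod_cast roPart_pos h0
  · intro i hi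
    rw [hS, Finset.mem_sigma] at hi
    exact_mod_cast roPart_pos (hT _ hi.1).1

end

section

open scoped ArithmeticFunction.vonMangoldt

variable {κ : ℝ} {f Λf : ℕ → ℂ}

lemma exp_mul_log_add_le {κ A u : ℝ} (hu : 0 < u) :
    Real.exp (κ * (Real.log u + A)) = Real.exp (κ * A) * u ^ κ := by
  rw [Real.rpow_def_of_pos hu, ← Real.exp_add]; ring_nf

lemma IsHalaszClass.exists_sum_twistAbs_le (hκ : 0 < κ) : ∃ C : ℝ, 0 < C ∧
    ∀ f Λf : ℕ → ℂ, IsHalaszClass κ f Λf → ∀ (y : ℕ) (u v : ℝ), Real.exp 200 ≤ y → 0 ≤ u →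
    u ≤ 1 / Real.log y → 1 / Real.log y ≤ v →
    (∀ X Y : ℝ, C ≤ X → X ^ (2 / 3 : ℝ) ≤ Y → Y ≤ X →
      ∑ n ∈ Finset.Ioc ⌊X⌋₊ ⌊X + Y⌋₊, twistAbs y u v f n ≤
        C * (Y / Real.log X) * Real.log y ^ κ) ∧
    ∀ S : Finset ℕ, (∀ m ∈ S, m ≠ 0) →
      ∑ m ∈ S, twistAbs y u v f m / m ≤ C * Real.log y ^ κ := by
  obtain ⟨B, hB1, hB⟩ := IsHalaszClass.exists_shiuClass hκ
  obtain ⟨C, hC, hsh⟩ := exists_shiu hB1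
  refine ⟨C * Real.exp (κ * 48) + Real.exp (9 * B + κ * 48) + C + 1, by positivity,
    fun f Λf h y u v hy hu huy hv => ?_⟩
  have hy0 : (0 : ℝ) < y := (Real.exp_pos _).trans_le hy
  have hly : 200 ≤ Real.log y := by
    rw [Real.le_log_iff_exp_le hy0]; exact hy
  have hy2 : 2 ≤ y := by
    have : (2 : ℝ) ≤ y := by linarith [Real.add_one_le_exp (200 : ℝ)]
    exact_mod_cast this
  have hu2 : u ≤ 1 / 200 := huy.trans (one_div_le_one_div_of_le (by norm_num) hly)
  have hv0 : 0 ≤ v := (by positivity : 0 ≤ 1 / Real.log y).trans hv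
  have hg := hB f Λf h y u v hy2 hu hu2 huy hv0
  have hpr : ∀ S : Finset ℕ, (∀ p ∈ S, p.Prime) → Real.exp (∑ p ∈ S, twistAbs y u v f p / p) ≤
      Real.exp (κ * 48) * Real.log y ^ κ := fun S hS => by
    rw [← exp_mul_log_add_le (by linarith)]
    exact Real.exp_le_exp.mpr (h.sum_primes_twistAbs_le hκ hy hu huy hv hS)
  have hl0 : 0 ≤ Real.log y ^ κ := by positivity
  refine ⟨fun X Y hX hXY hYX => ?_, fun S hS => ?_⟩
  · have hCX : C ≤ X := le_trans (by
      have : 0 < C * Real.exp (κ * 48) + Real.exp (9 * B + κ * 48) := by positivity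
      linarith) hX
    have hX1 : 1 ≤ X := le_trans (by
      have : 0 < C * Real.exp (κ * 48) + Real.exp (9 * B + κ * 48) := by positivity
      linarith) hX
    have hY0 : 0 ≤ Y := (by positivity : (0 : ℝ) ≤ X ^ (2 / 3 : ℝ)).trans hXY
    have hq : 0 ≤ Y / Real.log X := div_nonneg hY0 (Real.log_nonneg hX1)
    calc _ ≤ C * (Y / Real.log X) *
          Real.exp (∑ p ∈ (⌊X⌋₊ + 1).primesBelow, twistAbs y u v f p / p) :=
          hsh _ hg X Y hCX hXY hYX
      _ ≤ C * (Y / Real.log X) * (Real.exp (κ * 48) * Real.log y ^ κ) := by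
          gcongr
          exact hpr _ fun p hp => Nat.prime_of_mem_primesBelow hp
      _ = C * Real.exp (κ * 48) * (Y / Real.log X) * Real.log y ^ κ := by ring
      _ ≤ _ := by
          gcongr
          linarith [Real.exp_pos (9 * B + κ * 48)]
  · set Y0 := S.sup id + 1 with hY0
    have hsm : ∀ a ∈ S, SmoothBelow Y0 a := fun a ha p hp hpa => by
      have h1 : p ≤ a := Nat.le_of_dvd (Nat.pos_of_ne_zero (hS a ha)) hpa
      have h2 : a ≤ S.sup id := Finset.le_sup (f := id) ha
      omega
    have h1 := hg.sum_smooth_le (by linarith) (ν := 0) (by norm_num) hsm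
    have hrw : ∀ m : ℕ, twistAbs y u v f m * (m : ℝ) ^ ((0 : ℝ) - 1) = twistAbs y u v f m / m := by
      intro m
      rw [zero_sub, Real.rpow_neg_one, div_eq_mul_inv]
    simp_rw [hrw] at h1
    calc _ ≤ _ := h1
      _ = Real.exp (9 * B) * Real.exp (∑ p ∈ Y0.primesBelow, twistAbs y u v f p / p) := by
          rw [Real.exp_add]
      _ ≤ Real.exp (9 * B) * (Real.exp (κ * 48) * Real.log y ^ κ) := by
          gcongr
          exact hpr _ fun p hp => Nat.prime_of_mem_primesBelow hp
      _ = Real.exp (9 * B + κ * 48) * Real.log y ^ κ := by rw [Real.exp_add]; ring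
      _ ≤ _ := by
          gcongr
          have : 0 < C * Real.exp (κ * 48) := by positivity
          linarith

lemma IsHalaszClass.exists_sum_norm_le (hκ : 0 < κ) : ∃ C : ℝ, 0 < C ∧
    ∀ f Λf : ℕ → ℂ, IsHalaszClass κ f Λf → ∀ X Y : ℝ, C ≤ X → X ^ (2 / 3 : ℝ) ≤ Y → Y ≤ X →
      ∑ n ∈ Finset.Ioc ⌊X⌋₊ ⌊X + Y⌋₊, ‖f n‖ ≤ C * (Y / Real.log X) * Real.log X ^ κ := by
  obtain ⟨B, hB1, hB⟩ := IsHalaszClass.exists_shiuClass hκ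
  obtain ⟨C, hC, hsh⟩ := exists_shiu hB1
  refine ⟨C * Real.exp (κ * 8) + C + Real.exp 1, by positivity, fun f Λf h X Y hX hXY hYX => ?_⟩
  have hCe : 0 < C * Real.exp (κ * 8) := by positivity
  have hXe : Real.exp 1 ≤ X := le_trans (by linarith) hX
  have hX1 : 1 < X := lt_of_lt_of_le (by linarith [Real.add_one_le_exp (1 : ℝ)]) hXe
  have hlX := Real.log_pos hX1
  have hg := hB f Λf h 2 0 0 le_rfl le_rfl (by norm_num)
    (div_nonneg zero_le_one (Real.log_natCast_nonneg 2)) le_rfl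
  have htw : twistAbs 2 0 0 f = fun n => ‖f n‖ := by
    funext n; simp [twistAbs]
  rw [htw] at hg
  have hY0 : 0 ≤ Y := (by positivity : (0 : ℝ) ≤ X ^ (2 / 3 : ℝ)).trans hXY
  have hq : 0 ≤ Y / Real.log X := div_nonneg hY0 hlX.le
  calc _ ≤ C * (Y / Real.log X) *
        Real.exp (∑ p ∈ (⌊X⌋₊ + 1).primesBelow, ‖f p‖ / p) := by
        exact hsh _ hg X Y (by linarith [Real.exp_pos 1]) hXY hYX
    _ ≤ C * (Y / Real.log X) * (Real.exp (κ * 8) * Real.log X ^ κ) := by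
        rw [← exp_mul_log_add_le hlX]
        gcongr
        refine h.sum_primes_norm_le hκ hXe fun p hp => ⟨Nat.prime_of_mem_primesBelow hp, ?_⟩
        exact (Nat.le_floor_iff (by linarith)).mp
          (Nat.lt_succ_iff.mp (Nat.lt_of_mem_primesBelow hp))
    _ = C * Real.exp (κ * 8) * (Y / Real.log X) * Real.log X ^ κ := by ring
    _ ≤ _ := by
        gcongr
        linarith [Real.exp_pos 1]

lemma sum_divisorsAntidiagonal_Ioc_le {a g : ℕ → ℝ} (ha : ∀ n, 0 ≤ a n) (hg : ∀ n, 0 ≤ g n)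
    {X Y : ℝ} (hX : 1 ≤ X) (hY : 0 ≤ Y) (hYX : Y ≤ X) :
    ∑ n ∈ Finset.Ioc ⌊X⌋₊ ⌊X + Y⌋₊, ∑ p ∈ n.divisorsAntidiagonal, a p.1 * g p.2 ≤
      ∑ k ∈ Finset.Icc 1 ⌊√X⌋₊, a k * ∑ m ∈ Finset.Ioc ⌊X / k⌋₊ ⌊X / k + Y / k⌋₊, g m +
      ∑ m ∈ Finset.Icc 1 ⌊2 * √X⌋₊, g m * ∑ k ∈ Finset.Ioc ⌊X / m⌋₊ ⌊X / m + Y / m⌋₊, a k := by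
  have hX0 : 0 < X := by linarith
  set M := ⌊X + Y⌋₊ with hM
  set T := Finset.Ioc ⌊X⌋₊ M with hT
  have hTmem : ∀ n, n ∈ T ↔ X < n ∧ (n : ℝ) ≤ X + Y := by
    intro n
    rw [hT, Finset.mem_Ioc, Nat.floor_lt hX0.le, hM, Nat.le_floor_iff (by linarith)]
  set P := ((Finset.Icc 1 M) ×ˢ (Finset.Icc 1 M)).filter fun p => p.1 * p.2 ∈ T with hP
  have hfib : ∑ n ∈ T, ∑ p ∈ n.divisorsAntidiagonal, a p.1 * g p.2 =
      ∑ p ∈ P, a p.1 * g p.2 := by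
    rw [← Finset.sum_fiberwise_of_maps_to (s := P) (t := T) (g := fun p => p.1 * p.2)
      (fun p hp => (Finset.mem_filter.mp hp).2)]
    refine Finset.sum_congr rfl fun n hn => Finset.sum_congr ?_ fun _ _ => rfl
    have hn0 : n ≠ 0 := by
      rintro rfl
      have := ((hTmem 0).mp hn).1
      simp at this; linarith
    ext p
    simp only [hP, Nat.mem_divisorsAntidiagonal, Finset.mem_filter, Finset.mem_product,
      Finset.mem_Icc]
    constructor
    · rintro ⟨h1, -⟩
      have h01 : p.1 ≠ 0 := fun h0 => hn0 (by rw [← h1, h0, zero_mul])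
      have h02 : p.2 ≠ 0 := fun h0 => hn0 (by rw [← h1, h0, mul_zero])
      have hnM : n ≤ M := (Finset.mem_Ioc.mp hn).2
      have l1 : p.1 ≤ n := Nat.le_of_dvd (Nat.pos_of_ne_zero hn0) (Dvd.intro _ h1)
      have l2 : p.2 ≤ n := Nat.le_of_dvd (Nat.pos_of_ne_zero hn0) (Dvd.intro_left _ h1)
      refine ⟨⟨⟨⟨by omega, by omega⟩, by omega, by omega⟩, h1 ▸ hn⟩, h1⟩
    · rintro ⟨-, h1⟩
      exact ⟨h1, hn0⟩
  rw [hfib]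
  have hpos : ∀ p : ℕ × ℕ, 0 ≤ a p.1 * g p.2 := fun p => mul_nonneg (ha _) (hg _)
  have hsq : 0 < √X := Real.sqrt_pos.mpr hX0
  have hsq2 : √X * √X = X := Real.mul_self_sqrt hX0.le
  have hA : ∑ p ∈ P with p.1 ≤ ⌊√X⌋₊, a p.1 * g p.2 ≤
      ∑ k ∈ Finset.Icc 1 ⌊√X⌋₊, a k * ∑ m ∈ Finset.Ioc ⌊X / k⌋₊ ⌊X / k + Y / k⌋₊, g m := by
    simp_rw [Finset.mul_sum]
    rw [Finset.sum_sigma']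
    rw [← Finset.sum_image (s := P.filter fun p => p.1 ≤ ⌊√X⌋₊)
      (g := fun p : ℕ × ℕ => (⟨p.1, p.2⟩ : Σ _ : ℕ, ℕ)) (f := fun i => a i.1 * g i.2)]
    · refine Finset.sum_le_sum_of_subset_of_nonneg ?_ fun i _ _ => mul_nonneg (ha _) (hg _)
      intro i hi
      obtain ⟨p, hp, rfl⟩ := Finset.mem_image.mp hi
      simp only [hP, Finset.mem_filter, Finset.mem_product, Finset.mem_Icc, hTmem] at hp
      obtain ⟨⟨⟨⟨h1, -⟩, h2, -⟩, h3, h4⟩, h5⟩ := hp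
      have hk : (0 : ℝ) < p.1 := by exact_mod_cast h1
      push_cast at h3 h4
      rw [Finset.mem_sigma, Finset.mem_Icc, Finset.mem_Ioc]
      dsimp only
      rw [Nat.floor_lt (by positivity), ← add_div, Nat.le_floor_iff (by positivity : 0 ≤ (X + Y) / _),
        div_lt_iff₀ hk, le_div_iff₀ hk]
      exact ⟨⟨h1, h5⟩, by linarith, by linarith⟩
    · rintro ⟨p, q⟩ _ ⟨p', q'⟩ _ he
      simpa using he
  have hB : ∑ p ∈ P with ¬ p.1 ≤ ⌊√X⌋₊, a p.1 * g p.2 ≤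
      ∑ m ∈ Finset.Icc 1 ⌊2 * √X⌋₊, g m * ∑ k ∈ Finset.Ioc ⌊X / m⌋₊ ⌊X / m + Y / m⌋₊, a k := by
    simp_rw [Finset.mul_sum]
    rw [Finset.sum_sigma']
    simp_rw [mul_comm (g _) (a _)]
    rw [← Finset.sum_image (s := P.filter fun p => ¬ p.1 ≤ ⌊√X⌋₊)
      (g := fun p : ℕ × ℕ => (⟨p.2, p.1⟩ : Σ _ : ℕ, ℕ)) (f := fun i => a i.2 * g i.1)]
    · refine Finset.sum_le_sum_of_subset_of_nonneg ?_ fun i _ _ => mul_nonneg (ha _) (hg _)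
      intro i hi
      obtain ⟨p, hp, rfl⟩ := Finset.mem_image.mp hi
      simp only [hP, Finset.mem_filter, Finset.mem_product, Finset.mem_Icc, hTmem] at hp
      obtain ⟨⟨⟨⟨h1, -⟩, h2, -⟩, h3, h4⟩, h5⟩ := hp
      have hk : (0 : ℝ) < p.2 := by exact_mod_cast h2
      push_cast at h3 h4
      rw [not_le, Nat.floor_lt hsq.le] at h5
      rw [Finset.mem_sigma, Finset.mem_Icc, Finset.mem_Ioc]
      dsimp only
      rw [Nat.floor_lt (by positivity), ← add_div, Nat.le_floor_iff (by positivity : 0 ≤ (X + Y) / _),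
        Nat.le_floor_iff (by positivity), div_lt_iff₀ hk, le_div_iff₀ hk]
      refine ⟨⟨h2, ?_⟩, by linarith, by linarith⟩
      have : (p.2 : ℝ) * √X ≤ (2 * √X) * √X := by
        calc (p.2 : ℝ) * √X ≤ p.2 * p.1 := by gcongr
          _ ≤ 2 * X := by linarith
          _ = _ := by rw [mul_assoc, hsq2]
      exact le_of_mul_le_mul_right this hsq
    · rintro ⟨p, q⟩ _ ⟨p', q'⟩ _ he
      simp at he ⊢
      exact ⟨he.2, he.1⟩
  rw [← Finset.sum_filter_add_sum_filter_not P (fun p => p.1 ≤ ⌊√X⌋₊)]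
  exact add_le_add hA hB

end

section

open scoped ArithmeticFunction.vonMangoldt

variable {κ : ℝ} {f Λf : ℕ → ℂ}

lemma powInt_nonneg {η b : ℝ} (hη : 0 ≤ η) (hb : 0 ≤ b) : 0 ≤ powInt η b :=
  intervalIntegral.integral_nonneg hη fun _ _ => Real.rpow_nonneg hb _

lemma powInt_roPart_le {y n : ℕ} {η X : ℝ} (hη : 0 ≤ η) (hX : 1 < X) (hn : n ≠ 0)
    (hXn : X ≤ n) : powInt η (roPart y n) ≤ 2 / Real.log X * (smPart y n : ℝ) ^ η := by
  have ha : (1 : ℝ) ≤ smPart y n := by exact_mod_cast smPart_pos y n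
  have hb : (1 : ℝ) ≤ roPart y n := by exact_mod_cast roPart_pos (y := y) hn
  have hab : (smPart y n : ℝ) * roPart y n = n := by exact_mod_cast (smPart_spec (y := y) hn).1
  set a : ℝ := ((smPart y n : ℕ) : ℝ)
  set b : ℝ := ((roPart y n : ℕ) : ℝ)
  have ha0 : 0 < a := by linarith
  have hb0 : 0 < b := by linarith
  have hl : Real.log X ≤ Real.log a + Real.log b := by
    rw [← Real.log_mul ha0.ne' hb0.ne', hab]
    exact Real.log_le_log (by linarith) hXn
  have hlX : 0 < Real.log X := Real.log_pos hX
  rcases le_total (Real.log X / 2) (Real.log b) with h | h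
  · have e := integral_log_mul_rpow_neg hb0 1 η
    simp only [one_mul] at e
    rw [intervalIntegral.integral_const_mul] at e
    have e1 : Real.log b * powInt η b ≤ 1 := by
      have : 0 < b ^ (-η) := Real.rpow_pos_of_pos hb0 _
      rw [powInt, e]; linarith
    have e2 : powInt η b ≤ 2 / Real.log X := by
      rw [le_div_iff₀ hlX]
      have := powInt_nonneg hη hb0.le
      nlinarith
    refine e2.trans (le_mul_of_one_le_right (by positivity) (Real.one_le_rpow ha hη))
  · have e1 : powInt η b ≤ η := by
      have := intervalIntegral.norm_integral_le_of_norm_le_const (a := 0) (b := η) (C := 1)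
        (f := fun α => b ^ (-α)) (fun α hα => by
          rw [Set.uIoc_of_le hη] at hα
          rw [Real.norm_of_nonneg (by positivity)]
          exact Real.rpow_le_one_of_one_le_of_nonpos hb (by linarith [hα.1]))
      rw [sub_zero, abs_of_nonneg hη, one_mul] at this
      exact (le_abs_self _).trans this
    have e2 : η * (Real.log X / 2) ≤ a ^ η := by
      rw [Real.rpow_def_of_pos ha0]
      have h2 : Real.log X / 2 ≤ Real.log a := by linarith
      have : η * (Real.log X / 2) ≤ Real.log a * η := by rw [mul_comm]; gcongr
      linarith [Real.add_one_le_exp (Real.log a * η)]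
    rw [div_mul_eq_mul_div, le_div_iff₀ hlX]
    nlinarith

lemma div_rpow_le_div {X Y k : ℝ} (hX : 1 ≤ X) (hXY : X ^ (19 / 20 : ℝ) ≤ Y) (hk : 0 < k)
    (hZ : X ^ (1 / 4 : ℝ) ≤ X / k) : (X / k) ^ (4 / 5 : ℝ) ≤ Y / k := by
  have hX0 : 0 < X := by linarith
  set Z := X / k with hZd
  have hZ0 : 0 < Z := by positivity
  have h1 : X ^ (1 / 20 : ℝ) ≤ Z ^ (1 / 5 : ℝ) := by
    calc X ^ (1 / 20 : ℝ) = (X ^ (1 / 4 : ℝ)) ^ (1 / 5 : ℝ) := by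
          rw [← Real.rpow_mul hX0.le]; norm_num
      _ ≤ _ := by gcongr
  have h2 : Z ^ (4 / 5 : ℝ) * Z ^ (1 / 5 : ℝ) = Z := by
    rw [← Real.rpow_add hZ0]; norm_num
  have h3 : X ^ (19 / 20 : ℝ) * X ^ (1 / 20 : ℝ) = X := by
    rw [← Real.rpow_add hX0]; norm_num
  have h4 : Y / k = Z * (Y / X) := by rw [hZd]; field_simp
  have h5 : X ≤ Y * Z ^ (1 / 5 : ℝ) := by
    calc X = _ := h3.symm
      _ ≤ _ := mul_le_mul hXY h1 (by positivity) ((Real.rpow_nonneg hX0.le _).trans hXY)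
  rw [h4, ← mul_div_assoc, le_div_iff₀ hX0]
  calc Z ^ (4 / 5 : ℝ) * X ≤ Z ^ (4 / 5 : ℝ) * (Y * Z ^ (1 / 5 : ℝ)) := by gcongr
    _ = (Z ^ (4 / 5 : ℝ) * Z ^ (1 / 5 : ℝ)) * Y := by ring
    _ = _ := by rw [h2]

lemma IsHalaszClass.exists_sum_roTwist_le (hκ : 0 < κ) : ∃ C : ℝ, 0 < C ∧
    ∀ f Λf : ℕ → ℂ, IsHalaszClass κ f Λf → ∀ (y : ℕ) (X Y : ℝ), Real.exp 200 ≤ y → C ≤ X →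
    X ^ (19 / 20 : ℝ) ≤ Y → Y ≤ X → ∀ w : ℕ → ℝ, (∀ n, 0 ≤ w n ∧ w n ≤ 1) →
    ‖∑ n ∈ Finset.Ioc ⌊X⌋₊ ⌊X + Y⌋₊, roTwist y (1 / Real.log y) f n * (w n : ℂ)‖ ≤
      C * (Y / Real.log X) * Real.log y ^ κ := by
  obtain ⟨C, hC, H⟩ := IsHalaszClass.exists_sum_twistAbs_le hκ
  refine ⟨C + 1, by linarith, fun f Λf h y X Y hy hX hXY hYX w hw => ?_⟩
  have hX1 : 1 ≤ X := by linarith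
  have hly : 0 ≤ 1 / Real.log y :=
    one_div_nonneg.mpr (Real.log_natCast_nonneg y)
  have hY0 : 0 ≤ Y := (Real.rpow_nonneg (by linarith) _).trans hXY
  have h1 := (H f Λf h y 0 (1 / Real.log y) hy le_rfl hly le_rfl).1 X Y (by linarith)
    ((Real.rpow_le_rpow_of_exponent_le hX1 (by norm_num)).trans hXY) hYX
  have hb : 0 ≤ Y / Real.log X := div_nonneg hY0 (Real.log_nonneg hX1)
  have hc : 0 ≤ Real.log y ^ κ := Real.rpow_nonneg (Real.log_natCast_nonneg y) _
  refine (norm_sum_le _ _).trans (le_trans ?_ (h1.trans ?_))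
  · refine Finset.sum_le_sum fun n _ => ?_
    rw [norm_mul, roTwist, norm_mul, Complex.norm_real, Complex.norm_real,
      Real.norm_of_nonneg (hw n).1, Real.norm_of_nonneg (by positivity), twistAbs, Real.rpow_zero,
      mul_one]
    exact mul_le_of_le_one_right (by positivity) (hw n).2
  · gcongr; linarith

lemma norm_sum_rough_roTwist_le (h : IsHalaszClass κ f Λf) (hκ : 0 < κ) (y : ℕ) {η : ℝ}
    {n : ℕ} (hn : n ≠ 0) :
    ‖∑ p ∈ n.divisorsAntidiagonal, restr (RoughFrom y) Λf p.1 * roTwist y (2 * η) f p.2‖ *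
      (smPart y n : ℝ) ^ η ≤
    κ * ∑ p ∈ n.divisorsAntidiagonal, Λ p.1 * twistAbs y η (2 * η) f p.2 := by
  rw [Finset.mul_sum]
  refine le_trans (mul_le_mul_of_nonneg_right (norm_sum_le _ _) (by positivity)) ?_
  rw [Finset.sum_mul]
  refine Finset.sum_le_sum fun p hp => ?_
  obtain ⟨hp1, -⟩ := Nat.mem_divisorsAntidiagonal.mp hp
  have hp0 : p.1 ≠ 0 := fun h0 => hn (by rw [← hp1, h0, zero_mul])
  have hp20 : p.2 ≠ 0 := fun h0 => hn (by rw [← hp1, h0, mul_zero])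
  by_cases hr : RoughFrom y p.1
  · rw [restr_of hp0 hr, ← hp1, (roPart_mul_of_rough hr hp0 hp20).1, norm_mul, roTwist, norm_mul,
      Complex.norm_real, Real.norm_of_nonneg (by positivity), twistAbs]
    have := h.bound p.1 (Nat.pos_of_ne_zero hp0)
    calc ‖Λf p.1‖ * (‖f p.2‖ * (roPart y p.2 : ℝ) ^ (-(2 * η))) * (smPart y p.2 : ℝ) ^ η
        ≤ κ * Λ p.1 * (‖f p.2‖ * (roPart y p.2 : ℝ) ^ (-(2 * η))) * (smPart y p.2 : ℝ) ^ η := by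
          gcongr
      _ = _ := by ring
  · rw [restr_of_not hr, zero_mul, norm_zero, zero_mul]
    exact mul_nonneg hκ.le (mul_nonneg (vM_nonneg _) (twistAbs_nonneg _ _ _ _ _))

lemma IsHalaszClass.exists_sum_vM_twistAbs_le (hκ : 0 < κ) : ∃ C : ℝ, 0 < C ∧
    ∀ f Λf : ℕ → ℂ, IsHalaszClass κ f Λf → ∀ (y : ℕ) (X Y : ℝ), Real.exp 200 ≤ y → C ≤ X →
    X ^ (19 / 20 : ℝ) ≤ Y → Y ≤ X →
    ∑ n ∈ Finset.Ioc ⌊X⌋₊ ⌊X + Y⌋₊, ∑ p ∈ n.divisorsAntidiagonal,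
      Λ p.1 * twistAbs y (1 / Real.log y) (2 * (1 / Real.log y)) f p.2 ≤
      C * Y * Real.log y ^ κ := by
  obtain ⟨C, hC, H⟩ := IsHalaszClass.exists_sum_twistAbs_le hκ
  obtain ⟨D, hD, hBT⟩ := exists_brun_titchmarsh
  refine ⟨2 * C + D * C + C ^ 2 + Real.exp 12 + 16, by positivity,
    fun f Λf h y X Y hy hX hXY hYX => ?_⟩
  have hX16 : 16 ≤ X := by
    have : 0 ≤ 2 * C + D * C + C ^ 2 + Real.exp 12 := by positivity
    linarith
  have hX1 : 1 ≤ X := by linarith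
  have hX0 : 0 < X := by linarith
  have hXC : C ^ 2 ≤ X := by
    have : 0 ≤ 2 * C + D * C + Real.exp 12 := by positivity
    linarith
  have hlX : 12 ≤ Real.log X := by
    rw [Real.le_log_iff_exp_le hX0]
    have : 0 ≤ 2 * C + D * C + C ^ 2 := by positivity
    linarith
  have hY0 : 0 ≤ Y := (Real.rpow_nonneg hX0.le _).trans hXY
  have hly : 0 ≤ 1 / Real.log y :=
    one_div_nonneg.mpr (Real.log_natCast_nonneg y)
  obtain ⟨h1, h2⟩ := H f Λf h y (1 / Real.log y) (2 * (1 / Real.log y)) hy hly le_rfl (by linarith)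
  set g := twistAbs y (1 / Real.log y) (2 * (1 / Real.log y)) f with hg
  have hW : 0 ≤ Real.log y ^ κ := Real.rpow_nonneg (Real.log_natCast_nonneg y) _
  set W := Real.log y ^ κ with hWd
  have hg0 : ∀ n, 0 ≤ g n := twistAbs_nonneg _ _ _ _
  have hsq2 : √X * √X = X := Real.mul_self_sqrt hX0.le
  have hsq4 : 4 ≤ √X := Real.le_sqrt_of_sq_le (by linarith)
  have hsq0 : 0 < √X := by linarith
  have hq : X ^ (1 / 4 : ℝ) ≤ √X / 2 := by
    have e : X ^ (1 / 4 : ℝ) = √(√X) := by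
      rw [Real.sqrt_eq_rpow, Real.sqrt_eq_rpow, ← Real.rpow_mul hX0.le]; norm_num
    rw [e, Real.sqrt_le_left (by linarith)]
    nlinarith
  refine (sum_divisorsAntidiagonal_Ioc_le vM_nonneg hg0 hX1 hY0 hYX).trans ?_
  have hA : ∑ k ∈ Finset.Icc 1 ⌊√X⌋₊,
      Λ k * ∑ m ∈ Finset.Ioc ⌊X / k⌋₊ ⌊X / k + Y / k⌋₊, g m ≤ 2 * C * Y * W := by
    have e1 : ∀ k ∈ Finset.Icc 1 ⌊√X⌋₊,
        Λ k * ∑ m ∈ Finset.Ioc ⌊X / k⌋₊ ⌊X / k + Y / k⌋₊, g m ≤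
        Λ k / k * (2 * C * Y / Real.log X * W) := by
      intro k hk
      rw [Finset.mem_Icc, Nat.le_floor_iff hsq0.le] at hk
      have hk0 : (0 : ℝ) < k := by exact_mod_cast hk.1
      have hZ : √X ≤ X / k := by
        rw [le_div_iff₀ hk0]
        calc √X * k ≤ √X * √X := by gcongr; exact hk.2
          _ = X := hsq2
      have hZ1 : 1 ≤ X / k := by linarith
      have hCZ : C ≤ X / k := (Real.le_sqrt_of_sq_le hXC).trans hZ
      have hlZ : Real.log X / 2 ≤ Real.log (X / k) := by
        rw [← Real.log_sqrt hX0.le]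
        exact Real.log_le_log hsq0 hZ
      have := h1 (X / k) (Y / k) hCZ
        ((Real.rpow_le_rpow_of_exponent_le hZ1 (by norm_num)).trans
          (div_rpow_le_div hX1 hXY hk0 (by linarith))) (by gcongr)
      calc _ ≤ Λ k * (C * (Y / k / Real.log (X / k)) * W) := by
            gcongr
        _ ≤ Λ k * (C * (Y / k / (Real.log X / 2)) * W) := by
            have := vM_nonneg k
            gcongr
        _ = _ := by field_simp
    refine (Finset.sum_le_sum e1).trans ?_
    rw [← Finset.sum_mul]
    have e2 := sum_vM_div_le ⌊√X⌋₊
    have e3 : Real.log ⌊√X⌋₊ ≤ Real.log X / 2 := by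
      rw [← Real.log_sqrt hX0.le]
      refine Real.log_le_log ?_ (Nat.floor_le hsq0.le)
      exact_mod_cast Nat.floor_pos.mpr (by linarith)
    calc _ ≤ Real.log X * (2 * C * Y / Real.log X * W) := by
          have : 0 ≤ 2 * C * Y / Real.log X * W := by positivity
          gcongr
          linarith
      _ = _ := by field_simp
  have hB : ∑ m ∈ Finset.Icc 1 ⌊2 * √X⌋₊,
      g m * ∑ k ∈ Finset.Ioc ⌊X / m⌋₊ ⌊X / m + Y / m⌋₊, Λ k ≤ D * C * Y * W := by
    have e1 : ∀ m ∈ Finset.Icc 1 ⌊2 * √X⌋₊,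
        g m * ∑ k ∈ Finset.Ioc ⌊X / m⌋₊ ⌊X / m + Y / m⌋₊, Λ k ≤ g m / m * (D * Y) := by
      intro m hm
      rw [Finset.mem_Icc, Nat.le_floor_iff (by positivity)] at hm
      have hm0 : (0 : ℝ) < m := by exact_mod_cast hm.1
      have hZ : √X / 2 ≤ X / m := by
        rw [le_div_iff₀ hm0]
        calc √X / 2 * m ≤ √X / 2 * (2 * √X) := by gcongr; exact hm.2
          _ = √X * √X := by ring
          _ = X := hsq2
      have hZ1 : 1 ≤ X / m := by linarith
      have := hBT (Finset.Ioc ⌊X / m⌋₊ ⌊X / m + Y / m⌋₊) (X / m) (Y / m) hZ1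
        ((Real.rpow_le_rpow_of_exponent_le hZ1 (by norm_num)).trans
          (div_rpow_le_div hX1 hXY hm0 (by linarith)))
        (fun k hk => by
          rw [Finset.mem_Ioc, Nat.floor_lt (by positivity), Nat.le_floor_iff (by positivity)] at hk
          exact hk)
      calc _ ≤ g m * (D * (Y / m)) := by gcongr; exact hg0 m
        _ = _ := by ring
    refine (Finset.sum_le_sum e1).trans ?_
    rw [← Finset.sum_mul]
    have e2 := h2 (Finset.Icc 1 ⌊2 * √X⌋₊) (fun m hm => by
      rw [Finset.mem_Icc] at hm; omega)
    calc _ ≤ C * W * (D * Y) := by gcongr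
      _ = _ := by ring
  calc _ ≤ 2 * C * Y * W + D * C * Y * W := add_le_add hA hB
    _ = (2 * C + D * C) * Y * W := by ring
    _ ≤ _ := by
      refine mul_le_mul_of_nonneg_right (mul_le_mul_of_nonneg_right ?_ hY0) hW
      have : 0 ≤ C ^ 2 + Real.exp 12 := by positivity
      linarith

lemma IsHalaszClass.exists_sum_rough_roTwist_le (hκ : 0 < κ) : ∃ C : ℝ, 0 < C ∧
    ∀ f Λf : ℕ → ℂ, IsHalaszClass κ f Λf → ∀ (y : ℕ) (X Y : ℝ), Real.exp 200 ≤ y → C ≤ X →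
    X ^ (19 / 20 : ℝ) ≤ Y → Y ≤ X → ∀ w : ℕ → ℝ, (∀ n, 0 ≤ w n ∧ w n ≤ 1) →
    ‖∑ n ∈ Finset.Ioc ⌊X⌋₊ ⌊X + Y⌋₊, (∑ p ∈ n.divisorsAntidiagonal,
      _root_.restr (RoughFrom y) Λf p.1 * roTwist y (2 * (1 / Real.log y)) f p.2) *
      (powInt (1 / Real.log y) (roPart y n) * w n : ℝ)‖ ≤
      C * (Y / Real.log X) * Real.log y ^ κ := by
  obtain ⟨C, hC, H⟩ := IsHalaszClass.exists_sum_vM_twistAbs_le hκ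
  refine ⟨2 * κ * C + C + 2, by positivity, fun f Λf h y X Y hy hX hXY hYX w hw => ?_⟩
  have : 0 < κ * C := by positivity
  have hX1 : 1 < X := by linarith
  have hX0 : 0 < X := by linarith
  have hlX : 0 < Real.log X := Real.log_pos hX1
  have hly : 0 ≤ 1 / Real.log y :=
    one_div_nonneg.mpr (Real.log_natCast_nonneg y)
  have hY0 : 0 ≤ Y := (Real.rpow_nonneg hX0.le _).trans hXY
  have hW : 0 ≤ Real.log y ^ κ := Real.rpow_nonneg (Real.log_natCast_nonneg y) _
  have h1 := H f Λf h y X Y hy (by linarith) hXY hYX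
  have e : ∀ n ∈ Finset.Ioc ⌊X⌋₊ ⌊X + Y⌋₊, ‖(∑ p ∈ n.divisorsAntidiagonal,
      _root_.restr (RoughFrom y) Λf p.1 * roTwist y (2 * (1 / Real.log y)) f p.2) *
      (powInt (1 / Real.log y) (roPart y n) * w n : ℝ)‖ ≤ 2 * κ / Real.log X *
      ∑ p ∈ n.divisorsAntidiagonal,
        Λ p.1 * twistAbs y (1 / Real.log y) (2 * (1 / Real.log y)) f p.2 := by
    intro n hn
    have hXn : X < n := by
      rw [Finset.mem_Ioc, Nat.floor_lt hX0.le] at hn; exact hn.1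
    have hn0 : n ≠ 0 := by
      rintro rfl; simp at hXn; linarith
    have hp0 : 0 ≤ powInt (1 / Real.log y) (roPart y n) := powInt_nonneg hly (by positivity)
    rw [norm_mul, Complex.norm_real, Real.norm_of_nonneg (mul_nonneg hp0 (hw n).1)]
    calc _ ≤ ‖∑ p ∈ n.divisorsAntidiagonal, _root_.restr (RoughFrom y) Λf p.1 *
            roTwist y (2 * (1 / Real.log y)) f p.2‖ *
            (2 / Real.log X * (smPart y n : ℝ) ^ (1 / Real.log y)) := by
          refine mul_le_mul_of_nonneg_left ?_ (norm_nonneg _)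
          exact (mul_le_of_le_one_right hp0 (hw n).2).trans
            (powInt_roPart_le hly hX1 hn0 hXn.le)
      _ = 2 / Real.log X * (‖∑ p ∈ n.divisorsAntidiagonal, _root_.restr (RoughFrom y) Λf p.1 *
            roTwist y (2 * (1 / Real.log y)) f p.2‖ * (smPart y n : ℝ) ^ (1 / Real.log y)) := by
          ring
      _ ≤ 2 / Real.log X * (κ * ∑ p ∈ n.divisorsAntidiagonal,
            Λ p.1 * twistAbs y (1 / Real.log y) (2 * (1 / Real.log y)) f p.2) := by
          exact mul_le_mul_of_nonneg_left (norm_sum_rough_roTwist_le h hκ y hn0) (by positivity)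
      _ = _ := by ring
  refine (norm_sum_le _ _).trans ((Finset.sum_le_sum e).trans ?_)
  rw [← Finset.mul_sum]
  calc _ ≤ 2 * κ / Real.log X * (C * Y * Real.log y ^ κ) := by gcongr
    _ = 2 * κ * C * (Y / Real.log X) * Real.log y ^ κ := by ring
    _ ≤ _ := by gcongr; linarith

end

section

open scoped ArithmeticFunction.vonMangoldt
open scoped LSeries.notation

variable {κ : ℝ} {f Λf : ℕ → ℂ}

lemma roughTrunc_eq_zero (h : IsHalaszClass κ f Λf) {y N k : ℕ} (hk : k ∉ Finset.Icc y N) :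
    roughTrunc y N Λf k = 0 := by
  rw [Finset.mem_Icc, not_and_or] at hk
  unfold roughTrunc
  split_ifs with hN
  · have hky : k < y := by omega
    by_cases hr : RoughFrom y k
    · rcases eq_or_ne k 0 with rfl | h0
      · exact restr_zero
      rw [restr_of h0 hr]
      refine h.supp k fun hpp => ?_
      obtain ⟨p, hp, hpk⟩ := Nat.exists_prime_and_dvd hpp.ne_one
      have := hr p hp hpk
      have := Nat.le_of_dvd (Nat.pos_of_ne_zero h0) hpk
      omega
    · exact restr_of_not hr
  · rfl

lemma norm_roughTrunc_le (h : IsHalaszClass κ f Λf) (y N : ℕ) {k : ℕ} (hk : k ≠ 0) :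
    ‖roughTrunc y N Λf k‖ ≤ κ * Λ k := by
  have hb := h.bound k (Nat.pos_of_ne_zero hk)
  unfold roughTrunc
  split_ifs
  · exact (norm_restr_le k).trans hb
  · rw [norm_zero]; exact (norm_nonneg _).trans hb

lemma LSeriesSummable_roughTrunc (h : IsHalaszClass κ f Λf) (y N : ℕ) (s : ℂ) :
    LSeriesSummable (roughTrunc y N Λf) s :=
  summable_of_ne_finset_zero (s := Finset.Icc y N) fun k hk => by
    rw [LSeries.term, roughTrunc_eq_zero h hk, zero_div, ite_self]

lemma LSeries_roughTrunc (h : IsHalaszClass κ f Λf) {y : ℕ} (hy : 1 ≤ y) (N : ℕ) (c t : ℝ) :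
    LSeries (roughTrunc y N Λf) (c + t * I) = ∑ k ∈ Finset.Icc y N,
      (roughTrunc y N Λf k * (((k : ℝ) ^ (-c) : ℝ) : ℂ)) * cexp (-(Real.log k * t) * I) := by
  rw [LSeries, tsum_eq_sum (s := Finset.Icc y N) fun k hk => by
    rw [LSeries.term, roughTrunc_eq_zero h hk, zero_div, ite_self]]
  refine Finset.sum_congr rfl fun k hk => ?_
  have hk1 : k ≠ 0 := by have := (Finset.mem_Icc.mp hk).1; omega
  have hkc : (k : ℂ) ≠ 0 := by exact_mod_cast hk1
  rw [LSeries.term_of_ne_zero hk1, div_eq_mul_inv, ← Complex.cpow_neg, neg_add,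
    Complex.cpow_add _ _ hkc, mul_assoc, Complex.ofReal_cpow (Nat.cast_nonneg k), ofReal_natCast,
    Complex.cpow_def_of_ne_zero hkc (-(t * I)), Complex.natCast_log, ofReal_neg]
  congr 3
  ring

lemma norm_LSeries_roughTrunc_le (h : IsHalaszClass κ f Λf) {y : ℕ} (hy : 1 ≤ y) (N : ℕ)
    (c t : ℝ) : ‖LSeries (roughTrunc y N Λf) (c + t * I)‖ ≤
      κ * ∑ k ∈ Finset.Icc y N, Λ k * (k : ℝ) ^ (-c) := by
  rw [LSeries_roughTrunc h hy, Finset.mul_sum]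
  refine (norm_sum_le _ _).trans (Finset.sum_le_sum fun k hk => ?_)
  have hk1 : k ≠ 0 := by have := (Finset.mem_Icc.mp hk).1; omega
  rw [norm_mul, norm_mul, Complex.norm_real, Real.norm_of_nonneg (by positivity)]
  have : ‖cexp (-(Real.log k * t) * I)‖ = 1 := by
    have := Complex.norm_exp_ofReal_mul_I (-(Real.log k * t))
    push_cast at this ⊢
    exact this
  rw [this, mul_one, ← mul_assoc]
  gcongr
  exact norm_roughTrunc_le h y N hk1

lemma IsHalaszClass.exists_roughTrunc_mean_value : ∃ C : ℝ, 0 < C ∧ ∀ κ : ℝ, ∀ f Λf : ℕ → ℂ,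
    IsHalaszClass κ f Λf → 0 < κ → ∀ (y N : ℕ) (T c : ℝ), 2 ≤ T → T ^ 4 ≤ y →
    Integrable (fun t : ℝ => 2 * T / (T ^ 2 + t ^ 2) *
      ‖LSeries (roughTrunc y N Λf) (c + t * I)‖ ^ 2) ∧
    ∫ t : ℝ, 2 * T / (T ^ 2 + t ^ 2) * ‖LSeries (roughTrunc y N Λf) (c + t * I)‖ ^ 2 ≤
      C * κ ^ 2 / T * ∑ k ∈ Finset.Icc y N, Λ k * (k : ℝ) ^ (1 - 2 * c) := by
  obtain ⟨C, hC, H⟩ := exists_mean_value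
  refine ⟨C, hC, fun κ f Λf h hκ y N T c hT hTy => ?_⟩
  have hy1 : 1 ≤ y := by
    have : (1 : ℝ) ≤ y := (one_le_pow₀ (by linarith)).trans hTy
    exact_mod_cast this
  obtain ⟨h1, h2⟩ := H (Finset.Icc y N) y T κ hT hTy hκ.le
    (fun l hl => by exact_mod_cast (Finset.mem_Icc.mp hl).1) (fun k => (k : ℝ) ^ (-c))
    (fun k => roughTrunc y N Λf k * (((k : ℝ) ^ (-c) : ℝ) : ℂ)) (fun k _ => by positivity)
    (fun k hk => by
      have hk1 : k ≠ 0 := by have := (Finset.mem_Icc.mp hk).1; omega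
      rw [norm_mul, Complex.norm_real, Real.norm_of_nonneg (by positivity)]
      gcongr
      exact norm_roughTrunc_le h y N hk1)
  simp_rw [LSeries_roughTrunc h hy1 N c]
  refine ⟨h1, h2.trans (le_of_eq ?_)⟩
  congr 1
  refine Finset.sum_congr rfl fun k hk => ?_
  have hk0 : (0 : ℝ) < k := by
    have := (Finset.mem_Icc.mp hk).1
    exact_mod_cast (by omega : 0 < k)
  rw [mul_assoc]
  congr 1
  rw [← Real.rpow_natCast, ← Real.rpow_mul hk0.le]
  nth_rewrite 1 [← Real.rpow_one (k : ℝ)]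
  rw [← Real.rpow_add hk0]
  congr 1
  push_cast
  ring

lemma sum_vM_rpow_neg_le' {S : Finset ℕ} {τ : ℝ} (hτ : 0 < τ) (hτ1 : τ ≤ 1) :
    ∑ k ∈ S, Λ k * (k : ℝ) ^ (-(1 + τ)) ≤ 36 / τ := by
  refine le_trans (le_of_eq (Finset.sum_congr rfl fun k _ => ?_))
    (sum_vM_rpow_neg_le (S := S) hτ hτ1)
  rw [Real.rpow_neg (Nat.cast_nonneg k), div_eq_mul_inv]

lemma sum_vM_rpow_shift_le {y N : ℕ} (hy : 1 ≤ y) {x τ : ℝ} (hx : 1 ≤ x) (hN : (N : ℝ) ≤ 4 * x)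
    (hτ : 0 < τ) (hτ1 : τ ≤ 1) {c : ℝ} (hc : 1 - τ ≤ c) :
    ∑ k ∈ Finset.Icc y N, Λ k * (k : ℝ) ^ (-c) ≤ 4 * x ^ τ * (36 / τ) := by
  have hS : ∀ k ∈ Finset.Icc y N, (k : ℝ) ≤ 4 * x := fun k hk =>
    le_trans (by exact_mod_cast (Finset.mem_Icc.mp hk).2) hN
  have h0 := sum_vM_rpow_top_le hτ hτ1 hS
  have h4 : (4 * x) ^ τ ≤ 4 * x ^ τ := by
    rw [Real.mul_rpow (by norm_num) (by linarith)]
    gcongr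
    calc (4 : ℝ) ^ τ ≤ 4 ^ (1 : ℝ) := Real.rpow_le_rpow_of_exponent_le (by norm_num) hτ1
      _ = 4 := Real.rpow_one 4
  calc _ ≤ ∑ k ∈ Finset.Icc y N, (4 * x) ^ τ * (Λ k / k * (k / (4 * x)) ^ τ) := by
        refine Finset.sum_le_sum fun k hk => ?_
        have hk1 : (1 : ℝ) ≤ k := by
          have := (Finset.mem_Icc.mp hk).1
          exact_mod_cast (by omega : 1 ≤ k)
        have hk0 : (0 : ℝ) < k := by linarith
        have e : (4 * x) ^ τ * (Λ k / k * (k / (4 * x)) ^ τ) = Λ k * (k : ℝ) ^ (-1 + τ) := by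
          rw [Real.div_rpow hk0.le (by linarith), Real.rpow_add hk0, Real.rpow_neg_one]
          have : (4 * x) ^ τ ≠ 0 := (Real.rpow_pos_of_pos (by linarith) _).ne'
          field_simp
        rw [e]
        have := vM_nonneg k
        gcongr
        linarith
    _ = (4 * x) ^ τ * ∑ k ∈ Finset.Icc y N, Λ k / k * (k / (4 * x)) ^ τ := by
        rw [Finset.mul_sum]
    _ ≤ _ := by
        refine mul_le_mul h4 h0 (Finset.sum_nonneg fun k _ => ?_) (by positivity)
        have := vM_nonneg k
        positivity

lemma IsHalaszClass.roTwist_LSeries (h : IsHalaszClass κ f Λf) (hκ : 0 < κ) {y : ℕ} (hy : 2 ≤ y)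
    {a : ℝ} {s : ℂ} (hs : 19 / 20 ≤ s.re) (hsa : 1 < s.re + a) :
    _root_.LSeriesSummable (roTwist y a f) s ∧ LSeries (roTwist y a f) s =
      LSeries (_root_.restr (SmoothBelow y) f) s *
        LSeries (_root_.restr (RoughFrom y) f) (s + a) := by
  have h1 := h.smooth_summable hκ hy hs
  have h2 : _root_.LSeriesSummable (powTwist a (_root_.restr (RoughFrom y) f)) s :=
    LSeriesSummable_powTwist.mpr ((h.rough y).LSeriesSummable (by simpa using hsa))
  have e : ∀ {n : ℕ}, n ≠ 0 → roTwist y a f n = ((_root_.restr (SmoothBelow y) f) ⍟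
      powTwist a (_root_.restr (RoughFrom y) f)) n := fun hn => h.roTwist_eq_convolution y a hn
  refine ⟨(LSeriesSummable_congr s e).mpr (h1.convolution h2), ?_⟩
  rw [LSeries_congr e, LSeries_convolution' h1 h2, LSeries_powTwist]

lemma IsHalaszClass.dblConv_LSeries (h : IsHalaszClass κ f Λf) (hκ : 0 < κ) {y : ℕ} (N : ℕ)
    (hy : Real.exp 200 ≤ y) {α β c : ℝ} (hα : 0 ≤ α) (hα1 : α ≤ 1 / Real.log y) (hβ : 0 ≤ β)
    (hβ1 : β ≤ 1 / Real.log y) (hc : 1 < c) (t : ℝ) :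
    _root_.LSeriesSummable (dblConv y N α β f Λf) ((c - α - β : ℝ) + t * I) ∧
    ‖LSeries (dblConv y N α β f Λf) ((c - α - β : ℝ) + t * I)‖ ≤ Real.exp (80 * κ) *
      (‖LSeries (roughTrunc y N Λf) ((c - β : ℝ) + t * I)‖ *
        ‖LSeries (roughTrunc y N Λf) ((c + β : ℝ) + t * I)‖) *
      ‖LSeries f ((c + β : ℝ) + t * I)‖ := by
  have hy0 : (0 : ℝ) < y := (Real.exp_pos _).trans_le hy
  have hly : 200 ≤ Real.log y := by
    rw [Real.le_log_iff_exp_le hy0]; exact hy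
  have hy2 : 2 ≤ y := by
    have : (2 : ℝ) ≤ y := by linarith [Real.add_one_le_exp (200 : ℝ)]
    exact_mod_cast this
  have hi : 1 / Real.log y ≤ 1 / 200 := one_div_le_one_div_of_le (by norm_num) hly
  have h2i : 2 / Real.log y = 2 * (1 / Real.log y) := by ring
  have h3i : 3 / Real.log y = 3 * (1 / Real.log y) := by ring
  set s : ℂ := ((c - α - β : ℝ) + t * I) with hs
  have hre : s.re = c - α - β := by simp [hs]
  obtain ⟨h1, h2⟩ := h.roTwist_LSeries hκ hy2 (a := α + 2 * β) (s := s) (by rw [hre]; linarith)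
    (by rw [hre]; linarith)
  have h3 : ∀ a : ℝ, _root_.LSeriesSummable (powTwist a (roughTrunc y N Λf)) s := fun a =>
    LSeriesSummable_powTwist.mpr (LSeriesSummable_roughTrunc h y N _)
  have h4 := (h3 (α + 2 * β)).convolution h1
  refine ⟨(h3 α).convolution h4, ?_⟩
  have e1 : s + (α : ℂ) = (c - β : ℝ) + t * I := by rw [hs]; push_cast; ring
  have e2 : s + ((α + 2 * β : ℝ) : ℂ) = (c + β : ℝ) + t * I := by rw [hs]; push_cast; ring
  rw [dblConv, LSeries_convolution' (h3 α) h4, LSeries_convolution' (h3 _) h1, h2,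
    LSeries_powTwist, LSeries_powTwist, e1, e2]
  have h5 := h.smooth_ratio hκ hy (s := s) (d := α + 2 * β) (by rw [hre]; linarith) (by linarith)
    (by linarith)
  rw [e2] at h5
  rw [h.LSeries_eq_smooth_mul_rough hκ y (s := (c + β : ℝ) + t * I) (by simp; linarith)]
  simp only [norm_mul]
  calc _ ≤ ‖LSeries (roughTrunc y N Λf) ((c - β : ℝ) + t * I)‖ *
        (‖LSeries (roughTrunc y N Λf) ((c + β : ℝ) + t * I)‖ *
        ((Real.exp (80 * κ) *
          ‖LSeries (_root_.restr (SmoothBelow y) f) ((c + β : ℝ) + t * I)‖) *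
        ‖LSeries (_root_.restr (RoughFrom y) f) ((c + β : ℝ) + t * I)‖)) := by gcongr
    _ = _ := by ring

/-- Mean-square and uniform bounds for the two prime sums near the lines `Re s = 1 ∓ β`. -/
lemma IsHalaszClass.exists_roughTrunc_bounds (hκ : 0 < κ) : ∃ C : ℝ, 0 < C ∧
    ∀ f Λf : ℕ → ℂ, IsHalaszClass κ f Λf → ∀ (y N : ℕ) (T x β τ : ℝ), 2 ≤ T → T ^ 4 ≤ y →
    Real.exp 1 ≤ x → (N : ℝ) ≤ 4 * x → 0 ≤ β → τ = β + 1 / Real.log x → 2 * τ ≤ 1 →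
    (Integrable (fun t : ℝ => 2 * T / (T ^ 2 + t ^ 2) *
      ‖LSeries (roughTrunc y N Λf) ((1 + 1 / Real.log x - β : ℝ) + t * I)‖ ^ 2) ∧
    ∫ t : ℝ, 2 * T / (T ^ 2 + t ^ 2) *
      ‖LSeries (roughTrunc y N Λf) ((1 + 1 / Real.log x - β : ℝ) + t * I)‖ ^ 2 ≤
      C * x ^ (2 * β) / (T * τ)) ∧
    (Integrable (fun t : ℝ => 2 * T / (T ^ 2 + t ^ 2) *
      ‖LSeries (roughTrunc y N Λf) ((1 + 1 / Real.log x + β : ℝ) + t * I)‖ ^ 2) ∧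
    ∫ t : ℝ, 2 * T / (T ^ 2 + t ^ 2) *
      ‖LSeries (roughTrunc y N Λf) ((1 + 1 / Real.log x + β : ℝ) + t * I)‖ ^ 2 ≤
      C / (T * τ)) ∧
    ∀ t : ℝ, ‖LSeries (roughTrunc y N Λf) ((1 + 1 / Real.log x - β : ℝ) + t * I)‖ ≤
        C * x ^ β / τ ∧
      ‖LSeries (roughTrunc y N Λf) ((1 + 1 / Real.log x + β : ℝ) + t * I)‖ ≤ C / τ := by
  obtain ⟨C, hC, H⟩ := IsHalaszClass.exists_roughTrunc_mean_value
  refine ⟨C * κ ^ 2 * (72 * Real.exp 2) + κ * (144 * Real.exp 2), by positivity,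
    fun f Λf h y N T x β τ hT hTy hx hN hβ hτ hτ1 => ?_⟩
  have hy1 : 1 ≤ y := by
    have : (1 : ℝ) ≤ y := (one_le_pow₀ (by linarith)).trans hTy
    exact_mod_cast this
  have hx0 : 0 < x := (Real.exp_pos 1).trans_le hx
  have hx1 : 1 ≤ x := by linarith [Real.add_one_le_exp (1 : ℝ)]
  have hL : 1 ≤ Real.log x := by rw [Real.le_log_iff_exp_le hx0]; exact hx
  have hiL : 0 < 1 / Real.log x := by positivity
  have hτ0 : 0 < τ := by linarith
  have hxτ : x ^ τ = Real.exp 1 * x ^ β := by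
    rw [hτ, Real.rpow_add hx0, mul_comm]
    congr 1
    rw [Real.rpow_def_of_pos hx0, mul_one_div_cancel (by linarith)]
  have hxτ2 : x ^ (2 * τ) = Real.exp 2 * x ^ (2 * β) := by
    rw [mul_comm 2 τ, Real.rpow_mul hx0.le, hxτ, Real.mul_rpow (Real.exp_pos 1).le (by positivity),
      ← Real.rpow_mul hx0.le, mul_comm β 2, ← Real.exp_one_rpow 2, mul_comm]
  have he12 : Real.exp 1 ≤ Real.exp 2 := Real.exp_le_exp.mpr (by norm_num)
  have he2 : 1 ≤ Real.exp 2 := Real.one_le_exp (by norm_num)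
  have hp1 : 0 < C * κ ^ 2 * (72 * Real.exp 2) := by positivity
  have hp2 : 0 < κ * (144 * Real.exp 2) := by positivity
  have hT0 : 0 < T := by linarith
  refine ⟨?_, ?_, fun t => ⟨?_, ?_⟩⟩
  · obtain ⟨h1, h2⟩ := H κ f Λf h hκ y N T (1 + 1 / Real.log x - β) hT hTy
    refine ⟨h1, h2.trans ?_⟩
    have := sum_vM_rpow_shift_le (N := N) hy1 hx1 hN (by linarith : 0 < 2 * τ) hτ1
      (c := -(1 - 2 * (1 + 1 / Real.log x - β))) (by linarith)
    rw [neg_neg, hxτ2] at this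
    calc _ ≤ C * κ ^ 2 / T * (4 * (Real.exp 2 * x ^ (2 * β)) * (36 / (2 * τ))) := by gcongr
      _ = C * κ ^ 2 * (72 * Real.exp 2) * x ^ (2 * β) / (T * τ) := by field_simp; ring
      _ ≤ _ := by gcongr; linarith
  · obtain ⟨h1, h2⟩ := H κ f Λf h hκ y N T (1 + 1 / Real.log x + β) hT hTy
    refine ⟨h1, h2.trans ?_⟩
    have := sum_vM_rpow_neg_le' (S := Finset.Icc y N) (by linarith : 0 < 2 * τ) hτ1
    rw [show -(1 + 2 * τ) = 1 - 2 * (1 + 1 / Real.log x + β) by rw [hτ]; ring] at this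
    calc _ ≤ C * κ ^ 2 / T * (36 / (2 * τ)) := by gcongr
      _ = C * κ ^ 2 * 18 / (T * τ) := by field_simp; ring
      _ ≤ _ := by
        gcongr
        have : C * κ ^ 2 * 18 ≤ C * κ ^ 2 * (72 * Real.exp 2) := by gcongr; linarith
        linarith
  · have := sum_vM_rpow_shift_le (N := N) hy1 hx1 hN hτ0 (by linarith)
      (c := 1 + 1 / Real.log x - β) (by linarith)
    rw [hxτ] at this
    refine (norm_LSeries_roughTrunc_le h hy1 N _ t).trans ?_
    calc _ ≤ κ * (4 * (Real.exp 1 * x ^ β) * (36 / τ)) := by gcongr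
      _ = κ * (144 * Real.exp 1) * x ^ β / τ := by ring
      _ ≤ κ * (144 * Real.exp 2) * x ^ β / τ := by gcongr
      _ ≤ _ := by gcongr; linarith
  · have := sum_vM_rpow_neg_le' (S := Finset.Icc y N) hτ0 (by linarith)
    rw [show 1 + τ = 1 + 1 / Real.log x + β by rw [hτ]; ring] at this
    refine (norm_LSeries_roughTrunc_le h hy1 N _ t).trans ?_
    calc _ ≤ κ * (36 / τ) := by gcongr
      _ = κ * 36 / τ := by ring
      _ ≤ κ * (144 * Real.exp 2) / τ := by gcongr; linarith
      _ ≤ _ := by gcongr; linarith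

end

section

open scoped ArithmeticFunction.vonMangoldt

variable {κ : ℝ} {f Λf : ℕ → ℂ}

lemma mul_le_half_add_inv {a b ρ : ℝ} (hρ : 0 < ρ) :
    a * b ≤ (ρ * a ^ 2 + ρ⁻¹ * b ^ 2) / 2 := by
  have h : 0 ≤ ρ⁻¹ * (ρ * a - b) ^ 2 := by positivity
  have e : ρ⁻¹ * (ρ * a - b) ^ 2 = ρ * a ^ 2 - 2 * (a * b) + ρ⁻¹ * b ^ 2 := by
    field_simp; ring
  linarith

set_option maxHeartbeats 2000000 in
lemma IsHalaszClass.exists_main_term_le (hκ : 0 < κ) : ∃ C : ℝ, 0 < C ∧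
    ∀ f Λf : ℕ → ℂ, IsHalaszClass κ f Λf → ∀ (y N : ℕ) (x z w T U α β τ E G : ℝ),
    Real.exp 200 ≤ y → 0 ≤ α → α ≤ 1 / Real.log y → 0 ≤ β → β ≤ 1 / Real.log y →
    2 ≤ U → U ^ 4 ≤ y → Real.exp 200 ≤ x → (N : ℝ) ≤ 4 * x → τ = β + 1 / Real.log x → 0 < T →
    0 < w → w ≤ x / 4 → 2 * w ≤ z → z ≤ x →
    (∀ t : ℝ, |t| ≤ T / 2 → ‖LSeries f ((1 + 1 / Real.log x + β : ℝ) + t * I)‖ ≤ E) →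
    (∀ t : ℝ, ‖LSeries f ((1 + 1 / Real.log x + β : ℝ) + t * I)‖ ≤ G) →
    ∀ S : Finset ℕ, (∀ n ∉ S, trap x (x + z) w n = 0) →
    ‖∑ n ∈ S, dblConv y N α β f Λf n * trap x (x + z) w n‖ ≤
      C * x ^ (-α) * (z * E / τ + x / T * G / τ + x ^ 2 / (w * U) * G / τ ^ 2) := by
  obtain ⟨C, hC, H⟩ := IsHalaszClass.exists_roughTrunc_bounds hκ
  refine ⟨Real.exp (80 * κ) * Real.exp 1 * (36 * C + 216 * C ^ 2 * Real.pi), by positivity,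
    fun f Λf h y N x z w T U α β τ E G hy hα hα1 hβ hβ1 hU hUy hx hN hτ hT hw hwx hwz hzx hE hG S
      hS => ?_⟩
  have hx0 : 0 < x := (Real.exp_pos _).trans_le hx
  have hL : 200 ≤ Real.log x := by rw [Real.le_log_iff_exp_le hx0]; exact hx
  have hiL : 1 / Real.log x ≤ 1 / 200 := one_div_le_one_div_of_le (by norm_num) hL
  have hiL0 : 0 < 1 / Real.log x := by positivity
  have hy0 : (0 : ℝ) < y := (Real.exp_pos _).trans_le hy
  have hly : 200 ≤ Real.log y := by rw [Real.le_log_iff_exp_le hy0]; exact hy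
  have hi : 1 / Real.log y ≤ 1 / 200 := one_div_le_one_div_of_le (by norm_num) hly
  have hτ0 : 0 < τ := by linarith
  have hU0 : 0 < U := by linarith
  have hz : 0 ≤ z := by linarith
  have hE0 : 0 ≤ E := (norm_nonneg _).trans (hE 0 (by rw [abs_zero]; linarith))
  have hG0 : 0 ≤ G := (norm_nonneg _).trans (hG 0)
  obtain ⟨⟨hA1, hA2⟩, ⟨hB1, hB2⟩, hAB⟩ := H f Λf h y N U x β τ hU hUy
    ((Real.exp_le_exp.mpr (by norm_num)).trans hx) hN hβ hτ (by linarith)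
  set A : ℝ → ℝ := fun t => ‖LSeries (roughTrunc y N Λf) ((1 + 1 / Real.log x - β : ℝ) + t * I)‖
    with hA
  set B : ℝ → ℝ := fun t => ‖LSeries (roughTrunc y N Λf) ((1 + 1 / Real.log x + β : ℝ) + t * I)‖
    with hB
  set σ : ℝ := 1 + 1 / Real.log x - α - β with hσ
  set ρ : ℝ := x ^ (-β) with hρ
  have hρ0 : 0 < ρ := Real.rpow_pos_of_pos hx0 _
  set K₁ : ℝ := 8 * x ^ (σ - 1) * z * E + 36 * x ^ σ / T * G with hK₁
  set K₂ : ℝ := 108 * x ^ (σ + 1) / (w * U) * G * (C * x ^ β / τ * (C / τ)) with hK₂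
  have hK₁0 : 0 ≤ K₁ := by positivity
  have hK₂0 : 0 ≤ K₂ := by positivity
  set φ : ℝ → ℝ := fun t => 2 * U / (U ^ 2 + t ^ 2) with hφ
  have hφ0 : ∀ t, 0 ≤ φ t := fun t => by simp only [hφ]; positivity
  set D : ℝ → ℝ := fun t => Real.exp (80 * κ) * (K₁ * U / 2 *
    (ρ * (φ t * A t ^ 2) + ρ⁻¹ * (φ t * B t ^ 2)) + K₂ * φ t) with hD
  have hφi : Integrable φ := integrable_cauchy hU0
  have hφI : ∫ t, φ t = 2 * Real.pi := integral_cauchy_zero hU0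
  have hi1 : Integrable fun t => ρ * (φ t * A t ^ 2) + ρ⁻¹ * (φ t * B t ^ 2) :=
    (hA1.const_mul ρ).add (hB1.const_mul ρ⁻¹)
  have hDi : Integrable D := ((hi1.const_mul _).add (hφi.const_mul _)).const_mul _
  have h_itg : ∫ t, D t ≤ Real.exp (80 * κ) * (K₁ * C * x ^ β / τ + K₂ * (2 * Real.pi)) := by
    have e1 : ∫ t, D t = Real.exp (80 * κ) * (K₁ * U / 2 *
        (ρ * ∫ t, φ t * A t ^ 2) + K₁ * U / 2 * (ρ⁻¹ * ∫ t, φ t * B t ^ 2) +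
          K₂ * (2 * Real.pi)) := by
      rw [hD, integral_const_mul, integral_add (hi1.const_mul _) (hφi.const_mul _),
        integral_const_mul, integral_const_mul, hφI,
        integral_add (hA1.const_mul ρ) (hB1.const_mul ρ⁻¹), integral_const_mul,
        integral_const_mul]
      simp only [hφ, hA, hB]
      ring
    have e2 : ρ * (C * x ^ (2 * β) / (U * τ)) = C * x ^ β / (U * τ) := by
      have : ρ * x ^ (2 * β) = x ^ β := by
        rw [hρ, ← Real.rpow_add hx0]; congr 1; ring
      rw [← this]; ring
    have e3 : ρ⁻¹ = x ^ β := by rw [hρ, Real.rpow_neg hx0.le, inv_inv]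
    rw [e1]
    gcongr
    calc _ ≤ K₁ * U / 2 * (ρ * (C * x ^ (2 * β) / (U * τ))) +
          K₁ * U / 2 * (ρ⁻¹ * (C / (U * τ))) := by gcongr
      _ = K₁ * C * x ^ β / τ := by rw [e2, e3]; field_simp; ring
  have hmain := norm_sum_trap_le (σ := σ) hw hwx hz hzx (by rw [hσ]; linarith)
    (by rw [hσ]; linarith) (c := dblConv y N α β f Λf)
    (by
      have := (h.dblConv_LSeries hκ N hy hα hα1 hβ hβ1 (c := 1 + 1 / Real.log x)
        (by linarith) 0).1
      rwa [ofReal_zero, zero_mul, add_zero] at this) hDi (fun t => ?_) hS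
  · refine (hmain.trans h_itg).trans ?_
    have e4 : x ^ σ = Real.exp 1 * x * x ^ (-α) * ρ := by
      have : x ^ (1 / Real.log x) = Real.exp 1 := by
        rw [Real.rpow_def_of_pos hx0, mul_one_div_cancel (by linarith)]
      rw [hσ, hρ, ← this, sub_eq_add_neg, sub_eq_add_neg, Real.rpow_add hx0, Real.rpow_add hx0,
        Real.rpow_add hx0, Real.rpow_one]
      ring
    have e5 : x ^ (σ - 1) = x ^ σ / x := by rw [Real.rpow_sub hx0, Real.rpow_one]
    have e6 : x ^ (σ + 1) = x ^ σ * x := by rw [Real.rpow_add hx0, Real.rpow_one]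
    have e7 : ρ * x ^ β = 1 := by rw [hρ, ← Real.rpow_add hx0]; simp
    have e8 : x ^ β = ρ⁻¹ := eq_inv_of_mul_eq_one_right e7
    have e9 : Real.exp (80 * κ) * (K₁ * C * x ^ β / τ + K₂ * (2 * Real.pi)) =
        Real.exp (80 * κ) * Real.exp 1 * x ^ (-α) * ((8 * C) * (z * E / τ) +
          (36 * C) * (x / T * G / τ) +
          (216 * C ^ 2 * Real.pi) * (x ^ 2 / (w * U) * G / τ ^ 2)) := by
      rw [hK₁, hK₂, e5, e6, e4, e8]
      field_simp
      ring
    set M := 36 * C + 216 * C ^ 2 * Real.pi with hM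
    have hpi := Real.pi_pos
    have hM1 : 8 * C ≤ M := by have : 0 ≤ 216 * C ^ 2 * Real.pi := by positivity
                               linarith
    have hM2 : 36 * C ≤ M := le_add_of_nonneg_right (by positivity)
    have hM3 : 216 * C ^ 2 * Real.pi ≤ M := le_add_of_nonneg_left (by positivity)
    rw [e9]
    calc _ ≤ Real.exp (80 * κ) * Real.exp 1 * x ^ (-α) * (M * (z * E / τ) +
          M * (x / T * G / τ) + M * (x ^ 2 / (w * U) * G / τ ^ 2)) := by gcongr
      _ = _ := by ring
  · have hre : ((σ : ℂ) + t * I).re = σ := by simp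
    have him : ((σ : ℂ) + t * I).im = t := by simp
    have hs1 : 9 / 10 ≤ ((σ : ℂ) + t * I).re := by rw [hre, hσ]; linarith
    have hs2 : ((σ : ℂ) + t * I).re ≤ 2 := by rw [hre, hσ]; linarith
    have m1 := norm_trapMellin_le_length hw hwx hz hzx hs1 hs2
    have m2 := norm_trapMellin_le_inv hw hwx hz hzx hs1 hs2
    have m3 := norm_trapMellin_le_inv_sq hw hwx hz hzx hs1 hs2
    rw [hre] at m1 m2 m3
    have hst : |t| ≤ ‖(σ : ℂ) + t * I‖ := by
      have := Complex.abs_im_le_norm ((σ : ℂ) + t * I)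
      rwa [him] at this
    have h1 := (h.dblConv_LSeries hκ N hy hα hα1 hβ hβ1 (c := 1 + 1 / Real.log x)
        (by linarith) t).2
    obtain ⟨hAt, hBt⟩ := hAB t
    set m := ‖trapMellin x (x + z) w ((σ : ℂ) + t * I)‖ with hm
    set F := ‖LSeries f ((1 + 1 / Real.log x + β : ℝ) + t * I)‖ with hF
    have hA0 : 0 ≤ A t := norm_nonneg _
    have hB0 : 0 ≤ B t := norm_nonneg _
    have hF0 : 0 ≤ F := norm_nonneg _
    have hm0 : 0 ≤ m := norm_nonneg _
    rw [norm_mul]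
    have h2 : m * ‖LSeries (dblConv y N α β f Λf) ((σ : ℂ) + t * I)‖ ≤
        Real.exp (80 * κ) * ((m * F) * (A t * B t)) := by
      calc _ ≤ m * (Real.exp (80 * κ) * (A t * B t) * F) := by gcongr
        _ = _ := by ring
    refine h2.trans (mul_le_mul_of_nonneg_left ?_ (Real.exp_pos _).le)
    have hab := mul_le_half_add_inv (a := A t) (b := B t) hρ0
    have hq0 : 0 ≤ ρ * A t ^ 2 + ρ⁻¹ * B t ^ 2 := by positivity
    have hsplit : ρ * (φ t * A t ^ 2) + ρ⁻¹ * (φ t * B t ^ 2) =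
      φ t * (ρ * A t ^ 2 + ρ⁻¹ * B t ^ 2) := by ring
    rw [hsplit]
    rcases le_or_gt |t| U with htU | htU
    · have hUφ : 1 ≤ U * φ t := by
        have : t ^ 2 ≤ U ^ 2 := sq_le_sq' (by linarith [(abs_le.mp htU).1]) (abs_le.mp htU).2
        simp only [hφ]
        rw [← mul_div_assoc, le_div_iff₀ (by positivity)]
        nlinarith
      have hmF : m * F ≤ K₁ := by
        rcases le_or_gt |t| (T / 2) with ht | ht
        · calc m * F ≤ (4 * x ^ (σ - 1) * (z + 2 * w)) * E :=
                mul_le_mul m1 (hE t ht) hF0 (by positivity)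
            _ ≤ (4 * x ^ (σ - 1) * (z + z)) * E := by gcongr
            _ = 8 * x ^ (σ - 1) * z * E := by ring
            _ ≤ K₁ := by rw [hK₁]; exact le_add_of_nonneg_right (by positivity)
        · have hst' : T / 2 ≤ ‖(σ : ℂ) + t * I‖ := by linarith
          calc m * F ≤ (18 * x ^ σ / ‖(σ : ℂ) + t * I‖) * G :=
                mul_le_mul m2 (hG t) hF0 (by positivity)
            _ ≤ (18 * x ^ σ / (T / 2)) * G := by gcongr
            _ = 36 * x ^ σ / T * G := by field_simp; ring
            _ ≤ K₁ := by rw [hK₁]; exact le_add_of_nonneg_left (by positivity)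
      calc (m * F) * (A t * B t) ≤ K₁ * ((ρ * A t ^ 2 + ρ⁻¹ * B t ^ 2) / 2) :=
            mul_le_mul hmF hab (by positivity) hK₁0
        _ ≤ (U * φ t) * (K₁ * ((ρ * A t ^ 2 + ρ⁻¹ * B t ^ 2) / 2)) :=
            le_mul_of_one_le_left (by positivity) hUφ
        _ = K₁ * U / 2 * (φ t * (ρ * A t ^ 2 + ρ⁻¹ * B t ^ 2)) := by ring
        _ ≤ _ := le_add_of_nonneg_right (mul_nonneg hK₂0 (hφ0 t))
    · have hsq : (U ^ 2 + t ^ 2) / 2 ≤ ‖(σ : ℂ) + t * I‖ ^ 2 := by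
        have e1 : t ^ 2 ≤ ‖(σ : ℂ) + t * I‖ ^ 2 := by
          rw [← sq_abs t]; gcongr
        have e2 : U ^ 2 ≤ t ^ 2 := by
          rw [← sq_abs t]; gcongr
        linarith
      calc (m * F) * (A t * B t) ≤ ((108 * x ^ (σ + 1) / (w * ‖(σ : ℂ) + t * I‖ ^ 2)) * G) *
            (C * x ^ β / τ * (C / τ)) := by
            have := hG t
            gcongr
        _ ≤ ((108 * x ^ (σ + 1) / (w * ((U ^ 2 + t ^ 2) / 2))) * G) *
            (C * x ^ β / τ * (C / τ)) := by gcongr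
        _ = K₂ * φ t := by rw [hK₂]; simp only [hφ]; field_simp
        _ ≤ _ := le_add_of_nonneg_left (by have := hφ0 t; positivity)

end

section

open scoped ArithmeticFunction.vonMangoldt

variable {κ : ℝ} {f Λf : ℕ → ℂ}

lemma norm_integral_integral_rpow_neg_le {J : ℝ → ℝ → ℂ} {V : ℝ → ℝ} {x η : ℝ} (hx : 1 < x)
    (hη : 0 ≤ η) (hV : IntervalIntegrable V volume 0 η) (hV0 : ∀ β, 0 ≤ β → β ≤ η → 0 ≤ V β)
    (hJ : ∀ α β, 0 ≤ α → α ≤ η → 0 ≤ β → β ≤ η → ‖J α β‖ ≤ x ^ (-α) * V β) :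
    ‖∫ α in (0 : ℝ)..η, ∫ β in (0 : ℝ)..η, J α β‖ ≤
      1 / Real.log x * ∫ β in (0 : ℝ)..η, V β := by
  have hx0 : 0 < x := by linarith
  have hl : 0 < Real.log x := Real.log_pos hx
  have hI : 0 ≤ ∫ β in (0 : ℝ)..η, V β :=
    intervalIntegral.integral_nonneg hη fun β hβ => hV0 β hβ.1 hβ.2
  have h1 : ∀ α, 0 ≤ α → α ≤ η →
      ‖∫ β in (0 : ℝ)..η, J α β‖ ≤ x ^ (-α) * ∫ β in (0 : ℝ)..η, V β := by
    intro α h0 h1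
    rw [← intervalIntegral.integral_const_mul]
    exact intervalIntegral.norm_integral_le_of_norm_le hη
      (Filter.Eventually.of_forall fun β hβ => hJ α β h0 h1 hβ.1.le hβ.2) (hV.const_mul _)
  have hc : Continuous fun α : ℝ => x ^ (-α) :=
    (Real.continuous_const_rpow hx0.ne').comp continuous_neg
  have e := integral_log_mul_rpow_neg hx0 1 η
  simp only [one_mul] at e
  rw [intervalIntegral.integral_const_mul] at e
  have h2 : ∫ α in (0 : ℝ)..η, x ^ (-α) ≤ 1 / Real.log x := by
    rw [le_div_iff₀ hl, mul_comm, e]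
    linarith [Real.rpow_pos_of_pos hx0 (-η)]
  calc _ ≤ ∫ α in (0 : ℝ)..η, x ^ (-α) * ∫ β in (0 : ℝ)..η, V β :=
        intervalIntegral.norm_integral_le_of_norm_le hη
          (Filter.Eventually.of_forall fun α hα => h1 α hα.1.le hα.2)
          ((hc.mul continuous_const).intervalIntegrable _ _)
    _ = (∫ α in (0 : ℝ)..η, x ^ (-α)) * ∫ β in (0 : ℝ)..η, V β :=
        intervalIntegral.integral_mul_const _ _
    _ ≤ _ := by gcongr

lemma integral_shift_rpow_le {L η p : ℝ} (hL : 0 < L) (hη : 0 ≤ η) (hp : 0 < p) :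
    IntervalIntegrable (fun β : ℝ => (β + 1 / L) ^ (-p - 1)) volume 0 η ∧
    ∫ β in (0 : ℝ)..η, (β + 1 / L) ^ (-p - 1) ≤ L ^ p / p := by
  have hpos : ∀ β ∈ Set.uIcc 0 η, 0 < β + 1 / L := fun β hβ => by
    rw [Set.uIcc_of_le hη] at hβ
    have : 0 < 1 / L := by positivity
    linarith [hβ.1]
  have hi : IntervalIntegrable (fun β : ℝ => (β + 1 / L) ^ (-p - 1)) volume 0 η :=
    (ContinuousOn.rpow_const (by fun_prop) fun β hβ => Or.inl (hpos β hβ).ne').intervalIntegrable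
  refine ⟨hi, ?_⟩
  have hd : ∀ β ∈ Set.uIcc 0 η, HasDerivAt (fun β : ℝ => -(β + 1 / L) ^ (-p) / p)
      ((β + 1 / L) ^ (-p - 1)) β := fun β hβ => by
    have h1 := (((hasDerivAt_id β).add_const (1 / L)).rpow_const (p := -p)
      (Or.inl (hpos β hβ).ne')).neg.div_const p
    refine h1.congr_deriv ?_
    rw [div_eq_iff hp.ne']
    change -(1 * -p * (β + 1 / L) ^ (-p - 1)) = _
    ring
  rw [intervalIntegral.integral_eq_sub_of_hasDerivAt hd hi]
  have h0 : (0 + 1 / L) ^ (-p) = L ^ p := by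
    rw [zero_add, one_div, Real.inv_rpow hL.le, Real.rpow_neg hL.le, inv_inv]
  rw [h0]
  have h1 : 0 ≤ (η + 1 / L) ^ (-p) := Real.rpow_nonneg (by positivity) _
  have : 0 ≤ (η + 1 / L) ^ (-p) / p := by positivity
  rw [neg_div, neg_div]
  linarith

lemma integral_harmonic_mean_le {L η κ Q R : ℝ} (hL : 0 < L) (hη : 0 ≤ η) (hκ : 0 < κ)
    (hQ : 0 < Q) (hR : 0 < R) :
    IntervalIntegrable (fun β : ℝ => 2 * Q * R / ((β + 1 / L) * (Q * (β + 1 / L) ^ κ + R)))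
      volume 0 η ∧
    ∫ β in (0 : ℝ)..η, 2 * Q * R / ((β + 1 / L) * (Q * (β + 1 / L) ^ κ + R)) ≤
      2 * Q / κ * Real.log (1 + R * L ^ κ / Q) := by
  have hpos : ∀ β ∈ Set.uIcc 0 η, 0 < β + 1 / L := fun β hβ => by
    rw [Set.uIcc_of_le hη] at hβ
    have : 0 < 1 / L := by positivity
    linarith [hβ.1]
  have hpos2 : ∀ τ : ℝ, 0 < τ → 0 < Q * τ ^ κ + R := fun τ hτ => by positivity
  have hi : IntervalIntegrable
      (fun β : ℝ => 2 * Q * R / ((β + 1 / L) * (Q * (β + 1 / L) ^ κ + R))) volume 0 η := by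
    refine ContinuousOn.intervalIntegrable ?_
    refine ContinuousOn.div continuousOn_const (ContinuousOn.mul (by fun_prop)
      (ContinuousOn.add (ContinuousOn.mul continuousOn_const (ContinuousOn.rpow_const (by fun_prop)
        fun β hβ => Or.inl (hpos β hβ).ne')) continuousOn_const)) fun β hβ => ?_
    exact (mul_pos (hpos β hβ) (hpos2 _ (hpos β hβ))).ne'
  refine ⟨hi, ?_⟩
  have hd : ∀ β ∈ Set.uIcc 0 η, HasDerivAt (fun β : ℝ => 2 * Q / κ *
      (κ * Real.log (β + 1 / L) - Real.log (Q * (β + 1 / L) ^ κ + R)))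
      (2 * Q * R / ((β + 1 / L) * (Q * (β + 1 / L) ^ κ + R))) β := fun β hβ => by
    have hτ := hpos β hβ
    have h0 : HasDerivAt (fun β : ℝ => β + 1 / L) 1 β := (hasDerivAt_id β).add_const (1 / L)
    have h1 := (h0.log hτ.ne').const_mul κ
    have h2 := (((h0.rpow_const (p := κ) (Or.inl hτ.ne')).const_mul Q).add_const R).log
      (hpos2 _ hτ).ne'
    refine ((h1.sub h2).const_mul (2 * Q / κ)).congr_deriv ?_
    have e : (β + 1 / L) ^ (κ - 1) = (β + 1 / L) ^ κ / (β + 1 / L) := by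
      rw [Real.rpow_sub hτ, Real.rpow_one]
    rw [e]
    have hτ2 := hpos2 _ hτ
    set τ := β + 1 / L
    set u := τ ^ κ
    field_simp
    ring
  rw [intervalIntegral.integral_eq_sub_of_hasDerivAt hd hi, ← mul_sub]
  refine mul_le_mul_of_nonneg_left ?_ (by positivity)
  have hiL : 0 < 1 / L := by positivity
  set τ := η + 1 / L with hτd
  have hτ : 0 < τ := by positivity
  have e1 : κ * Real.log τ - Real.log (Q * τ ^ κ + R) ≤ -Real.log Q := by
    have : Real.log (Q * τ ^ κ) ≤ Real.log (Q * τ ^ κ + R) :=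
      Real.log_le_log (by positivity) (by linarith)
    rw [Real.log_mul hQ.ne' (Real.rpow_pos_of_pos hτ _).ne', Real.log_rpow hτ] at this
    linarith
  have e2 : κ * Real.log (0 + 1 / L) - Real.log (Q * (0 + 1 / L) ^ κ + R) =
      -Real.log (Q + R * L ^ κ) := by
    have hLκ : 0 < L ^ κ := Real.rpow_pos_of_pos hL _
    have e3 : Q * (0 + 1 / L) ^ κ + R = (Q + R * L ^ κ) / L ^ κ := by
      rw [zero_add, one_div, Real.inv_rpow hL.le]
      field_simp
    rw [e3, Real.log_div (by positivity) hLκ.ne', zero_add, one_div, Real.log_inv,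
      Real.log_rpow hL]
    ring
  have e3 : 1 + R * L ^ κ / Q = (Q + R * L ^ κ) / Q := by field_simp
  rw [e2, e3, Real.log_div (by positivity) hQ.ne']
  linarith

lemma min_le_harmonic {Q R τ κ : ℝ} (hQ : 0 < Q) (hR : 0 < R) (hτ : 0 < τ) :
    min Q (R * τ ^ (-κ)) / τ ≤ 2 * Q * R / (τ * (Q * τ ^ κ + R)) := by
  have hu : 0 < τ ^ κ := Real.rpow_pos_of_pos hτ _
  rw [Real.rpow_neg hτ.le, div_le_div_iff₀ hτ (by positivity)]
  set u := τ ^ κ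
  have h1 : min Q (R * u⁻¹) * u ≤ R := by
    calc _ ≤ (R * u⁻¹) * u := by gcongr; exact min_le_right _ _
      _ = R := by field_simp
  have h2 : min Q (R * u⁻¹) ≤ Q := min_le_left _ _
  have h3 : min Q (R * u⁻¹) * (Q * u + R) ≤ 2 * Q * R := by nlinarith
  nlinarith

/-- The doubly integrated main term. -/
lemma IsHalaszClass.exists_integral_main_term_le (hκ : 0 < κ) : ∃ C : ℝ, 0 < C ∧
    ∀ f Λf : ℕ → ℂ, IsHalaszClass κ f Λf → ∀ (y N : ℕ) (x z w T U Q : ℝ),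
    Real.exp 200 ≤ y → 2 ≤ U → U ^ 4 ≤ y → Real.exp 200 ≤ x → (N : ℝ) ≤ 4 * x →
    Real.log x ^ κ ≤ T → 0 < w → w ≤ x / 4 → 2 * w ≤ z → z ≤ x → 0 < Q →
    (∀ t : ℝ, |t| ≤ T → ‖LSeries f ((1 + 1 / Real.log x : ℝ) + t * I)‖ ≤ Q) →
    ∀ S : Finset ℕ, (∀ n ∉ S, trap x (x + z) w n = 0) →
    ‖∫ α in (0 : ℝ)..(1 / Real.log y), ∫ β in (0 : ℝ)..(1 / Real.log y),
      2 * ∑ n ∈ S, dblConv y N α β f Λf n * trap x (x + z) w n‖ ≤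
      C / Real.log x * (z * (Q * Real.log (1 + 2 ^ κ * Real.log x ^ κ / Q) + 1) +
        x / T * Real.log x ^ κ + x ^ 2 / (w * U) * Real.log x ^ (κ + 1)) := by
  obtain ⟨C, hC, H⟩ := IsHalaszClass.exists_main_term_le hκ
  set R : ℝ := 2 ^ κ with hR
  have hR0 : 0 < R := Real.rpow_pos_of_pos (by norm_num) _
  have hκ1 : 0 < κ + 1 := by linarith
  refine ⟨2 * C * (2 / κ + 4 * R + R / κ + R / (κ + 1)), by positivity,
    fun f Λf h y N x z w T U Q hy hU hUy hx hN hT hw hwx hwz hzx hQ hQF S hS => ?_⟩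
  have hx0 : 0 < x := (Real.exp_pos _).trans_le hx
  set L := Real.log x with hLd
  have hL : 200 ≤ L := by rw [hLd, Real.le_log_iff_exp_le hx0]; exact hx
  have hL0 : 0 < L := by linarith
  have hy0 : (0 : ℝ) < y := (Real.exp_pos _).trans_le hy
  have hly : 200 ≤ Real.log y := by rw [Real.le_log_iff_exp_le hy0]; exact hy
  set η := 1 / Real.log y with hηd
  have hη0 : 0 ≤ η := by positivity
  have hη1 : η ≤ 1 := by
    rw [hηd, div_le_one (by linarith)]; linarith
  have hLκ : 0 < L ^ κ := Real.rpow_pos_of_pos hL0 _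
  have hT0 : 0 < T := hLκ.trans_le hT
  have hU0 : 0 < U := by linarith
  have hz : 0 ≤ z := by linarith
  obtain ⟨hi1, hb1⟩ := integral_harmonic_mean_le hL0 hη0 hκ hQ hR0
  obtain ⟨hi2, hb2⟩ := integral_shift_rpow_le hL0 hη0 hκ
  obtain ⟨hi3, hb3⟩ := integral_shift_rpow_le hL0 hη0 hκ1
  set V₁ : ℝ → ℝ := fun β => 2 * Q * R / ((β + 1 / L) * (Q * (β + 1 / L) ^ κ + R)) with hV₁
  set V₂ : ℝ → ℝ := fun β => (β + 1 / L) ^ (-κ - 1) with hV₂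
  set V₃ : ℝ → ℝ := fun β => (β + 1 / L) ^ (-(κ + 1) - 1) with hV₃
  set V : ℝ → ℝ := fun β => 2 * C * (z * (V₁ β + 4 * R) + x / T * R * V₂ β +
    x ^ 2 / (w * U) * R * V₃ β) with hV
  have hi4 : IntervalIntegrable (fun β => z * (V₁ β + 4 * R)) volume 0 η :=
    (hi1.add intervalIntegrable_const).const_mul z
  have hi5 : IntervalIntegrable (fun β => z * (V₁ β + 4 * R) + x / T * R * V₂ β) volume 0 η :=
    hi4.add (hi2.const_mul _)
  have hVi : IntervalIntegrable V volume 0 η := (hi5.add (hi3.const_mul _)).const_mul _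
  have hVI : ∫ β in (0 : ℝ)..η, V β = 2 * C * (z * ((∫ β in (0 : ℝ)..η, V₁ β) + η * (4 * R)) +
      x / T * R * (∫ β in (0 : ℝ)..η, V₂ β) +
      x ^ 2 / (w * U) * R * ∫ β in (0 : ℝ)..η, V₃ β) := by
    rw [hV, intervalIntegral.integral_const_mul,
      intervalIntegral.integral_add hi5 (hi3.const_mul _),
      intervalIntegral.integral_add hi4 (hi2.const_mul _), intervalIntegral.integral_const_mul,
      intervalIntegral.integral_const_mul, intervalIntegral.integral_const_mul,
      intervalIntegral.integral_add hi1 intervalIntegrable_const, intervalIntegral.integral_const,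
      sub_zero, smul_eq_mul]
  have hx1 : 1 < x := by linarith [Real.add_one_le_exp (200 : ℝ)]
  refine (norm_integral_integral_rpow_neg_le (V := V) hx1 hη0 hVi (fun β hβ hβη => ?_)
    fun α β hα hα1 hβ hβ1 => ?_).trans ?_
  · have : 0 < β + 1 / L := by positivity
    simp only [hV, hV₁, hV₂, hV₃]
    positivity
  · set τ := β + 1 / L with hτ
    have hiL : 1 / L ≤ 1 / 200 := one_div_le_one_div_of_le (by norm_num) hL
    have hη2 : η ≤ 1 / 200 := one_div_le_one_div_of_le (by norm_num) hly
    have hτ0 : 0 < τ := by positivity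
    have hτ1 : τ ≤ 1 := by linarith
    have hG : ∀ t : ℝ, ‖LSeries f ((1 + 1 / L + β : ℝ) + t * I)‖ ≤ R * τ ^ (-κ) := by
      intro t
      have h1 := h.norm_LSeries_le hκ (s := ((1 + 1 / L + β : ℝ) : ℂ) + t * I) (by
        simp only [add_re, ofReal_re, mul_re, I_re, ofReal_im, I_im, mul_zero, mul_one, sub_zero,
          add_zero]
        linarith)
      have e : (((1 + 1 / L + β : ℝ) : ℂ) + t * I).re - 1 = τ := by
        simp only [add_re, ofReal_re, mul_re, I_re, ofReal_im, I_im, mul_zero, mul_one, sub_zero,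
          add_zero]
        rw [hτ]; ring
      rw [e] at h1
      refine h1.trans ?_
      rw [hR, Real.rpow_neg hτ0.le, ← Real.inv_rpow hτ0.le,
        ← Real.mul_rpow (by norm_num) (by positivity)]
      refine Real.rpow_le_rpow (by positivity) ?_ hκ.le
      have : 1 ≤ 1 / τ := by rw [le_div_iff₀ hτ0]; linarith
      rw [← one_div]; linarith
    have hG0 : ∀ t : ℝ, ‖LSeries f ((1 + 1 / L : ℝ) + t * I)‖ ≤ R * L ^ κ := by
      intro t
      have h1 := h.norm_LSeries_le hκ (s := ((1 + 1 / L : ℝ) : ℂ) + t * I) (by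
        simp only [add_re, ofReal_re, mul_re, I_re, ofReal_im, I_im, mul_zero, mul_one, sub_zero,
          add_zero]
        have : 0 < 1 / L := by positivity
        linarith)
      have e : (((1 + 1 / L : ℝ) : ℂ) + t * I).re - 1 = 1 / L := by
        simp only [add_re, ofReal_re, mul_re, I_re, ofReal_im, I_im, mul_zero, mul_one, sub_zero,
          add_zero]
        ring
      rw [e, one_div_one_div] at h1
      refine h1.trans ?_
      rw [hR, ← Real.mul_rpow (by norm_num) (by positivity)]
      exact Real.rpow_le_rpow (by positivity) (by linarith) hκ.le
    have hsum : _root_.LSeriesSummable f ((1 + 1 / L : ℝ) : ℂ) := h.LSeriesSummable (by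
      rw [ofReal_re]
      have : 0 < 1 / L := by positivity
      linarith)
    have hE : ∀ t : ℝ, |t| ≤ T / 2 → ‖LSeries f ((1 + 1 / L + β : ℝ) + t * I)‖ ≤
        min Q (R * τ ^ (-κ)) + 4 * R * β := by
      intro t ht
      have h1 := norm_LSeries_shift_le hsum hβ hQ.le hT0 hQF hG0 ht
      have h2 : 4 * (R * L ^ κ) * β / T ≤ 4 * R * β := by
        rw [div_le_iff₀ hT0]
        calc 4 * (R * L ^ κ) * β = 4 * R * β * L ^ κ := by ring
          _ ≤ _ := by gcongr
      have h3 : 0 ≤ 4 * R * β := by positivity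
      rcases le_total Q (R * τ ^ (-κ)) with hm | hm
      · rw [min_eq_left hm]; linarith
      · rw [min_eq_right hm]; linarith [hG t]
    have hmain := H f Λf h y N x z w T U α β τ (min Q (R * τ ^ (-κ)) + 4 * R * β)
      (R * τ ^ (-κ)) hy hα hα1 hβ hβ1 hU hUy hx hN rfl hT0 hw hwx hwz hzx hE hG S hS
    rw [norm_mul, Complex.norm_ofNat]
    have hxα : 0 < x ^ (-α) := Real.rpow_pos_of_pos hx0 _
    have e1 : (min Q (R * τ ^ (-κ)) + 4 * R * β) / τ ≤ V₁ β + 4 * R := by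
      rw [add_div]
      refine add_le_add (min_le_harmonic hQ hR0 hτ0) ?_
      rw [div_le_iff₀ hτ0]
      have : β ≤ τ := by rw [hτ]; linarith [(by positivity : 0 < 1 / L)]
      gcongr
    have e2 : R * τ ^ (-κ) / τ = R * V₂ β := by
      simp only [hV₂]
      rw [← hτ, Real.rpow_sub hτ0, Real.rpow_one]; ring
    have e3 : R * τ ^ (-κ) / τ ^ 2 = R * V₃ β := by
      simp only [hV₃]
      rw [← hτ, show -(κ + 1) - 1 = -κ - 2 by ring, Real.rpow_sub hτ0, Real.rpow_two]; ring
    calc _ ≤ 2 * (C * x ^ (-α) * (z * (min Q (R * τ ^ (-κ)) + 4 * R * β) / τ +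
          x / T * (R * τ ^ (-κ)) / τ + x ^ 2 / (w * U) * (R * τ ^ (-κ)) / τ ^ 2)) := by gcongr
      _ = 2 * (C * x ^ (-α) * (z * ((min Q (R * τ ^ (-κ)) + 4 * R * β) / τ) +
          x / T * (R * τ ^ (-κ) / τ) + x ^ 2 / (w * U) * (R * τ ^ (-κ) / τ ^ 2))) := by
          ring
      _ ≤ 2 * (C * x ^ (-α) * (z * (V₁ β + 4 * R) +
          x / T * (R * V₂ β) + x ^ 2 / (w * U) * (R * V₃ β))) := by rw [e2, e3]; gcongr
      _ = _ := by simp only [hV]; ring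
  · rw [hVI]
    have hlog : 0 ≤ Real.log (1 + R * L ^ κ / Q) :=
      Real.log_nonneg (by linarith [(by positivity : 0 < R * L ^ κ / Q)])
    set lg := Real.log (1 + R * L ^ κ / Q) with hlg
    set M := 2 / κ + 4 * R + R / κ + R / (κ + 1) with hM
    have p1 : 0 < 2 / κ := by positivity
    have p2 : 0 < R / κ := by positivity
    have p3 : 0 < R / (κ + 1) := by positivity
    have hL1 : 0 ≤ L ^ (κ + 1) := by positivity
    have q1 : (∫ β in (0 : ℝ)..η, V₁ β) + η * (4 * R) ≤ M * (Q * lg + 1) := by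
      calc _ ≤ 2 * Q / κ * lg + 1 * (4 * R) := by gcongr
        _ = 2 / κ * (Q * lg) + 4 * R * 1 := by ring
        _ ≤ M * (Q * lg) + M * 1 := by
            have : 2 / κ ≤ M := by rw [hM]; linarith
            have : 4 * R ≤ M := by rw [hM]; linarith
            gcongr
        _ = _ := by ring
    have q2 : R * (∫ β in (0 : ℝ)..η, V₂ β) ≤ M * L ^ κ := by
      calc _ ≤ R * (L ^ κ / κ) := by gcongr
        _ = R / κ * L ^ κ := by ring
        _ ≤ _ := by gcongr; rw [hM]; linarith
    have q3 : R * (∫ β in (0 : ℝ)..η, V₃ β) ≤ M * L ^ (κ + 1) := by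
      calc _ ≤ R * (L ^ (κ + 1) / (κ + 1)) := by gcongr
        _ = R / (κ + 1) * L ^ (κ + 1) := by ring
        _ ≤ _ := by gcongr; rw [hM]; linarith
    calc _ = 1 / L * (2 * C * (z * ((∫ β in (0 : ℝ)..η, V₁ β) + η * (4 * R)) +
          x / T * (R * (∫ β in (0 : ℝ)..η, V₂ β)) +
          x ^ 2 / (w * U) * (R * ∫ β in (0 : ℝ)..η, V₃ β))) := by ring
      _ ≤ 1 / L * (2 * C * (z * (M * (Q * lg + 1)) + x / T * (M * L ^ κ) +
          x ^ 2 / (w * U) * (M * L ^ (κ + 1)))) := by gcongr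
      _ = _ := by ring

end

section

open scoped ArithmeticFunction.vonMangoldt

variable {κ : ℝ} {f Λf : ℕ → ℂ}

/-- A bound for intervals `(X, X + Y]` with `Y ≤ X` extends to `Y ≤ 2 X`. -/
lemma norm_sum_Ioc_le_of_halves {g : ℕ → ℂ} {C B : ℝ} (hC : 0 ≤ C) (hB : 0 ≤ B)
    (H : ∀ X Y : ℝ, C ≤ X → X ^ (19 / 20 : ℝ) ≤ Y → Y ≤ X →
      ‖∑ n ∈ Finset.Ioc ⌊X⌋₊ ⌊X + Y⌋₊, g n‖ ≤ C * (Y / Real.log X) * B)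
    {X Y : ℝ} (hX : C ≤ X) (hX1 : 1 < X) (hXY : (2 * X) ^ (19 / 20 : ℝ) ≤ Y / 2)
    (hYX : Y ≤ 2 * X) :
    ‖∑ n ∈ Finset.Ioc ⌊X⌋₊ ⌊X + Y⌋₊, g n‖ ≤ C * (Y / Real.log X) * B := by
  have hY : 0 ≤ Y / 2 := (Real.rpow_nonneg (by linarith) _).trans hXY
  have hl : 0 < Real.log X := Real.log_pos hX1
  have h1 := H X (Y / 2) hX ((Real.rpow_le_rpow (by linarith) (by linarith)
    (by norm_num)).trans hXY) (by linarith)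
  have h2 := H (X + Y / 2) (Y / 2) (by linarith) ((Real.rpow_le_rpow (by linarith) (by linarith)
    (by norm_num)).trans hXY) (by linarith)
  rw [show X + Y / 2 + Y / 2 = X + Y by ring] at h2
  rw [← Finset.sum_Ioc_consecutive g (Nat.floor_le_floor (by linarith : X ≤ X + Y / 2))
    (Nat.floor_le_floor (by linarith : X + Y / 2 ≤ X + Y))]
  have h3 : Y / 2 / Real.log (X + Y / 2) ≤ Y / 2 / Real.log X :=
    div_le_div_of_nonneg_left hY hl (Real.log_le_log (by linarith) (by linarith))
  calc _ ≤ C * (Y / 2 / Real.log X) * B + C * (Y / 2 / Real.log (X + Y / 2)) * B :=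
        (norm_add_le _ _).trans (add_le_add h1 h2)
    _ ≤ C * (Y / 2 / Real.log X) * B + C * (Y / 2 / Real.log X) * B := by gcongr
    _ = _ := by ring

/-- Replacing the indicator of `(x, x + z]` by a trapezoid costs the mass of two short intervals. -/
lemma norm_sum_Ioc_le_trap {x z w : ℝ} (hw : 0 < w) (hwx : w ≤ x) (hz : 0 ≤ z) (f : ℕ → ℂ) :
    ‖∑ n ∈ Finset.Ioc ⌊x⌋₊ ⌊x + z⌋₊, f n‖ ≤
      ‖∑ n ∈ Finset.Ioc ⌊x - w⌋₊ ⌊x - w + (z + 2 * w)⌋₊, f n * (trap x (x + z) w n : ℂ)‖ +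
      ∑ n ∈ Finset.Ioc ⌊x - w⌋₊ ⌊x - w + w⌋₊, ‖f n‖ +
      ∑ n ∈ Finset.Ioc ⌊x + z⌋₊ ⌊x + z + w⌋₊, ‖f n‖ := by
  set g : ℕ → ℂ := fun n => f n * (trap x (x + z) w n : ℂ) with hg
  have hgn : ∀ n, ‖g n‖ ≤ ‖f n‖ := fun n => by
    have := trap_mem_Icc hw (by linarith : x ≤ x + z) (n : ℝ)
    rw [hg, norm_mul, Complex.norm_real, Real.norm_of_nonneg this.1]
    exact mul_le_of_le_one_right (norm_nonneg _) this.2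
  have hmid : ∑ n ∈ Finset.Ioc ⌊x⌋₊ ⌊x + z⌋₊, f n = ∑ n ∈ Finset.Ioc ⌊x⌋₊ ⌊x + z⌋₊, g n := by
    refine Finset.sum_congr rfl fun n hn => ?_
    rw [Finset.mem_Ioc, Nat.floor_lt (by linarith), Nat.le_floor_iff (by linarith)] at hn
    rw [hg]
    simp only
    rw [trap_eq_one hw hn.1.le hn.2, Complex.ofReal_one, mul_one]
  rw [show x - w + (z + 2 * w) = x + z + w by ring, sub_add_cancel, hmid]
  have hs : ∑ n ∈ Finset.Ioc ⌊x⌋₊ ⌊x + z⌋₊, g n =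
      ∑ n ∈ Finset.Ioc ⌊x - w⌋₊ ⌊x + z + w⌋₊, g n - ∑ n ∈ Finset.Ioc ⌊x - w⌋₊ ⌊x⌋₊, g n -
      ∑ n ∈ Finset.Ioc ⌊x + z⌋₊ ⌊x + z + w⌋₊, g n := by
    rw [← Finset.sum_Ioc_consecutive g (Nat.floor_le_floor (by linarith : x - w ≤ x))
      (Nat.floor_le_floor (by linarith : x ≤ x + z + w)),
      ← Finset.sum_Ioc_consecutive g (Nat.floor_le_floor (by linarith : x ≤ x + z))
      (Nat.floor_le_floor (by linarith : x + z ≤ x + z + w))]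
    ring
  rw [hs]
  refine (norm_sub_le _ _).trans (add_le_add ((norm_sub_le _ _).trans (add_le_add le_rfl ?_)) ?_)
  · exact (norm_sum_le _ _).trans (Finset.sum_le_sum fun n _ => hgn n)
  · exact (norm_sum_le _ _).trans (Finset.sum_le_sum fun n _ => hgn n)

/-- The smoothed short-interval bound with free parameters. -/
lemma IsHalaszClass.exists_sum_Ioc_le (hκ : 0 < κ) : ∃ C : ℝ, 0 < C ∧
    ∀ f Λf : ℕ → ℂ, IsHalaszClass κ f Λf → ∀ (y : ℕ) (x z w T U Q : ℝ), C ≤ x →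
    Real.exp 200 ≤ y → 2 ≤ U → U ^ 4 ≤ y → Real.log x ^ κ ≤ T → 0 < w → w ≤ x / 4 →
    2 * w ≤ z → z ≤ x → (2 * x) ^ (2 / 3 : ℝ) ≤ w → (2 * x) ^ (19 / 20 : ℝ) ≤ z / 2 → 0 < Q →
    (∀ t : ℝ, |t| ≤ T → ‖LSeries f ((1 + 1 / Real.log x : ℝ) + t * I)‖ ≤ Q) →
    ‖∑ n ∈ Finset.Ioc ⌊x⌋₊ ⌊x + z⌋₊, f n‖ ≤ C / Real.log x *
      (z * Real.log y ^ κ + w * Real.log x ^ κ +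
        z * (Q * Real.log (1 + 2 ^ κ * Real.log x ^ κ / Q) + 1) +
        x / T * Real.log x ^ κ + x ^ 2 / (w * U) * Real.log x ^ (κ + 1)) := by
  obtain ⟨C₁, hC₁, H₁⟩ := IsHalaszClass.exists_sum_norm_le hκ
  obtain ⟨C₂, hC₂, H₂⟩ := IsHalaszClass.exists_sum_roTwist_le hκ
  obtain ⟨C₃, hC₃, H₃⟩ := IsHalaszClass.exists_sum_rough_roTwist_le hκ
  obtain ⟨C₄, hC₄, H₄⟩ := IsHalaszClass.exists_integral_main_term_le hκ
  have h2κ : (0 : ℝ) < 2 ^ κ := Real.rpow_pos_of_pos (by norm_num) _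
  have p1 : 0 < C₁ * 2 ^ κ := mul_pos hC₁ h2κ
  have he : (200 : ℝ) + 1 ≤ Real.exp 200 := Real.add_one_le_exp 200
  refine ⟨2 * C₁ + 4 * C₁ * 2 ^ κ + 4 * C₂ + 4 * C₃ + 2 * C₂ + 2 * C₃ + C₄ + Real.exp 200,
    by positivity,
    fun f Λf h y x z w T U Q hx hy hU hUy hT hw hwx hwz hzx hw2 hz2 hQ hF => ?_⟩
  have hxe : Real.exp 200 ≤ x := by linarith
  have hx0 : 0 < x := by linarith
  have hz0 : 0 ≤ z := by linarith
  set L := Real.log x with hL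
  have hL200 : 200 ≤ L := by rw [hL, Real.le_log_iff_exp_le hx0]; exact hxe
  have hL0 : 0 < L := by linarith
  have hLκ : 0 ≤ L ^ κ := by positivity
  have hlyκ : 0 ≤ Real.log y ^ κ := Real.rpow_nonneg (Real.log_natCast_nonneg y) _
  have hl2 : Real.log 2 ≤ 1 := by linarith [Real.log_two_lt_d9]
  have hX0 : x / 2 ≤ x - w := by linarith
  have hlX : L / 2 ≤ Real.log (x - w) := by
    have : Real.log (x / 2) ≤ Real.log (x - w) := Real.log_le_log (by linarith) hX0
    rw [Real.log_div hx0.ne' two_ne_zero] at this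
    linarith
  have hinv : ∀ a : ℝ, 0 ≤ a → a / Real.log (x - w) ≤ 2 * (a / L) := fun a ha => by
    calc a / Real.log (x - w) ≤ a / (L / 2) :=
          div_le_div_of_nonneg_left ha (by linarith) hlX
      _ = _ := by ring
  have htr := fun n : ℕ => trap_mem_Icc hw (by linarith : x ≤ x + z) (n : ℝ)
  have hE1 : ∑ n ∈ Finset.Ioc ⌊x - w⌋₊ ⌊x - w + w⌋₊, ‖f n‖ ≤ 2 * C₁ * (w / L) * L ^ κ := by
    have := H₁ f Λf h (x - w) w (by linarith) ((Real.rpow_le_rpow (by linarith) (by linarith)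
      (by norm_num)).trans hw2) (by linarith)
    have h1 : Real.log (x - w) ^ κ ≤ L ^ κ := by
      refine Real.rpow_le_rpow (by linarith) ?_ hκ.le
      exact Real.log_le_log (by linarith) (by linarith)
    have h2 := hinv w hw.le
    have h0 : 0 ≤ Real.log (x - w) ^ κ := Real.rpow_nonneg (by linarith) _
    calc _ ≤ C₁ * (w / Real.log (x - w)) * Real.log (x - w) ^ κ := this
      _ ≤ C₁ * (2 * (w / L)) * L ^ κ := by gcongr
      _ = _ := by ring
  have hE2 : ∑ n ∈ Finset.Ioc ⌊x + z⌋₊ ⌊x + z + w⌋₊, ‖f n‖ ≤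
      C₁ * 2 ^ κ * (w / L) * L ^ κ := by
    have := H₁ f Λf h (x + z) w (by linarith) ((Real.rpow_le_rpow (by linarith) (by linarith)
      (by norm_num)).trans hw2) (by linarith)
    have hl : L ≤ Real.log (x + z) := Real.log_le_log hx0 (by linarith)
    have hl' : Real.log (x + z) ≤ 2 * L := by
      have : Real.log (x + z) ≤ Real.log (2 * x) := Real.log_le_log (by linarith) (by linarith)
      rw [Real.log_mul two_ne_zero hx0.ne'] at this
      linarith
    have h1 : Real.log (x + z) ^ κ ≤ (2 * L) ^ κ :=
      Real.rpow_le_rpow (by linarith) hl' hκ.le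
    rw [Real.mul_rpow two_pos.le hL0.le] at h1
    have h0 : 0 ≤ Real.log (x + z) ^ κ := Real.rpow_nonneg (by linarith) _
    calc _ ≤ C₁ * (w / Real.log (x + z)) * Real.log (x + z) ^ κ := this
      _ ≤ C₁ * (w / L) * (2 ^ κ * L ^ κ) := by gcongr
      _ = _ := by ring
  have hXY : (2 * (x - w)) ^ (19 / 20 : ℝ) ≤ (z + 2 * w) / 2 :=
    ((Real.rpow_le_rpow (by linarith) (by linarith) (by norm_num)).trans hz2).trans (by linarith)
  have hYL : (z + 2 * w) / Real.log (x - w) ≤ 4 * (z / L) := by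
    refine (hinv _ (by linarith)).trans ?_
    calc 2 * ((z + 2 * w) / L) ≤ 2 * ((z + z) / L) := by gcongr
      _ = _ := by ring
  have hA := norm_sum_Ioc_le_of_halves hC₂.le hlyκ (fun X Y hX hXY hYX =>
    H₂ f Λf h y X Y hy hX hXY hYX (fun n => trap x (x + z) w n) htr)
    (X := x - w) (Y := z + 2 * w) (by linarith) (by linarith) hXY (by linarith)
  have hB := norm_sum_Ioc_le_of_halves hC₃.le hlyκ (fun X Y hX hXY hYX =>
    H₃ f Λf h y X Y hy hX hXY hYX (fun n => trap x (x + z) w n) htr)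
    (X := x - w) (Y := z + 2 * w) (by linarith) (by linarith) hXY (by linarith)
  set S := Finset.Ioc ⌊x - w⌋₊ ⌊x - w + (z + 2 * w)⌋₊ with hS
  have hM := H₄ f Λf h y ⌊4 * x⌋₊ x z w T U Q hy hU hUy hxe (Nat.floor_le (by linarith)) hT hw
    hwx hwz hzx hQ hF S fun n hn => by
      rw [hS, Finset.mem_Ioc, not_and_or, not_lt, not_le, Nat.le_floor_iff (by linarith),
        Nat.floor_lt (by linarith)] at hn
      rcases hn with hn | hn
      · exact trap_eq_zero_left hw (by linarith) hn
      · exact trap_eq_zero_right hw (by linarith) (by linarith)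
  have hdec := h.sum_eq_add_add_integral hκ y ⌊4 * x⌋₊ (1 / Real.log y)
    (fun n => trap x (x + z) w n) (T := S) fun n hn => by
      rw [hS, Finset.mem_Ioc] at hn
      exact ⟨by omega, hn.2.trans (Nat.floor_le_floor (by linarith))⟩
  have hmain := norm_sum_Ioc_le_trap hw (by linarith : w ≤ x) hz0 f
  rw [← hS, hdec] at hmain
  have h3 := norm_add₃_le (a := ∑ n ∈ S, roTwist y (1 / Real.log y) f n * (trap x (x + z) w n : ℂ))
    (b := ∑ n ∈ S, (∑ p ∈ n.divisorsAntidiagonal, _root_.restr (RoughFrom y) Λf p.1 *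
        roTwist y (2 * (1 / Real.log y)) f p.2) *
        (powInt (1 / Real.log y) (roPart y n) * trap x (x + z) w n : ℝ))
    (c := ∫ α in (0 : ℝ)..(1 / Real.log y), ∫ β in (0 : ℝ)..(1 / Real.log y),
      2 * ∑ n ∈ S, dblConv y ⌊4 * x⌋₊ α β f Λf n * (trap x (x + z) w n : ℂ))
  have hzL : 0 ≤ z / L := by positivity
  have hwL : 0 ≤ w / L * L ^ κ := by positivity
  set E := z * (Q * Real.log (1 + 2 ^ κ * L ^ κ / Q) + 1) + x / T * L ^ κ +
    x ^ 2 / (w * U) * L ^ (κ + 1) with hE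
  have hT0 : 0 < T := lt_of_lt_of_le (by positivity) hT
  have hE0 : 0 ≤ E := by
    have : 0 ≤ Real.log (1 + 2 ^ κ * L ^ κ / Q) :=
      Real.log_nonneg (by linarith [(by positivity : 0 ≤ 2 ^ κ * L ^ κ / Q)])
    positivity
  have hA' : C₂ * ((z + 2 * w) / Real.log (x - w)) * Real.log y ^ κ ≤
    C₂ * (4 * (z / L)) * Real.log y ^ κ := by gcongr
  have hB' : C₃ * ((z + 2 * w) / Real.log (x - w)) * Real.log y ^ κ ≤
    C₃ * (4 * (z / L)) * Real.log y ^ κ := by gcongr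
  set D := 2 * C₁ + 4 * C₁ * 2 ^ κ + 4 * C₂ + 4 * C₃ + 2 * C₂ + 2 * C₃ + C₄ + Real.exp 200 with hD
  have hgoal : D / L * (z * Real.log y ^ κ + w * L ^ κ +
        z * (Q * Real.log (1 + 2 ^ κ * L ^ κ / Q) + 1) +
        x / T * L ^ κ + x ^ 2 / (w * U) * L ^ (κ + 1)) =
      D * (z / L * Real.log y ^ κ) + D * (w / L * L ^ κ) + D * (E / L) := by
    rw [hE]; ring
  rw [hgoal]
  have q1 : (4 * C₂ + 4 * C₃) * (z / L * Real.log y ^ κ) ≤ D * (z / L * Real.log y ^ κ) :=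
    mul_le_mul_of_nonneg_right (by rw [hD]; linarith) (by positivity)
  have q2 : (2 * C₁ + C₁ * 2 ^ κ) * (w / L * L ^ κ) ≤ D * (w / L * L ^ κ) :=
    mul_le_mul_of_nonneg_right (by rw [hD]; linarith) hwL
  have q3 : C₄ * (E / L) ≤ D * (E / L) :=
    mul_le_mul_of_nonneg_right (by rw [hD]; linarith) (by positivity)
  have hM' : C₄ / L * E = C₄ * (E / L) := by ring
  rw [hM'] at hM
  linarith

end

section

open scoped ArithmeticFunction.vonMangoldt

variable {κ : ℝ} {f Λf : ℕ → ℂ}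

lemma Fser_eq_LSeries {s : ℂ} (hs : s ≠ 0) : Fser f s = LSeries f s := by
  refine tsum_congr fun n => ?_
  rcases eq_or_ne n 0 with rfl | hn
  · rw [LSeries.term_zero, Nat.cast_zero, Complex.zero_cpow hs, div_zero]
  · rw [LSeries.term_of_ne_zero hn]

/-- The maximum `e^{-M} (log x)^κ` dominates `F` on the segment, and `M` is bounded below. -/
lemma IsHalaszClass.iSup_bounds (h : IsHalaszClass κ f Λf) (hκ : 0 < κ) {L T M : ℝ}
    (hL : 2 * κ ≤ L) (hL0 : 0 < L) (hT : 0 ≤ T)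
    (hM : (⨆ t : {t : ℝ // |t| ≤ T}, ‖Fser f (((1 + 1 / L : ℝ) : ℂ) + ((t : ℝ) : ℂ) * I)‖) =
      Real.exp (-M) * L ^ κ) :
    -(1 / 2) ≤ M ∧ ∀ t : ℝ, |t| ≤ T →
      ‖LSeries f (((1 + 1 / L : ℝ) : ℂ) + (t : ℂ) * I)‖ ≤ Real.exp (-M) * L ^ κ := by
  have hre : ∀ t : ℝ, (((1 + 1 / L : ℝ) : ℂ) + (t : ℂ) * I).re = 1 + 1 / L := fun t => by
    rw [Complex.add_re, Complex.ofReal_re, Complex.re_ofReal_mul, Complex.I_re, mul_zero, add_zero]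
  have hiL : 0 < 1 / L := by positivity
  have heq : ∀ t : ℝ, Fser f (((1 + 1 / L : ℝ) : ℂ) + (t : ℂ) * I) =
      LSeries f (((1 + 1 / L : ℝ) : ℂ) + (t : ℂ) * I) := fun t => by
    refine Fser_eq_LSeries fun h0 => ?_
    have := hre t
    rw [h0, Complex.zero_re] at this
    linarith
  have hle : ∀ t : ℝ, ‖LSeries f (((1 + 1 / L : ℝ) : ℂ) + (t : ℂ) * I)‖ ≤ (1 + L) ^ κ := fun t => by
    have := h.norm_LSeries_le hκ (s := ((1 + 1 / L : ℝ) : ℂ) + (t : ℂ) * I)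
      (by rw [hre]; linarith)
    rwa [hre, add_sub_cancel_left, one_div_one_div] at this
  constructor
  · have : Nonempty {t : ℝ // |t| ≤ T} := ⟨⟨0, by rwa [abs_zero]⟩⟩
    have h1 : Real.exp (-M) * L ^ κ ≤ (1 + L) ^ κ := by
      rw [← hM]
      exact ciSup_le fun t => by rw [heq]; exact hle t
    have h2 : (1 + L) ^ κ ≤ Real.exp (1 / 2) * L ^ κ := by
      rw [show 1 + L = (1 + 1 / L) * L by field_simp; ring, Real.mul_rpow (by positivity) hL0.le]
      refine mul_le_mul_of_nonneg_right ?_ (by positivity)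
      calc (1 + 1 / L) ^ κ ≤ Real.exp (1 / L) ^ κ := by
            refine Real.rpow_le_rpow (by positivity) ?_ hκ.le
            linarith [Real.add_one_le_exp (1 / L)]
        _ = Real.exp (1 / L * κ) := (Real.exp_mul _ _).symm
        _ ≤ Real.exp (1 / 2) := by
            rw [Real.exp_le_exp, one_div_mul_eq_div, div_le_div_iff₀ hL0 two_pos]
            linarith
    have h3 := le_of_mul_le_mul_right (h1.trans h2) (by positivity)
    rw [Real.exp_le_exp] at h3
    linarith
  · intro t ht
    rw [← hM, ← heq]
    refine le_ciSup (f := fun t : {t : ℝ // |t| ≤ T} =>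
      ‖Fser f (((1 + 1 / L : ℝ) : ℂ) + ((t : ℝ) : ℂ) * I)‖) ⟨(1 + L) ^ κ, ?_⟩ ⟨t, ht⟩
    rintro _ ⟨u, rfl⟩
    simp only [heq]
    exact hle u

lemma log_one_add_mul_exp_le {a M : ℝ} (ha : 0 < a) (hM : -(1 / 2) ≤ M) :
    Real.log (1 + a * Real.exp M) ≤ (2 * Real.log (1 + a) + 1) * (1 + M) := by
  have h1 : 1 + a * Real.exp M ≤ (1 + a) * Real.exp (M + 1 / 2) := by
    have : 1 ≤ Real.exp (M + 1 / 2) := Real.one_le_exp (by linarith)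
    have h2 : a * Real.exp M ≤ a * Real.exp (M + 1 / 2) :=
      mul_le_mul_of_nonneg_left (Real.exp_le_exp.mpr (by linarith)) ha.le
    linarith
  have h2 := Real.log_le_log (by positivity) h1
  rw [Real.log_mul (by positivity) (Real.exp_pos _).ne', Real.log_exp] at h2
  have h3 : 0 ≤ Real.log (1 + a) := Real.log_nonneg (by linarith)
  nlinarith

/-- The auxiliary conditions hold for all large `x`. -/
lemma exists_forall_log_conditions (κ : ℝ) : ∃ X : ℝ, 0 < X ∧ ∀ x : ℝ, X ≤ x →
    200 ≤ Real.log x ∧ 2 * κ ≤ Real.log x ∧ 200 ≤ Real.log (Real.log x) ∧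
      3 + κ * Real.log (Real.log x) ≤ Real.log x / 4 := by
  have h1 := Real.tendsto_log_atTop
  have h2 := h1.comp h1
  have h3 : ∀ᶠ u : ℝ in Filter.atTop, 3 + κ * Real.log u ≤ u / 4 := by
    have := (Real.isLittleO_log_id_atTop.const_mul_left κ).bound (by norm_num : (0 : ℝ) < 1 / 8)
    filter_upwards [this, Filter.eventually_ge_atTop 24] with u hu hu'
    rw [id, Real.norm_eq_abs, Real.norm_eq_abs, abs_of_nonneg (by linarith : 0 ≤ u)] at hu
    linarith [le_abs_self (κ * Real.log u)]
  obtain ⟨X, hX⟩ := Filter.eventually_atTop.mp (((h1.eventually_ge_atTop 200).and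
    (h1.eventually_ge_atTop (2 * κ))).and ((h2.eventually_ge_atTop 200).and (h1.eventually h3)))
  refine ⟨max X 1, by positivity, fun x hx => ?_⟩
  obtain ⟨⟨a, b⟩, c, d⟩ := hX x (le_trans (le_max_left _ _) hx)
  exact ⟨a, b, c, d⟩

set_option maxHeartbeats 1000000 in
/-- The short-interval bound when the interval is long, `x ^ (1 - δ)` with `δ < 1 / 320`. -/
lemma IsHalaszClass.exists_sum_Ioc_rpow_le (hκ : 0 < κ) : ∃ C : ℝ, 0 < C ∧
    ∀ f Λf : ℕ → ℂ, IsHalaszClass κ f Λf → ∀ x δ M : ℝ, C ≤ x →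
    200 ≤ Real.log x → 200 ≤ Real.log (Real.log x) →
    3 + κ * Real.log (Real.log x) ≤ Real.log x / 4 → 0 < δ → δ < 1 / 320 → -(1 / 2) ≤ M →
    (∀ t : ℝ, |t| ≤ x ^ δ * Real.log x ^ κ →
      ‖LSeries f (((1 + 1 / Real.log x : ℝ) : ℂ) + (t : ℂ) * I)‖ ≤
        Real.exp (-M) * Real.log x ^ κ) →
    ‖∑ n ∈ Finset.Ioc ⌊x⌋₊ ⌊x + x ^ (1 - δ)⌋₊, f n‖ ≤ C * (x ^ (1 - δ) / Real.log x) *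
      ((1 + M) * (Real.exp (-M) * Real.log x ^ κ) +
        (δ * Real.log x + Real.log (Real.log x)) ^ κ) := by
  obtain ⟨D, hD, H⟩ := IsHalaszClass.exists_sum_Ioc_le hκ
  set K : ℝ := 8 * κ + 16 with hK
  have hK0 : 0 < K := by positivity
  have h2κ : (0 : ℝ) < 2 ^ κ := Real.rpow_pos_of_pos (by norm_num) _
  set c : ℝ := 2 * Real.log (1 + 2 ^ κ) + 1 with hc
  have hc0 : 0 < c := by
    have : 0 ≤ Real.log (1 + (2 : ℝ) ^ κ) := Real.log_nonneg (by linarith)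
    linarith
  refine ⟨D * ((2 * K) ^ κ + 11) + D * c + D, by positivity,
    fun f Λf h x δ M hx hL200 hℓ hLκℓ hδ hδ' hM2 hF => ?_⟩
  have t2 : 0 < D * ((2 * K) ^ κ + 11) := by positivity
  have t3 : 0 < D * c := by positivity
  set C := D * ((2 * K) ^ κ + 11) + D * c + D with hCdef
  have hC0 : 0 < C := by positivity
  have hx0 : 0 < x := by linarith
  set L := Real.log x with hL
  set ℓ := Real.log L with hℓdef
  set z := x ^ (1 - δ) with hz
  have hL0 : 0 < L := by linarith
  have hx1 : 1 ≤ x := by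
    by_contra hcon
    have := Real.log_nonpos hx0.le (not_le.mp hcon).le
    linarith
  have hexpx : ∀ a : ℝ, x ^ a = Real.exp (L * a) := fun a => Real.rpow_def_of_pos hx0 a
  have hexpL : ∀ a : ℝ, L ^ a = Real.exp (ℓ * a) := fun a => Real.rpow_def_of_pos hL0 a
  have hz0 : 0 < z := Real.rpow_pos_of_pos hx0 _
  have hxδ : 1 ≤ x ^ δ := Real.one_le_rpow hx1 hδ.le
  have hxδz : x ^ δ * z = x := by
    rw [hz, ← Real.rpow_add hx0, add_sub_cancel, Real.rpow_one]
  have hzx : z ≤ x := by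
    calc z = 1 * z := (one_mul z).symm
      _ ≤ x ^ δ * z := by gcongr
      _ = x := hxδz
  have hLκ1 : 1 ≤ L ^ κ := Real.one_le_rpow (by linarith) hκ.le
  have hLκ0 : 0 < L ^ κ := by linarith
  set Γ := δ * L + ℓ with hΓ
  have hδL : 0 < δ * L := by positivity
  have hΓ1 : 1 ≤ Γ := by linarith
  have hΓ0 : 0 < Γ := by linarith
  have hΓκ : 1 ≤ Γ ^ κ := Real.one_le_rpow hΓ1 hκ.le
  set Q := Real.exp (-M) * L ^ κ with hQ
  have hQ0 : 0 < Q := by positivity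
  have hMQ : 0 ≤ (1 + M) * Q := mul_nonneg (by linarith) hQ0.le
  have hzL : 0 ≤ z / L := by positivity
  set T := x ^ δ * L ^ κ with hT
  set U := x ^ (2 * δ) * L ^ (2 * κ + 4) with hU
  set w := z / (8 * L ^ κ) with hw
  set y : ℕ := ⌈Real.exp (K * Γ)⌉₊ with hy
  have hKΓ : 200 ≤ K * Γ := by
    have : 1 * Γ ≤ K * Γ := by gcongr; linarith
    linarith
  have hyle : Real.exp (K * Γ) ≤ y := Nat.le_ceil _
  have hy200 : Real.exp 200 ≤ y := (Real.exp_le_exp.mpr hKΓ).trans hyle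
  have hlogy : Real.log y ≤ 2 * K * Γ := by
    have e0 := Real.exp_pos (K * Γ)
    have e1 : (y : ℝ) ≤ Real.exp (2 * K * Γ) := by
      have e2 := (Nat.ceil_lt_add_one e0.le).le
      have e3 : 2 ≤ Real.exp (K * Γ) := by linarith [Real.add_one_le_exp (K * Γ)]
      rw [show 2 * K * Γ = K * Γ + K * Γ by ring, Real.exp_add]
      nlinarith
    rw [← Real.log_exp (2 * K * Γ)]
    exact Real.log_le_log (lt_of_lt_of_le e0 hyle) e1
  have hUexp : U = Real.exp (2 * (δ * L) + (2 * κ + 4) * ℓ) := by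
    rw [hU, hexpx, hexpL, ← Real.exp_add]; ring_nf
  have hκℓ : 0 < κ * ℓ := mul_pos hκ (by linarith)
  have hU2 : 2 ≤ U := by
    rw [hUexp]
    linarith [Real.add_one_le_exp (2 * (δ * L) + (2 * κ + 4) * ℓ)]
  have hUy : U ^ 4 ≤ y := by
    refine le_trans ?_ hyle
    rw [hUexp, ← Real.exp_nat_mul, Real.exp_le_exp, hK, hΓ]
    have e1 : (8 * κ + 16) * (δ * L + ℓ) = (4 : ℕ) * (2 * (δ * L) + (2 * κ + 4) * ℓ) +
        (8 * (κ * (δ * L)) + 8 * (δ * L)) := by push_cast; ring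
    have e2 := mul_pos hκ hδL
    rw [e1]
    linarith
  have hTL : L ^ κ ≤ T := le_mul_of_one_le_left hLκ0.le hxδ
  have hw0 : 0 < w := by positivity
  have hwz : w ≤ z / 8 := by
    rw [hw]
    exact div_le_div_of_nonneg_left hz0.le (by norm_num) (by linarith)
  have hδL' : δ * L ≤ 1 / 320 * L := by gcongr
  have h2x : ∀ a : ℝ, 0 ≤ a → a ≤ 1 → (2 * x) ^ a ≤ 2 * x ^ a := fun a ha ha1 => by
    rw [Real.mul_rpow two_pos.le hx0.le]
    refine mul_le_mul_of_nonneg_right ?_ (by positivity)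
    calc (2 : ℝ) ^ a ≤ 2 ^ (1 : ℝ) := Real.rpow_le_rpow_of_exponent_le (by norm_num) ha1
      _ = 2 := Real.rpow_one 2
  have he1 : (2 : ℝ) ≤ Real.exp 1 := by linarith [Real.add_one_le_exp (1 : ℝ)]
  have he3 : (8 : ℝ) ≤ Real.exp 1 ^ 3 := by nlinarith [mul_self_nonneg (Real.exp 1 - 2)]
  have hw2 : (2 * x) ^ (2 / 3 : ℝ) ≤ w := by
    refine (h2x _ (by norm_num) (by norm_num)).trans ?_
    rw [hw, le_div_iff₀ (by positivity)]
    have e16 : (16 : ℝ) ≤ Real.exp 4 := by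
      have : Real.exp 4 = Real.exp 1 ^ 3 * Real.exp 1 := by
        rw [← Real.exp_nat_mul, ← Real.exp_add]; norm_num
      rw [this]; nlinarith
    calc 2 * x ^ (2 / 3 : ℝ) * (8 * L ^ κ) = 16 * (x ^ (2 / 3 : ℝ) * L ^ κ) := by ring
      _ ≤ Real.exp 4 * (x ^ (2 / 3 : ℝ) * L ^ κ) := by gcongr
      _ = Real.exp (4 + (L * (2 / 3) + ℓ * κ)) := by
          rw [hexpx, hexpL, ← Real.exp_add, ← Real.exp_add]
      _ ≤ Real.exp (L * (1 - δ)) := Real.exp_le_exp.mpr (by linarith)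
      _ = z := (hexpx _).symm
  have hz2 : (2 * x) ^ (19 / 20 : ℝ) ≤ z / 2 := by
    refine (h2x _ (by norm_num) (by norm_num)).trans ?_
    rw [le_div_iff₀ two_pos]
    have e4 : (4 : ℝ) ≤ Real.exp 2 := by
      have : Real.exp 2 = Real.exp 1 * Real.exp 1 := by rw [← Real.exp_add]; norm_num
      rw [this]; nlinarith
    calc 2 * x ^ (19 / 20 : ℝ) * 2 = 4 * x ^ (19 / 20 : ℝ) := by ring
      _ ≤ Real.exp 2 * x ^ (19 / 20 : ℝ) := by gcongr
      _ = Real.exp (2 + L * (19 / 20)) := by rw [hexpx, ← Real.exp_add]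
      _ ≤ Real.exp (L * (1 - δ)) := Real.exp_le_exp.mpr (by linarith)
      _ = z := (hexpx _).symm
  have hmain := H f Λf h y x z w T U Q (by linarith) hy200 hU2 hUy hTL hw0 (by linarith)
    (by linarith) hzx hw2 hz2 hQ0 hF
  have b1 : Real.log y ^ κ ≤ (2 * K) ^ κ * Γ ^ κ := by
    rw [← Real.mul_rpow (by positivity) hΓ0.le]
    exact Real.rpow_le_rpow (Real.log_natCast_nonneg y) hlogy hκ.le
  have b2 : w * L ^ κ = z / 8 := by rw [hw]; field_simp
  have b3 : Real.log (1 + 2 ^ κ * L ^ κ / Q) ≤ c * (1 + M) := by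
    have : 2 ^ κ * L ^ κ / Q = 2 ^ κ * Real.exp M := by
      rw [hQ, Real.exp_neg]; field_simp
    rw [this]
    exact log_one_add_mul_exp_le h2κ hM2
  have b4 : x / T * L ^ κ = z := by
    have : 0 < x ^ δ := by positivity
    rw [div_mul_eq_mul_div, div_eq_iff (by positivity), hT]
    calc x * L ^ κ = x ^ δ * z * L ^ κ := by rw [hxδz]
      _ = _ := by ring
  have b5 : x ^ 2 / (w * U) * L ^ (κ + 1) ≤ 8 * z := by
    have e1 : x ^ 2 / (w * U) * L ^ (κ + 1) = 8 * z * L ^ (-3 : ℝ) := by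
      have g1 : L ^ (2 * κ + 4) = L ^ κ * L ^ (κ + 1) * L ^ (3 : ℝ) := by
        rw [← Real.rpow_add hL0, ← Real.rpow_add hL0]; ring_nf
      have g2 : x ^ (2 * δ) = x ^ δ * x ^ δ := by rw [← Real.rpow_add hx0]; ring_nf
      have g3 : x ^ 2 = x ^ δ * x ^ δ * z ^ 2 := by
        rw [show x ^ δ * x ^ δ * z ^ 2 = (x ^ δ * z) ^ 2 by ring, hxδz]
      have p1 : 0 < x ^ δ := by positivity
      have p2 : 0 < L ^ (κ + 1) := by positivity
      have p3 : 0 < L ^ (3 : ℝ) := by positivity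
      rw [hU, hw, g1, g2, g3, Real.rpow_neg hL0.le]
      field_simp
    rw [e1]
    exact mul_le_of_le_one_right (by positivity)
      (Real.rpow_le_one_of_one_le_of_nonpos (by linarith) (by norm_num))
  have b6 : Q * Real.log (1 + 2 ^ κ * L ^ κ / Q) ≤ c * ((1 + M) * Q) := by
    calc _ ≤ Q * (c * (1 + M)) := by gcongr
      _ = _ := by ring
  calc _ ≤ D / L * (z * Real.log y ^ κ + w * L ^ κ +
        z * (Q * Real.log (1 + 2 ^ κ * L ^ κ / Q) + 1) + x / T * L ^ κ +
        x ^ 2 / (w * U) * L ^ (κ + 1)) := hmain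
    _ ≤ D / L * (z * ((2 * K) ^ κ * Γ ^ κ) + z / 8 + z * (c * ((1 + M) * Q) + 1) + z +
        8 * z) := by
        rw [b2, b4]; gcongr
    _ = D * (z / L) * (c * ((1 + M) * Q)) + D * (z / L) * ((2 * K) ^ κ * Γ ^ κ + 81 / 8) := by
        ring
    _ ≤ D * (z / L) * (c * ((1 + M) * Q)) +
        D * (z / L) * ((2 * K) ^ κ * Γ ^ κ + 11 * Γ ^ κ) := by gcongr; linarith
    _ = D * c * (z / L) * ((1 + M) * Q) + D * ((2 * K) ^ κ + 11) * (z / L) * Γ ^ κ := by ring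
    _ ≤ C * (z / L) * ((1 + M) * Q) + C * (z / L) * Γ ^ κ := by
        gcongr <;> (rw [hCdef]; linarith)
    _ = _ := by ring

end

theorem halasz_short_intervals_corollary (κ : ℝ) (hκ : 0 < κ) :
    ∃ C : ℝ, 0 < C ∧ ∀ f Λf : ℕ → ℂ, IsHalaszClass κ f Λf →
    ∀ x δ : ℝ, C ≤ x → 0 < δ → δ < 1 / 4 →
    ∀ Mδ : ℝ,
      (⨆ t : {t : ℝ // |t| ≤ x ^ δ * Real.log x ^ κ},
          ‖Fser f (((1 + 1 / Real.log x : ℝ) : ℂ) + ((t : ℝ) : ℂ) * Complex.I)‖)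
        = Real.exp (-Mδ) * Real.log x ^ κ →
      ‖∑ n ∈ Finset.Ioc ⌊x⌋₊ ⌊x + x ^ (1 - δ)⌋₊, f n‖ ≤
        C * (x ^ (1 - δ) / Real.log x) *
          ((1 + Mδ) * Real.exp (-Mδ) * Real.log x ^ κ
            + (δ * Real.log x + Real.log (Real.log x)) ^ κ) := by
  obtain ⟨C₁, hC₁, H₁⟩ := IsHalaszClass.exists_sum_norm_le hκ
  obtain ⟨D, hD, H⟩ := IsHalaszClass.exists_sum_Ioc_rpow_le hκ
  obtain ⟨X, hX, HX⟩ := exists_forall_log_conditions κ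
  refine ⟨C₁ * 320 ^ κ + C₁ + D + X, by positivity, fun f Λf h x δ hx hδ hδ4 M hM => ?_⟩
  have t1 : 0 < C₁ * 320 ^ κ := by positivity
  set C := C₁ * 320 ^ κ + C₁ + D + X with hCdef
  obtain ⟨hL200, hL2κ, hℓ, hLκℓ⟩ := HX x (by linarith)
  have hx0 : 0 < x := by linarith
  set L := Real.log x with hL
  have hL0 : 0 < L := by linarith
  have hx1 : 1 ≤ x := by
    by_contra hcon
    have := Real.log_nonpos hx0.le (not_le.mp hcon).le
    linarith
  obtain ⟨hM2, hF⟩ := h.iSup_bounds hκ hL2κ hL0 (by positivity) hM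
  set z := x ^ (1 - δ) with hz
  have hz0 : 0 < z := Real.rpow_pos_of_pos hx0 _
  set Γ := δ * L + Real.log L with hΓ
  have hδL : 0 < δ * L := by positivity
  have hΓ0 : 0 < Γ := by linarith
  have hzL : 0 ≤ z / L := by positivity
  rw [mul_assoc (1 + M)]
  have hMQ : 0 ≤ (1 + M) * (Real.exp (-M) * L ^ κ) :=
    mul_nonneg (by linarith) (by positivity)
  have hRHS : 0 ≤ (1 + M) * (Real.exp (-M) * L ^ κ) + Γ ^ κ := by positivity
  rcases le_or_gt (1 / 320) δ with hδ' | hδ'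
  · have hzx : z ≤ x := by
      calc z ≤ x ^ (1 : ℝ) := Real.rpow_le_rpow_of_exponent_le hx1 (by linarith)
        _ = x := Real.rpow_one x
    have h1 := H₁ f Λf h x z (by linarith)
      (Real.rpow_le_rpow_of_exponent_le hx1 (by linarith)) hzx
    have h2 : L ^ κ ≤ 320 ^ κ * Γ ^ κ := by
      rw [← Real.mul_rpow (by norm_num) hΓ0.le]
      refine Real.rpow_le_rpow hL0.le ?_ hκ.le
      have : 1 / 320 * L ≤ δ * L := by gcongr
      linarith
    calc _ ≤ ∑ n ∈ Finset.Ioc ⌊x⌋₊ ⌊x + z⌋₊, ‖f n‖ := norm_sum_le _ _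
      _ ≤ C₁ * (z / L) * L ^ κ := h1
      _ ≤ C₁ * (z / L) * (320 ^ κ * Γ ^ κ) := by gcongr
      _ = C₁ * 320 ^ κ * (z / L) * Γ ^ κ := by ring
      _ ≤ C * (z / L) * ((1 + M) * (Real.exp (-M) * L ^ κ) + Γ ^ κ) := by
          gcongr
          · rw [hCdef]; linarith
          · linarith
  · refine (H f Λf h x δ M (by linarith) hL200 hℓ hLκℓ hδ hδ' hM2 hF).trans ?_
    exact mul_le_mul_of_nonneg_right (mul_le_mul_of_nonneg_right (by rw [hCdef]; linarith) hzL) hRHS
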